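/- Let K be an algebraically closed field of characteristic zero, X an algebraic variety over K, Z an irreducible algebraic scheme over K, and φ₁, φ₂ : Z → X rational maps whose restrictions to Z_red are dominant. Then the following are equivalent: (1) there exist nonempty Zariski open subsets V ⊆ Z and U ⊆ X such that the restrictions φ₁^V, φ₂^V : V → U are dominant regular morphisms and there exist infinitely many hypersurfaces H on U satisfying (φ₁^V)⁻¹(H) = (φ₂^V)⁻¹(H) as closed subschemes; (2) there exists g ∈ K(X) \ K such that g∘φ₁ = g∘φ₂. -/

import Mathlib

/-!
# Theorem 4.1 (main theorem, scheme-theoretic form)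

The algebraic variety `X` over the algebraically closed field `K` of characteristic zero is
modelled by an (affine model with) coordinate ring `R`: a finitely generated `K`-algebra
domain.  The irreducible algebraic scheme `Z` (possibly nonreduced) is modelled by a
finitely generated `K`-algebra `S` whose nilradical is prime (= irreducibility of `Spec S`);
`Z_red` has coordinate ring `S/nilradical S`.  The rational maps `φ₁, φ₂ : Z → X` are
modelled (after shrinking `Z`, which affects nothing) by `K`-algebra homomorphisms
`f₁, f₂ : R → S`; dominance of their restrictions to `Z_red` is injectivity of the
compositions `R → S → S/nilradical S`.

Condition (1): on suitable basic open subsets `V = Spec S_s ⊆ Z` and `U = Spec R_r ⊆ X` to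
which the `φᵢ` restrict (this restriction is encoded by ring maps `F₁, F₂` making the
evident squares commute), infinitely many hypersurfaces `H = V(I)` on `U` have equal
scheme-theoretic inverse images, i.e. `I·S_s` taken along `F₁` and `F₂` agree.

Condition (2): a nonconstant `g = a/b ∈ K(X) \ K` with `g∘φ₁ = g∘φ₂` as rational maps on
the irreducible scheme `Z`, i.e. the cross-difference `f₁(a)f₂(b) − f₂(a)f₁(b)` is killed
by some `u` outside the nilradical (equality on a dense open subscheme of `Z`).
-/

/-- A prime ideal `P` of a commutative ring has height one. -/
def HeightOnePrime {R : Type*} [CommRing R] (P : Ideal R) : Prop :=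
  P.IsPrime ∧ P ≠ ⊥ ∧ ∀ Q : Ideal R, Q.IsPrime → Q < P → Q = ⊥

/-- `I` is the radical vanishing ideal of a nonempty Zariski closed subset of pure
codimension one. -/
def IsHypersurfaceIdeal {R : Type*} [CommRing R] (I : Ideal R) : Prop :=
  I.IsRadical ∧ I ≠ ⊤ ∧ ∀ P ∈ I.minimalPrimes, HeightOnePrime P

theorem HeightOnePrime.exists_uniformizer_aux {B : Type*} [CommRing B] [IsDomain B]
    [IsNoetherianRing B] {F : Type*} [Field F] [Algebra B F] [IsFractionRing B F]
    (P : Ideal B) [P.IsPrime] (hP : P ≠ ⊥) (hP1 : ∀ Q : Ideal B, Q.IsPrime → Q < P → Q = ⊥)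
    (c : B) (hc : c ∉ P)
    (hcond : ∀ f : F, IsIntegral B f → ∃ b : B, algebraMap B F b = algebraMap B F c * f)
    (L : Type*) [CommRing L] [IsLocalRing L] [Algebra B L] [IsLocalization.AtPrime L P]
    [Algebra L F] [IsScalarTower B L F] [IsFractionRing L F] [IsDomain L] [IsNoetherianRing L] :
    ∃ t ∈ P, t ≠ 0 ∧ ∀ f : B, f ≠ 0 → ∃ n : ℕ, ∃ r₁ r₂ : B, r₁ ∉ P ∧ r₂ ∉ P ∧
      r₂ * f = r₁ * t ^ n := by
  have hle : P.primeCompl ≤ nonZeroDivisors B := P.primeCompl_le_nonZeroDivisors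
  have hcm : (IsLocalRing.maximalIdeal L).comap (algebraMap B L) = P :=
    IsLocalization.AtPrime.under_maximalIdeal L P
  have hmc : ∀ Q : Ideal L, (Q.comap (algebraMap B L)).map (algebraMap B L) = Q :=
    fun Q => IsLocalization.map_under P.primeCompl L Q
  have : IsIntegrallyClosed L := by
    rw [isIntegrallyClosed_iff F]
    intro f hf
    obtain ⟨s, hs⟩ := IsIntegral.exists_multiple_integral_of_isLocalization P.primeCompl f hf
    obtain ⟨b, hb⟩ := hcond _ hs
    refine ⟨IsLocalization.mk' L b (⟨c, hc⟩ * s), ?_⟩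
    have h1 : algebraMap L F (IsLocalization.mk' L b (⟨c, hc⟩ * s)) *
        algebraMap B F (c * s) = algebraMap B F b := by
      rw [IsScalarTower.algebraMap_apply B L F, IsScalarTower.algebraMap_apply B L F, ← map_mul]
      congr 1
      exact IsLocalization.mk'_spec L b (⟨c, hc⟩ * s)
    have h2 : algebraMap B F (c * s) ≠ 0 := by
      rw [Ne, FaithfulSMul.algebraMap_eq_zero_iff]
      intro h0
      apply (⟨c, hc⟩ * s : P.primeCompl).2
      change (c * s : B) ∈ P
      rw [h0]; exact P.zero_mem
    apply mul_right_cancel₀ h2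
    rw [h1, hb, map_mul, Submonoid.smul_def, Algebra.smul_def]
    ring
  have hPL : IsLocalRing.maximalIdeal L ≠ ⊥ := by
    intro h
    apply hP
    rw [← hcm, h, ← RingHom.ker_eq_comap_bot]
    exact (RingHom.injective_iff_ker_eq_bot _).1 (IsLocalization.injective L hle)
  have hu : ∀ Q : Ideal L, Q ≠ ⊥ → Q.IsPrime → Q = IsLocalRing.maximalIdeal L := by
    intro Q hQ hQp
    have h1 : Q ≤ IsLocalRing.maximalIdeal L := IsLocalRing.le_maximalIdeal hQp.ne_top
    by_contra hne
    have hc1 : Q.comap (algebraMap B L) ≤ P := by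
      rw [← hcm]
      exact Ideal.comap_mono h1
    have hc2 : Q.comap (algebraMap B L) ≠ P := by
      intro h
      apply hne
      rw [← hmc Q, ← hmc (IsLocalRing.maximalIdeal L), hcm, h]
    have := hP1 _ (hQp.comap _) (lt_of_le_of_ne hc1 hc2)
    apply hQ
    rw [← hmc Q, this, Ideal.map_bot]
  have hpir : IsPrincipalIdealRing L :=
    ((tfae_of_isNoetherianRing_of_isLocalRing_of_isDomain L).out 3 0 rfl rfl).1 (And.intro this hu)
  have : IsDiscreteValuationRing L := { not_a_field' := hPL }
  obtain ⟨ϖ, hϖ⟩ := IsDiscreteValuationRing.exists_irreducible L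
  obtain ⟨⟨t, s⟩, hts⟩ := IsLocalization.surj P.primeCompl ϖ
  have key : ∀ x : L, IsUnit x → ∃ r₁ r₂ : B, r₁ ∉ P ∧ r₂ ∉ P ∧
      algebraMap B L r₂ * x = algebraMap B L r₁ := by
    intro x hx
    obtain ⟨⟨r, s⟩, hrs⟩ := IsLocalization.surj P.primeCompl x
    refine ⟨r, s, ?_, s.2, by rw [mul_comm]; exact hrs⟩
    have : IsUnit (algebraMap B L r) := by
      rw [← hrs]
      exact hx.mul (IsLocalization.map_units L s)
    exact (IsLocalization.AtPrime.isUnit_to_map_iff L P r).1 this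
  have hus := IsLocalization.map_units L s
  have hinj : Function.Injective (algebraMap B L) := IsLocalization.injective L hle
  have htm : t ∈ P := by
    by_contra h
    have := (IsLocalization.AtPrime.isUnit_to_map_iff L P t).2 h
    rw [← hts] at this
    exact hϖ.not_isUnit (isUnit_of_mul_isUnit_left this)
  refine ⟨t, htm, ?_, ?_⟩
  · rintro rfl
    rw [map_zero] at hts
    exact (mul_ne_zero hϖ.ne_zero hus.ne_zero) hts
  · intro f hf
    have hf' : algebraMap B L f ≠ 0 := by
      rw [Ne, ← map_zero (algebraMap B L)]; exact fun h => hf (hinj h)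
    obtain ⟨n, u, hu⟩ := IsDiscreteValuationRing.eq_unit_mul_pow_irreducible hf' hϖ
    obtain ⟨v, hv⟩ := hus
    obtain ⟨r₁, r₂, h1, h2, h3⟩ := key (u * ↑(v⁻¹ ^ n)) (u.isUnit.mul (Units.isUnit _))
    refine ⟨n, r₁, r₂, h1, h2, hinj ?_⟩
    rw [map_mul, map_mul, ← h3, map_pow, ← hts, mul_pow, hu, ← hv]
    have : ((v⁻¹ ^ n : Lˣ) : L) * (v : L) ^ n = 1 := by
      rw [← Units.val_pow_eq_pow_val, ← Units.val_mul, ← mul_pow, inv_mul_cancel, one_pow,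
        Units.val_one]
    linear_combination (-(algebraMap B L r₂ * u * ϖ ^ n)) * this

theorem HeightOnePrime.exists_uniformizer {B : Type*} [CommRing B] [IsDomain B]
    [IsNoetherianRing B] {F : Type*} [Field F] [Algebra B F] [IsFractionRing B F]
    (P : Ideal B) [P.IsPrime] (hP : P ≠ ⊥) (hP1 : ∀ Q : Ideal B, Q.IsPrime → Q < P → Q = ⊥)
    (c : B) (hc : c ∉ P)
    (hcond : ∀ f : F, IsIntegral B f → ∃ b : B, algebraMap B F b = algebraMap B F c * f) :
    ∃ t ∈ P, t ≠ 0 ∧ ∀ f : B, f ≠ 0 → ∃ n : ℕ, ∃ r₁ r₂ : B, r₁ ∉ P ∧ r₂ ∉ P ∧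
      r₂ * f = r₁ * t ^ n := by
  have hle : P.primeCompl ≤ nonZeroDivisors B := P.primeCompl_le_nonZeroDivisors
  let _ : Algebra (Localization.AtPrime P) F :=
    IsLocalization.localizationAlgebraOfSubmonoidLe _ F P.primeCompl _ hle
  have : IsScalarTower B (Localization.AtPrime P) F :=
    IsLocalization.localization_isScalarTower_of_submonoid_le _ F P.primeCompl _ hle
  have : IsFractionRing (Localization.AtPrime P) F :=
    IsFractionRing.isFractionRing_of_isDomain_of_isLocalization P.primeCompl _ F
  have : IsDomain (Localization.AtPrime P) :=
    IsLocalization.isDomain_of_le_nonZeroDivisors _ hle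
  have : IsNoetherianRing (Localization.AtPrime P) :=
    IsLocalization.isNoetherianRing P.primeCompl _ inferInstance
  exact exists_uniformizer_aux (F := F) P hP hP1 c hc hcond (Localization.AtPrime P)

section ValuationBasics

variable {Λ Γ : Type*} [Field Λ] [LinearOrderedCommGroupWithZero Γ] {v : Valuation Λ Γ}

/-- A valuation lies over the prime element `p` of `A`. -/
def LiesOverElem {A : Type*} [CommRing A] [Algebra A Λ] (p : A) (v : Valuation Λ Γ) : Prop :=
  ∀ a : A, v (algebraMap A Λ a) ≤ 1 ∧ (v (algebraMap A Λ a) < 1 ↔ p ∣ a)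

/-- The derivation `D` has at most logarithmic poles along `w` for the valuation `v`. -/
structure LogGood {k : Type*} [CommRing k] [Algebra k Λ] (v : Valuation Λ Γ) (w : Λ)
    (D : Derivation k Λ Λ) : Prop where
  lt_one : ∀ f, v f ≤ 1 → v (w * D f) < 1
  le : ∀ f, v (w * D f) ≤ v f

/-- The center of a valuation on a ring mapping into its valuation ring. -/
def valuationCenter {B : Type*} [CommRing B] (f : B →+* Λ) (v : Valuation Λ Γ)
    (h : ∀ b, v (f b) ≤ 1) : Ideal B where
  carrier := {b | v (f b) < 1}
  zero_mem' := by simp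
  add_mem' {a b} ha hb := by
    change v (f (a + b)) < 1
    rw [map_add]
    exact v.map_add_lt ha hb
  smul_mem' a b hb := by
    change v (f (a * b)) < 1
    rw [map_mul, map_mul]
    exact (mul_le_of_le_one_left' (h a)).trans_lt hb

theorem mem_valuationCenter {B : Type*} [CommRing B] {f : B →+* Λ}
    {h : ∀ b, v (f b) ≤ 1} {b : B} : b ∈ valuationCenter f v h ↔ v (f b) < 1 := Iff.rfl

theorem not_mem_valuationCenter {B : Type*} [CommRing B] {f : B →+* Λ}
    {h : ∀ b, v (f b) ≤ 1} {b : B} : b ∉ valuationCenter f v h ↔ v (f b) = 1 := by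
  rw [mem_valuationCenter, not_lt]
  exact ⟨fun h1 => le_antisymm (h b) h1, fun h => h.ge⟩

instance valuationCenter_isPrime {B : Type*} [CommRing B] (f : B →+* Λ)
    (h : ∀ b, v (f b) ≤ 1) : (valuationCenter f v h).IsPrime where
  ne_top' := by
    rw [Ne, Ideal.eq_top_iff_one, mem_valuationCenter]
    simp
  mem_or_mem' {x y} hxy := by
    by_contra hc
    push Not at hc
    rw [not_mem_valuationCenter, not_mem_valuationCenter] at hc
    rw [mem_valuationCenter, map_mul, map_mul, hc.1, hc.2] at hxy
    simp at hxy

variable {A : Type*} [CommRing A] [Algebra A Λ]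

theorem Valuation.le_one_of_isIntegral (hA : ∀ a : A, v (algebraMap A Λ a) ≤ 1) {s : Λ}
    (hs : IsIntegral A s) : v s ≤ 1 := by
  let g : A →+* v.integer := (algebraMap A Λ).codRestrict v.integer hA
  have h : IsIntegral v.integer s := by
    obtain ⟨q, hq, h0⟩ := hs
    refine ⟨q.map g, hq.map g, ?_⟩
    rw [Polynomial.eval₂_map]
    exact h0
  exact Valuation.Integers.mem_of_integral (Valuation.integer.integers v) h

theorem Valuation.eval₂_le_one {B : Type*} [CommRing B] {f : B →+* Λ} (h : ∀ b, v (f b) ≤ 1)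
    {s : Λ} (hs : v s ≤ 1) (q : Polynomial B) : v (q.eval₂ f s) ≤ 1 := by
  rw [Polynomial.eval₂_eq_sum_range]
  refine v.map_sum_le fun i _ => ?_
  rw [map_mul, map_pow]
  exact mul_le_one' (h _) (pow_le_one' hs _)

variable {p : A} (hv : LiesOverElem p v)
include hv

theorem LiesOverElem.eq_one {a : A} (h : ¬ p ∣ a) : v (algebraMap A Λ a) = 1 :=
  le_antisymm (hv a).1 (not_lt.1 fun h1 => h ((hv a).2.1 h1))

theorem LiesOverElem.lt_one : v (algebraMap A Λ p) < 1 := (hv p).2.2 dvd_rfl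

theorem LiesOverElem.le_one (a : A) : v (algebraMap A Λ a) ≤ 1 := (hv a).1

theorem LiesOverElem.le_one_of_isIntegral {s : Λ} (hs : IsIntegral A s) : v s ≤ 1 :=
  v.le_one_of_isIntegral hv.le_one hs

variable [IsDomain A] [IsNoetherianRing A]

theorem LiesOverElem.exists_pow (hp : Prime p) {a : A} (ha : a ≠ 0) :
    ∃ n : ℕ, v (algebraMap A Λ a) = v (algebraMap A Λ p) ^ n := by
  obtain ⟨c, hc, h⟩ :=
    (FiniteMultiplicity.of_prime_left hp ha).exists_eq_pow_mul_and_not_dvd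
  refine ⟨multiplicity p a, ?_⟩
  nth_rw 1 [hc]
  rw [map_mul, map_mul, hv.eq_one h, mul_one, map_pow, map_pow]

theorem LiesOverElem.exists_mul_pow_le_one [Algebra.IsAlgebraic A Λ] (hp : Prime p) (s : Λ) :
    ∃ n : ℕ, v s * v (algebraMap A Λ p) ^ n ≤ 1 := by
  obtain ⟨f, hf, hi⟩ := IsAlgebraic.exists_integral_multiple (Algebra.IsAlgebraic.isAlgebraic (R := A) s)
  obtain ⟨n, hn⟩ := hv.exists_pow hp hf
  refine ⟨n, ?_⟩
  have := hv.le_one_of_isIntegral hi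
  rwa [Algebra.smul_def, map_mul, hn, mul_comm] at this

end ValuationBasics

section

variable {Λ : Type*} [Field Λ]

theorem exists_clearDen {A : Type*} [CommRing A] [IsDomain A] [Algebra A Λ]
    [Algebra.IsAlgebraic A Λ] (T : Finset Λ) :
    ∃ f : A, f ≠ 0 ∧ ∀ s ∈ T, IsIntegral A (algebraMap A Λ f * s) := by
  classical
  induction T using Finset.induction_on with
  | empty => exact ⟨1, one_ne_zero, by simp⟩
  | insert a T _ ih =>
    obtain ⟨f, hf, h⟩ := ih
    obtain ⟨g, hg, h2⟩ := IsAlgebraic.exists_integral_multiple (Algebra.IsAlgebraic.isAlgebraic (R := A) a)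
    rw [Algebra.smul_def] at h2
    refine ⟨f * g, mul_ne_zero hf hg, fun s hs => ?_⟩
    rcases Finset.mem_insert.1 hs with rfl | hs
    · rw [map_mul, mul_assoc]
      exact isIntegral_algebraMap.mul h2
    · rw [map_mul, mul_comm (algebraMap A Λ f), mul_assoc]
      exact isIntegral_algebraMap.mul (h s hs)

universe w in
/-- Away from finitely many primes, finitely many elements are integral. -/
theorem exists_good_integral {A : Type*} [CommRing A] [IsDomain A] [Algebra A Λ]
    [Algebra.IsAlgebraic A Λ] (T : Finset Λ) :
    ∃ f : A, f ≠ 0 ∧ ∀ {Γ : Type w} [LinearOrderedCommGroupWithZero Γ] (v : Valuation Λ Γ) (p : A),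
      LiesOverElem p v → ¬ p ∣ f → ∀ s ∈ T, v s ≤ 1 := by
  obtain ⟨f, hf, h⟩ := exists_clearDen (A := A) T
  refine ⟨f, hf, fun v p hv hpf s hs => ?_⟩
  have := hv.le_one_of_isIntegral (h s hs)
  rwa [map_mul, hv.eq_one hpf, one_mul] at this

universe w in
/-- Away from finitely many primes, finitely many nonzero elements are units. -/
theorem exists_good_unit {A : Type*} [CommRing A] [IsDomain A] [Algebra A Λ]
    [Algebra.IsAlgebraic A Λ] (T : Finset Λ) :
    ∃ f : A, f ≠ 0 ∧ ∀ {Γ : Type w} [LinearOrderedCommGroupWithZero Γ] (v : Valuation Λ Γ) (p : A),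
      LiesOverElem p v → ¬ p ∣ f → ∀ s ∈ T, s ≠ 0 → v s = 1 := by
  classical
  obtain ⟨f, hf, h⟩ := exists_good_integral (A := A) (T ∪ T.image (·⁻¹))
  refine ⟨f, hf, fun v p hv hpf s hs hs0 => ?_⟩
  have h1 := h v p hv hpf s (by simp [hs])
  have h2 := h v p hv hpf s⁻¹ (by simp [hs])
  refine le_antisymm h1 ?_
  rwa [map_inv₀, inv_le_one₀ (zero_lt_iff.2 ((Valuation.ne_zero_iff _).2 hs0))] at h2

end

open Polynomial in
theorem Polynomial.exists_pseudo_div {A : Type*} [CommRing A] (g : A[X])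
    (hg : 0 < g.natDegree) (q : A[X]) :
    ∃ (k : ℕ) (h r : A[X]), C (g.leadingCoeff ^ k) * q = g * h + r ∧ r.natDegree < g.natDegree := by
  induction hn : q.natDegree using Nat.strong_induction_on generalizing q with
  | _ n ih =>
    by_cases hlt : q.natDegree < g.natDegree
    · exact ⟨0, 0, q, by simp, hlt⟩
    · push Not at hlt
      have h1 := natDegree_cancelLeads_lt_of_natDegree_le_natDegree hlt (hg.trans_le hlt)
      obtain ⟨k, h, r, h2, h3⟩ := ih _ (hn ▸ h1) _ rfl
      refine ⟨k + 1, h + C (g.leadingCoeff ^ k) * C q.leadingCoeff *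
        X ^ (q.natDegree - g.natDegree), r, ?_, h3⟩
      rw [cancelLeads, Nat.sub_eq_zero_of_le hlt, pow_zero, mul_one] at h2
      rw [pow_succ, C_mul]
      linear_combination h2

section Unramified

open Polynomial

variable {Λ Γ : Type*} [Field Λ] [LinearOrderedCommGroupWithZero Γ] {v : Valuation Λ Γ}
  {A : Type*} [CommRing A] [Algebra A Λ] {p : A}

theorem LiesOverElem.aeval_le_one (hv : LiesOverElem p v) {y : Λ} (hy : v y ≤ 1) (q : A[X]) :
    v (aeval y q) ≤ 1 :=
  v.eval₂_le_one (f := algebraMap A Λ) hv.le_one hy q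

theorem LiesOverElem.exists_minimal_primitive (hv : LiesOverElem p v) {y : Λ} (hy : v y ≤ 1)
    {q : A[X]} (hq : v (aeval y q) < 1) (hqp : ¬ C p ∣ q) :
    ∃ g : A[X], v (aeval y g) < 1 ∧ ¬ p ∣ g.leadingCoeff ∧ 0 < g.natDegree ∧
      ∀ r : A[X], v (aeval y r) < 1 → r.natDegree < g.natDegree → C p ∣ r := by
  classical
  have hex : ∃ n, ∃ g : A[X], g.natDegree = n ∧ v (aeval y g) < 1 ∧ ¬ C p ∣ g :=
    ⟨_, q, rfl, hq, hqp⟩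
  obtain ⟨g, hgn, hg, hgp⟩ := Nat.find_spec hex
  have hmin : ∀ r : A[X], v (aeval y r) < 1 → r.natDegree < g.natDegree → C p ∣ r := by
    intro r hr hrn
    by_contra hc
    exact Nat.find_min hex (hgn ▸ hrn) ⟨r, rfl, hr, hc⟩
  have h0 : 0 < g.natDegree := by
    by_contra h0
    rw [Nat.pos_iff_ne_zero, not_not] at h0
    obtain ⟨a, rfl⟩ := natDegree_eq_zero.1 h0
    rw [aeval_C] at hg
    exact hgp (map_dvd C ((hv a).2.1 hg))
  refine ⟨g, hg, fun hl => ?_, h0, hmin⟩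
  have h1 : v (aeval y g.eraseLead) < 1 := by
    rw [eq_sub_of_add_eq (eraseLead_add_C_mul_X_pow g), map_sub, map_mul, aeval_C]
    refine v.map_sub_lt hg ?_
    rw [map_mul, map_pow, aeval_X, map_pow]
    exact (mul_le_of_le_one_right' (pow_le_one' hy _)).trans_lt ((hv _).2.2 hl)
  have h2 : C p ∣ g.eraseLead := by
    by_cases h : g.eraseLead.natDegree < g.natDegree
    · exact hmin _ h1 h
    · have := eraseLead_natDegree_le g
      omega
  apply hgp
  rw [← eraseLead_add_C_mul_X_pow g]
  exact dvd_add h2 ((map_dvd C hl).mul_right _)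

theorem LiesOverElem.exists_mul_eq (hv : LiesOverElem p v) {y : Λ} (hy : v y ≤ 1) {M : A[X]}
    (hM : aeval y M = 0) (hM' : v (aeval y M.derivative) = 1) {q : A[X]}
    (hq : v (aeval y q) < 1) :
    ∃ f q' : A[X], v (aeval y f) = 1 ∧ aeval y f * aeval y q = algebraMap A Λ p * aeval y q' := by
  by_cases hqp : C p ∣ q
  · obtain ⟨q', rfl⟩ := hqp
    exact ⟨1, q', by simp, by simp⟩
  obtain ⟨g, hg, hgp, hg0, hmin⟩ := hv.exists_minimal_primitive hy hq hqp
  obtain ⟨k, h, r, h1, h2⟩ := g.exists_pseudo_div hg0 q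
  obtain ⟨l, n, s, h3, h4⟩ := g.exists_pseudo_div hg0 M
  have ha : v (algebraMap A Λ g.leadingCoeff) = 1 := hv.eq_one hgp
  have hr : C p ∣ r := by
    refine hmin r ?_ h2
    have : r = C (g.leadingCoeff ^ k) * q - g * h := by rw [h1]; ring
    rw [this, map_sub, map_mul, map_mul]
    refine v.map_sub_lt ?_ ?_
    · rw [map_mul, aeval_C, map_pow, map_pow, ha, one_pow, one_mul]
      exact hq
    · rw [map_mul]
      exact (mul_le_of_le_one_right' (hv.aeval_le_one hy h)).trans_lt hg
  have hs : C p ∣ s := by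
    refine hmin s ?_ h4
    have : s = C (g.leadingCoeff ^ l) * M - g * n := by rw [h3]; ring
    rw [this, map_sub, map_mul, map_mul, hM, mul_zero, zero_sub, v.map_neg, map_mul]
    exact (mul_le_of_le_one_right' (hv.aeval_le_one hy n)).trans_lt hg
  obtain ⟨r, rfl⟩ := hr
  obtain ⟨s, rfl⟩ := hs
  have hn : v (aeval y n) = 1 := by
    refine le_antisymm (hv.aeval_le_one hy n) (not_lt.1 fun hn => ?_)
    have h5 := congrArg (fun q => aeval y (derivative q)) h3
    simp only [derivative_mul, derivative_C, map_add, map_mul, zero_mul, zero_add,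
      aeval_C] at h5
    have h6 : v (algebraMap A Λ (g.leadingCoeff ^ l) * aeval y (derivative M)) < 1 := by
      rw [h5]
      refine v.map_add_lt (v.map_add_lt ?_ ?_) ?_
      · rw [map_mul]
        exact (mul_le_of_le_one_left' (hv.aeval_le_one hy _)).trans_lt hn
      · rw [map_mul]
        exact (mul_le_of_le_one_right' (hv.aeval_le_one hy _)).trans_lt hg
      · rw [map_mul]
        exact (mul_le_of_le_one_right' (hv.aeval_le_one hy _)).trans_lt hv.lt_one
    rw [map_mul, hM', map_pow, map_pow, ha] at h6
    simp at h6
  refine ⟨n * C (g.leadingCoeff ^ k), n * r - s * h, ?_, ?_⟩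
  · rw [map_mul, map_mul, hn, aeval_C, map_pow, map_pow, ha]; simp
  · have h1' := congrArg (aeval y) h1
    have h3' := congrArg (aeval y) h3
    simp only [map_add, map_mul, map_sub, aeval_C, hM, mul_zero] at h1' h3' ⊢
    linear_combination (aeval y n) * h1' - (aeval y h) * h3'

/-- If the derivative of an equation of `y` is a unit, then `A[y]` is unramified at `v`. -/
theorem LiesOverElem.exists_zpow_of_unramified [IsDomain A] [IsNoetherianRing A]
    [Algebra.IsAlgebraic A Λ] (hp : Prime p) (hv : LiesOverElem p v)
    {y : Λ} (hy : v y ≤ 1) {M : A[X]}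
    (hM : aeval y M = 0) (hM' : v (aeval y M.derivative) = 1) (q : A[X]) (hq : aeval y q ≠ 0) :
    ∃ n : ℕ, v (aeval y q) = v (algebraMap A Λ p) ^ n := by
  have key : ∀ (N : ℕ) (q : A[X]), v (algebraMap A Λ p) ^ N ≤ v (aeval y q) →
      ∃ n : ℕ, v (aeval y q) = v (algebraMap A Λ p) ^ n := by
    intro N
    induction N with
    | zero =>
      intro q hN
      exact ⟨0, le_antisymm (by simpa using hv.aeval_le_one hy q) (by simpa using hN)⟩
    | succ N ih =>
      intro q hN
      rcases (hv.aeval_le_one hy q).lt_or_eq with h | h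
      · obtain ⟨f, q', h1, h2⟩ := hv.exists_mul_eq hy hM hM' h
        have h3 := congrArg v h2
        rw [map_mul, map_mul, h1, one_mul] at h3
        by_cases hp0 : v (algebraMap A Λ p) = 0
        · exact ⟨1, by rw [h3, hp0]; simp⟩
        rw [h3, pow_succ', mul_le_mul_iff_right₀ (zero_lt_iff.2 hp0)] at hN
        obtain ⟨n, hn⟩ := ih q' hN
        exact ⟨n + 1, by rw [h3, hn, pow_succ']⟩
      · exact ⟨0, by simpa using h⟩
  obtain ⟨N, hN⟩ := hv.exists_mul_pow_le_one hp (aeval y q)⁻¹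
  refine key N q ?_
  rw [map_inv₀] at hN
  rwa [inv_mul_le_iff₀ (zero_lt_iff.2 (v.ne_zero_iff.2 hq)), mul_one] at hN

theorem LiesOverElem.le_one_of_unramified [IsDomain A] [IsNoetherianRing A] [FaithfulSMul A Λ]
    [Algebra.IsAlgebraic A Λ] (hp : Prime p) (hv : LiesOverElem p v)
    {y : Λ} (hy : v y ≤ 1) {M : A[X]}
    (hM : aeval y M = 0) (hM' : v (aeval y M.derivative) = 1) {s : Λ}
    (hs : ∃ a : A, a ≠ 0 ∧ ∃ q : A[X], algebraMap A Λ a * s = aeval y q)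
    (h : v (algebraMap A Λ p * s) < 1) : v s ≤ 1 := by
  obtain ⟨a, ha, q, hq⟩ := hs
  by_cases hs0 : s = 0
  · simp [hs0]
  have ha0 : algebraMap A Λ a ≠ 0 := by rwa [Ne, FaithfulSMul.algebraMap_eq_zero_iff]
  obtain ⟨n, hn⟩ := hv.exists_zpow_of_unramified hp hy hM hM' q (hq ▸ mul_ne_zero ha0 hs0)
  obtain ⟨m, hm⟩ := hv.exists_pow hp ha
  have hp0 : 0 < v (algebraMap A Λ p) := by
    rw [zero_lt_iff, Ne, map_eq_zero, FaithfulSMul.algebraMap_eq_zero_iff]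
    exact hp.ne_zero
  rw [← hq, map_mul, hm] at hn
  have h1 : v (algebraMap A Λ p) ^ (n + 1) < v (algebraMap A Λ p) ^ m := by
    rw [pow_succ', ← hn, mul_left_comm, ← map_mul]
    exact mul_lt_of_lt_one_right (pow_pos hp0 m) h
  rw [pow_lt_pow_iff_right_of_lt_one₀ hp0 hv.lt_one] at h1
  have h2 : v (algebraMap A Λ p) ^ m * v s ≤ v (algebraMap A Λ p) ^ m * 1 := by
    rw [hn, mul_one]
    exact pow_le_pow_right_of_le_one' hv.lt_one.le (Nat.lt_succ_iff.1 h1)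
  exact (mul_le_mul_iff_right₀ (pow_pos hp0 m)).1 h2

end Unramified

section LogGood

open Polynomial

variable {Λ Γ : Type*} [Field Λ] [LinearOrderedCommGroupWithZero Γ] {v : Valuation Λ Γ}
  {A : Type*} [CommRing A] [Algebra A Λ] {p : A}

/-- An element of the valuation ring is a simple root of a polynomial modulo the maximal ideal. -/
theorem LiesOverElem.exists_simple_root [IsDomain A] [IsNoetherianRing A] [FaithfulSMul A Λ]
    [Algebra.IsAlgebraic A Λ] (hp : Prime p) (hA : ∀ n : ℕ, n ≠ 0 → IsUnit (n : A))
    (hv : LiesOverElem p v) {f : Λ} (hf : v f ≤ 1) :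
    ∃ g : A[X], v (aeval f g) < 1 ∧ v (aeval f (derivative g)) = 1 := by
  have h1 : ∃ q : A[X], v (aeval f q) < 1 ∧ ¬ C p ∣ q := by
    obtain ⟨q, hq0, hq⟩ := Algebra.IsAlgebraic.isAlgebraic (R := A) f
    have hCp : Prime (C p : A[X]) := prime_C_iff.2 hp
    have hfin := FiniteMultiplicity.of_prime_left hCp hq0
    obtain ⟨c, hc, h⟩ := hfin.exists_eq_pow_mul_and_not_dvd
    refine ⟨c, ?_, h⟩
    rw [hc, map_mul, map_pow, aeval_C, mul_eq_zero] at hq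
    rcases hq with hq | hq
    · exfalso
      have := eq_zero_of_pow_eq_zero hq
      rw [FaithfulSMul.algebraMap_eq_zero_iff] at this
      exact hp.ne_zero this
    · simp [hq]
  obtain ⟨q, hq, hqp⟩ := h1
  obtain ⟨g, hg, hgp, hg0, hmin⟩ := hv.exists_minimal_primitive hf hq hqp
  refine ⟨g, hg, le_antisymm (hv.aeval_le_one hf _) (not_lt.1 fun h => ?_)⟩
  have h2 := hmin _ h (natDegree_derivative_lt hg0.ne')
  rw [C_dvd_iff_dvd_coeff] at h2
  have h3 := h2 (g.natDegree - 1)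
  rw [coeff_derivative, Nat.sub_add_cancel hg0, coeff_natDegree] at h3
  apply hgp
  have h4 : ((g.natDegree - 1 : ℕ) : A) + 1 = (g.natDegree : ℕ) := by
    rw [← Nat.cast_add_one, Nat.sub_add_cancel hg0]
  rw [h4] at h3
  exact (hA _ hg0.ne').dvd_mul_right.1 h3

theorem derivation_aeval_sub_le {k : Type*} [CommRing k] [Algebra k Λ] {D : Derivation k Λ Λ}
    (hD : ∀ a : A, v (D (algebraMap A Λ a)) ≤ 1)
    {f : Λ} (hf : v f ≤ 1) (g : A[X]) :
    v (D (aeval f g) - aeval f (derivative g) * D f) ≤ 1 := by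
  induction g using Polynomial.induction_on' with
  | add g h hg hh =>
    have : D (aeval f (g + h)) - aeval f (derivative (g + h)) * D f =
      (D (aeval f g) - aeval f (derivative g) * D f) +
        (D (aeval f h) - aeval f (derivative h) * D f) := by
      simp only [map_add]; ring
    rw [this]
    exact v.map_add_le hg hh
  | monomial n a =>
    have : D (aeval f (monomial n a)) - aeval f (derivative (monomial n a)) * D f =
        f ^ n * D (algebraMap A Λ a) := by
      rw [derivative_monomial, aeval_monomial, aeval_monomial, D.leibniz, D.leibniz_pow]
      simp only [smul_eq_mul, nsmul_eq_mul, map_mul, map_natCast]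
      ring
    rw [this, map_mul, map_pow]
    exact mul_le_one' (pow_le_one' hf _) (hD _)

/-- The improvement step for the order of the poles of a derivation. -/
theorem LiesOverElem.derivation_step {k : Type*} [CommRing k] [Algebra k Λ] {D : Derivation k Λ Λ}
    (hv : LiesOverElem p v) (hD : ∀ a : A, v (D (algebraMap A Λ a)) ≤ 1)
    (hA : ∀ n : ℕ, n ≠ 0 → IsUnit (n : A))
    {V : Subring Λ} (hV : ∀ f ∈ V, v f ≤ 1) (hAV : ∀ a : A, algebraMap A Λ a ∈ V)
    {w : Λ} (hw0 : w ≠ 0) (hw1 : v w < 1)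
    {e : ℕ} (he : e ≠ 0) {u : Λ} (hu : u ∈ V) (hwe : w ^ e = u * algebraMap A Λ p)
    (hu1 : v u = 1) (hwd : ∀ f ∈ V, v f < 1 → ∃ g ∈ V, f = w * g)
    (hroot : ∀ f ∈ V, ∃ g : A[X], v (aeval f g) < 1 ∧ v (aeval f (derivative g)) = 1)
    {C : Γ} (hC1 : 1 ≤ C)
    (hC : ∀ f ∈ V, v (algebraMap A Λ p * D f) ≤ C) :
    ∀ f ∈ V, v (algebraMap A Λ p * D f) ≤ v w * C := by
  have hwp : v w ^ e = v (algebraMap A Λ p) := by rw [← map_pow, hwe, map_mul, hu1, one_mul]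
  have hw0' : 0 < v w := zero_lt_iff.2 (v.ne_zero_iff.2 hw0)
  have hpw : v (algebraMap A Λ p) ≤ v w := by
    rw [← hwp]
    exact (pow_le_pow_right_of_le_one' hw1.le (Nat.one_le_iff_ne_zero.2 he)).trans_eq
      (pow_one _)
  have hDw : v (algebraMap A Λ p * D w) ≤ v w * C := by
    have h1 := congrArg D hwe
    rw [D.leibniz_pow, D.leibniz, smul_eq_mul, smul_eq_mul, smul_eq_mul, nsmul_eq_mul] at h1
    have h2 : v (w ^ (e - 1) * (algebraMap A Λ p * D w)) ≤ v w ^ e * C := by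
      have h3 : (e : Λ) * (w ^ (e - 1) * (algebraMap A Λ p * D w)) =
          algebraMap A Λ p * (u * D (algebraMap A Λ p)) +
            algebraMap A Λ p * (algebraMap A Λ p * D u) := by
        linear_combination (algebraMap A Λ p) * h1
      have h4 : v (e : Λ) = 1 := by
        rw [← map_natCast (algebraMap A Λ)]
        exact hv.eq_one fun h => absurd (hv.lt_one) (by
          obtain ⟨b, hb⟩ := (isUnit_of_dvd_unit h (hA e he)).exists_right_inv
          have := congrArg (fun a => v (algebraMap A Λ a)) hb
          simp only [map_mul, map_one] at this
          intro h5
          have := (mul_le_of_le_one_right' (hv.le_one b)).trans_lt h5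
          simp_all)
      have h5 := congrArg v h3
      rw [map_mul, h4, one_mul] at h5
      rw [h5, hwp]
      refine v.map_add_le ?_ ?_
      · rw [map_mul, map_mul, hu1, one_mul]
        exact mul_le_mul' le_rfl ((hD p).trans hC1)
      · rw [map_mul]
        exact mul_le_mul' le_rfl (hC u hu)
    rw [map_mul, map_pow] at h2
    obtain ⟨e, rfl⟩ := Nat.exists_eq_succ_of_ne_zero he
    rw [Nat.succ_eq_add_one, Nat.add_sub_cancel, pow_succ, mul_assoc] at h2
    exact (mul_le_mul_iff_right₀ (pow_pos hw0' e)).1 h2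
  intro f hf
  obtain ⟨g, hg, hg'⟩ := hroot f hf
  have hgV : aeval f g ∈ V := by
    rw [aeval_eq_sum_range]
    refine V.sum_mem fun i _ => ?_
    rw [Algebra.smul_def]
    exact V.mul_mem (hAV _) (V.pow_mem hf _)
  obtain ⟨h, hh, hgh⟩ := hwd _ hgV hg
  have h1 := derivation_aeval_sub_le hD (hV f hf) g
  rw [hgh, D.leibniz, smul_eq_mul, smul_eq_mul] at h1
  have h2 : aeval f (derivative g) * (algebraMap A Λ p * D f) =
      (w * (algebraMap A Λ p * D h) + h * (algebraMap A Λ p * D w)) - algebraMap A Λ p *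
      (w * D h + h * D w - aeval f (derivative g) * D f) := by
    ring
  have h3 := congrArg v h2
  rw [map_mul, hg', one_mul] at h3
  rw [h3]
  refine v.map_sub_le (v.map_add_le ?_ ?_) ?_
  · rw [map_mul]
    exact mul_le_mul' le_rfl (hC h hh)
  · rw [map_mul]
    exact (mul_le_of_le_one_left' (hV h hh)).trans hDw
  · rw [map_mul]
    exact mul_le_mul' hpw (h1.trans hC1)

end LogGood

section

variable {Λ Γ : Type*} [Field Λ] [LinearOrderedCommGroupWithZero Γ] {v : Valuation Λ Γ}
  {A : Type*} [CommRing A] [Algebra A Λ] {p : A}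

theorem Ideal.eq_bot_of_lt_span_prime [IsDomain A] [IsNoetherianRing A] (hp : Prime p)
    (Q : Ideal A) [Q.IsPrime] (hQ : Q < Ideal.span {p}) : Q = ⊥ := by
  rw [eq_bot_iff]
  intro q hq
  by_contra h0
  obtain ⟨c, hc, h⟩ := (FiniteMultiplicity.of_prime_left hp h0).exists_eq_pow_mul_and_not_dvd
  rw [hc] at hq
  rcases ‹Q.IsPrime›.mem_or_mem hq with h1 | h1
  · have h2 := ‹Q.IsPrime›.mem_of_pow_mem _ h1
    exact hQ.not_ge ((Ideal.span_singleton_le_iff_mem _).2 h2)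
  · exact h (Ideal.mem_span_singleton.1 (hQ.le h1))

/-- A valuation over a prime element of a normal domain restricts to a discrete valuation on each
finite extension. -/
theorem LiesOverElem.exists_discrete [IsDomain A] [IsNoetherianRing A] [IsIntegrallyClosed A]
    [FaithfulSMul A Λ] [CharZero A]
    [Algebra.IsAlgebraic A Λ] (hp : Prime p) (hv : LiesOverElem p v) (f : Λ) :
    ∃ (Λ₀ : Subfield Λ) (w : Λ) (T : Finset Λ), f ∈ Λ₀ ∧ w ∈ Λ₀ ∧ w ≠ 0 ∧ v w < 1 ∧
      (∀ a : A, algebraMap A Λ a ∈ Λ₀) ∧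
      (∀ s ∈ Λ₀, s ≠ 0 → v s ≤ 1 → ∃ n : ℕ, ∃ b ∈ Submodule.span A (T : Set Λ), ∃ c ∈
        Submodule.span A (T : Set Λ), b ∈ Λ₀ ∧ c ∈ Λ₀ ∧ v b = 1 ∧ v c = 1 ∧ s * c = w ^ n * b) ∧
      (∀ c ∈ Submodule.span A (T : Set Λ), v c ≤ 1) := by
  let _ := FractionRing.liftAlgebra A Λ
  let κ := FractionRing A
  have hf : IsIntegral κ f :=
    ((Algebra.IsAlgebraic.isAlgebraic (R := A) f).extendScalars
      (IsFractionRing.injective A κ)).isIntegral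
  let L := IntermediateField.adjoin κ {f}
  have : FiniteDimensional κ L := IntermediateField.adjoin.finiteDimensional hf
  have : CharZero κ := charZero_of_injective_algebraMap (IsFractionRing.injective A κ)
  let C := integralClosure A L
  have : Module.Finite A C := IsIntegralClosure.finite A κ L C
  have : IsNoetherianRing C := IsNoetherianRing.of_finite A C
  have : IsFractionRing C L := integralClosure.isFractionRing_of_finite_extension κ L
  let φ : C →ₐ[A] Λ := (L.val.restrictScalars A).comp C.val
  have hφ : ∀ c, v (φ c) ≤ 1 := fun c => hv.le_one_of_isIntegral
    (((mem_integralClosure_iff A L).1 c.2).map (L.val.restrictScalars A))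
  have hφinj : Function.Injective φ := by
    intro a b hab
    exact Subtype.ext (Subtype.ext hab)
  let P := valuationCenter φ.toRingHom v hφ
  have hφA : ∀ a, φ (algebraMap A C a) = algebraMap A Λ a := φ.commutes
  have hPA : P.comap (algebraMap A C) = Ideal.span {p} := by
    ext a
    rw [Ideal.mem_comap, mem_valuationCenter, Ideal.mem_span_singleton, ← (hv a).2, ← hφA]
    rfl
  have hAC : Function.Injective (algebraMap A C) := fun a b hab =>
    FaithfulSMul.algebraMap_injective A Λ (by rw [← hφA, ← hφA, hab])
  have hP0 : P ≠ ⊥ := by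
    intro h
    have h1 : p ∈ P.comap (algebraMap A C) := by
      rw [hPA]; exact Ideal.mem_span_singleton_self p
    rw [h, Ideal.mem_comap, Ideal.mem_bot, map_eq_zero_iff _ hAC] at h1
    exact hp.ne_zero h1
  have hP1 : ∀ Q : Ideal C, Q.IsPrime → Q < P → Q = ⊥ := by
    intro Q hQ hQP
    apply Ideal.eq_bot_of_comap_eq_bot (R := A)
    obtain ⟨x, hxP, hxQ⟩ := SetLike.exists_of_lt hQP
    have h1 := Ideal.comap_lt_comap_of_integral_mem_sdiff (R := A) hQP.le
      (x := x) ⟨hxP, hxQ⟩ (Algebra.IsIntegral.isIntegral x)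
    rw [hPA] at h1
    have : (Q.comap (algebraMap A C)).IsPrime := hQ.comap _
    exact Ideal.eq_bot_of_lt_span_prime hp _ h1
  obtain ⟨t, htP, ht0, ht⟩ := HeightOnePrime.exists_uniformizer (F := L) P hP0 hP1 1
    (fun h => by simpa using mem_valuationCenter.1 h) (fun f hf => by
      obtain ⟨b, hb⟩ := IsIntegralClosure.isIntegral_iff (A := C).1 (isIntegral_trans (R := A) f hf)
      exact ⟨b, by rw [hb, map_one, one_mul]⟩)
  have hval : ∀ c : C, c ∉ P → v (φ c) = 1 := fun c hc => not_mem_valuationCenter.1 hc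
  obtain ⟨T, hT⟩ := (Module.Finite.fg_top (R := A) (M := C))
  classical
  have hspan : ∀ x, x ∈ Submodule.span A ((T.image φ : Finset Λ) : Set Λ) ↔ ∃ c, φ c = x := by
    intro x
    rw [Finset.coe_image]
    change x ∈ Submodule.span A (φ.toLinearMap '' _) ↔ _
    rw [Submodule.span_image, hT]
    simp
  refine ⟨L.toSubfield, φ t, T.image φ, IntermediateField.mem_adjoin_simple_self κ f, ?_, ?_, ?_,
    ?_, ?_, ?_⟩
  · exact (t : L).2
  · rwa [Ne, map_eq_zero_iff _ hφinj]
  · exact mem_valuationCenter.1 htP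
  · intro a
    rw [IsScalarTower.algebraMap_apply A κ Λ]
    exact L.algebraMap_mem _
  · intro s hs hs0 hs1
    obtain ⟨b, c, hc, hbc⟩ := IsFractionRing.div_surjective (A := C) (⟨s, hs⟩ : L)
    have hc0 := nonZeroDivisors.ne_zero hc
    have hφc0 : φ c ≠ 0 := by rwa [Ne, map_eq_zero_iff _ hφinj]
    have hbc' : φ b = s * φ c := by
      have h1 := congrArg (L.val) hbc
      rw [map_div₀] at h1
      exact (div_eq_iff hφc0).1 h1
    have hb0 : b ≠ 0 := by
      rintro rfl
      rw [map_zero] at hbc'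
      exact mul_ne_zero hs0 hφc0 hbc'.symm
    obtain ⟨n, r₁, r₂, h1, h2, h3⟩ := ht b hb0
    obtain ⟨m, q₁, q₂, h4, h5, h6⟩ := ht c hc0
    have h3' := congrArg φ h3
    have h6' := congrArg φ h6
    simp only [map_mul, map_pow] at h3' h6'
    have ht0' : φ t ≠ 0 := by rwa [Ne, map_eq_zero_iff _ hφinj]
    have hvt : 0 < v (φ t) := zero_lt_iff.2 (v.ne_zero_iff.2 ht0')
    have hmn : m ≤ n := by
      have e1 := congrArg v h3'
      have e2 := congrArg v h6'
      rw [map_mul, map_mul, hval _ h1, hval _ h2, one_mul, one_mul, map_pow] at e1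
      rw [map_mul, map_mul, hval _ h4, hval _ h5, one_mul, one_mul, map_pow] at e2
      have e3 := congrArg v hbc'
      rw [map_mul, e1, e2] at e3
      have e4 : v (φ t) ^ n ≤ v (φ t) ^ m := by
        rw [e3]; exact mul_le_of_le_one_left' hs1
      exact (pow_le_pow_iff_right_of_lt_one₀ hvt (mem_valuationCenter.1 htP)).1 e4
    refine ⟨n - m, φ (r₁ * q₂), (hspan _).2 ⟨_, rfl⟩, φ (r₂ * q₁), (hspan _).2 ⟨_, rfl⟩,
      ((r₁ * q₂ : C) : L).2, ((r₂ * q₁ : C) : L).2, ?_, ?_, ?_⟩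
    · rw [map_mul, map_mul, hval _ h1, hval _ h5, one_mul]
    · rw [map_mul, map_mul, hval _ h2, hval _ h4, one_mul]
    · have h7 : φ t ^ n = φ t ^ m * φ t ^ (n - m) := by rw [← pow_add, Nat.add_sub_cancel' hmn]
      have h8 : φ q₂ ≠ 0 := by
        rw [← v.ne_zero_iff, hval _ h5]; exact one_ne_zero
      have h9 := pow_ne_zero m ht0'
      apply mul_left_cancel₀ h9
      rw [map_mul, map_mul]
      linear_combination (φ r₁ * φ q₂) * h7 + φ q₂ * h3' - φ q₂ * φ r₂ * hbc' - s * φ r₂ * h6'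
  · intro c hc
    obtain ⟨c, rfl⟩ := (hspan _).1 hc
    exact hφ c

theorem LiesOverElem.logGood {k : Type*} [CommRing k] [Algebra k Λ] [IsDomain A]
    [IsNoetherianRing A] [IsIntegrallyClosed A] [FaithfulSMul A Λ] [CharZero A]
    [Algebra.IsAlgebraic A Λ] (hA : ∀ n : ℕ, n ≠ 0 → IsUnit (n : A)) (hp : Prime p)
    (hv : LiesOverElem p v) (D : Derivation k Λ Λ)
    (hD : ∀ a : A, v (D (algebraMap A Λ a)) ≤ 1) : LogGood v (algebraMap A Λ p) D := by
  have hp0 : algebraMap A Λ p ≠ 0 := by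
    rw [Ne, FaithfulSMul.algebraMap_eq_zero_iff]; exact hp.ne_zero
  have hvp : 0 < v (algebraMap A Λ p) := zero_lt_iff.2 (v.ne_zero_iff.2 hp0)
  have key : ∀ f, v f ≤ 1 → v (algebraMap A Λ p * D f) < 1 ∧ v (algebraMap A Λ p * D f) ≤ v f := by
    intro f hf1
    obtain ⟨Λ₀, w, T, hf, hw, hw0, hw1, hAΛ, hdec, hT⟩ := hv.exists_discrete hp f
    let V : Subring Λ := Λ₀.toSubring ⊓ v.integer
    have hV : ∀ f ∈ V, v f ≤ 1 := fun f hf => hf.2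
    have hwv : 0 < v w := zero_lt_iff.2 (v.ne_zero_iff.2 hw0)
    have hdec' : ∀ s ∈ V, s ≠ 0 → ∃ n : ℕ, ∃ u ∈ V, v u = 1 ∧ s = w ^ n * u := by
      intro s hs hs0
      obtain ⟨n, b, -, c, -, hb0, hc0, hb1, hc1, h⟩ := hdec s hs.1 hs0 hs.2
      refine ⟨n, b / c, ⟨Λ₀.div_mem hb0 hc0, ?_⟩, ?_, ?_⟩
      · change v (b / c) ≤ 1
        rw [map_div₀, hb1, hc1, div_one]
      · rw [map_div₀, hb1, hc1, div_one]
      · have hc : c ≠ 0 := by rw [← v.ne_zero_iff, hc1]; exact one_ne_zero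
        rw [← mul_div_assoc, ← h, mul_div_cancel_right₀ _ hc]
    obtain ⟨e, u, hu, hu1, hwe⟩ := hdec' _ ⟨hAΛ p, hv.le_one p⟩ hp0
    have he : e ≠ 0 := by
      rintro rfl
      have := hv.lt_one
      rw [hwe, pow_zero, one_mul, hu1] at this
      exact lt_irrefl _ this
    have hu0 : u ≠ 0 := by rw [← v.ne_zero_iff, hu1]; exact one_ne_zero
    have hstep := fun (C : Γ) (hC1 : 1 ≤ C) => hv.derivation_step (D := D) hD hA (V := V) hV
      (fun a => ⟨hAΛ a, hv.le_one a⟩) hw0 hw1 he (u := u⁻¹)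
      ⟨Λ₀.inv_mem hu.1, by change v u⁻¹ ≤ 1; rw [map_inv₀, hu1, inv_one]⟩
      (by rw [hwe]; field_simp) (by rw [map_inv₀, hu1, inv_one]) (fun g hg hg1 => by
        by_cases hg0 : g = 0
        · exact ⟨0, V.zero_mem, by rw [hg0, mul_zero]⟩
        obtain ⟨n, x, hx, hx1, hgx⟩ := hdec' g hg hg0
        obtain ⟨n, rfl⟩ := Nat.exists_eq_succ_of_ne_zero (n := n) (by
          rintro rfl
          rw [hgx, pow_zero, one_mul, hx1] at hg1
          exact lt_irrefl _ hg1)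
        exact ⟨w ^ n * x, V.mul_mem (V.pow_mem ⟨hw, hw1.le⟩ _) hx, by rw [hgx, pow_succ]; ring⟩)
      (fun g hg => hv.exists_simple_root hp hA (hV g hg)) (C := C) hC1
    classical
    have hbound : ∃ N : ℕ, ∀ s ∈ V, v (algebraMap A Λ p * D s) ≤ (v w ^ N)⁻¹ := by
      have h1 : ∃ N : ℕ, ∀ s ∈ insert w T, v (D s) ≤ (v w ^ N)⁻¹ := by
        have h2 : ∀ s : Λ, ∃ N : ℕ, v (D s) ≤ (v w ^ N)⁻¹ := by
          intro s
          obtain ⟨N, hN⟩ := hv.exists_mul_pow_le_one hp (D s)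
          refine ⟨e * N, ?_⟩
          have h3 : v (algebraMap A Λ p) = v w ^ e := by rw [hwe, map_mul, hu1, mul_one, map_pow]
          rw [h3, ← pow_mul] at hN
          calc v (D s) = v (D s) * v w ^ (e * N) * (v w ^ (e * N))⁻¹ := by
                rw [mul_assoc, mul_inv_cancel₀ (pow_pos hwv _).ne', mul_one]
            _ ≤ 1 * (v w ^ (e * N))⁻¹ := mul_le_mul' hN le_rfl
            _ = _ := one_mul _
        choose N hN using h2
        refine ⟨(insert w T).sup N, fun s hs => (hN s).trans ?_⟩
        rw [inv_le_inv₀ (pow_pos hwv _) (pow_pos hwv _)]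
        exact pow_le_pow_right_of_le_one' hw1.le (Finset.le_sup hs)
      obtain ⟨N, hN⟩ := h1
      have hN1 : 1 ≤ (v w ^ N)⁻¹ := by
        rw [one_le_inv₀ (pow_pos hwv _)]
        exact pow_le_one' hw1.le _
      have hspan : ∀ c ∈ Submodule.span A (T : Set Λ), v (D c) ≤ (v w ^ N)⁻¹ := by
        intro c hc
        induction hc using Submodule.span_induction with
        | mem x hx => exact hN x (Finset.mem_insert_of_mem hx)
        | zero => simp
        | add x y _ _ hx hy => rw [map_add]; exact v.map_add_le hx hy
        | smul a x hx' hx =>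
          rw [Algebra.smul_def, D.leibniz, smul_eq_mul, smul_eq_mul]
          refine v.map_add_le ?_ ?_
          · rw [map_mul]; exact (mul_le_of_le_one_left' (hv.le_one a)).trans hx
          · rw [map_mul]
            exact (mul_le_one' (hT x hx') (hD a)).trans hN1
      have hDw : ∀ n : ℕ, v (D (w ^ n)) ≤ v (D w) := by
        intro n
        rw [D.leibniz_pow, smul_eq_mul, nsmul_eq_mul, map_mul, map_mul, map_pow]
        have : v (n : Λ) ≤ 1 := by
          rw [← map_natCast (algebraMap A Λ)]; exact hv.le_one _
        exact mul_le_of_le_one_left' this |>.trans (mul_le_of_le_one_left' (pow_le_one' hw1.le _))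
      refine ⟨N, fun s hs => ?_⟩
      by_cases hs0 : s = 0
      · simp [hs0]
      obtain ⟨n, b, hb, c, hc, -, -, hb1, hc1, h⟩ := hdec s hs.1 hs0 hs.2
      have h2 : c * D s = w ^ n * D b + b * D (w ^ n) - s * D c := by
        have := congrArg D h
        rw [D.leibniz, D.leibniz (w ^ n)] at this
        simp only [smul_eq_mul] at this
        linear_combination this
      have h3 : v (D s) ≤ (v w ^ N)⁻¹ := by
        rw [← one_mul (v (D s)), ← hc1, ← map_mul, h2]
        refine v.map_sub_le (v.map_add_le ?_ ?_) ?_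
        · rw [map_mul, map_pow]
          exact (mul_le_of_le_one_left' (pow_le_one' hw1.le _)).trans (hspan b hb)
        · rw [map_mul, hb1, one_mul]
          exact (hDw n).trans (hN w (Finset.mem_insert_self _ _))
        · rw [map_mul]
          exact (mul_le_of_le_one_left' hs.2).trans (hspan c hc)
      rw [map_mul]
      exact (mul_le_of_le_one_left' (hv.le_one p)).trans h3
    obtain ⟨N, hN⟩ := hbound
    have hN0 : ∀ s ∈ V, v (algebraMap A Λ p * D s) ≤ 1 := by
      induction N with
      | zero => simpa using hN
      | succ N ih =>
        refine ih fun s hs => ?_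
        have := hstep _ ?_ hN s hs
        · rwa [pow_succ', mul_inv, mul_inv_cancel_left₀ hwv.ne'] at this
        · rw [one_le_inv₀ (pow_pos hwv _)]
          exact pow_le_one' hw1.le _
    have hN1 : ∀ s ∈ V, v (algebraMap A Λ p * D s) ≤ v w := by
      intro s hs
      simpa using hstep 1 le_rfl hN0 s hs
    refine ⟨(hN1 f ⟨hf, hf1⟩).trans_lt hw1, ?_⟩
    by_cases hf0 : f = 0
    · simp [hf0]
    obtain ⟨n, u, hu, hu1, rfl⟩ := hdec' f ⟨hf, hf1⟩ hf0
    have h1 : algebraMap A Λ p * D (w ^ n * u) = w ^ n * (algebraMap A Λ p * D u) +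
        (n : Λ) * u * w ^ (n - 1) * (algebraMap A Λ p * D w) := by
      rw [D.leibniz, D.leibniz_pow, smul_eq_mul, smul_eq_mul, smul_eq_mul, nsmul_eq_mul]
      ring
    rw [h1, map_mul v (w ^ n) u, hu1, mul_one]
    refine v.map_add_le ?_ ?_
    · rw [map_mul]; exact mul_le_of_le_one_right' (hN0 u hu)
    · rcases Nat.eq_zero_or_pos n with rfl | hn
      · simp
      have hn1 : v (n : Λ) ≤ 1 := by
        rw [← map_natCast (algebraMap A Λ)]; exact hv.le_one _
      rw [map_mul, map_mul, map_mul, hu1, mul_one, map_pow, map_pow]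
      calc _ ≤ v w ^ (n - 1) * v w := mul_le_mul' (mul_le_of_le_one_left' hn1) (hN1 w ⟨hw, hw1.le⟩)
        _ = v w ^ n := by rw [← pow_succ, Nat.sub_add_cancel hn]
  refine ⟨fun f hf => (key f hf).1, fun f => ?_⟩
  rcases le_total (v f) 1 with h | h
  · exact (key f h).2
  · have hf0 : f ≠ 0 := by
      rintro rfl
      simp at h
    have hf0' : 0 < v f := zero_lt_iff.2 (v.ne_zero_iff.2 hf0)
    have h1 := (key f⁻¹ (by rw [map_inv₀]; exact inv_le_one_of_one_le₀ h)).2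
    rw [D.leibniz_inv, smul_eq_mul] at h1
    have h2 : algebraMap A Λ p * (-f⁻¹ ^ 2 * D f) = -(f⁻¹ * (f⁻¹ * (algebraMap A Λ p * D f))) := by
      ring
    rw [h2, v.map_neg, map_mul, map_inv₀] at h1
    have h3 := (mul_le_iff_le_one_right (inv_pos.2 hf0')).1 h1
    rwa [map_mul, map_inv₀, inv_mul_le_iff₀ hf0', mul_one] at h3

end

open MvPolynomial in
/-- The valuation `v` lies over the polynomial `π` in the chart `u`. -/
def LiesOverChart {K Λ Γ ι : Type*} [Field K] [Field Λ] [Algebra K Λ]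
    [LinearOrderedCommGroupWithZero Γ] (u : ι → Λ) (π : MvPolynomial ι K)
    (v : Valuation Λ Γ) : Prop :=
  ∀ a, v (aeval u a) ≤ 1 ∧ (v (aeval u a) < 1 ↔ π ∣ a)

/-- The algebra structure over a polynomial ring given by a family of elements. -/
noncomputable abbrev chartAlgebra {K Λ ι : Type*} [CommRing K] [CommRing Λ] [Algebra K Λ] (u : ι → Λ) :
    Algebra (MvPolynomial ι K) Λ := (MvPolynomial.aeval (R := K) u).toRingHom.toAlgebra

theorem IsTranscendenceBasis.isAlgebraic_chartAlgebra {K Λ ι : Type*} [Field K] [Field Λ]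
    [Algebra K Λ] {u : ι → Λ} (hu : IsTranscendenceBasis K u) :
    letI := chartAlgebra (K := K) u
    Algebra.IsAlgebraic (MvPolynomial ι K) Λ := by
  letI := chartAlgebra (K := K) u
  have h := hu.isAlgebraic
  have h2 := (Algebra.isAlgebraic_ringHom_iff_of_comp_eq (R := MvPolynomial ι K)
    (S := Algebra.adjoin K (Set.range u)) (A := Λ) (B := Λ)
    hu.1.aevalEquiv (RingEquiv.refl Λ) (by
      ext x <;> simp [RingHom.algebraMap_toAlgebra])).1
  exact h2 h

theorem AlgebraicIndependent.faithfulSMul_chartAlgebra {K Λ ι : Type*} [Field K] [Field Λ]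
    [Algebra K Λ] {u : ι → Λ} (hu : AlgebraicIndependent K u) :
    letI := chartAlgebra (K := K) u
    FaithfulSMul (MvPolynomial ι K) Λ := by
  letI := chartAlgebra (K := K) u
  exact (faithfulSMul_iff_algebraMap_injective _ _).2 hu

theorem exists_valuationSubring_center {B Λ : Type*} [CommRing B] [Field Λ]
    (f : B →+* Λ) (hf : Function.Injective f) (P : Ideal B) [P.IsPrime] :
    ∃ O : ValuationSubring Λ, ∀ b, O.valuation (f b) ≤ 1 ∧ (O.valuation (f b) < 1 ↔ b ∈ P) := by
  have : IsDomain B := hf.isDomain f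
  have hunit : ∀ y : P.primeCompl, IsUnit (f y) := fun y => by
    rw [isUnit_iff_ne_zero, Ne, map_eq_zero_iff f hf]
    rintro h
    exact y.2 (by rw [h]; exact P.zero_mem)
  let g : Localization.AtPrime P →+* Λ := IsLocalization.lift hunit
  obtain ⟨O, hO, hloc⟩ := IsLocalRing.exists_factor_valuationRing g
  have hg : ∀ b, g (algebraMap B _ b) = f b := fun b => IsLocalization.lift_eq hunit b
  refine ⟨O, fun b => ?_⟩
  have h1 : O.valuation (f b) ≤ 1 := by
    rw [ValuationSubring.valuation_le_one_iff, ← hg]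
    exact hO _
  refine ⟨h1, ?_⟩
  have h2 : IsUnit (algebraMap B (Localization.AtPrime P) b) ↔ b ∉ P := by
    rw [IsLocalization.AtPrime.isUnit_to_map_iff _ P]; rfl
  rw [← not_iff_not, ← h2, not_lt]
  have h3 : (1 ≤ O.valuation (f b)) ↔ O.valuation (f b) = 1 :=
    ⟨fun h => le_antisymm h1 h, fun h => h.ge⟩
  rw [h3]
  have h4 : ((g.codRestrict O.toSubring hO (algebraMap B _ b) : O) : Λ) = f b := hg b
  rw [← h4, ← ValuationSubring.valuation_eq_one_iff]
  exact ⟨fun h => hloc.map_nonunit _ h, fun h => h.map _⟩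

theorem exists_liesOverChart {K Λ ι : Type*} [Field K] [Field Λ] [Algebra K Λ] {u : ι → Λ}
    (hu : AlgebraicIndependent K u) {π : MvPolynomial ι K} (hπ : Prime π) :
    ∃ O : ValuationSubring Λ, LiesOverChart u π O.valuation := by
  have := (Ideal.span_singleton_prime hπ.ne_zero).2 hπ
  obtain ⟨O, hO⟩ := exists_valuationSubring_center
    (MvPolynomial.aeval (R := K) u).toRingHom hu (Ideal.span {π})
  refine ⟨O, fun a => ⟨(hO a).1, ?_⟩⟩
  rw [← Ideal.mem_span_singleton]
  exact (hO a).2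

section LiesOverChart

open MvPolynomial

variable {K Λ Γ ι : Type*} [Field K] [Field Λ] [Algebra K Λ]
    [LinearOrderedCommGroupWithZero Γ] {u : ι → Λ} {π : MvPolynomial ι K} {v : Valuation Λ Γ}

theorem LiesOverChart.liesOverElem (hv : LiesOverChart u π v) :
    letI := chartAlgebra (K := K) u
    LiesOverElem π v := hv

theorem LiesOverChart.exists_pow [Finite ι] (hv : LiesOverChart u π v) (hπ : Prime π)
    {g : MvPolynomial ι K} (hg : g ≠ 0) : ∃ m : ℕ, v (aeval u g) = v (aeval u π) ^ m := by
  let := chartAlgebra (K := K) u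
  exact hv.liesOverElem.exists_pow hπ hg

theorem IsTranscendenceBasis.exists_clearDen (hu : IsTranscendenceBasis K u) (T : Finset Λ) :
    ∃ g : MvPolynomial ι K, g ≠ 0 ∧ ∀ {Γ : Type*} [LinearOrderedCommGroupWithZero Γ]
      (v : Valuation Λ Γ) (π : MvPolynomial ι K), LiesOverChart u π v →
      ∀ s ∈ T, v (aeval u g * s) ≤ 1 := by
  let := chartAlgebra (K := K) u
  have := hu.1.faithfulSMul_chartAlgebra
  have := hu.isAlgebraic_chartAlgebra
  obtain ⟨g, hg, h⟩ := _root_.exists_clearDen (A := MvPolynomial ι K) T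
  exact ⟨g, hg, fun v π hv s hs => hv.liesOverElem.le_one_of_isIntegral (h s hs)⟩

end LiesOverChart

open MvPolynomial in
theorem MvPolynomial.aeval_mul_of_isHomogeneous {K Λ ι : Type*} [CommRing K] [CommRing Λ]
    [Algebra K Λ] {p : MvPolynomial ι K} {m : ℕ} (hp : p.IsHomogeneous m) (c : Λ) (w : ι → Λ) :
    aeval (fun i => c * w i) p = c ^ m * aeval w p := by
  rw [aeval_def, aeval_def, eval₂_eq, eval₂_eq, Finset.mul_sum]
  refine Finset.sum_congr rfl fun d hd => ?_
  rw [Finset.prod_congr rfl fun i _ => mul_pow c (w i) (d i), Finset.prod_mul_distrib,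
    Finset.prod_pow_eq_pow_sum]
  have h : ∑ i ∈ d.support, d i = m := by
    rw [← hp (mem_support_iff.1 hd), Finsupp.weight_apply, Finsupp.sum]
    simp
  rw [h]
  ring

open MvPolynomial in
theorem valuation_aeval_eq_pow {K Λ Γ : Type*} [Field K] [Field Λ] [Algebra K Λ]
    [LinearOrderedCommGroupWithZero Γ] {n : ℕ} {z : Fin (n + 1) → Λ}
    (hz : AlgebraicIndependent K z) {v : Valuation Λ Γ}
    (hv : LiesOverChart (K := K) (Fin.cons (z 0)⁻¹ fun i => z i.succ / z 0) (X 0) v)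
    {q : MvPolynomial (Fin (n + 1)) K} (hq : q ≠ 0) :
    v (aeval z q) = v (z 0) ^ q.totalDegree := by
  classical
  have hz0 : z 0 ≠ 0 := hz.ne_zero 0
  have hv1 : 1 < v (z 0) := by
    have h := (hv (X 0)).2.2 dvd_rfl
    rw [aeval_X, Fin.cons_zero, map_inv₀] at h
    exact (inv_lt_one₀ (zero_lt_iff.2 (v.ne_zero_iff.2 hz0))).1 h
  let w : Fin (n + 1) → Λ := Fin.cons 1 fun i => z i.succ / z 0
  have hzw : z = fun i => z 0 * w i := by
    funext i
    refine Fin.cases ?_ (fun i => ?_) i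
    · simp [w]
    · simp [w]; field_simp
  let sub : MvPolynomial (Fin (n + 1)) K →ₐ[K] MvPolynomial (Fin (n + 1)) K :=
    aeval (Fin.cons 1 fun i => X i.succ)
  let h0 : MvPolynomial (Fin (n + 1)) K →ₐ[K] MvPolynomial (Fin (n + 1)) K :=
    aeval (Fin.cons 0 fun i => X i.succ)
  have hsub : ∀ p, aeval (R := K) w p =
      aeval (R := K) (Fin.cons (z 0)⁻¹ fun i => z i.succ / z 0 : Fin (n + 1) → Λ) (sub p) := by
    intro p
    have : aeval (R := K) w = (aeval (R := K) (Fin.cons (z 0)⁻¹ fun i => z i.succ / z 0 : Fin (n + 1) → Λ)).comp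
        sub := by
      refine MvPolynomial.algHom_ext fun i => ?_
      refine Fin.cases ?_ (fun i => ?_) i <;> simp [w, sub]
    rw [this]; rfl
  have hle : ∀ p, v (aeval (R := K) w p) ≤ 1 := fun p => by rw [hsub]; exact (hv _).1
  have heq : ∀ (p : MvPolynomial (Fin (n + 1)) K) m, p.IsHomogeneous m → p ≠ 0 → v (aeval w p) = 1 := by
    intro p m hp hp0
    refine le_antisymm (hle p) (not_lt.1 fun hlt => ?_)
    have hw0 : aeval w p ≠ 0 := by
      intro h
      have := aeval_mul_of_isHomogeneous hp (z 0) w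
      rw [h, mul_zero, ← hzw] at this
      exact hp0 ((map_eq_zero_iff _ hz).1 this)
    rw [hsub] at hlt hw0
    obtain ⟨r, hr⟩ := (hv _).2.1 hlt
    have h1 : h0 (sub p) = sub p := by
      have : h0.comp sub = sub := by
        refine MvPolynomial.algHom_ext fun i => ?_
        refine Fin.cases ?_ (fun i => ?_) i <;> simp [h0, sub]
      rw [← AlgHom.comp_apply, this]
    apply hw0
    rw [← h1, hr, map_mul]
    simp [h0]
  have hterm : ∀ i, aeval z (homogeneousComponent i q) =
      z 0 ^ i * aeval w (homogeneousComponent i q) := by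
    intro i
    conv_lhs => rw [hzw]
    exact aeval_mul_of_isHomogeneous (homogeneousComponent_isHomogeneous i q) _ _
  have htop : homogeneousComponent q.totalDegree q ≠ 0 := by
    obtain ⟨d, hd, hd2⟩ := Finset.exists_mem_eq_sup q.support (support_nonempty.2 hq)
      fun s => s.sum fun _ e => e
    intro h
    have h2 := coeff_homogeneousComponent q.totalDegree q d
    rw [h, coeff_zero, if_pos] at h2
    · exact mem_support_iff.1 hd h2.symm
    · exact hd2.symm
  have htopv : v (aeval z (homogeneousComponent q.totalDegree q)) = v (z 0) ^ q.totalDegree := by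
    rw [hterm, map_mul, heq _ _ (homogeneousComponent_isHomogeneous _ _) htop, mul_one, map_pow]
  conv_lhs => rw [← sum_homogeneousComponent q, Finset.sum_range_succ, map_add]
  rw [Valuation.map_add_eq_of_lt_right, htopv]
  rw [htopv, map_sum]
  refine v.map_sum_lt (pow_ne_zero _ (v.ne_zero_iff.2 hz0)) fun i hi => ?_
  rw [hterm, map_mul, map_pow]
  refine (mul_le_of_le_one_right' (hle _)).trans_lt ?_
  exact pow_lt_pow_right₀ hv1 (Finset.mem_range.1 hi)

theorem valuation_trace_le {κ L Λ Γ : Type*} [Field κ] [Field L] [Field Λ] [Algebra κ L]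
    [Algebra L Λ] [Algebra κ Λ] [IsScalarTower κ L Λ] [IsAlgClosed Λ] [Algebra.IsAlgebraic L Λ]
    [FiniteDimensional κ L] [Algebra.IsSeparable κ L] [LinearOrderedCommGroupWithZero Γ]
    (v : Valuation Λ Γ) (x : L) (C : Γ)
    (h : ∀ σ : Λ →ₐ[κ] Λ, v (σ (algebraMap L Λ x)) ≤ C) :
    v (algebraMap κ Λ (Algebra.trace κ L x)) ≤ C := by
  rw [trace_eq_sum_embeddings Λ]
  refine v.map_sum_le fun σ _ => ?_
  obtain ⟨τ, hτ⟩ := IsAlgClosed.surjective_domRestrict_of_isAlgebraic (K := κ) (L := L) (M := Λ)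
    (E := Λ) σ
  rw [← hτ]
  exact h τ

theorem trace_mem_range_of_valuation.{w} {A κ L : Type*} {Λ : Type w} [CommRing A] [IsDomain A]
    [UniqueFactorizationMonoid A] [Field κ] [Field L] [Field Λ] [Algebra A κ]
    [IsFractionRing A κ] [Algebra κ L] [Algebra A Λ] [Algebra κ Λ] [IsScalarTower A κ Λ]
    [Algebra L Λ] [IsScalarTower κ L Λ] [IsAlgClosed Λ] [Algebra.IsAlgebraic L Λ]
    [FiniteDimensional κ L] [Algebra.IsSeparable κ L]
    (hex : ∀ p : A, Prime p → ∃ O : ValuationSubring Λ, LiesOverElem p O.valuation) (x : L)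
    (h : ∀ (Γ : Type w) [LinearOrderedCommGroupWithZero Γ] (v : Valuation Λ Γ) (p : A), Prime p →
      LiesOverElem p v → v (algebraMap L Λ x) ≤ 1) :
    Algebra.trace κ L x ∈ (algebraMap A κ).range := by
  obtain ⟨a, b, hab, hT⟩ := IsFractionRing.exists_reduced_fraction (A := A) (Algebra.trace κ L x)
  by_cases hb : IsUnit (b : A)
  · obtain ⟨u, hu⟩ := hb
    refine ⟨a * ↑u⁻¹, ?_⟩
    rw [← hT, IsLocalization.eq_mk'_iff_mul_eq, ← hu, ← map_mul, mul_assoc, Units.inv_mul, mul_one]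
  exfalso
  have hb0 : (b : A) ≠ 0 := nonZeroDivisors.coe_ne_zero b
  obtain ⟨p, hp, hpb⟩ := WfDvdMonoid.exists_irreducible_factor hb hb0
  have hpa : ¬ p ∣ a := fun hpa => hp.not_isUnit (hab hpa hpb)
  obtain ⟨O, hO⟩ := hex p hp.prime
  have h1 := valuation_trace_le (κ := κ) O.valuation x 1 fun σ => by
    refine h _ (O.valuation.comap (σ : Λ →+* Λ)) p hp.prime fun a => ?_
    have : (σ : Λ →+* Λ) (algebraMap A Λ a) = algebraMap A Λ a := by
      rw [IsScalarTower.algebraMap_apply A κ Λ]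
      exact σ.commutes _
    rw [Valuation.comap_apply, this]
    exact hO a
  have h2 : algebraMap A Λ b * algebraMap κ Λ (Algebra.trace κ L x) = algebraMap A Λ a := by
    rw [IsScalarTower.algebraMap_apply A κ Λ, IsScalarTower.algebraMap_apply A κ Λ, ← map_mul,
      ← hT, IsLocalization.mk'_spec']
  have h3 := congrArg O.valuation h2
  rw [map_mul, hO.eq_one hpa] at h3
  have h4 := (hO b).2.2 hpb
  have : O.valuation (algebraMap A Λ b) * O.valuation (algebraMap κ Λ (Algebra.trace κ L x)) < 1 :=
    (mul_le_of_le_one_right' h1).trans_lt h4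
  exact this.ne h3

open MvPolynomial

theorem IsTranscendenceBasis.projective_chart {K L : Type*} [Field K] [Field L] [Algebra K L]
    {n : ℕ} {z : Fin (n + 1) → L} (hz : IsTranscendenceBasis K z) :
    IsTranscendenceBasis K (Fin.cons (z 0)⁻¹ fun i => z i.succ / z 0 : Fin (n + 1) → L) := by
  set z' : Fin (n + 1) → L := Fin.cons (z 0)⁻¹ fun i => z i.succ / z 0 with hz'
  have hz0 : z 0 ≠ 0 := hz.1.ne_zero 0
  have hle : IntermediateField.adjoin K (Set.range z) ≤ IntermediateField.adjoin K (Set.range z') := by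
    rw [IntermediateField.adjoin_le_iff]
    rintro _ ⟨i, rfl⟩
    have h0 : z 0 ∈ IntermediateField.adjoin K (Set.range z') := by
      have := IntermediateField.subset_adjoin K (Set.range z') ⟨0, rfl⟩
      have := inv_mem this
      simpa [hz'] using this
    refine Fin.cases h0 (fun i => ?_) i
    have := IntermediateField.subset_adjoin K (Set.range z') ⟨i.succ, rfl⟩
    have := mul_mem this h0
    simpa [hz', hz0] using this
  have halg : Algebra.IsAlgebraic (Algebra.adjoin K (Set.range z')) L := by
    rw [← IntermediateField.isAlgebraic_adjoin_iff_top]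
    have h1 : Algebra.IsAlgebraic (IntermediateField.adjoin K (Set.range z)) L := hz.isAlgebraic_field
    let := (IntermediateField.inclusion hle).toRingHom.toAlgebra
    have : IsScalarTower (IntermediateField.adjoin K (Set.range z))
      (IntermediateField.adjoin K (Set.range z')) L := IsScalarTower.of_algebraMap_eq fun _ => rfl
    exact Algebra.IsAlgebraic.tower_top (K := IntermediateField.adjoin K (Set.range z))
      (IntermediateField.adjoin K (Set.range z'))
  refine Algebra.IsAlgebraic.isTranscendenceBasis_of_lift_le_trdeg_of_finite K z' ?_
  rw [← hz.lift_cardinalMk_eq_trdeg]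

theorem exists_fin_isTranscendenceBasis (K L : Type*) [Field K] [Field L] [Algebra K L]
    [Algebra.EssFiniteType K L] : ∃ (l : ℕ) (z : Fin l → L), IsTranscendenceBasis K z := by
  have ⟨s, hs⟩ := IntermediateField.fg_top K L
  have : Algebra.IsAlgebraic (Algebra.adjoin K (s : Set L)) L := by
    rw [← IntermediateField.isAlgebraic_adjoin_iff_top, hs, Algebra.isAlgebraic_iff_isIntegral]
    refine Algebra.isIntegral_of_surjective IntermediateField.topEquiv.surjective
  have ⟨t, hts, ht⟩ := exists_isTranscendenceBasis_subset (R := K) (s : Set L)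
  have : Finite t := s.finite_toSet.subset hts
  obtain ⟨l, ⟨e⟩⟩ := Finite.exists_equiv_fin t
  exact ⟨l, _, (isTranscendenceBasis_equiv e.symm).2 ht⟩

theorem finiteDimensional_span_of_charts.{w} {K : Type*} {L Λ : Type w} [Field K] [CharZero K]
    [Field L] [Field Λ] [Algebra K L] [Algebra K Λ] [Algebra L Λ] [IsScalarTower K L Λ]
    [IsAlgClosed Λ] [Algebra.IsAlgebraic L Λ] [Algebra.EssFiniteType K L] (W : Set L)
    (hW : ∀ {l : ℕ} (u : Fin l → L), IsTranscendenceBasis K u →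
      ∃ f : MvPolynomial (Fin l) K, f ≠ 0 ∧
        ∀ (Γ : Type w) [LinearOrderedCommGroupWithZero Γ] (v : Valuation Λ Γ)
          (π : MvPolynomial (Fin l) K), Prime π →
          LiesOverChart (fun i => algebraMap L Λ (u i)) π v →
          ∀ s ∈ W, v (algebraMap L Λ (aeval u f * s)) ≤ 1) :
    FiniteDimensional K (Submodule.span K W) := by
  classical
  have : CharZero L := charZero_of_injective_algebraMap (algebraMap K L).injective
  obtain ⟨l, z, hz⟩ := exists_fin_isTranscendenceBasis K L
  obtain ⟨f, hf0, hf⟩ := hW z hz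
  let A := MvPolynomial (Fin l) K
  let κ := FractionRing A
  let iAL : Algebra A L := chartAlgebra z
  have hALdef : ∀ a : A, algebraMap A L a = aeval z a := fun _ => rfl
  have : FaithfulSMul A L := hz.1.faithfulSMul_chartAlgebra
  have : Algebra.IsAlgebraic A L := hz.isAlgebraic_chartAlgebra
  let iAΛ : Algebra A Λ := ((algebraMap L Λ).comp (algebraMap A L)).toAlgebra
  have : IsScalarTower A L Λ := IsScalarTower.of_algebraMap_eq fun _ => rfl
  let iκL : Algebra κ L := FractionRing.liftAlgebra A L
  have : IsScalarTower A κ L := FractionRing.isScalarTower_liftAlgebra A L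
  let iκΛ : Algebra κ Λ := ((algebraMap L Λ).comp (algebraMap κ L)).toAlgebra
  have : IsScalarTower κ L Λ := IsScalarTower.of_algebraMap_eq fun _ => rfl
  have : IsScalarTower A κ Λ := IsScalarTower.of_algebraMap_eq fun a => by
    change _ = algebraMap L Λ (algebraMap κ L (algebraMap A κ a))
    rw [← IsScalarTower.algebraMap_apply A κ L]
    rfl
  have : IsScalarTower K A L := IsScalarTower.of_algebraMap_eq fun a => by
    rw [hALdef, MvPolynomial.algebraMap_eq, aeval_C]
  have : IsScalarTower K κ L := IsScalarTower.of_algebraMap_eq fun a => by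
    rw [IsScalarTower.algebraMap_apply K A κ, ← IsScalarTower.algebraMap_apply A κ L,
      ← IsScalarTower.algebraMap_apply K A L]
  have : IsScalarTower K κ Λ := IsScalarTower.of_algebraMap_eq fun a => by
    rw [IsScalarTower.algebraMap_apply K L Λ, IsScalarTower.algebraMap_apply K κ L,
      ← IsScalarTower.algebraMap_apply κ L Λ]
  have : Algebra.IsAlgebraic κ L := (IsFractionRing.comap_isAlgebraic_iff (A := A)).1 ‹_›
  have : Algebra.EssFiniteType κ L := .of_comp K κ L
  have : FiniteDimensional κ L := Algebra.finite_of_essFiniteType_of_isAlgebraic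
  have : CharZero κ := charZero_of_injective_algebraMap (algebraMap K κ).injective
  have hfL : aeval z f ≠ 0 := by
    rw [Ne, map_eq_zero_iff _ hz.1]; exact hf0
  have hOver : ∀ (Γ : Type w) [LinearOrderedCommGroupWithZero Γ] (v : Valuation Λ Γ) (p : A),
      LiesOverElem p v ↔ LiesOverChart (fun i => algebraMap L Λ (z i)) p v := by
    intro Γ _ v p
    have : ∀ a : A, algebraMap A Λ a = aeval (fun i => algebraMap L Λ (z i)) a := by
      intro a
      change algebraMap L Λ (aeval z a) = _
      rw [← aeval_algebraMap_apply]
      rfl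
    simp only [LiesOverElem, LiesOverChart, this]
    exact Iff.rfl
  obtain ⟨J, y, hy⟩ := FiniteDimensional.exists_is_basis_integral A κ L
  have hint : ∀ s ∈ W, ∀ j, Algebra.trace κ L (aeval z f * s * y j) ∈ (algebraMap A κ).range := by
    intro s hs j
    refine trace_mem_range_of_valuation (Λ := Λ) ?_ _ ?_
    · intro p hp
      obtain ⟨O, hO⟩ := exists_liesOverChart
        (hz.1.map' (f := IsScalarTower.toAlgHom K L Λ) (algebraMap L Λ).injective) hp
      exact ⟨O, (hOver _ _ _).2 hO⟩
    · intro Γ _ v p hp hv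
      rw [map_mul, map_mul]
      refine mul_le_one' (hf Γ v p hp ((hOver _ _ _).1 hv) s hs) ?_
      exact hv.le_one_of_isIntegral (IsIntegral.map (IsScalarTower.toAlgHom A L Λ) (hy j))
  have hdeg : ∃ M, ∀ s ∈ W, ∀ j, ∀ q : A, algebraMap A κ q = Algebra.trace κ L (aeval z f * s * y j) →
      q.totalDegree ≤ M := by
    rcases l with _ | n
    · exact ⟨0, fun s _ j q _ => by rw [MvPolynomial.eq_C_of_isEmpty q, totalDegree_C]⟩
    set z' : Fin (n + 1) → L := Fin.cons (z 0)⁻¹ fun i => z i.succ / z 0 with hz'def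
    have hz' : IsTranscendenceBasis K z' := hz.projective_chart
    have hzΛ := hz.1.map' (f := IsScalarTower.toAlgHom K L Λ) (algebraMap L Λ).injective
    have hz'Λ := hz'.1.map' (f := IsScalarTower.toAlgHom K L Λ) (algebraMap L Λ).injective
    have hcoe : (fun i => algebraMap L Λ (z' i)) = Fin.cons (algebraMap L Λ (z 0))⁻¹
        fun i => algebraMap L Λ (z i.succ) / algebraMap L Λ (z 0) := by
      funext i
      refine Fin.cases ?_ (fun i => ?_) i <;> simp [hz'def]
    have hX : Prime (X 0 : MvPolynomial (Fin (n + 1)) K) := MvPolynomial.X_prime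
    obtain ⟨O, hO⟩ := exists_liesOverChart hz'Λ hX
    have hO : LiesOverChart (K := K) (fun i => algebraMap L Λ (z' i)) (X 0) O.valuation := hO
    have hO' := hO
    rw [hcoe] at hO'
    obtain ⟨f', hf'0, hf'⟩ := hW z' hz'
    have hcomm : ∀ g : MvPolynomial (Fin (n + 1)) K,
        aeval (fun i => algebraMap L Λ (z' i)) g = algebraMap L Λ (aeval z' g) :=
      fun g => aeval_algebraMap_apply _ _ _
    have hpow : ∀ g : MvPolynomial (Fin (n + 1)) K, g ≠ 0 → ∃ m : ℕ,
        O.valuation (algebraMap L Λ (aeval z' g)) * O.valuation (algebraMap L Λ (z 0)) ^ m = 1 := by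
      intro g hg
      obtain ⟨m, hm⟩ := hO.exists_pow hX hg
      refine ⟨m, ?_⟩
      rw [← hcomm, hm, aeval_X, ← mul_pow, ← map_mul, ← map_mul]
      simp [hz'def, hz.1.ne_zero 0]
    have hclear : ∃ g : MvPolynomial (Fin (n + 1)) K, g ≠ 0 ∧ ∀ (j : J) (v : Valuation Λ O.ValueGroup),
        LiesOverChart (K := K) (fun i => algebraMap L Λ (z' i)) (X 0) v →
        v (algebraMap L Λ (aeval z' g * y j)) ≤ 1 := by
      have hz'b : IsTranscendenceBasis K (fun i => algebraMap L Λ (z' i)) := hz'.algebraMap_comp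
      obtain ⟨g, hg0, hg⟩ := hz'b.exists_clearDen (Finset.univ.image fun j => algebraMap L Λ (y j))
      refine ⟨g, hg0, fun j v hv => ?_⟩
      have := hg v _ hv _ (Finset.mem_image_of_mem _ (Finset.mem_univ j))
      rwa [hcomm, ← map_mul] at this
    obtain ⟨g, hg0, hg⟩ := hclear
    obtain ⟨m₁, hm₁⟩ := hpow f' hf'0
    obtain ⟨m₂, hm₂⟩ := hpow g hg0
    have hz0 : O.valuation (algebraMap L Λ (z 0)) ≠ 0 := by
      rw [Ne, map_eq_zero, map_eq_zero]; exact hz.1.ne_zero 0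
    have hz1 : 1 < O.valuation (algebraMap L Λ (z 0)) := by
      have h := (hO' (X 0)).2.2 dvd_rfl
      rw [aeval_X, Fin.cons_zero, map_inv₀] at h
      exact (inv_lt_one₀ (zero_lt_iff.2 hz0)).1 h
    refine ⟨f.totalDegree + m₁ + m₂, fun s hs j q hq => ?_⟩
    by_cases hq0 : q = 0
    · rw [hq0, totalDegree_zero]; exact Nat.zero_le _
    have hval : ∀ p : A, O.valuation (algebraMap A Λ p) =
        O.valuation (aeval (fun i => algebraMap L Λ (z i)) p) := by
      intro a
      change O.valuation (algebraMap L Λ (aeval z a)) = _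
      rw [← aeval_algebraMap_apply]
      rfl
    have hval' : ∀ p : A, p ≠ 0 → O.valuation (aeval (fun i => algebraMap L Λ (z i)) p) =
        O.valuation (algebraMap L Λ (z 0)) ^ p.totalDegree :=
      fun p hp => valuation_aeval_eq_pow hzΛ hO' hp
    have hle := valuation_trace_le (κ := κ) O.valuation (aeval z f * s * y j)
      (O.valuation (algebraMap L Λ (z 0)) ^ (f.totalDegree + m₁ + m₂)) fun σ => by
      have hσz : ∀ i, σ (algebraMap L Λ (z i)) = algebraMap L Λ (z i) := by
        intro i
        have h1 : algebraMap L Λ (z i) = algebraMap κ Λ (algebraMap A κ (X i)) := by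
          rw [← IsScalarTower.algebraMap_apply A κ Λ, IsScalarTower.algebraMap_apply A L Λ, hALdef,
            aeval_X]
        rw [h1, AlgHom.commutes]
      have hσz' : ∀ g : MvPolynomial (Fin (n + 1)) K, σ (algebraMap L Λ (aeval z' g)) = algebraMap L Λ (aeval z' g) := by
        intro g
        have h2 : (σ.restrictScalars K).comp (aeval (fun i => algebraMap L Λ (z' i))) =
            aeval (fun i => algebraMap L Λ (z' i)) := by
          refine MvPolynomial.algHom_ext fun i => ?_
          rw [AlgHom.comp_apply, aeval_X]
          change σ _ = _
          refine Fin.cases ?_ (fun i => ?_) i <;> simp [hz'def, hσz]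
        rw [← hcomm]
        exact DFunLike.congr_fun h2 g
      have hv : LiesOverChart (K := K) (fun i => algebraMap L Λ (z' i)) (X 0)
          (O.valuation.comap (σ : Λ →+* Λ)) := by
        intro a
        have h1 : aeval (fun i => algebraMap L Λ (z' i)) a = algebraMap L Λ (aeval z' a) :=
          aeval_algebraMap_apply _ _ _
        rw [Valuation.comap_apply, RingHom.coe_coe, h1, hσz', ← h1]
        exact hO a
      have h1 := hf' _ _ _ hX hv s hs
      have h2 := hg j _ hv
      rw [Valuation.comap_apply, RingHom.coe_coe, map_mul, map_mul, hσz', map_mul] at h1 h2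
      have h3 : O.valuation (σ (algebraMap L Λ (aeval z f))) =
          O.valuation (algebraMap L Λ (z 0)) ^ f.totalDegree := by
        have : σ (algebraMap L Λ (aeval z f)) = algebraMap A Λ f := by
          rw [← hALdef, ← IsScalarTower.algebraMap_apply A L Λ, IsScalarTower.algebraMap_apply A κ Λ,
            AlgHom.commutes]
        rw [this, hval]
        exact valuation_aeval_eq_pow hzΛ hO' hf0
      rw [map_mul, map_mul, map_mul, map_mul, map_mul, map_mul, h3, pow_add, pow_add, mul_assoc,
        mul_assoc]
      refine mul_le_mul_right ?_ _
      refine mul_le_mul' ?_ ?_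
      · calc _ = O.valuation (σ (algebraMap L Λ s)) * (O.valuation (algebraMap L Λ (aeval z' f')) *
              O.valuation (algebraMap L Λ (z 0)) ^ m₁) := by rw [hm₁, mul_one]
          _ = (O.valuation (algebraMap L Λ (aeval z' f')) * O.valuation (σ (algebraMap L Λ s))) *
              O.valuation (algebraMap L Λ (z 0)) ^ m₁ := by ac_rfl
          _ ≤ _ := mul_le_of_le_one_left' h1
      · calc _ = O.valuation (σ (algebraMap L Λ (y j))) * (O.valuation (algebraMap L Λ (aeval z' g)) *
              O.valuation (algebraMap L Λ (z 0)) ^ m₂) := by rw [hm₂, mul_one]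
          _ = (O.valuation (algebraMap L Λ (aeval z' g)) * O.valuation (σ (algebraMap L Λ (y j)))) *
              O.valuation (algebraMap L Λ (z 0)) ^ m₂ := by ac_rfl
          _ ≤ _ := mul_le_of_le_one_left' h2
    rw [← hq, ← IsScalarTower.algebraMap_apply A κ Λ, hval, hval' _ hq0] at hle
    exact (pow_le_pow_iff_right₀ hz1).1 hle
  obtain ⟨M, hM⟩ := hdeg
  let Φ : L →ₗ[K] (J → κ) :=
    { toFun := fun s j => Algebra.trace κ L (aeval z f * s * y j)
      map_add' := fun a b => by
        funext j; simp only [mul_add, add_mul, map_add, Pi.add_apply]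
      map_smul' := fun c a => by
        funext j
        simp only [mul_smul_comm, smul_mul_assoc, RingHom.id_apply, Pi.smul_apply]
        rw [← algebraMap_smul κ c, map_smul, algebraMap_smul] }
  have hΦ : Function.Injective Φ := by
    rw [injective_iff_map_eq_zero]
    intro s hs
    have h1 : ∀ t, Algebra.trace κ L (aeval z f * s * t) = 0 := by
      intro t
      have : (Algebra.traceForm κ L (aeval z f * s)) = 0 := by
        refine y.ext fun j => ?_
        have := congrFun hs j
        simpa [Φ, Algebra.traceForm_apply] using this
      have := LinearMap.congr_fun this t
      simpa [Algebra.traceForm_apply] using this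
    have h2 := (traceForm_nondegenerate κ L).1 (aeval z f * s) h1
    exact (mul_eq_zero.1 h2).resolve_left hfL
  let G : restrictTotalDegree (Fin l) K M →ₗ[K] κ :=
    ((Algebra.linearMap A κ).restrictScalars K).comp (restrictTotalDegree (Fin l) K M).subtype
  have hle : (Submodule.span K W).map Φ ≤ LinearMap.range (G.compLeft J) := by
    rw [Submodule.map_span_le]
    intro s hs
    choose q hq using hint s hs
    exact ⟨fun j => ⟨q j, (mem_restrictTotalDegree _ _ _).2 (hM s hs j _ (hq j))⟩, funext hq⟩
  have : Module.Finite K ((Submodule.span K W).map Φ) := Submodule.finiteDimensional_of_le hle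
  exact Module.Finite.equiv (Submodule.equivMapOfInjective Φ hΦ (Submodule.span K W)).symm

universe w in
theorem IsTranscendenceBasis.exists_good {K Λ ι : Type*} [Field K] [Field Λ] [Algebra K Λ]
    {u : ι → Λ} (hu : IsTranscendenceBasis K u) (T : Finset Λ) :
    ∃ g : MvPolynomial ι K, g ≠ 0 ∧ ∀ {Γ : Type w} [LinearOrderedCommGroupWithZero Γ]
      (v : Valuation Λ Γ) (π : MvPolynomial ι K), LiesOverChart u π v → ¬ π ∣ g →
      ∀ s ∈ T, v s ≤ 1 ∧ (s ≠ 0 → v s = 1) := by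
  let := chartAlgebra (K := K) u
  have := hu.1.faithfulSMul_chartAlgebra
  have := hu.isAlgebraic_chartAlgebra
  obtain ⟨g, hg, h⟩ := exists_good_unit.{w} (A := MvPolynomial ι K) T
  refine ⟨g, hg, fun v π hv hπ s hs => ⟨?_, h v π hv hπ s hs⟩⟩
  by_cases hs0 : s = 0
  · rw [hs0, map_zero]; exact zero_le_one
  · exact (h v π hv hπ s hs hs0).le

universe u in
/-- The residue field of a valuation trivial on the base field. -/
theorem Valuation.exists_residue {K Γ₀ : Type*} {Λ : Type u} [Field K] [Field Λ] [Algebra K Λ]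
    [LinearOrderedCommGroupWithZero Γ₀] (v : Valuation Λ Γ₀)
    (hK : ∀ c : K, v (algebraMap K Λ c) ≤ 1) :
    ∃ (O : Subalgebra K Λ) (k : Type u) (_ : Field k) (_ : Algebra K k) (ρ : O →ₐ[K] k),
      (∀ a, a ∈ O ↔ v a ≤ 1) ∧ ∀ a : O, ρ a = 0 ↔ v (a : Λ) < 1 := by
  let O : Subalgebra K Λ := { v.integer with algebraMap_mem' := hK }
  have hO : ∀ a, a ∈ O ↔ v a ≤ 1 := fun _ => Iff.rfl
  let f : v.valuationSubring →+* IsLocalRing.ResidueField v.valuationSubring :=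
    IsLocalRing.residue _
  let g : O →+* v.valuationSubring :=
    { toFun := fun a => ⟨a, a.2⟩, map_one' := rfl, map_mul' := fun _ _ => rfl, map_zero' := rfl,
      map_add' := fun _ _ => rfl }
  let iK : Algebra K (IsLocalRing.ResidueField v.valuationSubring) :=
    ((f.comp g).comp (algebraMap K O)).toAlgebra
  refine ⟨O, IsLocalRing.ResidueField v.valuationSubring, inferInstance, iK,
    { f.comp g with commutes' := fun _ => rfl }, hO, fun a => ?_⟩
  change IsLocalRing.residue _ (g a) = 0 ↔ _
  rw [IsLocalRing.residue_eq_zero_iff, v.isEquiv_valuation_valuationSubring.lt_one_iff_lt_one]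
  exact ValuationSubring.valuation_lt_one_iff _ _

/-- Residues of all but one of the chart coordinates are independent. -/
theorem MvPolynomial.exists_algebraicIndependent_of_prime {K k : Type*} [Field K] [Field k]
    [Algebra K k] {l : ℕ} {π : MvPolynomial (Fin l) K} (hπ : Prime π) (ū : Fin l → k)
    (h : ∀ a, aeval ū a = 0 → π ∣ a) :
    ∃ i : Fin l, AlgebraicIndependent K (fun j : {j // j ≠ i} => ū j) := by
  have hne : π.vars.Nonempty := by
    rw [Finset.nonempty_iff_ne_empty]
    intro h0
    obtain ⟨c, rfl⟩ : ∃ c, π = C c := by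
      have := (mem_supported (s := (∅ : Set (Fin l)))).2 (by simp [h0] : (π.vars : Set (Fin l)) ⊆ ∅)
      rw [supported_empty] at this
      obtain ⟨c, hc⟩ := this
      exact ⟨c, hc.symm⟩
    have hc : c ≠ 0 := fun h => hπ.ne_zero (by rw [h, map_zero])
    exact hπ.not_isUnit ((isUnit_iff_ne_zero.2 hc).map C)
  obtain ⟨i, hi⟩ := hne
  refine ⟨i, ?_⟩
  rw [AlgebraicIndependent, injective_iff_map_eq_zero]
  intro a ha
  by_contra ha0
  have h1 : π ∣ rename Subtype.val a := by
    apply h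
    rw [aeval_rename]
    exact ha
  have h2 : degreeOf i (rename (Subtype.val : {j // j ≠ i} → Fin l) a) = 0 := by
    refine Nat.le_zero.1 (degreeOf_le_iff.2 fun m hm => Nat.le_zero.2 ?_)
    by_contra hmi
    have hm' : i ∈ (rename (Subtype.val : {j // j ≠ i} → Fin l) a).vars :=
      (mem_vars_iff_mem_support i).2 ⟨m, hm, Finsupp.mem_support_iff.2 hmi⟩
    classical
    have := vars_rename _ _ hm'
    simp at this
  obtain ⟨b, hb⟩ := h1
  have hb0 : rename (Subtype.val : {j // j ≠ i} → Fin l) a ≠ 0 := by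
    rw [Ne, map_eq_zero_iff _ (rename_injective _ Subtype.val_injective)]
    exact ha0
  rw [hb, degreeOf_mul_eq (left_ne_zero_of_mul (hb ▸ hb0)) (right_ne_zero_of_mul (hb ▸ hb0))] at h2
  have h3 : degreeOf i π ≠ 0 := by
    intro h0
    obtain ⟨m, hm, hmi⟩ := (mem_vars_iff_mem_support i).1 hi
    exact (Finsupp.mem_support_iff.1 hmi) (Nat.le_zero.1 (degreeOf_le_iff.1 h0.le m hm))
  omega

theorem AlgebraicIndependent.of_subset_closure {K k α β : Type*} [Field K] [Field k] [Algebra K k]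
    [Finite α] [Finite β] {y : α → k} (hy : AlgebraicIndependent K y) {w : β → k}
    (hcard : Nat.card β ≤ Nat.card α)
    (h : Set.range y ⊆ (AlgebraicIndependent.matroid K k).closure (Set.range w)) :
    AlgebraicIndependent K w := by
  have h1 : (Set.range y).encard = Nat.card α := by
    rw [← (Set.finite_range y).cast_ncard_eq, ← Nat.card_coe_set_eq,
      Nat.card_range_of_injective hy.injective]
  have h2 : ((Set.range w).ncard : ℕ∞) ≤ Nat.card β := by
    rw [← Nat.card_coe_set_eq]
    exact_mod_cast Nat.card_le_card_of_surjective _ Set.rangeFactorization_surjective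
  have h3 : (Nat.card α : ℕ∞) ≤ (AlgebraicIndependent.matroid K k).eRk (Set.range w) := by
    rw [← Matroid.eRk_closure_eq, ← h1]
    refine Matroid.Indep.encard_le_eRk_of_subset ?_ h
    exact hy.to_subtype_range
  have h4 := (AlgebraicIndependent.matroid K k).eRk_le_encard (Set.range w)
  have h5 : (Set.range w).encard = (Set.range w).ncard :=
    ((Set.finite_range w).cast_ncard_eq).symm
  rw [h5] at h4
  have h6 : (Nat.card β : ℕ∞) ≤ Nat.card α := by exact_mod_cast hcard
  have h7 : (AlgebraicIndependent.matroid K k).Indep (Set.range w) := by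
    rw [Matroid.indep_iff_eRk_eq_encard_of_finite (Set.finite_range w), h5]
    exact le_antisymm h4 ((h2.trans h6).trans h3)
  have h8 : (Set.range w).ncard = Nat.card β := by
    have := le_antisymm h2 ((h6.trans h3).trans h4)
    exact_mod_cast this
  have h9 : Function.Injective w := by
    have : Function.Bijective (Set.rangeFactorization w) :=
      Set.rangeFactorization_surjective.bijective_of_nat_card_le
        (by rw [Nat.card_coe_set_eq, h8])
    exact fun a b hab => this.1 (Subtype.ext hab)
  exact (algebraicIndependent_subtype_range h9).1 h7

theorem mem_matroid_closure_of_eval₂ {K k β : Type*} [Field K] [Field k] [Algebra K k]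
    {w : β → k} {z : k} {M : Polynomial (MvPolynomial β K)} (hM : M.Monic)
    (h : M.eval₂ (aeval w).toRingHom z = 0) :
    z ∈ (AlgebraicIndependent.matroid K k).closure (Set.range w) := by
  rw [AlgebraicIndependent.matroid_closure_eq, SetLike.mem_coe, Subalgebra.mem_algebraicClosure]
  let g : MvPolynomial β K →ₐ[K] Algebra.adjoin K (Set.range w) :=
    aeval fun i => ⟨w i, Algebra.subset_adjoin ⟨i, rfl⟩⟩
  refine ⟨M.map g.toRingHom, (hM.map _).ne_zero, ?_⟩
  rw [Polynomial.aeval_def, Polynomial.eval₂_map]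
  have : (Algebra.adjoin K (Set.range w)).val.comp g = aeval w := by
    refine MvPolynomial.algHom_ext fun i => ?_
    simp [g]
  rw [← this] at h
  exact h

theorem Subalgebra.coe_aeval {K Λ β : Type*} [CommRing K] [CommRing Λ] [Algebra K Λ]
    {O : Subalgebra K Λ} (b : β → O) (g : MvPolynomial β K) :
    ((aeval b g : O) : Λ) = aeval (fun i => (b i : Λ)) g :=
  (aeval_algebraMap_apply Λ b g).symm

theorem MvPolynomial.aeval_algHom_comp {K O k β : Type*} [CommRing K] [CommRing O] [CommRing k]
    [Algebra K O] [Algebra K k] (ρ : O →ₐ[K] k) (b : β → O) (g : MvPolynomial β K) :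
    aeval (fun i => ρ (b i)) g = ρ (aeval b g) := by
  have : aeval (fun i => ρ (b i)) = ρ.comp (aeval b) :=
    MvPolynomial.algHom_ext fun i => by simp
  rw [this]; rfl

theorem residue_mem_matroid_closure {K Λ Γ k β : Type*} [Field K] [Field Λ] [Algebra K Λ]
    [Field k] [Algebra K k] [LinearOrderedCommGroupWithZero Γ] {v : Valuation Λ Γ}
    {O : Subalgebra K Λ} {ρ : O →ₐ[K] k} (hρ : ∀ a : O, ρ a = 0 ↔ v (a : Λ) < 1)
    (b : β → O) (z : O) {M : Polynomial (MvPolynomial β K)} (hM : M.Monic)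
    (h : v (M.eval₂ (aeval fun i => (b i : Λ)).toRingHom (z : Λ)) < 1) :
    ρ z ∈ (AlgebraicIndependent.matroid K k).closure (Set.range fun i => ρ (b i)) := by
  refine mem_matroid_closure_of_eval₂ hM ?_
  have h1 : (aeval fun i => ρ (b i)).toRingHom =
      ρ.toRingHom.comp (aeval (R := K) b).toRingHom :=
    RingHom.ext fun g => aeval_algHom_comp ρ b g
  have h2 : (aeval fun i => (b i : Λ)).toRingHom =
      O.val.toRingHom.comp (aeval (R := K) b).toRingHom :=
    RingHom.ext fun g => (Subalgebra.coe_aeval b g).symm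
  have h3 := Polynomial.hom_eval₂ M (aeval (R := K) b).toRingHom ρ.toRingHom z
  have h4 := Polynomial.hom_eval₂ M (aeval (R := K) b).toRingHom O.val.toRingHom z
  rw [h1]
  refine h3.symm.trans ((hρ _).2 ?_)
  rw [h2] at h
  exact (congrArg v h4).trans_lt h

universe w in
/-- At almost every prime of a chart, the residues of `d` independent elements span at least
`d - 1` dimensions. -/
theorem IsTranscendenceBasis.exists_good_residue {K : Type*} {Λ : Type*} [Field K] [Field Λ]
    [Algebra K Λ] {d l : ℕ} {x : Fin d → Λ} (hx : AlgebraicIndependent K x) {u : Fin l → Λ}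
    (hu : IsTranscendenceBasis K u) :
    ∃ f : MvPolynomial (Fin l) K, f ≠ 0 ∧ ∀ {Γ : Type w} [LinearOrderedCommGroupWithZero Γ]
      (v : Valuation Λ Γ) (π : MvPolynomial (Fin l) K), Prime π → LiesOverChart u π v →
      ¬ π ∣ f → ∀ {ι : Type} [Finite ι], Nat.card ι + 1 = d → ∀ ℓ : ι → Λ, (∀ i, v (ℓ i) ≤ 1) →
      (∀ j, ∃ M : Polynomial (MvPolynomial ι K), M.Monic ∧
        v (M.eval₂ (aeval ℓ).toRingHom (x j)) < 1) →
      ∀ q : MvPolynomial ι K, q ≠ 0 → v (aeval ℓ q) = 1 := by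
  classical
  obtain ⟨B, hxB, hB⟩ := exists_isTranscendenceBasis_superset (R := K) (s := Set.range x)
    hx.to_subtype_range
  have hcard : Cardinal.mk B = l := by
    have h1 := hu.lift_cardinalMk_eq_trdeg
    have h2 := hB.lift_cardinalMk_eq_trdeg
    simp only [Cardinal.mk_fin, Cardinal.lift_natCast, Cardinal.lift_uzero, Cardinal.lift_id] at h1 h2
    rw [h2, h1]
  have hBfin : Finite B := by
    rw [← Cardinal.mk_lt_aleph0_iff, hcard]
    exact Cardinal.natCast_lt_aleph0
  have hBcard : Nat.card B = l := by rw [Nat.card, hcard, Cardinal.toNat_natCast]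
  let := chartAlgebra (K := K) ((↑) : B → Λ)
  have := hB.1.faithfulSMul_chartAlgebra
  have := hB.isAlgebraic_chartAlgebra
  have hden : ∀ i, ∃ a : MvPolynomial B K, a ≠ 0 ∧ IsIntegral (MvPolynomial B K) (a • u i) :=
    fun i => IsAlgebraic.exists_integral_multiple
      (Algebra.IsAlgebraic.isAlgebraic (R := MvPolynomial B K) (u i))
  choose a ha0 ha using hden
  obtain ⟨f, hf0, hf⟩ := hu.exists_good.{w}
    ((Finset.univ.image fun i => aeval ((↑) : B → Λ) (a i)) ∪ (Set.toFinite B).toFinset)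
  refine ⟨f, hf0, fun v π hπ hv hπf ι _ hι ℓ hℓ hM q hq => ?_⟩
  have hK : ∀ c : K, v (algebraMap K Λ c) ≤ 1 := fun c => by simpa using (hv (C c)).1
  obtain ⟨O, k, _, _, ρ, hO, hρ⟩ := v.exists_residue hK
  have hBO : ∀ b : B, (b : Λ) ∈ O := fun b => (hO _).2 (hf v π hv hπf b (by simp)).1
  let τ := {b : B // (b : Λ) ∉ Set.range x}
  have hτ : Nat.card τ + d = l := by
    have h1 : Nat.card {b : B // (b : Λ) ∈ Set.range x} = d := by
      have e : {b : B // (b : Λ) ∈ Set.range x} ≃ Set.range x :=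
        { toFun := fun b => ⟨b.1, b.2⟩, invFun := fun b => ⟨⟨b.1, hxB b.2⟩, b.2⟩ }
      rw [Nat.card_congr e, Nat.card_range_of_injective hx.injective, Nat.card_fin]
    rw [← hBcard, ← Nat.card_congr (Equiv.sumCompl fun b : B => (b : Λ) ∈ Set.range x),
      Nat.card_sum, h1, add_comm]
  let ρB : B → k := fun b => ρ ⟨b, hBO b⟩
  let ℓO : ι → O := fun i => ⟨ℓ i, (hO _).2 (hℓ i)⟩
  let w : ι ⊕ τ → k := Sum.elim (fun i => ρ (ℓO i)) fun b => ρB b.1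
  have hxO : ∀ j, x j ∈ O := fun j => hBO ⟨x j, hxB ⟨j, rfl⟩⟩
  have hxcl : ∀ j, ρ ⟨x j, hxO j⟩ ∈ (AlgebraicIndependent.matroid K k).closure (Set.range w) := by
    intro j
    obtain ⟨M, hM1, hM2⟩ := hM j
    refine (AlgebraicIndependent.matroid K k).closure_subset_closure ?_
      (residue_mem_matroid_closure hρ ℓO ⟨x j, hxO j⟩ hM1 hM2)
    rintro _ ⟨i, rfl⟩
    exact ⟨Sum.inl i, rfl⟩
  have hBcl : Set.range ρB ⊆ (AlgebraicIndependent.matroid K k).closure (Set.range w) := by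
    rintro _ ⟨b, rfl⟩
    by_cases hb : (b : Λ) ∈ Set.range x
    · obtain ⟨j, hj⟩ := hb
      have : b = ⟨x j, hxB ⟨j, rfl⟩⟩ := Subtype.ext hj.symm
      rw [this]
      exact hxcl j
    · exact (AlgebraicIndependent.matroid K k).subset_closure _ (Set.subset_univ _)
        ⟨Sum.inr ⟨b, hb⟩, rfl⟩
  have huO : ∀ i, u i ∈ O := fun i => (hO _).2 (by simpa using (hv (X i)).1)
  have hucl : ∀ i, ρ ⟨u i, huO i⟩ ∈ (AlgebraicIndependent.matroid K k).closure (Set.range ρB) := by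
    intro i
    let bO : B → O := fun b => ⟨b, hBO b⟩
    obtain ⟨M, hM1, hM2⟩ := ha i
    have h1 : ((aeval bO (a i) * ⟨u i, huO i⟩ : O) : Λ) = a i • u i := by
      rw [Algebra.smul_def]
      exact congrArg (· * u i) (Subalgebra.coe_aeval bO (a i))
    have h2 := residue_mem_matroid_closure hρ bO (aeval bO (a i) * ⟨u i, huO i⟩) hM1 (by
      rw [h1]
      refine (congrArg v hM2).trans_lt ?_
      rw [map_zero]; exact zero_lt_one)
    rw [map_mul] at h2
    have h3 : ρ (aeval bO (a i)) ≠ 0 := by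
      rw [Ne, hρ, not_lt]
      have h4 : aeval ((↑) : B → Λ) (a i) ≠ 0 := by
        rw [Ne, map_eq_zero_iff _ hB.1]; exact ha0 i
      exact ((hf v π hv hπf _ (by simp)).2 h4).ge.trans_eq (congrArg v (Subalgebra.coe_aeval bO (a i))).symm
    change _ ∈ (AlgebraicIndependent.matroid K k).closure (Set.range ρB) at h2
    rw [AlgebraicIndependent.matroid_closure_eq, SetLike.mem_coe, Subalgebra.mem_algebraicClosure] at h2 ⊢
    have h5 : ρ (aeval bO (a i)) ∈ Algebra.adjoin K (Set.range ρB) := by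
      rw [← aeval_algHom_comp, Algebra.adjoin_range_eq_range_aeval]
      exact ⟨_, rfl⟩
    have h6 : IsAlgebraic (Algebra.adjoin K (Set.range ρB)) (ρ (aeval bO (a i))) :=
      isAlgebraic_algebraMap (⟨_, h5⟩ : Algebra.adjoin K (Set.range ρB))
    have h7 := h6.inv.mul h2
    rwa [inv_mul_cancel_left₀ h3] at h7
  obtain ⟨i, hi⟩ := MvPolynomial.exists_algebraicIndependent_of_prime hπ (fun i => ρ ⟨u i, huO i⟩)
    (fun a ha => by
      rw [aeval_algHom_comp, hρ, Subalgebra.coe_aeval] at ha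
      exact (hv a).2.1 ha)
  have hw := hi.of_subset_closure (w := w) (by
    rw [Nat.card_sum]
    have : Nat.card {j : Fin l // j ≠ i} = l - 1 := by
      rw [Nat.card_eq_fintype_card, Fintype.card_subtype_compl, Fintype.card_fin,
        Fintype.card_subtype_eq]
    have := i.pos
    omega) (by
    rintro _ ⟨j, rfl⟩
    have := (AlgebraicIndependent.matroid K k).closure_subset_closure hBcl (hucl j)
    rwa [Matroid.closure_closure] at this)
  have hℓ' : AlgebraicIndependent K fun i => ρ (ℓO i) := hw.comp Sum.inl Sum.inl_injective
  have h1 : aeval (fun i => ρ (ℓO i)) q ≠ 0 := by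
    rw [Ne, map_eq_zero_iff _ hℓ']; exact hq
  rw [aeval_algHom_comp, Ne, hρ, Subalgebra.coe_aeval, not_lt] at h1
  refine le_antisymm ?_ h1
  rw [← hO, ← Subalgebra.coe_aeval ℓO]
  exact (aeval ℓO q).2

theorem exists_primitive_of_subalgebra {A L : Type*} [CommRing A] [IsDomain A]
    [IsIntegrallyClosed A] [CharZero A] [Field L] [Algebra A L] [FaithfulSMul A L]
    [Algebra.IsAlgebraic A L] (hfin : letI := FractionRing.liftAlgebra A L
      FiniteDimensional (FractionRing A) L) (B : Subalgebra A L)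
    (hB : ∀ b ∈ B, IsIntegral A b) (hden : ∀ s : L, ∃ a : A, a ≠ 0 ∧ a • s ∈ B) :
    ∃ y ∈ B, Polynomial.aeval y (minpoly A y) = 0 ∧
      Polynomial.aeval y (minpoly A y).derivative ≠ 0 ∧
      ∀ s : L, ∃ a : A, a ≠ 0 ∧ ∃ q : Polynomial A, a • s = Polynomial.aeval y q := by
  let := FractionRing.liftAlgebra A L
  have := FractionRing.isScalarTower_liftAlgebra A L
  have : FiniteDimensional (FractionRing A) L := hfin
  have : CharZero (FractionRing A) :=
    charZero_of_injective_algebraMap (IsFractionRing.injective A (FractionRing A))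
  obtain ⟨y₀, hy₀⟩ := Field.exists_primitive_element (FractionRing A) L
  obtain ⟨a, ha, hy⟩ := hden y₀
  have hint := hB _ hy
  have hmin : minpoly (FractionRing A) (a • y₀) =
      (minpoly A (a • y₀)).map (algebraMap A (FractionRing A)) :=
    minpoly.isIntegrallyClosed_eq_field_fractions (FractionRing A) L hint
  refine ⟨a • y₀, hy, minpoly.aeval _ _, fun h => ?_, fun s => ?_⟩
  · have h1 : (minpoly (FractionRing A) (a • y₀)).Separable :=
      (Algebra.IsSeparable.isSeparable (FractionRing A) (a • y₀))
    have h2 := h1.aeval_derivative_ne_zero (minpoly.aeval _ (a • y₀))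
    rw [hmin, Polynomial.derivative_map, Polynomial.aeval_map_algebraMap] at h2
    exact h2 h
  · have h1 : s ∈ IntermediateField.adjoin (FractionRing A) {a • y₀} := by
      have h2 : y₀ ∈ IntermediateField.adjoin (FractionRing A) {a • y₀} := by
        have h3 := IntermediateField.mem_adjoin_simple_self (FractionRing A) (a • y₀)
        have h4 := IntermediateField.smul_mem _ h3 (x := (algebraMap A (FractionRing A) a)⁻¹)
        have h6 : (algebraMap A (FractionRing A) a)⁻¹ • (a • y₀) = y₀ := by
          rw [← algebraMap_smul (FractionRing A) a y₀, inv_smul_smul₀]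
          rwa [Ne, FaithfulSMul.algebraMap_eq_zero_iff]
        rwa [h6] at h4
      have h5 : IntermediateField.adjoin (FractionRing A) {y₀} ≤
          IntermediateField.adjoin (FractionRing A) {a • y₀} := by
        rw [IntermediateField.adjoin_le_iff]; simpa using h2
      rw [hy₀] at h5
      exact h5 trivial
    have h2 : s ∈ (IntermediateField.adjoin (FractionRing A) {a • y₀}).toSubalgebra := h1
    rw [IntermediateField.adjoin_simple_toSubalgebra_of_isAlgebraic
      (Algebra.IsAlgebraic.isAlgebraic _), Algebra.adjoin_singleton_eq_range_aeval] at h2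
    obtain ⟨p, hp⟩ := h2
    obtain ⟨b, hb, hbp⟩ := IsLocalization.integerNormalization_spec (nonZeroDivisors A) p
    refine ⟨b, nonZeroDivisors.ne_zero hb,
      IsLocalization.integerNormalization (nonZeroDivisors A) p, ?_⟩
    rw [← Polynomial.aeval_map_algebraMap (FractionRing A) (a • y₀)
      (IsLocalization.integerNormalization (nonZeroDivisors A) p), hbp, ← algebraMap_smul (FractionRing A) b p,
      map_smul, algebraMap_smul]
    exact congrArg (b • ·) hp.symm

theorem IsTranscendenceBasis.finiteDimensional_fractionRing {K L : Type*} [Field K] [Field L]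
    [Algebra K L] [Algebra.EssFiniteType K L] {ι : Type*} {u : ι → L} (hu : IsTranscendenceBasis K u) :
    letI := chartAlgebra (K := K) u
    haveI := hu.1.faithfulSMul_chartAlgebra
    letI := FractionRing.liftAlgebra (MvPolynomial ι K) L
    FiniteDimensional (FractionRing (MvPolynomial ι K)) L := by
  let A := MvPolynomial ι K
  let iAL : Algebra A L := chartAlgebra u
  have := hu.1.faithfulSMul_chartAlgebra
  have : Algebra.IsAlgebraic A L := hu.isAlgebraic_chartAlgebra
  let := FractionRing.liftAlgebra A L
  have := FractionRing.isScalarTower_liftAlgebra A L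
  have : IsScalarTower K A L := IsScalarTower.of_algebraMap_eq fun a => by
    rw [MvPolynomial.algebraMap_eq]
    exact (aeval_C u a).symm
  have : IsScalarTower K (FractionRing A) L := IsScalarTower.of_algebraMap_eq fun a => by
    rw [IsScalarTower.algebraMap_apply K A (FractionRing A),
      ← IsScalarTower.algebraMap_apply A (FractionRing A) L, ← IsScalarTower.algebraMap_apply K A L]
  have : Algebra.IsAlgebraic (FractionRing A) L :=
    (IsFractionRing.comap_isAlgebraic_iff (A := A)).1 ‹_›
  have : Algebra.EssFiniteType (FractionRing A) L := .of_comp K (FractionRing A) L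
  exact Algebra.finite_of_essFiniteType_of_isAlgebraic

universe w in
/-- At almost every prime of a chart, `L` is unramified. -/
theorem IsTranscendenceBasis.exists_good_unramified {K L Λ : Type*} [Field K] [CharZero K]
    [Field L] [Field Λ] [Algebra K L] [Algebra K Λ] [Algebra L Λ] [IsScalarTower K L Λ]
    [Algebra.IsAlgebraic L Λ] [Algebra.EssFiniteType K L] {l : ℕ} {u : Fin l → L}
    (hu : IsTranscendenceBasis K u) :
    ∃ f : MvPolynomial (Fin l) K, f ≠ 0 ∧ ∀ {Γ : Type w} [LinearOrderedCommGroupWithZero Γ]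
      (v : Valuation Λ Γ) (π : MvPolynomial (Fin l) K), Prime π →
      LiesOverChart (fun i => algebraMap L Λ (u i)) π v → ¬ π ∣ f → ∀ s : L,
      v (aeval (fun i => algebraMap L Λ (u i)) π * algebraMap L Λ s) < 1 → v (algebraMap L Λ s) ≤ 1 := by
  classical
  let A := MvPolynomial (Fin l) K
  have huΛ : IsTranscendenceBasis K fun i => algebraMap L Λ (u i) := hu.algebraMap_comp
  let iAL : Algebra A L := chartAlgebra u
  have := hu.1.faithfulSMul_chartAlgebra
  have : Algebra.IsAlgebraic A L := hu.isAlgebraic_chartAlgebra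
  obtain ⟨y, -, hy1, hy2, hy3⟩ := exists_primitive_of_subalgebra (A := A) (L := L)
    hu.finiteDimensional_fractionRing (integralClosure A L) (fun b hb => hb)
    fun s => IsAlgebraic.exists_integral_multiple (Algebra.IsAlgebraic.isAlgebraic (R := A) s)
  obtain ⟨f, hf0, hf⟩ := huΛ.exists_good.{w}
    {algebraMap L Λ y, algebraMap L Λ (Polynomial.aeval y (minpoly A y).derivative)}
  refine ⟨f, hf0, fun v π hπ hv hπf s hs => ?_⟩
  let iAΛ : Algebra A Λ := chartAlgebra fun i => algebraMap L Λ (u i)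
  have := huΛ.1.faithfulSMul_chartAlgebra
  have : Algebra.IsAlgebraic A Λ := huΛ.isAlgebraic_chartAlgebra
  have : IsScalarTower A L Λ := IsScalarTower.of_algebraMap_eq fun a =>
    aeval_algebraMap_apply Λ u a
  obtain ⟨a, ha0, q, hq⟩ := hy3 s
  refine hv.liesOverElem.le_one_of_unramified hπ (y := algebraMap L Λ y)
    (hf v π hv hπf _ (by simp)).1 (M := minpoly A y) ?_ ?_ ⟨a, ha0, q, ?_⟩ hs
  · rw [Polynomial.aeval_algebraMap_apply, hy1, map_zero]
  · rw [Polynomial.aeval_algebraMap_apply]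
    exact (hf v π hv hπf _ (by simp)).2 (by simpa using hy2)
  · rw [Polynomial.aeval_algebraMap_apply, ← hq, Algebra.smul_def, map_mul,
      ← IsScalarTower.algebraMap_apply A L Λ]

section Close
variable {Λ Γ : Type*} [Field Λ] [LinearOrderedCommGroupWithZero Γ]

/-- Two integral elements that are congruent modulo `γ`. -/
def Valuation.Close (v : Valuation Λ Γ) (γ : Γ) (a b : Λ) : Prop :=
  v a ≤ 1 ∧ v b ≤ 1 ∧ v (a - b) ≤ γ

namespace Valuation.Close
variable {v : Valuation Λ Γ} {γ : Γ} {a b a' b' : Λ}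

theorem refl (ha : v a ≤ 1) : v.Close γ a a := ⟨ha, ha, by simp⟩

theorem add (h : v.Close γ a b) (h' : v.Close γ a' b') : v.Close γ (a + a') (b + b') :=
  ⟨v.map_add_le h.1 h'.1, v.map_add_le h.2.1 h'.2.1, by
    rw [add_sub_add_comm]; exact v.map_add_le h.2.2 h'.2.2⟩

theorem mul (h : v.Close γ a b) (h' : v.Close γ a' b') : v.Close γ (a * a') (b * b') := by
  refine ⟨by rw [map_mul]; exact mul_le_one' h.1 h'.1,
    by rw [map_mul]; exact mul_le_one' h.2.1 h'.2.1, ?_⟩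
  rw [show a * a' - b * b' = a * (a' - b') + (a - b) * b' by ring]
  refine v.map_add_le ?_ ?_ <;> rw [map_mul]
  · exact (mul_le_of_le_one_left' h.1).trans h'.2.2
  · exact (mul_le_of_le_one_right' h'.2.1).trans h.2.2

theorem pow (h : v.Close γ a b) (n : ℕ) : v.Close γ (a ^ n) (b ^ n) := by
  induction n with
  | zero => simpa using refl (v := v) (γ := γ) (a := 1) (by simp)
  | succ n ih => simpa only [pow_succ] using ih.mul h

theorem sum {α : Type*} {s : Finset α} {f g : α → Λ} (h : ∀ i ∈ s, v.Close γ (f i) (g i)) :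
    v.Close γ (∑ i ∈ s, f i) (∑ i ∈ s, g i) := by
  classical
  induction s using Finset.induction_on with
  | empty => simpa using refl (v := v) (γ := γ) (a := 0) (by simp)
  | insert i s hi ih =>
    rw [Finset.sum_insert hi, Finset.sum_insert hi]
    exact (h i (by simp)).add (ih fun j hj => h j (by simp [hj]))

theorem symm (h : v.Close γ a b) : v.Close γ b a := ⟨h.2.1, h.1, by rw [v.map_sub_swap]; exact h.2.2⟩

theorem mono {γ' : Γ} (h : v.Close γ a b) (hγ : γ ≤ γ') : v.Close γ' a b :=
  ⟨h.1, h.2.1, h.2.2.trans hγ⟩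

theorem eq_one_iff (h : v.Close γ a b) (hγ : γ < 1) : v a = 1 ↔ v b = 1 := by
  have key : ∀ {a b}, v.Close γ a b → v a = 1 → v b = 1 := fun {a b} h ha => by
    have := v.map_sub_eq_of_lt_right (x := a - b) (y := a) (by
      rw [ha]; exact h.2.2.trans_lt hγ)
    rw [show a - b - a = -b by ring, v.map_neg, ha] at this
    exact this
  exact ⟨key h, key h.symm⟩

end Valuation.Close
end Close

section
variable {K : Type*} [Field K] {ι : Type*}

/-- Evaluation of a polynomial over a polynomial ring at a point `(a, y)`. -/
noncomputable def evPt {B : Type*} [CommRing B] [Algebra K B] (a : ι → B) (y : B) :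
    Polynomial (MvPolynomial ι K) →+* B :=
  Polynomial.eval₂RingHom (aeval a).toRingHom y

theorem evPt_apply {B : Type*} [CommRing B] [Algebra K B] (a : ι → B) (y : B)
    (f : Polynomial (MvPolynomial ι K)) :
    evPt a y f = f.sum fun n b => aeval a b * y ^ n :=
  Polynomial.eval₂_eq_sum

@[simp] theorem evPt_C {B : Type*} [CommRing B] [Algebra K B] (a : ι → B) (y : B)
    (f : MvPolynomial ι K) : evPt a y (Polynomial.C f) = aeval a f :=
  Polynomial.eval₂_C _ _

theorem map_evPt {B B' : Type*} [CommRing B] [Algebra K B] [CommRing B'] [Algebra K B']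
    (σ : B →ₐ[K] B') (a : ι → B) (y : B) (f : Polynomial (MvPolynomial ι K)) :
    σ (evPt a y f) = evPt (fun i => σ (a i)) (σ y) f := by
  have h (b : MvPolynomial ι K) : σ (aeval a b) = aeval (fun i => σ (a i)) b := by
    rw [← AlgHom.comp_apply, comp_aeval]
  simp only [evPt_apply, Polynomial.sum, map_sum, map_mul, map_pow, h]

/-- The divided difference `(P_a(y) - P_a(β)) / (y - β)`. -/
noncomputable def divDiff {B : Type*} [CommRing B] [Algebra K B]
    (P : Polynomial (MvPolynomial ι K)) (a : ι → B) (y β : B) : B :=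
  P.sum fun n b => aeval a b * ∑ i ∈ Finset.range n, y ^ i * β ^ (n - 1 - i)

theorem map_divDiff {B B' : Type*} [CommRing B] [Algebra K B] [CommRing B'] [Algebra K B']
    (σ : B →ₐ[K] B') (P : Polynomial (MvPolynomial ι K)) (a : ι → B) (y β : B) :
    σ (divDiff P a y β) = divDiff P (fun i => σ (a i)) (σ y) (σ β) := by
  have h (b : MvPolynomial ι K) : σ (aeval a b) = aeval (fun i => σ (a i)) b := by
    rw [← AlgHom.comp_apply, comp_aeval]
  simp only [divDiff, Polynomial.sum, map_sum, map_mul, map_pow, h]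

theorem sub_mul_divDiff {B : Type*} [CommRing B] [Algebra K B]
    (P : Polynomial (MvPolynomial ι K)) (a : ι → B) (y β : B) :
    (y - β) * divDiff P a y β = evPt a y P - evPt a β P := by
  simp only [divDiff, evPt_apply, Polynomial.sum, Finset.mul_sum, ← Finset.sum_sub_distrib]
  refine Finset.sum_congr rfl fun n _ => ?_
  rw [← mul_sub, ← Commute.mul_geom_sum₂ (Commute.all y β), Finset.mul_sum, Finset.mul_sum]
  exact Finset.sum_congr rfl fun i _ => by ring

theorem divDiff_self {B : Type*} [CommRing B] [Algebra K B]
    (P : Polynomial (MvPolynomial ι K)) (a : ι → B) (y : B) :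
    divDiff P a y y = evPt a y P.derivative := by
  rw [Polynomial.derivative_apply, Polynomial.sum, map_sum, divDiff, Polynomial.sum]
  refine Finset.sum_congr rfl fun n _ => ?_
  have h : ∑ i ∈ Finset.range n, y ^ i * y ^ (n - 1 - i) = n * y ^ (n - 1) := by
    rw [Finset.sum_congr rfl fun i hi => by
      rw [← pow_add, Nat.add_sub_cancel' (Nat.le_sub_one_of_lt (Finset.mem_range.1 hi))]]
    simp
  rw [h, map_mul, map_pow, evPt_C, map_mul, map_natCast, mul_assoc]
  congr 2
  exact congrArg (· ^ (n - 1)) (Polynomial.eval₂_X _ _).symm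

variable {Λ Γ : Type*} [Field Λ] [Algebra K Λ] [LinearOrderedCommGroupWithZero Γ]
  {v : Valuation Λ Γ}

theorem MvPolynomial.close_aeval (hK : ∀ c : K, v (algebraMap K Λ c) ≤ 1) {γ : Γ} {a a' : ι → Λ}
    (h : ∀ i, v.Close γ (a i) (a' i)) (g : MvPolynomial ι K) :
    v.Close γ (aeval a g) (aeval a' g) := by
  induction g using MvPolynomial.induction_on with
  | C c => simpa using .refl (hK c)
  | add p q hp hq => simpa using hp.add hq
  | mul_X p i hp => simpa using hp.mul (h i)

theorem close_evPt (hK : ∀ c : K, v (algebraMap K Λ c) ≤ 1) {γ : Γ} {a a' : ι → Λ}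
    (h : ∀ i, v.Close γ (a i) (a' i)) {y y' : Λ} (hy : v.Close γ y y')
    (f : Polynomial (MvPolynomial ι K)) : v.Close γ (evPt a y f) (evPt a' y' f) := by
  rw [evPt_apply, evPt_apply]
  exact .sum fun n _ => (close_aeval hK h _).mul (hy.pow n)

theorem close_divDiff (hK : ∀ c : K, v (algebraMap K Λ c) ≤ 1) {γ : Γ} {a a' : ι → Λ}
    (h : ∀ i, v.Close γ (a i) (a' i)) {y y' β β' : Λ} (hy : v.Close γ y y') (hβ : v.Close γ β β')
    (f : Polynomial (MvPolynomial ι K)) : v.Close γ (divDiff f a y β) (divDiff f a' y' β') :=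
  .sum fun _ _ => (close_aeval hK h _).mul (.sum fun _ _ => (hy.pow _).mul (hβ.pow _))

theorem MvPolynomial.valuation_aeval_le_pow (hK : ∀ c : K, v (algebraMap K Λ c) ≤ 1) {γ : Γ}
    (hγ : 1 ≤ γ) {a : ι → Λ} (ha : ∀ i, v (a i) ≤ γ) (g : MvPolynomial ι K) :
    v (aeval a g) ≤ γ ^ g.totalDegree := by
  rw [aeval_def, eval₂_eq]
  refine v.map_sum_le fun m hm => ?_
  rw [map_mul, map_prod]
  refine (mul_le_of_le_one_left' (hK _)).trans ?_
  calc ∏ i ∈ m.support, v (a i ^ m i) ≤ ∏ i ∈ m.support, γ ^ m i :=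
        Finset.prod_le_prod' fun i _ => by rw [map_pow]; exact pow_le_pow_left' (ha i) _
    _ = γ ^ (m.sum fun _ e => e) := by rw [Finset.prod_pow_eq_pow_sum]; rfl
    _ ≤ _ := pow_le_pow_right' hγ (le_totalDegree hm)

theorem MvPolynomial.aeval_algebraMap_eq {B : Type*} [CommRing B] [Algebra K B] (c : ι → K)
    (p : MvPolynomial ι K) :
    aeval (fun i => algebraMap K B (c i)) p = algebraMap K B (eval c p) := by
  rw [← coe_aeval_eq_eval]
  exact aeval_algebraMap_apply B c p

/-- A root of a line section of `p` is bounded by the base point. -/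
theorem MvPolynomial.valuation_le_of_aeval_line (hK : ∀ c : K, v (algebraMap K Λ c) ≤ 1) {γ : Γ}
    (hγ : 1 ≤ γ) {a : ι → Λ} (ha : ∀ i, v (a i) ≤ γ) {p : MvPolynomial ι K} {c : ι → K}
    (hc : eval c (homogeneousComponent p.totalDegree p) ≠ 0) {ξ : Λ}
    (hξ : aeval (fun i => a i - ξ * algebraMap K Λ (c i)) p = 0) : v ξ ≤ γ := by
  by_contra! hlt
  have hξ1 : 1 < v ξ := hγ.trans_lt hlt
  have hξ0 : ξ ≠ 0 := by rintro rfl; simp at hξ1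
  have hvξ : v ξ ≠ 0 := by simpa
  set b : ι → Λ := fun i => ξ⁻¹ * a i - algebraMap K Λ (c i) with hb
  have hδ : v ξ⁻¹ * γ < 1 := by
    rw [map_inv₀, inv_mul_lt_iff₀ (zero_lt_iff.2 hvξ), mul_one]; exact hlt
  have hclose : ∀ i, v.Close (v ξ⁻¹ * γ) (b i) (-algebraMap K Λ (c i)) := fun i => by
    have h1 : v (ξ⁻¹ * a i) ≤ v ξ⁻¹ * γ := by rw [map_mul]; gcongr; exact ha i
    refine ⟨v.map_sub_le (h1.trans hδ.le) (hK _), by rw [v.map_neg]; exact hK _, ?_⟩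
    simpa [hb] using h1
  have hK1 : ∀ k : K, k ≠ 0 → v (algebraMap K Λ k) = 1 := fun k hk => by
    refine le_antisymm (hK k) ?_
    have := hK k⁻¹
    rw [map_inv₀, map_inv₀] at this
    exact (inv_le_one₀ (by simpa [zero_lt_iff] using hk)).1 this
  have hx : (fun i => a i - ξ * algebraMap K Λ (c i)) = fun i => ξ * b i := by
    funext i; simp only [hb]; field_simp
  set n := p.totalDegree
  have hp : p = ∑ i ∈ Finset.range (n + 1), homogeneousComponent i p :=
    (sum_homogeneousComponent p).symm
  have hterm (i : ℕ) : v (aeval (fun i => ξ * b i) (homogeneousComponent i p)) =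
      v ξ ^ i * v (aeval b (homogeneousComponent i p)) := by
    rw [aeval_mul_of_isHomogeneous (homogeneousComponent_isHomogeneous i p), map_mul, map_pow]
  rw [hx, hp, map_sum, Finset.sum_range_succ] at hξ
  have htop : v (aeval b (homogeneousComponent n p)) = 1 := by
    rw [(close_aeval hK hclose _).eq_one_iff hδ]
    have h1 : (fun i => -algebraMap K Λ (c i)) = fun i => (-1 : Λ) * algebraMap K Λ (c i) := by simp
    rw [h1, aeval_mul_of_isHomogeneous (homogeneousComponent_isHomogeneous n p), map_mul, map_pow,
      v.map_neg, map_one, one_pow, one_mul, aeval_algebraMap_eq]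
    exact hK1 _ hc
  have hlow : v (∑ i ∈ Finset.range n, aeval (fun i => ξ * b i) (homogeneousComponent i p)) <
      v ξ ^ n := by
    refine v.map_sum_lt (pow_ne_zero _ hvξ) fun i hi => ?_
    rw [hterm]
    refine (mul_le_of_le_one_right' ?_).trans_lt (pow_lt_pow_right₀ hξ1 (Finset.mem_range.1 hi))
    exact (close_aeval hK hclose _).1
  have h2 := hterm n
  rw [htop, mul_one] at h2
  have h3 := v.map_add_eq_of_lt_right (hlow.trans_eq h2.symm)
  rw [hξ, h2, map_zero] at h3
  exact pow_ne_zero _ hvξ h3.symm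

theorem Polynomial.Monic.valuation_le_of_root {B : Type*} [CommRing B] {φ : B →+* Λ} {γ : Γ} (hγ : 1 ≤ γ)
    {M : Polynomial B} (hM : M.Monic) (h : ∀ n, v (φ (M.coeff n)) ≤ γ) {β : Λ}
    (hβ : M.eval₂ φ β = 0) : v β ≤ γ := by
  by_contra! hlt
  have hβ1 : 1 < v β := hγ.trans_lt hlt
  have hvβ : v β ≠ 0 := (zero_lt_one.trans hβ1).ne'
  rw [Polynomial.eval₂_eq_sum_range, Finset.sum_range_succ, hM.coeff_natDegree, map_one, one_mul] at hβ
  have hlow : v (∑ i ∈ Finset.range M.natDegree, φ (M.coeff i) * β ^ i) < v (β ^ M.natDegree) := by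
    rw [map_pow]
    refine v.map_sum_lt (pow_ne_zero _ hvβ) fun i hi => ?_
    rw [map_mul, map_pow]
    calc v (φ (M.coeff i)) * v β ^ i < v β * v β ^ i := by
          have := (h i).trans_lt hlt
          gcongr
          exact zero_lt_iff.2 (pow_ne_zero _ hvβ)
      _ = v β ^ (i + 1) := by rw [pow_succ']
      _ ≤ _ := pow_le_pow_right₀ hβ1.le (Finset.mem_range.1 hi)
  have h3 := v.map_add_eq_of_lt_right hlow
  rw [hβ, map_zero, map_pow] at h3
  exact pow_ne_zero _ hvβ h3.symm
end

section
variable {ι B : Type*} [CommRing B]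

theorem MvPolynomial.coeff_prod_line (x b : ι → B) (m : ι → ℕ) (s : Finset ι) :
    (∏ i ∈ s, (Polynomial.C (x i) + Polynomial.X * Polynomial.C (b i)) ^ m i).natDegree ≤
        ∑ i ∈ s, m i ∧
      (∏ i ∈ s, (Polynomial.C (x i) + Polynomial.X * Polynomial.C (b i)) ^ m i).coeff
        (∑ i ∈ s, m i) = ∏ i ∈ s, b i ^ m i := by
  classical
  have h1 (i : ι) : (Polynomial.C (x i) + Polynomial.X * Polynomial.C (b i)).natDegree ≤ 1 := by
    compute_degree
  induction s using Finset.induction_on with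
  | empty => simp
  | insert i s hi ih =>
    rw [Finset.prod_insert hi, Finset.sum_insert hi, Finset.prod_insert hi]
    have h2 : ((Polynomial.C (x i) + Polynomial.X * Polynomial.C (b i)) ^ m i).natDegree ≤ m i := by
      simpa using Polynomial.natDegree_pow_le_of_le (m i) (h1 i)
    refine ⟨Polynomial.natDegree_mul_le_of_le h2 ih.1, ?_⟩
    rw [Polynomial.coeff_mul_add_eq_of_natDegree_le h2 ih.1, ih.2]
    have := Polynomial.coeff_pow_of_natDegree_le (m := m i) (h1 i)
    rw [mul_one] at this
    rw [this]
    simp [Polynomial.coeff_C]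

variable {K : Type*} [CommRing K] [Algebra K B]

theorem MvPolynomial.coeff_line_of_isHomogeneous {q : MvPolynomial ι K} {n : ℕ} (hq : q.IsHomogeneous n)
    (x b : ι → B) :
    (aeval (fun i => Polynomial.C (x i) + Polynomial.X * Polynomial.C (b i)) q).natDegree ≤ n ∧
      (aeval (fun i => Polynomial.C (x i) + Polynomial.X * Polynomial.C (b i)) q).coeff n =
        aeval b q := by
  rw [aeval_def, eval₂_eq, aeval_def, eval₂_eq, Polynomial.finsetSum_coeff]
  have key (m) (hm : m ∈ q.support) : ∑ i ∈ m.support, m i = n := by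
    have := hq (mem_support_iff.1 hm)
    simpa [Finsupp.weight_apply, Finsupp.sum] using this
  constructor
  · refine Polynomial.natDegree_sum_le_of_forall_le _ _ fun m hm => ?_
    rw [IsScalarTower.algebraMap_apply K B, Polynomial.algebraMap_apply, ← key m hm]
    exact (Polynomial.natDegree_C_mul_le _ _).trans (coeff_prod_line x b m _).1
  · refine Finset.sum_congr rfl fun m hm => ?_
    rw [IsScalarTower.algebraMap_apply K B, Polynomial.algebraMap_apply, Polynomial.coeff_C_mul]
    have := (coeff_prod_line x b m m.support).2
    rw [key m hm] at this
    rw [this]; rfl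

theorem MvPolynomial.coeff_line (q : MvPolynomial ι K) (x b : ι → B) :
    (aeval (fun i => Polynomial.C (x i) + Polynomial.X * Polynomial.C (b i)) q).natDegree ≤
        q.totalDegree ∧
      (aeval (fun i => Polynomial.C (x i) + Polynomial.X * Polynomial.C (b i)) q).coeff
        q.totalDegree = aeval b (homogeneousComponent q.totalDegree q) := by
  set n := q.totalDegree
  have h1 : q = ∑ i ∈ Finset.range (n + 1), homogeneousComponent i q :=
    (sum_homogeneousComponent q).symm
  have h2 (i) := coeff_line_of_isHomogeneous (homogeneousComponent_isHomogeneous i q) x b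
  set f : ι → Polynomial B := fun i => Polynomial.C (x i) + Polynomial.X * Polynomial.C (b i)
  have h3 : aeval f q = ∑ i ∈ Finset.range (n + 1), aeval f (homogeneousComponent i q) := by
    rw [← map_sum, ← h1]
  rw [h3]
  refine ⟨Polynomial.natDegree_sum_le_of_forall_le _ _ fun i hi =>
    (h2 i).1.trans (Nat.lt_succ_iff.1 (Finset.mem_range.1 hi)), ?_⟩
  rw [Polynomial.finsetSum_coeff, Finset.sum_range_succ, (h2 n).2, Finset.sum_eq_zero, zero_add]
  exact fun i hi => Polynomial.coeff_eq_zero_of_natDegree_lt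
    ((h2 i).1.trans_lt (Finset.mem_range.1 hi))
end

section
variable {K : Type*} [Field K] {ι : Type*} {Λ Γ : Type*} [Field Λ] [Algebra K Λ]

/-- The points of the line through `x` in direction `c`. -/
def linePt (c : ι → K) (x : ι → Λ) (ξ : Λ) : ι → Λ := fun i => x i - ξ * algebraMap K Λ (c i)

/-- The points of `V(I)` over the line through `x` in direction `c`. -/
def linePts (I : Ideal (Polynomial (MvPolynomial ι K))) (c : ι → K) (x : ι → Λ) : Set (Λ × Λ) :=
  {q | ∀ f ∈ I, evPt (linePt c x q.1) q.2 f = 0}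

/-- `V(I)` is finite over the hypersurface `p = 0`, whose cone at infinity avoids `c`. -/
structure SectionData (I : Ideal (Polynomial (MvPolynomial ι K)))
    (P : Polynomial (MvPolynomial ι K)) (c : ι → K) (p : MvPolynomial ι K) : Prop where
  monic : P.Monic
  mem_P : P ∈ I
  mem_p : Polynomial.C p ∈ I
  top : eval c (homogeneousComponent p.totalDegree p) ≠ 0

/-- The polynomial whose roots are the parameters of the intersection of `p = 0` with a line. -/
noncomputable def linePoly (c : ι → K) (x : ι → Λ) (p : MvPolynomial ι K) : Polynomial Λ :=
  aeval (fun i => Polynomial.C (x i) + Polynomial.X * Polynomial.C (-algebraMap K Λ (c i))) p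

theorem eval_linePoly (c : ι → K) (x : ι → Λ) (p : MvPolynomial ι K) (ξ : Λ) :
    (linePoly c x p).eval ξ = aeval (linePt c x ξ) p := by
  rw [linePoly, aeval_def, eval₂_eq, aeval_def, eval₂_eq, Polynomial.eval_finsetSum]
  refine Finset.sum_congr rfl fun m _ => ?_
  rw [Polynomial.eval_mul, Polynomial.eval_prod, IsScalarTower.algebraMap_apply K Λ,
    Polynomial.algebraMap_apply]
  simp [linePt, sub_eq_add_neg, mul_comm ξ]

theorem SectionData.coeff_linePoly {I : Ideal (Polynomial (MvPolynomial ι K))}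
    {P : Polynomial (MvPolynomial ι K)} {c : ι → K} {p : MvPolynomial ι K}
    (h : SectionData I P c p) (x : ι → Λ) : ∃ a : K, a ≠ 0 ∧
      (linePoly c x p).natDegree = p.totalDegree ∧
      (linePoly c x p).leadingCoeff = algebraMap K Λ a := by
  obtain ⟨h1, h2⟩ := coeff_line p x fun i => -algebraMap K Λ (c i)
  have h3 : aeval (fun i => -algebraMap K Λ (c i)) (homogeneousComponent p.totalDegree p) =
      algebraMap K Λ ((-1) ^ p.totalDegree * eval c (homogeneousComponent p.totalDegree p)) := by
    have : (fun i => -algebraMap K Λ (c i)) = fun i => (-1 : Λ) * algebraMap K Λ (c i) := by simp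
    rw [this, aeval_mul_of_isHomogeneous (homogeneousComponent_isHomogeneous _ p),
      aeval_algebraMap_eq]
    simp
  have h4 : (-1) ^ p.totalDegree * eval c (homogeneousComponent p.totalDegree p) ≠ 0 :=
    mul_ne_zero (by simp) h.top
  rw [h3] at h2
  have h5 : (linePoly c x p).natDegree = p.totalDegree :=
    le_antisymm h1 (Polynomial.le_natDegree_of_ne_zero (by
      rw [linePoly, h2]; simpa using h.top))
  refine ⟨_, h4, h5, ?_⟩
  rw [Polynomial.leadingCoeff, h5]
  exact h2

theorem SectionData.linePoly_ne_zero {I : Ideal (Polynomial (MvPolynomial ι K))}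
    {P : Polynomial (MvPolynomial ι K)} {c : ι → K} {p : MvPolynomial ι K}
    (h : SectionData I P c p) (x : ι → Λ) : linePoly c x p ≠ 0 := by
  obtain ⟨a, ha, -, h2⟩ := h.coeff_linePoly x
  rw [← Polynomial.leadingCoeff_ne_zero, h2]
  simpa using ha

theorem evPt_eq_eval (a : ι → Λ) (y : Λ) (f : Polynomial (MvPolynomial ι K)) :
    evPt a y f = (f.map (aeval a).toRingHom).eval y := by
  rw [Polynomial.eval_map]; rfl

theorem SectionData.finite_linePts {I : Ideal (Polynomial (MvPolynomial ι K))}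
    {P : Polynomial (MvPolynomial ι K)} {c : ι → K} {p : MvPolynomial ι K}
    (h : SectionData I P c p) (x : ι → Λ) : (linePts I c x).Finite := by
  classical
  refine ((linePoly c x p).roots.toFinset.finite_toSet.biUnion fun ξ _ =>
    ((Set.finite_singleton ξ).prod
      (P.map (aeval (linePt c x ξ)).toRingHom).roots.toFinset.finite_toSet)).subset ?_
  rintro ⟨ξ, β⟩ hq
  have h1 := hq _ h.mem_p
  have h2 := hq _ h.mem_P
  rw [evPt_C, ← eval_linePoly] at h1
  rw [evPt_eq_eval] at h2
  simp only [Set.mem_iUnion]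
  refine ⟨ξ, ?_, rfl, ?_⟩
  · simpa [h.linePoly_ne_zero x] using h1
  · simpa [(h.monic.map _).ne_zero] using h2

/-- The logarithmic form of the hypersurface `V(I)` evaluated at the derivation `D`. -/
noncomputable def logForm (I : Ideal (Polynomial (MvPolynomial ι K)))
    (P : Polynomial (MvPolynomial ι K)) (c : ι → K) (x : ι → Λ) (y : Λ) (D : Λ → Λ) : Λ :=
  (∑ᶠ q ∈ linePts I c x, divDiff P (linePt c x q.1) y q.2 * (D q.1 / q.1)) /
    evPt x y P.derivative

variable [LinearOrderedCommGroupWithZero Γ] {v : Valuation Λ Γ}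
  {I : Ideal (Polynomial (MvPolynomial ι K))}
  {P : Polynomial (MvPolynomial ι K)} {c : ι → K} {p : MvPolynomial ι K}

theorem valuation_linePt_le (hK : ∀ c : K, v (algebraMap K Λ c) ≤ 1) {γ : Γ}
    {x : ι → Λ} (hx : ∀ i, v (x i) ≤ γ) {ξ : Λ} (hξ : v ξ ≤ γ) (i : ι) :
    v (linePt c x ξ i) ≤ γ :=
  v.map_sub_le (hx i) (by rw [map_mul]; exact (mul_le_of_le_one_right' (hK _)).trans hξ)

variable (Λ) in
/-- The poles of the logarithmic form are bounded in terms of those of `x`, `y`. -/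
theorem exists_logForm_bound (P : Polynomial (MvPolynomial ι K)) : ∃ M : ℕ,
    ∀ {Γ : Type*} [LinearOrderedCommGroupWithZero Γ] {v : Valuation Λ Γ} {I c p},
    SectionData I P c p → (∀ c : K, v (algebraMap K Λ c) ≤ 1) → ∀ {γ : Γ}, 1 ≤ γ →
    ∀ {x : ι → Λ}, (∀ i, v (x i) ≤ γ) → ∀ {y : Λ}, v y ≤ γ → v (evPt x y P.derivative)⁻¹ ≤ γ →
    ∀ {ϖ : Λ} {D : Λ → Λ}, (∀ f, v (ϖ * D f) ≤ v f) → v (ϖ * logForm I P c x y D) ≤ γ ^ M := by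
  set N := P.support.sup fun n => (P.coeff n).totalDegree
  refine ⟨N + (N + 1) * P.natDegree + 1, fun {Γ} _ v I c p h hK γ hγ x hx y hy hP ϖ D hD => ?_⟩
  have hcoeff (ξ : Λ) (hξ : v ξ ≤ γ) (n : ℕ) : v (aeval (linePt c x ξ) (P.coeff n)) ≤ γ ^ N := by
    by_cases hn : n ∈ P.support
    · exact (valuation_aeval_le_pow hK hγ (valuation_linePt_le hK hx hξ) _).trans
        (pow_le_pow_right' hγ (Finset.le_sup (f := fun n => (P.coeff n).totalDegree) hn))
    · rw [Polynomial.notMem_support_iff.1 hn]; simp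
  have hNγ : 1 ≤ γ ^ N := one_le_pow_of_one_le' hγ N
  rw [logForm, finsum_mem_eq_finite_toFinset_sum _ (h.finite_linePts x), mul_div_assoc',
    Finset.mul_sum, div_eq_mul_inv, map_mul, pow_succ]
  refine mul_le_mul' (v.map_sum_le fun q hq => ?_) hP
  have hq : q ∈ linePts I c x := by simpa using hq
  have hξ : v q.1 ≤ γ := valuation_le_of_aeval_line hK hγ hx h.top (by
    have := hq _ h.mem_p
    rwa [evPt_C] at this)
  have hroot : P.eval₂ (aeval (linePt c x q.1)).toRingHom q.2 = 0 := hq _ h.mem_P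
  have hβ : v q.2 ≤ γ ^ N := h.monic.valuation_le_of_root (φ := (aeval (linePt c x q.1)).toRingHom)
    hNγ (hcoeff _ hξ) hroot
  have h1 : v (divDiff P (linePt c x q.1) y q.2) ≤ γ ^ (N + (N + 1) * P.natDegree) := by
    refine v.map_sum_le fun n hn => ?_
    rw [map_mul, pow_add]
    refine mul_le_mul' (hcoeff _ hξ n) (v.map_sum_le fun i hi => ?_)
    have hβ' : v q.2 ≤ γ ^ (N + 1) := hβ.trans (pow_le_pow_right' hγ (Nat.le_succ N))
    have hy' : v y ≤ γ ^ (N + 1) := hy.trans (le_self_pow hγ (Nat.succ_ne_zero N))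
    rw [map_mul, map_pow, map_pow, pow_mul]
    calc v y ^ i * v q.2 ^ (n - 1 - i) ≤ (γ ^ (N + 1)) ^ i * (γ ^ (N + 1)) ^ (n - 1 - i) :=
          mul_le_mul' (pow_le_pow_left' hy' _) (pow_le_pow_left' hβ' _)
      _ = (γ ^ (N + 1)) ^ (i + (n - 1 - i)) := (pow_add _ _ _).symm
      _ ≤ _ := pow_le_pow_right' (one_le_pow_of_one_le' hγ _) (by
          have := Polynomial.le_natDegree_of_mem_supp n hn
          have := Finset.mem_range.1 hi
          omega)
  have h2 : v (ϖ * (D q.1 / q.1)) ≤ 1 := by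
    rw [mul_div_assoc', map_div₀]
    exact div_le_one_of_le₀ (hD _) zero_le
  rw [mul_left_comm, map_mul]
  exact (mul_le_of_le_one_right' h2).trans h1
end

theorem Valuation.exists_root_of_eval_lt_one {Λ Γ : Type*} [Field Λ] [IsAlgClosed Λ]
    [LinearOrderedCommGroupWithZero Γ] (v : Valuation Λ Γ) {M : Polynomial Λ}
    (hM : v M.leadingCoeff = 1) {z : Λ} (hz : v (M.eval z) < 1) : ∃ r, M.eval r = 0 ∧ v (z - r) < 1 := by
  have hM0 : M ≠ 0 := by rintro rfl; simp at hM
  rw [(IsAlgClosed.splits M).eval_eq_prod_roots, map_mul, hM, one_mul, map_multiset_prod,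
    Multiset.map_map] at hz
  by_contra! h
  refine hz.not_ge (Multiset.one_le_prod_of_one_le fun a ha => ?_)
  obtain ⟨r, hr, rfl⟩ := Multiset.mem_map.1 ha
  exact h r ((Polynomial.mem_roots hM0).1 hr)

section
variable {K : Type*} [Field K] {ι : Type*} {Λ Γ : Type*} [Field Λ] [Algebra K Λ]
  [LinearOrderedCommGroupWithZero Γ] {v : Valuation Λ Γ}
  {I : Ideal (Polynomial (MvPolynomial ι K))}
  {P : Polynomial (MvPolynomial ι K)} {c : ι → K} {p : MvPolynomial ι K}

theorem SectionData.le_one_of_mem (h : SectionData I P c p)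
    (hK : ∀ c : K, v (algebraMap K Λ c) ≤ 1) {x : ι → Λ} (hx : ∀ i, v (x i) ≤ 1) {q : Λ × Λ}
    (hq : q ∈ linePts I c x) : v q.1 ≤ 1 ∧ v q.2 ≤ 1 := by
  have hξ : v q.1 ≤ 1 := valuation_le_of_aeval_line hK le_rfl hx h.top (by
    have := hq _ h.mem_p
    rwa [evPt_C] at this)
  have hroot : P.eval₂ (aeval (linePt c x q.1)).toRingHom q.2 = 0 := hq _ h.mem_P
  refine ⟨hξ, h.monic.valuation_le_of_root (φ := (aeval (linePt c x q.1)).toRingHom) le_rfl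
    (fun n => ?_) hroot⟩
  exact (close_aeval hK (γ := 1) (fun i => .refl (valuation_linePt_le hK hx hξ i)) _).1

theorem close_linePt (hK : ∀ c : K, v (algebraMap K Λ c) ≤ 1) {x : ι → Λ}
    (hx : ∀ i, v (x i) ≤ 1) {ξ : Λ} (hξ : v ξ ≤ 1) (i : ι) : v.Close (v ξ) (x i) (linePt c x ξ i) := by
  refine ⟨hx i, valuation_linePt_le hK hx hξ i, ?_⟩
  rw [linePt, sub_sub_cancel, map_mul]
  exact mul_le_of_le_one_right' (hK _)

theorem SectionData.divDiff_le (h : SectionData I P c p)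
    (hK : ∀ c : K, v (algebraMap K Λ c) ≤ 1) {x : ι → Λ} (hx : ∀ i, v (x i) ≤ 1) {y : Λ}
    (hy : v y ≤ 1) (hP : evPt x y P = 0) {q : Λ × Λ} (hq : q ∈ linePts I c x) :
    v (divDiff P (linePt c x q.1) y q.2) ≤ 1 ∧
      v ((y - q.2) * divDiff P (linePt c x q.1) y q.2) ≤ v q.1 := by
  have hq1 := h.le_one_of_mem hK hx hq
  have hcl := close_linePt (c := c) hK hx hq1.1
  refine ⟨(close_divDiff hK (γ := 1) (fun i => .refl (hcl i).2.1) (.refl hy) (.refl hq1.2) P).1, ?_⟩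
  have := (close_evPt hK hcl (.refl hy) P).2.2
  rw [hP, zero_sub, v.map_neg] at this
  rwa [sub_mul_divDiff, hq _ h.mem_P, sub_zero]

theorem SectionData.term_lt_one (h : SectionData I P c p)
    (hK : ∀ c : K, v (algebraMap K Λ c) ≤ 1) {x : ι → Λ} (hx : ∀ i, v (x i) ≤ 1) {y : Λ}
    (hy : v y ≤ 1) (hP : evPt x y P = 0) {ϖ : Λ} {D : Derivation K Λ Λ} (hD : LogGood v ϖ D)
    {q : Λ × Λ} (hq : q ∈ linePts I c x) (hne : ¬ (v q.1 < 1 ∧ v (y - q.2) < 1)) :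
    v (ϖ * (divDiff P (linePt c x q.1) y q.2 * (D q.1 / q.1))) < 1 := by
  have hq1 := h.le_one_of_mem hK hx hq
  obtain ⟨h1, h2⟩ := h.divDiff_le hK hx hy hP hq
  have hle : v (divDiff P (linePt c x q.1) y q.2) ≤ v q.1 := by
    rcases hq1.1.lt_or_eq with hlt | heq
    · have h3 : v (y - q.2) = 1 := le_antisymm (v.map_sub_le hy hq1.2)
        (not_lt.1 fun h3 => hne ⟨hlt, h3⟩)
      rwa [map_mul, h3, one_mul] at h2
    · rwa [heq]
  rw [mul_left_comm, mul_div_assoc', map_mul, map_div₀]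
  by_cases h0 : v q.1 = 0
  · simp [h0]
  rw [mul_div_assoc', mul_comm, mul_div_assoc]
  exact (mul_le_of_le_one_right' (div_le_one_of_le₀ hle zero_le)).trans_lt (hD.lt_one _ hq1.1)

theorem SectionData.logForm_lt_one (h : SectionData I P c p)
    (hK : ∀ c : K, v (algebraMap K Λ c) ≤ 1) {x : ι → Λ} (hx : ∀ i, v (x i) ≤ 1) {y : Λ}
    (hy : v y ≤ 1) (hP : evPt x y P = 0) (hP' : v (evPt x y P.derivative) = 1)
    {ϖ : Λ} {D : Derivation K Λ Λ} (hD : LogGood v ϖ D)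
    {f : Polynomial (MvPolynomial ι K)} (hf : f ∈ I) (hf1 : v (evPt x y f) = 1) :
    v (ϖ * logForm I P c x y D) < 1 := by
  rw [logForm, finsum_mem_eq_finite_toFinset_sum _ (h.finite_linePts x), mul_div_assoc',
    Finset.mul_sum, map_div₀, hP', div_one]
  refine v.map_sum_lt one_ne_zero fun q hq => ?_
  have hq : q ∈ linePts I c x := by simpa using hq
  refine h.term_lt_one hK hx hy hP hD hq fun hlt => ?_
  have hq1 := h.le_one_of_mem hK hx hq
  have := (close_evPt hK (γ := max (v q.1) (v (y - q.2)))
    (fun i => (close_linePt (c := c) hK hx hq1.1 i).mono (le_max_left _ _))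
    ⟨hy, hq1.2, le_max_right _ _⟩ f).eq_one_iff (max_lt hlt.1 hlt.2)
  rw [hq f hf] at this
  simp [hf1] at this

theorem SectionData.exists_collided [IsAlgClosed Λ] (h : SectionData I P c p)
    (hK : ∀ c : K, v (algebraMap K Λ c) ≤ 1) {x : ι → Λ} (hx : ∀ i, v (x i) ≤ 1) {y : Λ}
    (hy : v y ≤ 1) (hP : evPt x y P = 0) (hP' : v (evPt x y P.derivative) = 1)
    {ϖ : Λ} {D : Derivation K Λ Λ} (hD : LogGood v ϖ D) (hI : ∀ f ∈ I, v (evPt x y f) < 1)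
    (κ : IntermediateField K Λ) (hκ : ∀ z : Λ, IsAlgebraic κ z → z ∈ κ)
    (hκv : ∀ z ∈ κ, z ≠ 0 → v z = 1) {e : ι} (he : c e ≠ 0)
    (hℓ : ∀ j, algebraMap K Λ (c e) * x j - algebraMap K Λ (c j) * x e ∈ κ) :
    ∃ ξ, v ξ < 1 ∧ v (ϖ * (logForm I P c x y D - D ξ / ξ)) < 1 ∧
      (∀ f ∈ I, v (evPt x y f) ≤ v ξ) ∧ x e - ξ * algebraMap K Λ (c e) ∈ κ := by
  classical
  have hK1 : ∀ k : K, k ≠ 0 → v (algebraMap K Λ k) = 1 := fun k hk =>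
    hκv _ (κ.algebraMap_mem k) (by simpa using hk)
  have hce : algebraMap K Λ (c e) ≠ 0 := by simpa using he
  -- the points of the line lying on `p = 0` are defined over `κ`
  have hline (ξ : Λ) (hξ : x e - ξ * algebraMap K Λ (c e) ∈ κ) (j : ι) : linePt c x ξ j ∈ κ := by
    have : linePt c x ξ j = (algebraMap K Λ (c e))⁻¹ *
        ((algebraMap K Λ (c e) * x j - algebraMap K Λ (c j) * x e) +
          algebraMap K Λ (c j) * (x e - ξ * algebraMap K Λ (c e))) := by
      rw [linePt]; field_simp; ring
    rw [this]
    exact κ.mul_mem (κ.inv_mem (κ.algebraMap_mem _))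
      (κ.add_mem (hℓ j) (κ.mul_mem (κ.algebraMap_mem _) hξ))
  have hκaev {a : ι → κ} (g : MvPolynomial ι K) :
      aeval (fun i => (a i : Λ)) g = algebraMap κ Λ (aeval a g) := aeval_algebraMap_apply Λ a g
  have hlineκ (ξ : Λ) (hξ : aeval (linePt c x ξ) p = 0) :
      x e - ξ * algebraMap K Λ (c e) ∈ κ := by
    apply hκ
    let x' : ι → κ := fun j => ⟨(algebraMap K Λ (c e))⁻¹ *
      (algebraMap K Λ (c e) * x j - algebraMap K Λ (c j) * x e),
        κ.mul_mem (κ.inv_mem (κ.algebraMap_mem _)) (hℓ j)⟩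
    let b : ι → κ := fun j => algebraMap K κ (c e)⁻¹ * algebraMap K κ (c j)
    obtain ⟨-, h2⟩ := coeff_line p x' b
    refine ⟨aeval (fun i => Polynomial.C (x' i) + Polynomial.X * Polynomial.C (b i)) p,
      fun h0 => ?_, ?_⟩
    · rw [h0, Polynomial.coeff_zero,
        aeval_mul_of_isHomogeneous (homogeneousComponent_isHomogeneous _ p),
        aeval_algebraMap_eq, ← map_pow, ← map_mul, eq_comm,
        map_eq_zero_iff _ (algebraMap K κ).injective] at h2
      exact mul_ne_zero (pow_ne_zero _ (inv_ne_zero he)) h.top h2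
    · have h3 := comp_aeval (fun i => Polynomial.C (x' i) + Polynomial.X * Polynomial.C (b i))
        ((Polynomial.aeval (R := κ) (x e - ξ * algebraMap K Λ (c e))).restrictScalars K)
      have h4 := DFunLike.congr_fun h3 p
      refine h4.trans (Eq.trans ?_ hξ)
      congr 2
      funext j
      have h5 : algebraMap κ Λ (b j) = (algebraMap K Λ (c e))⁻¹ * algebraMap K Λ (c j) := by
        rw [map_mul, ← IsScalarTower.algebraMap_apply, ← IsScalarTower.algebraMap_apply, map_inv₀]
      have h6 : algebraMap κ Λ (x' j) = (algebraMap K Λ (c e))⁻¹ *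
        (algebraMap K Λ (c e) * x j - algebraMap K Λ (c j) * x e) := rfl
      simp only [AlgHom.coe_restrictScalars', map_add, map_mul, Polynomial.aeval_C,
        Polynomial.aeval_X, h5, h6, linePt]
      field_simp
      ring
  have hβκ {a : ι → Λ} (ha : ∀ i, a i ∈ κ) {β : Λ} (hβ : evPt a β P = 0) : β ∈ κ := by
    apply hκ
    let a' : ι → κ := fun i => ⟨a i, ha i⟩
    refine ⟨P.map (aeval a').toRingHom, (h.monic.map _).ne_zero, ?_⟩
    rw [← hβ, Polynomial.aeval_def, Polynomial.eval₂_map]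
    have : (algebraMap κ Λ).comp (aeval (R := K) a').toRingHom = (aeval (R := K) a).toRingHom :=
      RingHom.ext fun g => (hκaev (a := a') g).symm
    rw [this]
    rfl
  have hevκ {a : ι → Λ} (ha : ∀ i, a i ∈ κ) {β : Λ} (hβ : β ∈ κ)
      (f : Polynomial (MvPolynomial ι K)) : evPt a β f ∈ κ := by
    rw [evPt_apply]
    refine κ.sum_mem fun n _ => κ.mul_mem ?_ (pow_mem hβ n)
    rw [show a = fun i => (((⟨a i, ha i⟩ : κ) : Λ)) from rfl, hκaev]
    exact (aeval (fun i => (⟨a i, ha i⟩ : κ)) _).2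
  -- existence of the collided point
  obtain ⟨k, hk0, -, hk⟩ := h.coeff_linePoly x
  have hx0 : linePt c x 0 = x := by funext i; simp [linePt]
  obtain ⟨ξ, hξ, hξ1⟩ := v.exists_root_of_eval_lt_one (M := linePoly c x p) (z := 0)
    (by rw [hk]; exact hK1 k hk0) (by
      rw [eval_linePoly, hx0]
      have := hI _ h.mem_p
      rwa [evPt_C] at this)
  rw [zero_sub, v.map_neg] at hξ1
  rw [eval_linePoly] at hξ
  have haκ : ∀ j, linePt c x ξ j ∈ κ := hline ξ (hlineκ ξ hξ)
  have hcl := close_linePt (c := c) hK hx hξ1.le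
  have hPa : v (evPt (linePt c x ξ) y P) < 1 := by
    have := (close_evPt hK hcl (.refl hy) P).2.2
    rw [hP, zero_sub, v.map_neg] at this
    exact this.trans_lt hξ1
  obtain ⟨β, hβ, hβ1⟩ := v.exists_root_of_eval_lt_one
    (M := P.map (aeval (linePt c x ξ)).toRingHom) (z := y)
    (by rw [(h.monic.map _).leadingCoeff, map_one]) (by rwa [← evPt_eq_eval])
  rw [← evPt_eq_eval] at hβ
  have hβ' : β ∈ κ := hβκ haκ hβ
  have hβle : v β ≤ 1 := by
    have := v.map_sub_le hy hβ1.le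
    rwa [sub_sub_cancel] at this
  have hq : (ξ, β) ∈ linePts I c x := fun f hf => by
    by_contra h0
    have := (close_evPt hK (γ := max (v ξ) (v (y - β))) (fun i => (hcl i).mono (le_max_left _ _))
      ⟨hy, hβle, le_max_right _ _⟩ f).eq_one_iff (max_lt hξ1 hβ1)
    rw [hκv _ (hevκ haκ hβ' f) h0] at this
    exact (hI f hf).ne (this.2 rfl)
  obtain ⟨hd1, hd2⟩ := h.divDiff_le hK hx hy hP hq
  have hdcl : v.Close (max (v ξ) (v (y - β))) (evPt x y P.derivative) (divDiff P (linePt c x ξ) y β) := by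
    rw [← divDiff_self]
    exact close_divDiff hK (fun i => (hcl i).mono (le_max_left _ _)) (.refl hy)
      ⟨hy, hβle, le_max_right _ _⟩ P
  have hdd : v (divDiff P (linePt c x ξ) y β) = 1 :=
    (hdcl.eq_one_iff (max_lt hξ1 hβ1)).1 hP'
  have hyβ : v (y - β) ≤ v ξ := by rwa [map_mul, hdd, mul_one] at hd2
  refine ⟨ξ, hξ1, ?_, fun f hf => ?_, hlineκ ξ hξ⟩
  · have hmem : (ξ, β) ∈ (h.finite_linePts x).toFinset := by simpa using hq
    have hne : evPt x y P.derivative ≠ 0 := by rw [← v.ne_zero_iff, hP']; exact one_ne_zero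
    rw [logForm, finsum_mem_eq_finite_toFinset_sum _ (h.finite_linePts x),
      ← Finset.add_sum_erase _ _ hmem]
    set s := ∑ q ∈ (h.finite_linePts x).toFinset.erase (ξ, β),
      divDiff P (linePt c x q.1) y q.2 * (D q.1 / q.1) with hs
    have hsv : v (ϖ * s) < 1 := by
      rw [hs, Finset.mul_sum]
      refine v.map_sum_lt one_ne_zero fun q hq' => ?_
      have hq'' : q ∈ linePts I c x := by simpa using Finset.mem_of_mem_erase hq'
      refine h.term_lt_one hK hx hy hP hD hq'' fun hlt => Finset.ne_of_mem_erase hq' ?_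
      have hqκ := hlineκ q.1 (by have := hq'' _ h.mem_p; rwa [evPt_C] at this)
      have e1 : q.1 = ξ := by
        by_contra hne1
        have h1 : algebraMap K Λ (c e) * (q.1 - ξ) ∈ κ := by
          have := κ.sub_mem (hlineκ ξ hξ) hqκ
          convert this using 1; ring
        have h2 := hκv _ h1 (mul_ne_zero hce (sub_ne_zero.2 hne1))
        rw [map_mul, hK1 _ he, one_mul] at h2
        exact (v.map_sub_lt hlt.1 hξ1).ne h2
      have e2 : q.2 = β := by
        by_contra hne1
        have h1 : q.2 ∈ κ := hβκ (hline q.1 hqκ) (hq'' _ h.mem_P)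
        have h2 := hκv _ (κ.sub_mem h1 hβ') (sub_ne_zero.2 hne1)
        have h3 := v.map_sub_lt hβ1 hlt.2
        rw [sub_sub_sub_cancel_left] at h3
        exact h3.ne h2
      exact Prod.ext e1 e2
    have hlog : v (ϖ * (D ξ / ξ)) ≤ 1 := by
      rw [mul_div_assoc', map_div₀]
      exact div_le_one_of_le₀ (hD.le _) zero_le
    have heq : ϖ * ((divDiff P (linePt c x ξ) y β * (D ξ / ξ) + s) / evPt x y P.derivative - D ξ / ξ) =
        ((divDiff P (linePt c x ξ) y β - evPt x y P.derivative) * (ϖ * (D ξ / ξ)) + ϖ * s) /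
          evPt x y P.derivative := by
      rw [eq_div_iff hne, mul_assoc, sub_mul, div_mul_cancel₀ _ hne]
      ring
    change v (ϖ * ((divDiff P (linePt c x ξ) y β * (D ξ / ξ) + s) /
      evPt x y P.derivative - D ξ / ξ)) < 1
    rw [heq, map_div₀, hP', div_one]
    refine v.map_add_lt ?_ hsv
    rw [map_mul]
    exact (mul_le_of_le_one_right' hlog).trans_lt (hdcl.symm.2.2.trans_lt (max_lt hξ1 hβ1))
  · have := (close_evPt hK hcl ⟨hy, hβle, hyβ⟩ f).2.2
    rwa [hq f hf, sub_zero] at this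
end

theorem MvPolynomial.exists_monic_line {K ι : Type*} [Field K] (p : MvPolynomial ι K) (c : ι → K) {e : ι}
    (he : c e ≠ 0) (hp : eval c (homogeneousComponent p.totalDegree p) ≠ 0) (j : ι) :
    ∃ M : Polynomial (MvPolynomial {i // i ≠ e} K), M.Monic ∧ ∃ a : K,
      ∀ {B : Type*} [CommRing B] [Algebra K B] (x : ι → B),
        M.eval₂ (aeval fun i : {i // i ≠ e} =>
          algebraMap K B (c e) * x i - algebraMap K B (c i) * x e).toRingHom (x j) =
        algebraMap K B a * aeval x p := by
  classical
  by_cases hj : c j = 0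
  · have hje : j ≠ e := by rintro rfl; exact he hj
    refine ⟨Polynomial.X - Polynomial.C (C (c e)⁻¹ * X ⟨j, hje⟩), Polynomial.monic_X_sub_C _, 0,
      fun {B} _ _ x => ?_⟩
    have h1 : algebraMap K B (c e)⁻¹ * algebraMap K B (c e) = 1 := by
      rw [← map_mul, inv_mul_cancel₀ he, map_one]
    simp [hj, ← mul_assoc, h1]
  let ℓ : ι → MvPolynomial {i // i ≠ e} K := fun i => if h : i ≠ e then X ⟨i, h⟩ else 0
  let x' : ι → MvPolynomial {i // i ≠ e} K := fun i => C (c e)⁻¹ * (ℓ i - C (c i / c j) * ℓ j)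
  let b : ι → MvPolynomial {i // i ≠ e} K := fun i => C (c i / c j)
  obtain ⟨h1, h2⟩ := coeff_line p x' b
  set M₀ := aeval (fun i => Polynomial.C (x' i) + Polynomial.X * Polynomial.C (b i)) p
  set a₀ : K := eval (fun i => c i / c j) (homogeneousComponent p.totalDegree p)
  have ha₀ : a₀ ≠ 0 := by
    have h3 := aeval_mul_of_isHomogeneous (homogeneousComponent_isHomogeneous p.totalDegree p)
      (c j)⁻¹ c
    have h4 : a₀ = (c j)⁻¹ ^ p.totalDegree * eval c (homogeneousComponent p.totalDegree p) := by
      rw [← coe_aeval_eq_eval, RingHom.coe_coe, ← h3]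
      simp only [a₀, div_eq_inv_mul]
      rfl
    rw [h4]
    exact mul_ne_zero (pow_ne_zero _ (inv_ne_zero hj)) hp
  have hb : aeval b (homogeneousComponent p.totalDegree p) = C a₀ :=
    aeval_algebraMap_eq (B := MvPolynomial {i // i ≠ e} K) _ _
  rw [hb] at h2
  have hℓ {B : Type _} [CommRing B] [Algebra K B] (x : ι → B) (i : ι) :
      (aeval fun i : {i // i ≠ e} =>
          algebraMap K B (c e) * x i - algebraMap K B (c i) * x e) (ℓ i) =
        algebraMap K B (c e) * x i - algebraMap K B (c i) * x e := by
    by_cases h : i = e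
    · subst h; simp [ℓ]
    · simp [ℓ, h]
  refine ⟨Polynomial.C (C a₀⁻¹) * M₀, ?_, a₀⁻¹, fun {B} _ _ x => ?_⟩
  · refine Polynomial.monic_of_natDegree_le_of_coeff_eq_one p.totalDegree
      ((Polynomial.natDegree_C_mul_le _ _).trans h1) ?_
    rw [Polynomial.coeff_C_mul, h2, ← C_mul, inv_mul_cancel₀ ha₀, C_1]
  · rw [Polynomial.eval₂_mul, Polynomial.eval₂_C]
    congr 1
    · simp
    · set φ := aeval (R := K) fun i : {i // i ≠ e} =>
          algebraMap K B (c e) * x i - algebraMap K B (c i) * x e with hφ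
      change (Polynomial.eval₂RingHom φ.toRingHom (x j)) M₀ = _
      have h5 : Polynomial.eval₂RingHom φ.toRingHom (x j) =
          ((Polynomial.eval₂AlgHom φ (x j) (fun _ => Commute.all _ _) : _ →ₐ[K] B) : _ →+* B) := rfl
      rw [h5, RingHom.coe_coe]
      simp only [M₀]
      rw [comp_aeval_apply]
      congr 2
      funext i
      have h6 : algebraMap K B (c e)⁻¹ * algebraMap K B (c e) = 1 := by
        rw [← map_mul, inv_mul_cancel₀ he, map_one]
      have h7 : algebraMap K B (c i / c j) * algebraMap K B (c j) = algebraMap K B (c i) := by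
        rw [← map_mul, div_mul_cancel₀ _ hj]
      have h8 : φ (ℓ i) = _ := hℓ x i
      have h9 : φ (ℓ j) = _ := hℓ x j
      have h10 (k : K) : φ (C k) = algebraMap K B k := φ.commutes k
      have h11 (q) : Polynomial.eval₂AlgHom φ (x j) (fun _ => Commute.all _ _) (Polynomial.C q) =
          φ q := Polynomial.eval₂_C _ _
      have h12 : Polynomial.eval₂AlgHom φ (x j) (fun _ => Commute.all _ _) Polynomial.X = x j :=
        Polynomial.eval₂_X _ _
      rw [map_add, h11, map_mul, map_mul, h11, h12, h10, h10, map_sub, map_mul, h8, h9, h10]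
      linear_combination (x i - algebraMap K B (c i / c j) * x j) * h6 + algebraMap K B (c e)⁻¹ * x e * h7

section
variable {K : Type*} [Field K] {Λ Γ : Type*} [Field Λ] [Algebra K Λ]
  [LinearOrderedCommGroupWithZero Γ] {v : Valuation Λ Γ} {d : ℕ}

/-- Any `d - 1` elements over which the `x j` are integral modulo the maximal ideal have
algebraically independent residues. -/
def GenericAt (K : Type*) [Field K] [Algebra K Λ] (x : Fin d → Λ) (v : Valuation Λ Γ) : Prop :=
  ∀ {ι : Type} [Finite ι], Nat.card ι + 1 = d → ∀ ℓ : ι → Λ, (∀ i, v (ℓ i) ≤ 1) →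
    (∀ j, ∃ M : Polynomial (MvPolynomial ι K), M.Monic ∧
      v (M.eval₂ (aeval ℓ).toRingHom (x j)) < 1) → ∀ q : MvPolynomial ι K, q ≠ 0 → v (aeval ℓ q) = 1

theorem Valuation.algebraMap_eq_one (hK : ∀ c : K, v (algebraMap K Λ c) ≤ 1) {c : K} (hc : c ≠ 0) :
    v (algebraMap K Λ c) = 1 := by
  refine le_antisymm (hK c) ?_
  have h := hK c⁻¹
  rw [map_inv₀, map_inv₀] at h
  exact (inv_le_one₀ (zero_lt_iff.2 (by simpa using hc))).1 h

theorem Valuation.eq_one_of_isAlgebraic {E : IntermediateField K Λ} (hE : ∀ w ∈ E, w ≠ 0 → v w = 1)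
    {z : Λ} (hz : IsAlgebraic E z) (hz0 : z ≠ 0) : v z = 1 := by
  have hE1 : ∀ a : E, v (algebraMap E Λ a) ≤ 1 := fun a => by
    by_cases ha : (a : Λ) = 0
    · change v (a : Λ) ≤ 1
      simp [ha]
    · exact (hE a a.2 ha).le
  have key {z : Λ} (hz : IsAlgebraic E z) : v z ≤ 1 := v.le_one_of_isIntegral hE1 hz.isIntegral
  refine le_antisymm (key hz) ?_
  have h := key hz.inv
  rw [map_inv₀] at h
  exact (inv_le_one₀ (zero_lt_iff.2 (by simpa using hz0))).1 h

theorem Valuation.eval_minpoly_eq [IsAlgClosed Λ] {E : IntermediateField K Λ} [CharZero E]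
    (hE : ∀ w ∈ E, w ≠ 0 → v w = 1) {α z : Λ} (hα : IsAlgebraic E α) (hz : v (z - α) < 1) :
    v (Polynomial.aeval z (minpoly E α)) = v (z - α) := by
  have hint := hα.isIntegral
  set m := (minpoly E α).map (algebraMap E Λ) with hm
  have hmonic : m.Monic := (minpoly.monic hint).map _
  have hev : Polynomial.aeval z (minpoly E α) = m.eval z := by
    rw [hm, Polynomial.eval_map, Polynomial.aeval_def]
  have hnodup : m.roots.Nodup := Polynomial.nodup_roots (minpoly.irreducible hint).separable.map
  have hroot : α ∈ m.roots := by
    rw [Polynomial.mem_roots hmonic.ne_zero, Polynomial.IsRoot, hm, Polynomial.eval_map,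
      ← Polynomial.aeval_def, minpoly.aeval]
  rw [hev, (IsAlgClosed.splits m).eval_eq_prod_roots, hmonic.leadingCoeff, one_mul]
  obtain ⟨s, hs⟩ := Multiset.exists_cons_of_mem hroot
  rw [hs] at hnodup ⊢
  rw [Multiset.map_cons, Multiset.prod_cons, map_mul, map_multiset_prod, Multiset.map_map]
  have hone : (s.map (v ∘ fun a => z - a)).prod = 1 := by
    refine Multiset.prod_eq_one fun x hx => ?_
    obtain ⟨β, hβ, rfl⟩ := Multiset.mem_map.1 hx
    have hne : α - β ≠ 0 := sub_ne_zero.2 fun h => (Multiset.nodup_cons.1 hnodup).1 (h ▸ hβ)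
    have hβ' : IsAlgebraic E β := by
      refine ⟨minpoly E α, minpoly.ne_zero hint, ?_⟩
      have : β ∈ m.roots := hs ▸ Multiset.mem_cons_of_mem hβ
      rw [Polynomial.mem_roots hmonic.ne_zero, Polynomial.IsRoot, hm, Polynomial.eval_map] at this
      exact this
    have h1 : v (α - β) = 1 := eq_one_of_isAlgebraic hE (hα.sub hβ') hne
    have : z - β = (z - α) + (α - β) := by ring
    simp only [Function.comp]
    rw [this, v.map_add_eq_of_lt_right (by rwa [h1]), h1]
  rw [hone, mul_one]

theorem SectionData.exists_collided_of_genericAt [CharZero K] [IsAlgClosed Λ]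
    {I : Ideal (Polynomial (MvPolynomial (Fin d) K))}
    {P : Polynomial (MvPolynomial (Fin d) K)} {c : Fin d → K} {p : MvPolynomial (Fin d) K}
    (h : SectionData I P c p)
    (hK : ∀ c : K, v (algebraMap K Λ c) ≤ 1) {x : Fin d → Λ} (hx : ∀ i, v (x i) ≤ 1) {y : Λ}
    (hy : v y ≤ 1) (hP : evPt x y P = 0) (hP' : v (evPt x y P.derivative) = 1)
    {ϖ : Λ} {D : Derivation K Λ Λ} (hD : LogGood v ϖ D) (hI : ∀ f ∈ I, v (evPt x y f) < 1)
    (hgen : GenericAt K x v) : ∃ e, c e ≠ 0 ∧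
      (∀ q : MvPolynomial {i // i ≠ e} K, q ≠ 0 → v (aeval (fun i : {i // i ≠ e} =>
        algebraMap K Λ (c e) * x i - algebraMap K Λ (c i) * x e) q) = 1) ∧
    ∃ ξ, v ξ < 1 ∧ v (ϖ * (logForm I P c x y D - D ξ / ξ)) < 1 ∧
      (∀ f ∈ I, v (evPt x y f) ≤ v ξ) ∧ ∃ G ∈ IntermediateField.adjoin K (Set.range x), v G = v ξ := by
  have hp1 : v (aeval x p) < 1 := by simpa using hI _ h.mem_p
  obtain ⟨e, he⟩ : ∃ e, c e ≠ 0 := by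
    by_contra! hc
    have h0 := h.top
    rcases Nat.eq_zero_or_pos p.totalDegree with hd | hd
    · rw [totalDegree_eq_zero_iff_eq_C] at hd
      have h1 : coeff 0 p ≠ 0 := fun h1 => by rw [hd, h1] at h0; simp at h0
      rw [hd, aeval_C, v.algebraMap_eq_one hK h1] at hp1
      exact hp1.false
    · refine h0 ?_
      have := aeval_mul_of_isHomogeneous (homogeneousComponent_isHomogeneous p.totalDegree p)
        (0 : K) c
      rw [zero_pow hd.ne', zero_mul] at this
      rw [← coe_aeval_eq_eval, RingHom.coe_coe, ← this]
      congr 2; funext i; rw [hc, zero_mul]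
  refine ⟨e, he, ?_⟩
  set ℓ : {i // i ≠ e} → Λ := fun i => algebraMap K Λ (c e) * x i - algebraMap K Λ (c i) * x e
  have hℓ1 : ∀ q : MvPolynomial {i // i ≠ e} K, q ≠ 0 → v (aeval ℓ q) = 1 := by
    refine hgen ?_ ℓ (fun i => ?_) (fun j => ?_)
    · have : 0 < d := e.pos
      simp [Nat.card_eq_fintype_card, Fintype.card_subtype_compl]
      omega
    · exact v.map_sub_le (by rw [map_mul]; exact mul_le_one' (hK _) (hx _))
        (by rw [map_mul]; exact mul_le_one' (hK _) (hx _))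
    · obtain ⟨M, hM, a, ha⟩ := exists_monic_line p c he h.top j
      refine ⟨M, hM, ?_⟩
      rw [ha, map_mul]
      exact (mul_le_of_le_one_left' (hK _)).trans_lt hp1
  refine ⟨hℓ1, ?_⟩
  let E := IntermediateField.adjoin K (Set.range ℓ)
  have : CharZero E := charZero_of_injective_algebraMap (algebraMap K E).injective
  have hE : ∀ w ∈ E, w ≠ 0 → v w = 1 := fun w hw hw0 => by
    obtain ⟨r, s, rfl⟩ := (IntermediateField.mem_adjoin_range_iff _ _ _).1 hw
    have hr : r ≠ 0 := by rintro rfl; simp at hw0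
    have hs : s ≠ 0 := by rintro rfl; simp at hw0
    rw [map_div₀, hℓ1 r hr, hℓ1 s hs, div_one]
  let κ : IntermediateField K Λ := (algebraicClosure E Λ).restrictScalars K
  have hκ' : ∀ z, z ∈ κ ↔ IsAlgebraic E z := fun z => mem_algebraicClosure_iff
  obtain ⟨ξ, h1, h2, h3, h4⟩ := h.exists_collided hK hx hy hP hP' hD hI κ (fun z hz => by
    rw [hκ']
    have hz : IsAlgebraic (algebraicClosure E Λ) z := hz
    exact hz.restrictScalars E) (fun z hz hz0 => Valuation.eq_one_of_isAlgebraic hE ((hκ' z).1 hz) hz0)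
    he (fun j => by
      by_cases hj : j = e
      · subst hj; simp
      · rw [hκ']
        have : ℓ ⟨j, hj⟩ ∈ E := IntermediateField.subset_adjoin _ _ ⟨_, rfl⟩
        exact isAlgebraic_algebraMap (⟨_, this⟩ : E))
  refine ⟨ξ, h1, h2, h3, Polynomial.aeval (x e) (minpoly E (x e - ξ * algebraMap K Λ (c e))), ?_, ?_⟩
  · have hmem (i) : x i ∈ IntermediateField.adjoin K (Set.range x) :=
      IntermediateField.subset_adjoin _ _ ⟨i, rfl⟩
    have hEle : E ≤ IntermediateField.adjoin K (Set.range x) := by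
      refine IntermediateField.adjoin_le_iff.2 ?_
      rintro _ ⟨i, rfl⟩
      exact sub_mem (mul_mem (IntermediateField.algebraMap_mem _ _) (hmem _))
        (mul_mem (IntermediateField.algebraMap_mem _ _) (hmem _))
    rw [Polynomial.aeval_eq_sum_range]
    refine sum_mem fun i _ => ?_
    rw [Algebra.smul_def]
    exact mul_mem (hEle (Subtype.mem _)) (pow_mem (hmem _) _)
  · have h5 : x e - (x e - ξ * algebraMap K Λ (c e)) = ξ * algebraMap K Λ (c e) := by ring
    have h6 : v (ξ * algebraMap K Λ (c e)) = v ξ := by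
      rw [map_mul, v.algebraMap_eq_one hK he, mul_one]
    rw [Valuation.eval_minpoly_eq hE ((hκ' _).1 h4) (by rwa [h5, h6]), h5, h6]
end

theorem Ideal.isNilpotent_of_mul_eq_zero {B : Type*} [CommRing B] {I : Ideal B}
    (h : ∀ a ∈ I, ∀ b ∈ I, a * b = 0) : IsNilpotent I :=
  ⟨2, by rw [pow_two]; exact eq_bot_iff.2 (Ideal.mul_le.2 fun a ha b hb => h a ha b hb)⟩

theorem exists_derivation_extend {K A L : Type*} [Field K] [CommRing A] [IsDomain A] [CharZero A]
    [Algebra K A] [Field L] [Algebra K L] (σ : A →ₐ[K] L) (hσ : Function.Injective σ) (δ : A →ₗ[K] L)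
    (hδ : ∀ a b, δ (a * b) = σ a * δ b + σ b * δ a) :
    ∃ Δ : Derivation K L L, ∀ a, Δ (σ a) = δ a := by
  have hδ1 : δ 1 = 0 := by simpa using hδ 1 1
  let h : A →+* TrivSqZeroExt L L :=
    { toFun := fun a => TrivSqZeroExt.inl (σ a) + TrivSqZeroExt.inr (δ a)
      map_one' := by simp [hδ1]
      map_mul' := fun a b => by
        refine TrivSqZeroExt.ext (by simp) ?_
        simp [hδ, mul_comm]
      map_zero' := by simp
      map_add' := fun a b => by
        refine TrivSqZeroExt.ext (by simp) (by simp) }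
  let _ : Algebra A L := σ.toRingHom.toAlgebra
  have hinj : FaithfulSMul A L := (faithfulSMul_iff_algebraMap_injective A L).2 hσ
  let _ : Algebra (FractionRing A) L := FractionRing.liftAlgebra A L
  have : IsScalarTower A (FractionRing A) L := FractionRing.isScalarTower_liftAlgebra A L
  have : Algebra.FormallySmooth A (FractionRing A) :=
    Algebra.FormallySmooth.of_isLocalization (nonZeroDivisors A)
  have : CharZero (FractionRing A) :=
    charZero_of_injective_algebraMap (IsFractionRing.injective A (FractionRing A))
  have : Algebra.FormallySmooth (FractionRing A) L := by
    obtain ⟨s, hs⟩ := exists_isTranscendenceBasis (FractionRing A) L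
    have := hs.isAlgebraic_field
    exact .of_algebraicIndependent_of_isSeparable hs.1
  have : Algebra.FormallySmooth A L := Algebra.FormallySmooth.comp A (FractionRing A) L
  let _ : Algebra A (TrivSqZeroExt L L) := h.toAlgebra
  let g : TrivSqZeroExt L L →ₐ[A] L :=
    { (TrivSqZeroExt.fstHom L L L : TrivSqZeroExt L L →ₐ[L] L).toRingHom with
      commutes' := fun a => by
        change TrivSqZeroExt.fst (TrivSqZeroExt.inl (σ a) + TrivSqZeroExt.inr (δ a)) = σ a
        simp }
  have hg : Function.Surjective g := fun z => ⟨TrivSqZeroExt.inl z, TrivSqZeroExt.fst_inl L z⟩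
  have hg' : IsNilpotent (RingHom.ker (g : TrivSqZeroExt L L →+* L)) := by
    refine Ideal.isNilpotent_of_mul_eq_zero fun a ha b hb => ?_
    have ha : a.fst = 0 := ha
    have hb : b.fst = 0 := hb
    refine TrivSqZeroExt.ext ?_ ?_
    · simp [ha]
    · simp [ha, hb]
  let ψ : L →ₐ[A] TrivSqZeroExt L L := Algebra.FormallySmooth.liftOfSurjective (AlgHom.id A L) g hg hg'
  have hψ (z : L) : (ψ z).fst = z :=
    Algebra.FormallySmooth.liftOfSurjective_apply (AlgHom.id A L) g hg hg' z
  have hψA (a : A) : ψ (σ a) = TrivSqZeroExt.inl (σ a) + TrivSqZeroExt.inr (δ a) := ψ.commutes a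
  refine ⟨Derivation.mk' { toFun := fun z => (ψ z).snd, map_add' := fun a b => (by simp), map_smul' := fun c z => ?_ } fun a b => ?_, fun a => ?_⟩
  · have : c • z = σ (algebraMap K A c) * z := by rw [σ.commutes, Algebra.smul_def]
    have h0 : δ (algebraMap K A c) = 0 := by
      rw [Algebra.algebraMap_eq_smul_one, map_smul, hδ1, smul_zero]
    rw [this, map_mul, hψA, h0]
    simp [Algebra.smul_def, hψ]
  · simp [hψ, mul_comm]
  · simp [hψA]

theorem AlgebraicIndependent.exists_derivation {K ι L : Type*} [Field K] [CharZero K] [Field L]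
    [Algebra K L] {x : ι → L} (hx : AlgebraicIndependent K x) (w : ι → L) :
    ∃ Δ : Derivation K L L, ∀ i, Δ (x i) = w i := by
  have : CharZero (MvPolynomial ι K) :=
    charZero_of_injective_algebraMap (algebraMap K (MvPolynomial ι K)).injective
  let _ : Algebra (MvPolynomial ι K) L := (aeval x).toRingHom.toAlgebra
  have : IsScalarTower K (MvPolynomial ι K) L := .of_algebraMap_eq fun c => by
    exact ((aeval x).commutes c).symm
  let D := MvPolynomial.mkDerivation K w
  obtain ⟨Δ, hΔ⟩ := exists_derivation_extend (aeval x) hx D.toLinearMap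
    (fun a b => D.leibniz a b)
  refine ⟨Δ, fun i => ?_⟩
  have := hΔ (X i)
  rw [aeval_X] at this
  rw [this]
  exact mkDerivation_X K w i

theorem IsTranscendenceBasis.derivation_eq_zero {K ι L M : Type*} [Field K] [CharZero K] [Field L]
    [Field M] [Algebra K L] [Algebra K M] {x : ι → L} (hx : IsTranscendenceBasis K x) (τ : L →ₐ[K] M)
    (Δ : L →ₗ[K] M) (hΔ : ∀ a b, Δ (a * b) = τ a * Δ b + τ b * Δ a) (h0 : ∀ i, Δ (x i) = 0) (z : L) :
    Δ z = 0 := by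
  let _ : Algebra L M := τ.toRingHom.toAlgebra
  have hsmul (a : L) (m : M) : a • m = τ a * m := rfl
  have hΔ1 : Δ 1 = 0 := by simpa using hΔ 1 1
  let D : Derivation K L M := Derivation.mk' Δ hΔ
  have hD (a : L) : D a = Δ a := rfl
  let N : IntermediateField K L :=
    { carrier := {z | D z = 0}
      mul_mem' := fun {a b} ha hb => by
        have ha : D a = 0 := ha
        have hb : D b = 0 := hb
        simp [ha, hb]
      add_mem' := fun {a b} ha hb => by
        have ha : D a = 0 := ha
        have hb : D b = 0 := hb
        simp [ha, hb]
      algebraMap_mem' := fun c => by simp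
      inv_mem' := fun a ha => by
        have ha : D a = 0 := ha
        simp [D.leibniz_inv, ha] }
  have hN (a : N) : D a = 0 := a.2
  have : CharZero N := charZero_of_injective_algebraMap (algebraMap K N).injective
  have hle : IntermediateField.adjoin K (Set.range x) ≤ N := by
    rw [IntermediateField.adjoin_le_iff]
    rintro _ ⟨i, rfl⟩
    exact h0 i
  have halg : IsAlgebraic N z := by
    have h1 : IsAlgebraic (IntermediateField.adjoin K (Set.range x)) z :=
      hx.isAlgebraic_field.isAlgebraic z
    let _ : Algebra (IntermediateField.adjoin K (Set.range x)) N :=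
      (IntermediateField.inclusion hle).toRingHom.toAlgebra
    have : IsScalarTower (IntermediateField.adjoin K (Set.range x)) N L := .of_algebraMap_eq fun _ => rfl
    exact h1.tower_top N
  have hDN (a : N) (b : L) : D (a • b) = a • D b := by
    change D ((a : L) * b) = (a : L) • D b
    rw [D.leibniz, hN, smul_zero, add_zero]
  let D' : Derivation N L M := Derivation.mk' { toFun := D, map_add' := D.map_add, map_smul' := hDN } D.leibniz
  have h2 := D'.map_aeval (minpoly N z) z
  rw [minpoly.aeval, map_zero, hsmul, eq_comm, mul_eq_zero] at h2
  refine h2.resolve_left fun h3 => ?_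
  rw [map_eq_zero] at h3
  have hz := halg.isIntegral
  exact (minpoly.irreducible hz).separable.aeval_derivative_ne_zero (minpoly.aeval N z) h3

section
variable {K ι : Type*} [Field K] {I : Ideal (Polynomial (MvPolynomial ι K))}
    {P : Polynomial (MvPolynomial ι K)} {c : ι → K} {p : MvPolynomial ι K}

theorem SectionData.linePts_map (h : SectionData I P c p) {Λ Λ' : Type*} [Field Λ]
    [Algebra K Λ] [IsAlgClosed Λ] [Field Λ'] [Algebra K Λ'] (τ : Λ →ₐ[K] Λ') (x : ι → Λ) :
    linePts I c (fun i => τ (x i)) = Prod.map τ τ '' linePts I c x := by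
  have hline (ξ : Λ) : linePt c (fun i => τ (x i)) (τ ξ) = fun i => τ (linePt c x ξ i) := by
    funext i; simp [linePt]
  have hsurj {M : Polynomial Λ} (hM : M ≠ 0) {z : Λ'} (hz : (M.map (τ : Λ →+* Λ')).eval z = 0) :
      ∃ ξ, τ ξ = z := by
    have h1 := (IsAlgClosed.splits M).roots_map (τ : Λ →+* Λ')
    have h2 : z ∈ (M.map (τ : Λ →+* Λ')).roots :=
      (Polynomial.mem_roots ((Polynomial.map_ne_zero_iff (τ : Λ →+* Λ').injective).2 hM)).2 hz
    rw [h1, Multiset.mem_map] at h2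
    obtain ⟨ξ, -, h⟩ := h2
    exact ⟨ξ, h⟩
  have hτ : Function.Injective τ := (τ : Λ →+* Λ').injective
  ext ⟨z, w⟩
  simp only [Set.mem_image, Prod.exists, Prod.map, Prod.mk.injEq]
  constructor
  · intro hz
    obtain ⟨ξ, rfl⟩ : ∃ ξ, τ ξ = z := by
      refine hsurj (h.linePoly_ne_zero x) ?_
      have h1 := hz _ h.mem_p
      rw [evPt_C] at h1
      rw [← h1]
      have h2 : (linePoly c x p).map (τ : Λ →+* Λ') = linePoly c (fun i => τ (x i)) p := by
        have h3 : ∀ M : Polynomial Λ, M.map (τ : Λ →+* Λ') = Polynomial.mapAlgHom τ M := fun _ => rfl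
        rw [h3, linePoly, comp_aeval_apply, linePoly]
        congr 2
        funext i
        rw [← h3]
        simp
      rw [h2, eval_linePoly]
    obtain ⟨β, rfl⟩ : ∃ β, τ β = w := by
      have hne : P.map (aeval (linePt c x ξ)).toRingHom ≠ 0 := (h.monic.map _).ne_zero
      refine hsurj hne ?_
      have h1 := hz _ h.mem_P
      simp only at h1
      rw [hline, evPt_eq_eval] at h1
      rw [← h1, Polynomial.map_map]
      congr 2
      refine MvPolynomial.ringHom_ext (fun k => ?_) (fun i => ?_) <;> simp
    refine ⟨ξ, β, fun f hf => hτ ?_, rfl, rfl⟩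
    have h1 := hz f hf
    simp only at h1
    rw [hline] at h1
    rw [map_zero, map_evPt]
    exact h1
  · rintro ⟨ξ, β, hq, rfl, rfl⟩ f hf
    have h1 := hq f hf
    simp only at h1 ⊢
    rw [hline, ← map_evPt, h1, map_zero]

theorem SectionData.logForm_map (h : SectionData I P c p) {Λ Λ' β : Type*} [Field Λ]
    [Algebra K Λ] [IsAlgClosed Λ] [Field Λ'] [Algebra K Λ'] [Fintype β] (τ : Λ →ₐ[K] Λ')
    (D : β → Λ → Λ) (D' : Λ' → Λ') (w : β → Λ') (hD : ∀ ξ, D' (τ ξ) = ∑ b, w b * τ (D b ξ))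
    (x : ι → Λ) (y : Λ) : logForm I P c (fun i => τ (x i)) (τ y) D' =
      ∑ b, w b * τ (logForm I P c x y (D b)) := by
  have hline (ξ : Λ) : linePt c (fun i => τ (x i)) (τ ξ) = fun i => τ (linePt c x ξ i) := by
    funext i; simp [linePt]
  have hτ : Function.Injective τ := (τ : Λ →+* Λ').injective
  simp only [logForm]
  rw [h.linePts_map, finsum_mem_image (hτ.prodMap hτ).injOn]
  simp only [finsum_mem_eq_finite_toFinset_sum _ (h.finite_linePts x), Prod.map, hline,
    ← map_divDiff, ← map_evPt, hD, map_div₀, map_sum, map_mul, mul_div_assoc', Finset.mul_sum]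
  rw [← Finset.sum_div, Finset.sum_comm]
  congr 1
  refine Finset.sum_congr rfl fun q _ => ?_
  rw [Finset.sum_div]
  refine Finset.sum_congr rfl fun b _ => ?_
  ring

end

section
variable {K F : Type*} [Field K] [CharZero K] {d : ℕ} [Field F] [Algebra K F]
  {I : Ideal (Polynomial (MvPolynomial (Fin d) K))} {P : Polynomial (MvPolynomial (Fin d) K)}
  {c : Fin d → K} {p : MvPolynomial (Fin d) K} {x : Fin d → F} {y : F}

/-- `θ` is the vector of coefficients of the logarithmic form of `V(I)` in terms of `d x`. -/
def IsLogCoeff (I : Ideal (Polynomial (MvPolynomial (Fin d) K)))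
    (P : Polynomial (MvPolynomial (Fin d) K)) (c : Fin d → K) (x : Fin d → F) (y : F) (θ : Fin d → F) :
    Prop :=
  ∀ b, ∃ D : Derivation K (AlgebraicClosure F) (AlgebraicClosure F),
    (∀ a, D (algebraMap F _ (x a)) = if a = b then 1 else 0) ∧
    algebraMap F _ (θ b) = logForm I P c (fun i => algebraMap F (AlgebraicClosure F) (x i))
      (algebraMap F _ y) D

theorem IsTranscendenceBasis.derivation_comp {Λ Λ' β : Type*} [Field Λ] [Field Λ'] [Algebra K Λ]
    [Algebra K Λ'] {x : Fin d → Λ} (hx : IsTranscendenceBasis K x) [Fintype β] (τ : Λ →ₐ[K] Λ')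
    (D' : Derivation K Λ' Λ') (w : β → Λ') (D : β → Derivation K Λ Λ)
    (h : ∀ a, D' (τ (x a)) = ∑ b, w b * τ (D b (x a))) (ξ : Λ) : D' (τ ξ) = ∑ b, w b * τ (D b ξ) := by
  have := hx.derivation_eq_zero τ (D'.toLinearMap ∘ₗ τ.toLinearMap -
    ∑ b, LinearMap.mulLeft K (w b) ∘ₗ τ.toLinearMap ∘ₗ (D b).toLinearMap) (fun a b => ?_) (fun i => ?_) ξ
  · simpa [sub_eq_zero] using this
  · simp [mul_sub, Finset.mul_sum, mul_add, Finset.sum_add_distrib]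
    have h1 (u v : Λ) : ∑ i, w i * (τ u * τ (D i v)) = ∑ i, τ u * (w i * τ (D i v)) :=
      Finset.sum_congr rfl fun _ _ => by ring
    rw [h1, h1]
    ring
  · simp [h]

theorem SectionData.exists_isLogCoeff (h : SectionData I P c p) (hx : IsTranscendenceBasis K x) (y : F) :
    ∃ θ, IsLogCoeff I P c x y θ := by
  have hx' : IsTranscendenceBasis K (fun i => algebraMap F (AlgebraicClosure F) (x i)) :=
    hx.algebraMap_comp
  have (b : Fin d) := hx'.1.exists_derivation (fun a => if a = b then 1 else 0)
  choose D hD using this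
  have (b : Fin d) : ∃ θ : F, algebraMap F _ θ = logForm I P c
      (fun i => algebraMap F (AlgebraicClosure F) (x i)) (algebraMap F _ y) (D b) := by
    have : CharZero F := charZero_of_injective_algebraMap (algebraMap K F).injective
    refine IntermediateField.mem_bot.1 ((InfiniteGalois.mem_bot_iff_fixed _).2 fun τ => ?_)
    have h1 := h.logForm_map ((τ : AlgebraicClosure F →ₐ[F] AlgebraicClosure F).restrictScalars K)
      (fun _ : Unit => D b) (D b) (fun _ => 1) (hx'.derivation_comp _ _ _ _ (fun a => ?_))
      (fun i => algebraMap F (AlgebraicClosure F) (x i)) (algebraMap F _ y)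
    · simpa using h1.symm
    · simp [hD]
  choose θ hθ using this
  exact ⟨θ, fun b => ⟨D b, hD b, hθ b⟩⟩

theorem IsLogCoeff.logForm_eq (h : SectionData I P c p) (hx : IsTranscendenceBasis K x) {θ : Fin d → F}
    (hθ : IsLogCoeff I P c x y θ) {Λ : Type*} [Field Λ] [Algebra K Λ] [IsAlgClosed Λ] (σ : F →ₐ[K] Λ)
    (D : Derivation K Λ Λ) : logForm I P c (fun i => σ (x i)) (σ y) D = ∑ b, σ (θ b) * D (σ (x b)) := by
  have hx' : IsTranscendenceBasis K (fun i => algebraMap F (AlgebraicClosure F) (x i)) :=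
    hx.algebraMap_comp
  choose Db hDb hθ using hθ
  let _ : Algebra F Λ := σ.toRingHom.toAlgebra
  have : IsScalarTower K F Λ := .of_algebraMap_eq fun k => (σ.commutes k).symm
  let τ' : AlgebraicClosure F →ₐ[F] Λ := IsAlgClosed.lift
  let τ := τ'.restrictScalars K
  have hτ (f : F) : τ (algebraMap F _ f) = σ f := τ'.commutes f
  have h1 := h.logForm_map τ (fun b => Db b) D (fun b => D (σ (x b)))
    (hx'.derivation_comp _ _ _ _ (fun a => ?_)) (fun i => algebraMap F (AlgebraicClosure F) (x i))
    (algebraMap F _ y)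
  · simpa [hτ, ← hθ, mul_comm] using h1
  · simp [hDb, hτ, apply_ite τ]
end

/-- A uniformizer of the localization at `P`, in elementary terms. -/
structure IsUniformizer {R : Type*} [CommRing R] (P : Ideal R) (t : R) : Prop where
  mem : t ∈ P
  ne_zero : t ≠ 0
  exists_eq : ∀ f : R, f ≠ 0 → ∃ n : ℕ, ∃ r₁ r₂ : R, r₁ ∉ P ∧ r₂ ∉ P ∧ r₂ * f = r₁ * t ^ n

theorem IsUniformizer.mul {R : Type*} [CommRing R] [IsDomain R] {P : Ideal R} [P.IsPrime] {t s : R}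
    (h : IsUniformizer P t) (hs : s ∉ P) : IsUniformizer P (s * t) where
  mem := P.mul_mem_left _ h.mem
  ne_zero := mul_ne_zero (fun h => hs (h ▸ P.zero_mem)) h.ne_zero
  exists_eq f hf := by
    obtain ⟨n, r₁, r₂, h1, h2, h3⟩ := h.exists_eq f hf
    have hsn : s ^ n ∉ P := fun h => hs (Ideal.IsPrime.mem_of_pow_mem ‹_› _ h)
    refine ⟨n, r₁, s ^ n * r₂, h1, fun h => ?_, by rw [mul_assoc, h3]; ring⟩
    rcases Ideal.IsPrime.mem_or_mem ‹_› h with h | h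
    exacts [hsn h, h2 h]

theorem Ideal.IsRadical.exists_mul_mem {R : Type*} [CommRing R] [IsNoetherianRing R] {I P : Ideal R}
    (hI : I.IsRadical) (hIP : P ∈ I.minimalPrimes) : ∃ s ∉ P, ∀ t ∈ P, s * t ∈ I := by
  classical
  have hfin := I.finite_minimalPrimes_of_isNoetherianRing
  have hP : P.IsPrime := hIP.1.1
  have h1 : ¬ (hfin.toFinset.erase P).inf id ≤ P := fun h => by
    obtain ⟨Q, hQ, hQP⟩ := (hP.inf_le' ).1 h
    simp only [Finset.mem_erase, Set.Finite.mem_toFinset] at hQ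
    exact hQ.1 (le_antisymm hQP (hIP.2 hQ.2.1 hQP))
  obtain ⟨s, hs, hsP⟩ := SetLike.not_le_iff_exists.1 h1
  refine ⟨s, hsP, fun t ht => ?_⟩
  have h2 : s * t ∈ I.radical := by
    rw [← Ideal.sInf_minimalPrimes, Submodule.mem_sInf]
    intro Q hQ
    by_cases hQP : Q = P
    · exact hQP ▸ P.mul_mem_left _ ht
    · exact Ideal.mul_mem_right _ Q ((Submodule.mem_finsetInf).1 hs Q (by simp [hQP, hQ]))
  rwa [hI.radical] at h2

theorem exists_isUniformizer {R : Type*} [CommRing R] [IsDomain R] [IsNoetherianRing R] {F : Type*}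
    [Field F] [Algebra R F] [IsFractionRing R F] {I P : Ideal R} (hI : I.IsRadical)
    (hIP : P ∈ I.minimalPrimes) (hP : HeightOnePrime P) {m : R} (hm : m ∉ P)
    (hcond : ∀ f : F, IsIntegral R f → ∃ b, algebraMap R F b = algebraMap R F m * f) :
    ∃ t ∈ I, IsUniformizer P t := by
  have := hP.1
  obtain ⟨t, ht, ht0, h⟩ := HeightOnePrime.exists_uniformizer P hP.2.1 hP.2.2 m hm hcond
  have hu : IsUniformizer P t := ⟨ht, ht0, h⟩
  obtain ⟨s, hs, h1⟩ := hI.exists_mul_mem hIP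
  exact ⟨s * t, h1 t ht, hu.mul hs⟩

/-- `R` is finite over the polynomial ring in the `x i`, birationally generated by `y`, with
all denominators dividing `m`. -/
structure Presentation {K R : Type*} (F : Type*) [Field K] [CommRing R] [Algebra K R] [Field F]
    [Algebra R F] {d : ℕ} (x : Fin d → R)
    (y : R) (P : Polynomial (MvPolynomial (Fin d) K)) (m : R) : Prop where
  inj : AlgebraicIndependent K x
  int : (aeval x : MvPolynomial (Fin d) K →ₐ[K] R).toRingHom.IsIntegral
  monic : P.Monic
  root : evPt x y P = 0
  ne_zero : m ≠ 0
  dvd : evPt x y P.derivative ∣ m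
  exists_eq : ∀ r, ∃ f : Polynomial (MvPolynomial (Fin d) K), m * r = evPt x y f
  cond : ∀ f : F, IsIntegral R f → ∃ b, algebraMap R F b = algebraMap R F m * f

section
variable {K R F : Type*} [Field K] [CommRing R] [IsDomain R] [Algebra K R] [Field F] [Algebra K F]
  [Algebra R F] [IsScalarTower K R F] [IsFractionRing R F] {d : ℕ} {x : Fin d → R}

theorem isScalarTower_chartAlgebra :
    letI : Algebra (MvPolynomial (Fin d) K) R := (aeval x).toRingHom.toAlgebra
    letI : Algebra (MvPolynomial (Fin d) K) F := chartAlgebra fun i => algebraMap R F (x i)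
    IsScalarTower (MvPolynomial (Fin d) K) R F := by
  let _ : Algebra (MvPolynomial (Fin d) K) R := (aeval x).toRingHom.toAlgebra
  let _ : Algebra (MvPolynomial (Fin d) K) F := chartAlgebra fun i => algebraMap R F (x i)
  exact .of_algebraMap_eq fun a => aeval_algebraMap_apply F x a

theorem isTranscendenceBasis_of_isIntegral (h : AlgebraicIndependent K x)
    (hint : (aeval x : MvPolynomial (Fin d) K →ₐ[K] R).toRingHom.IsIntegral) :
    IsTranscendenceBasis K fun i => algebraMap R F (x i) := by
  let iAR : Algebra (MvPolynomial (Fin d) K) R := (aeval x).toRingHom.toAlgebra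
  let iAF : Algebra (MvPolynomial (Fin d) K) F := chartAlgebra fun i => algebraMap R F (x i)
  have : IsScalarTower (MvPolynomial (Fin d) K) R F := isScalarTower_chartAlgebra
  have : Algebra.IsIntegral (MvPolynomial (Fin d) K) R := ⟨hint⟩
  have hu : AlgebraicIndependent K fun i => algebraMap R F (x i) :=
      h.map' (f := IsScalarTower.toAlgHom K R F) (IsFractionRing.injective R F)
  have := hu.faithfulSMul_chartAlgebra
  have : Algebra.IsAlgebraic (MvPolynomial (Fin d) K) F :=
    (IsFractionRing.isAlgebraic_iff' _ R F).1 inferInstance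
  have : IsScalarTower K (MvPolynomial (Fin d) K) F := .of_algebraMap_eq fun a => by
    rw [MvPolynomial.algebraMap_eq]
    exact (aeval_C _ a).symm
  have h1 := (IsTranscendenceBasis.mvPolynomial (Fin d) K).algebraMap_comp (A := F)
  convert h1 using 1
  funext i
  exact (aeval_X (R := K) (fun i => algebraMap R F (x i)) i).symm
end

theorem exists_presentation (K R F : Type*) [Field K] [CharZero K] [CommRing R] [IsDomain R]
    [Algebra K R] [Algebra.FiniteType K R] [Field F] [Algebra R F] [IsFractionRing R F]
    [Algebra K F] [IsScalarTower K R F] :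
    ∃ (d : ℕ) (x : Fin d → R) (y : R) (P : Polynomial (MvPolynomial (Fin d) K)) (m : R),
      Presentation F x y P m := by
  classical
  obtain ⟨d, g, hg, hgint⟩ := exists_integral_inj_algHom_of_fg K R
  let x : Fin d → R := fun i => g (X i)
  have hgx : g = aeval x := by ext i; simp [x]
  rw [hgx] at hg hgint
  have hxind : AlgebraicIndependent K x := hg
  let A := MvPolynomial (Fin d) K
  let u : Fin d → F := fun i => algebraMap R F (x i)
  let iAR : Algebra A R := (aeval x).toRingHom.toAlgebra
  let iAF : Algebra A F := chartAlgebra u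
  have : IsScalarTower A R F := isScalarTower_chartAlgebra
  have : Algebra.IsIntegral A R := ⟨hgint⟩
  have hu : IsTranscendenceBasis K u := isTranscendenceBasis_of_isIntegral hxind hgint
  have := hu.1.faithfulSMul_chartAlgebra
  have : Algebra.IsAlgebraic A F := hu.isAlgebraic_chartAlgebra
  have : Algebra.EssFiniteType K F := by
    have : Algebra.EssFiniteType R F := .of_isLocalization F (nonZeroDivisors R)
    exact .comp K R F
  have hfin := hu.finiteDimensional_fractionRing
  obtain ⟨y', ⟨y, hy⟩, hy1, hy2, hy3⟩ := exists_primitive_of_subalgebra (A := A) (L := F) hfin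
    (IsScalarTower.toAlgHom A R F).range (by
      rintro _ ⟨b, rfl⟩
      exact (Algebra.IsIntegral.isIntegral (R := A) b).algebraMap) fun s => by
      obtain ⟨a, b, hb, rfl⟩ := IsFractionRing.div_surjective R s
      obtain ⟨c, hc, e, he⟩ := ((Algebra.IsIntegral.isIntegral (R := A) b).isAlgebraic).exists_nonzero_dvd hb
      have hb0 : algebraMap R F b ≠ 0 := IsLocalization.to_map_ne_zero_of_mem_nonZeroDivisors F le_rfl hb
      refine ⟨c, hc, e * a, ?_⟩
      rw [Algebra.smul_def, IsScalarTower.algebraMap_apply A R F, he, map_mul]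
      change algebraMap R F e * algebraMap R F a = _
      rw [map_mul]
      field_simp
  have hevy (f : Polynomial A) : Polynomial.aeval y' f = algebraMap R F (evPt x y f) := by
    rw [← hy]
    change Polynomial.aeval (algebraMap R F y) f = _
    rw [Polynomial.aeval_algebraMap_apply]
    rfl
  let := FractionRing.liftAlgebra A F
  have := FractionRing.isScalarTower_liftAlgebra A F
  have : FiniteDimensional (FractionRing A) F := hfin
  have : CharZero (FractionRing A) :=
    charZero_of_injective_algebraMap (IsFractionRing.injective A (FractionRing A))
  have : Module.Finite A (integralClosure A F) :=
    IsIntegralClosure.finite A (FractionRing A) F (integralClosure A F)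
  obtain ⟨T, hT⟩ := (Module.finite_def (R := A) (M := integralClosure A F)).1 ‹_›
  have hkey : ∃ a : A, a ≠ 0 ∧ ∀ s : integralClosure A F, ∃ q : Polynomial A,
      a • (s : F) = Polynomial.aeval y' q := by
    choose a ha0 q hq using hy3
    refine ⟨∏ t ∈ T, a t, Finset.prod_ne_zero_iff.2 fun _ _ => ha0 _, fun s => ?_⟩
    have hs : s ∈ Submodule.span A (T : Set (integralClosure A F)) := hT ▸ trivial
    induction hs using Submodule.span_induction with
    | mem s hs =>
      rw [← Finset.prod_erase_mul _ _ hs, mul_smul, hq]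
      exact ⟨Polynomial.C (∏ t ∈ T.erase s, a t) * q s, by simp [Algebra.smul_def]⟩
    | zero => exact ⟨0, by simp⟩
    | add s t _ _ hs ht =>
      obtain ⟨q₁, h1⟩ := hs
      obtain ⟨q₂, h2⟩ := ht
      exact ⟨q₁ + q₂, by simp [h1, h2]⟩
    | smul b s _ hs =>
      obtain ⟨q₁, h1⟩ := hs
      refine ⟨Polynomial.C b * q₁, ?_⟩
      simp only [map_mul, Polynomial.aeval_C, ← h1]
      simp [Algebra.smul_def]
      ring
  obtain ⟨a, ha0, ha⟩ := hkey
  have hcond (f : F) (hf : IsIntegral A f) : ∃ q : Polynomial A,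
      algebraMap R F (evPt x y q) =
        algebraMap R F (evPt x y (minpoly A y').derivative * aeval x a) * f := by
    obtain ⟨q, hq⟩ := ha ⟨f, hf⟩
    refine ⟨(minpoly A y').derivative * q, ?_⟩
    rw [map_mul, map_mul, ← hevy q, ← hq, map_mul, mul_assoc, Algebra.smul_def,
      IsScalarTower.algebraMap_apply A R F]
    rfl
  have hint : IsIntegral A y' := by
    rw [← hy]
    exact (Algebra.IsIntegral.isIntegral (R := A) y).algebraMap
  refine ⟨d, x, y, minpoly A y', evPt x y (minpoly A y').derivative * aeval x a,
    hxind, hgint, minpoly.monic hint, ?_, mul_ne_zero ?_ ?_, Dvd.intro _ rfl, fun r => ?_, fun f hf => ?_⟩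
  · exact IsFractionRing.injective R F (by rw [← hevy, hy1, map_zero])
  · intro h
    exact hy2 (by rw [hevy, h, map_zero])
  · exact fun h => ha0 (hg (by simpa using h))
  · obtain ⟨q, hq⟩ := hcond (algebraMap R F r) (Algebra.IsIntegral.isIntegral (R := A) r).algebraMap
    exact ⟨q, IsFractionRing.injective R F (by rw [hq, map_mul])⟩
  · obtain ⟨q, hq⟩ := hcond f (isIntegral_trans f hf)
    exact ⟨_, hq⟩

/-- The valuation `v` of `Λ` restricts along `σ` to a valuation of `F` that is centered on the
ideal `P` of `R`. -/
structure CenteredAt {R F Λ Γ : Type*} [CommRing R] [Field F] [Algebra R F] [Field Λ]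
    [LinearOrderedCommGroupWithZero Γ] (σ : F →+* Λ) (v : Valuation Λ Γ) (P : Ideal R) : Prop where
  le_one : ∀ r, v (σ (algebraMap R F r)) ≤ 1
  lt_one_iff : ∀ r, v (σ (algebraMap R F r)) < 1 ↔ r ∈ P

section
variable {R F Λ Γ : Type*} [CommRing R] [Field F] [Algebra R F] [Field Λ]
    [LinearOrderedCommGroupWithZero Γ] {σ : F →+* Λ} {v : Valuation Λ Γ} {P : Ideal R}

theorem CenteredAt.eq_one_iff (h : CenteredAt σ v P) {r : R} :
    v (σ (algebraMap R F r)) = 1 ↔ r ∉ P := by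
  rw [← h.lt_one_iff, not_lt]
  exact ⟨fun h1 => h1.ge, fun h1 => le_antisymm (h.le_one r) h1⟩

theorem CenteredAt.isPrime (h : CenteredAt σ v P) : P.IsPrime := by
  refine ⟨fun h1 => ?_, fun {a b} hab => ?_⟩
  · have : (1 : R) ∈ P := h1 ▸ trivial
    rw [← h.lt_one_iff] at this
    simp at this
  · by_contra! hc
    rw [← h.eq_one_iff, ← h.eq_one_iff] at hc
    rw [← h.lt_one_iff, map_mul, map_mul, map_mul, hc.1, hc.2, mul_one] at hab
    exact hab.false

theorem CenteredAt.exists_pow [IsDomain R] [IsFractionRing R F] (h : CenteredAt σ v P) {t : R} (ht : IsUniformizer P t)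
    {f : R} (hf : f ≠ 0) : ∃ n : ℕ, v (σ (algebraMap R F f)) = v (σ (algebraMap R F t)) ^ n := by
  obtain ⟨n, r₁, r₂, h1, h2, h3⟩ := ht.exists_eq f hf
  have h4 := congrArg (fun r => v (σ (algebraMap R F r))) h3
  simp only [map_mul, map_pow, h.eq_one_iff.2 h1, h.eq_one_iff.2 h2, one_mul] at h4
  exact ⟨n, h4⟩

end

section
variable {K R F : Type*} [Field K] [CommRing R] [IsDomain R] [Algebra K R] [Field F] [Algebra K F]
  [Algebra R F] [IsScalarTower K R F] [IsFractionRing R F] {d : ℕ} {x : Fin d → R}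
  {y m : R} {P : Polynomial (MvPolynomial (Fin d) K)}

theorem Presentation.exists_sectionData [Infinite K] (h : Presentation F x y P m) {I : Ideal R}
    (hI : I ≠ ⊥) : ∃ c p, SectionData (I.comap (evPt x y)) P c p := by
  let iAR : Algebra (MvPolynomial (Fin d) K) R := (aeval x).toRingHom.toAlgebra
  have : Algebra.IsIntegral (MvPolynomial (Fin d) K) R := ⟨h.int⟩
  obtain ⟨r, hr, hr0⟩ := Submodule.exists_mem_ne_zero_of_ne_bot hI
  obtain ⟨p, hp, hp0⟩ := Submodule.exists_mem_ne_zero_of_ne_bot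
    (Ideal.comap_ne_bot_of_integral_mem hr0 hr (Algebra.IsIntegral.isIntegral (R := MvPolynomial (Fin d) K) r))
  have htop : homogeneousComponent p.totalDegree p ≠ 0 := by
    obtain ⟨s, hs, h1⟩ := Finset.exists_mem_eq_sup p.support (support_nonempty.2 hp0)
      fun s => s.sum fun _ e => e
    intro h0
    have h2 := congrArg (coeff s) h0
    rw [coeff_homogeneousComponent, if_pos, coeff_zero] at h2
    · exact mem_support_iff.1 hs h2
    · exact h1.symm
  obtain ⟨c, hc⟩ : ∃ c, eval c (homogeneousComponent p.totalDegree p) ≠ 0 := by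
    by_contra! hc
    exact htop (MvPolynomial.funext fun c => by simp [hc])
  refine ⟨c, p, h.monic, ?_, ?_, hc⟩
  · rw [Ideal.mem_comap, h.root]; exact I.zero_mem
  · rw [Ideal.mem_comap, evPt_C]; exact hp

omit [IsDomain R] in
theorem isIntegral_quotient_of_monic_line {ι : Type*} {x : ι → R}
    (hint : (aeval x : MvPolynomial ι K →ₐ[K] R).toRingHom.IsIntegral) {c : ι → K} {e : ι}
    (he : c e ≠ 0) {p : MvPolynomial ι K}
    (hp : eval c (homogeneousComponent p.totalDegree p) ≠ 0) {Q : Ideal R} (hpQ : aeval x p ∈ Q) :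
    ((aeval fun i : {i // i ≠ e} => Ideal.Quotient.mk Q (algebraMap K R (c e) * x i -
      algebraMap K R (c i) * x e)) : MvPolynomial {i // i ≠ e} K →ₐ[K] R ⧸ Q).toRingHom.IsIntegral := by
  let ℓ : {i // i ≠ e} → R ⧸ Q := fun i => Ideal.Quotient.mk Q (algebraMap K R (c e) * x i -
      algebraMap K R (c i) * x e)
  let iA : Algebra (MvPolynomial {i // i ≠ e} K) (R ⧸ Q) := (aeval ℓ).toRingHom.toAlgebra
  have : IsScalarTower K (MvPolynomial {i // i ≠ e} K) (R ⧸ Q) := .of_algebraMap_eq fun a => by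
    rw [MvPolynomial.algebraMap_eq]
    exact (aeval_C _ a).symm
  have hx (j : ι) : IsIntegral (MvPolynomial {i // i ≠ e} K) (Ideal.Quotient.mk Q (x j)) := by
    obtain ⟨M, hM, a, h⟩ := MvPolynomial.exists_monic_line p c he hp j
    refine ⟨M, hM, ?_⟩
    have h1 := h (fun i => Ideal.Quotient.mk Q (x i))
    have h2 : aeval (fun i => Ideal.Quotient.mk Q (x i)) p = Ideal.Quotient.mk Q (aeval x p) :=
      (MvPolynomial.comp_aeval_apply x (Ideal.Quotient.mkₐ K Q) p).symm
    rw [h2, Ideal.Quotient.eq_zero_iff_mem.2 hpQ, mul_zero] at h1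
    rw [← h1]
    rfl
  have hA (b : MvPolynomial ι K) : IsIntegral (MvPolynomial {i // i ≠ e} K) (Ideal.Quotient.mk Q (aeval x b)) := by
    induction b using MvPolynomial.induction_on with
    | C a =>
      rw [aeval_C]
      exact (isIntegral_algebraMap (R := K) (A := R ⧸ Q) (x := a)).tower_top
    | add a b ha hb => rw [map_add, map_add]; exact ha.add hb
    | mul_X b i hb => rw [map_mul, map_mul, aeval_X]; exact hb.mul (hx i)
  intro z
  obtain ⟨r, rfl⟩ := Ideal.Quotient.mk_surjective z
  obtain ⟨M, hM, hr⟩ := hint r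
  change IsIntegral (MvPolynomial {i // i ≠ e} K) (Ideal.Quotient.mk Q r)
  let f : MvPolynomial ι K →+* R ⧸ Q := (Ideal.Quotient.mk Q).comp (aeval x).toRingHom
  let g : MvPolynomial ι K →+* integralClosure (MvPolynomial {i // i ≠ e} K) (R ⧸ Q) :=
    f.codRestrict _ hA
  have h1 : IsIntegral (integralClosure (MvPolynomial {i // i ≠ e} K) (R ⧸ Q))
      (Ideal.Quotient.mk Q r) := by
    refine ⟨M.map g, hM.map g, ?_⟩
    rw [Polynomial.eval₂_map, ← map_zero (Ideal.Quotient.mk Q), ← hr, Polynomial.hom_eval₂]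
    rfl
  exact isIntegral_trans _ h1

variable {Λ Γ : Type*} [Field Λ] [Algebra K Λ] [LinearOrderedCommGroupWithZero Γ] {σ : F →ₐ[K] Λ}
  {v : Valuation Λ Γ} {Q : Ideal R} {I : Ideal R} {c : Fin d → K} {p : MvPolynomial (Fin d) K}

omit [IsDomain R] [IsFractionRing R F] in
theorem CenteredAt.algebraMap_le_one (h : CenteredAt (σ : F →+* Λ) v Q) (a : K) : v (algebraMap K Λ a) ≤ 1 := by
  have h1 := h.le_one (algebraMap K R a)
  rwa [← IsScalarTower.algebraMap_apply K R F, AlgHom.coe_toRingHom, AlgHom.commutes] at h1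

omit [IsDomain R] [IsFractionRing R F] in
theorem apply_evPt (σ : F →ₐ[K] Λ) (f : Polynomial (MvPolynomial (Fin d) K)) :
    evPt (fun i => σ (algebraMap R F (x i))) (σ (algebraMap R F y)) f = σ (algebraMap R F (evPt x y f)) :=
  (map_evPt (σ.comp (IsScalarTower.toAlgHom K R F)) x y f).symm

omit [IsDomain R] in
theorem Presentation.evPt_derivative (h : Presentation F x y P m) (hv : CenteredAt (σ : F →+* Λ) v Q) (hm : m ∉ Q) :
    v (evPt (fun i => σ (algebraMap R F (x i))) (σ (algebraMap R F y)) P.derivative) = 1 := by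
  rw [apply_evPt]
  refine hv.eq_one_iff.2 fun h1 => hm ?_
  obtain ⟨r, hr⟩ := h.dvd
  exact hr ▸ Q.mul_mem_right _ h1

/-- Away from `V(I)`, the logarithmic form of `V(I)` is regular. -/
theorem Presentation.logCoeff_lt_one [CharZero K] [IsAlgClosed Λ] (h : Presentation F x y P m)
    (hv : CenteredAt (σ : F →+* Λ) v Q) (hm : m ∉ Q) (hS : SectionData (I.comap (evPt x y)) P c p)
    {θ : Fin d → F} (hθ : IsLogCoeff (I.comap (evPt x y)) P c
      (fun i => algebraMap R F (x i)) (algebraMap R F y) θ) {ϖ : Λ} {D : Derivation K Λ Λ}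
    (hD : LogGood v ϖ D) (hI : ¬ I ≤ Q) :
    v (ϖ * ∑ b, σ (θ b) * D (σ (algebraMap R F (x b)))) < 1 := by
  rw [← hθ.logForm_eq hS (isTranscendenceBasis_of_isIntegral h.inj h.int) σ D]
  obtain ⟨f, hf, hfQ⟩ := SetLike.not_le_iff_exists.1 hI
  obtain ⟨g, hg⟩ := h.exists_eq f
  have hle1 (r : R) : v (σ (algebraMap R F r)) ≤ 1 := hv.le_one r
  refine hS.logForm_lt_one hv.algebraMap_le_one (fun i => hle1 _) (hle1 _) ?_
    (h.evPt_derivative hv hm) hD (f := g) ?_ ?_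
  · rw [apply_evPt, h.root, map_zero, map_zero]
  · rw [Ideal.mem_comap, ← hg]; exact I.mul_mem_left _ hf
  · have := hv.isPrime
    rw [apply_evPt, ← hg]
    exact hv.eq_one_iff.2 fun h1 => (Ideal.IsPrime.mem_or_mem ‹_› h1).elim hm hfQ

/-- At a generic point of `V(I)`, the logarithmic form of `V(I)` has the pole of `d t / t`. -/
theorem Presentation.logCoeff_sub_lt_one [CharZero K] [IsAlgClosed Λ] (h : Presentation F x y P m)
    (hv : CenteredAt (σ : F →+* Λ) v Q) (hm : m ∉ Q) (hS : SectionData (I.comap (evPt x y)) P c p)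
    {θ : Fin d → F} (hθ : IsLogCoeff (I.comap (evPt x y)) P c
      (fun i => algebraMap R F (x i)) (algebraMap R F y) θ) {ϖ : Λ} {D : Derivation K Λ Λ}
    (hD : LogGood v ϖ D) (hI : I ≤ Q) (hgen : GenericAt K (fun i => σ (algebraMap R F (x i))) v) :
    Q ∈ I.minimalPrimes ∧ ∀ t ∈ I, IsUniformizer Q t →
      v (ϖ * (∑ b, σ (θ b) * D (σ (algebraMap R F (x b))) -
        D (σ (algebraMap R F t)) / σ (algebraMap R F t))) < 1 := by
  have := hv.isPrime
  have hle1 (r : R) : v (σ (algebraMap R F r)) ≤ 1 := hv.le_one r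
  have hlt (r : R) : v (σ (algebraMap R F r)) < 1 ↔ r ∈ Q := hv.lt_one_iff r
  have heq (r : R) : v (σ (algebraMap R F r)) = 1 ↔ r ∉ Q := hv.eq_one_iff
  rw [← hθ.logForm_eq hS (isTranscendenceBasis_of_isIntegral h.inj h.int) σ D]
  obtain ⟨e, he, hgen', ξ, hξ, hlog, hle, G, hG, hGξ⟩ := hS.exists_collided_of_genericAt
    hv.algebraMap_le_one (fun i => hle1 _) (hle1 _)
    (by rw [apply_evPt, h.root, map_zero, map_zero])
    (h.evPt_derivative hv hm) hD (fun f hf => by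
      rw [apply_evPt, hlt]; exact hI hf) hgen
  refine ⟨?_, fun t ht htu => ?_⟩
  · obtain ⟨Q', hQ', hle⟩ := Ideal.exists_minimalPrimes_le hI
    rcases eq_or_lt_of_le hle with rfl | hlt'
    · exact hQ'
    exfalso
    have := hQ'.1.1
    obtain ⟨g, hgQ, hgQ'⟩ := SetLike.exists_of_lt hlt'
    have hint := isIntegral_quotient_of_monic_line h.int he hS.top (Q := Q') (hQ'.1.2 (by
      simpa using hS.mem_p))
    let ℓ : {i // i ≠ e} → R := fun i => algebraMap K R (c e) * x i - algebraMap K R (c i) * x e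
    let iA : Algebra (MvPolynomial {i // i ≠ e} K) (R ⧸ Q') :=
      (aeval fun i => Ideal.Quotient.mk Q' (ℓ i)).toRingHom.toAlgebra
    have hg0 : Ideal.Quotient.mk Q' g ≠ 0 := by rwa [Ne, Ideal.Quotient.eq_zero_iff_mem]
    obtain ⟨b, hb, hb0⟩ := Submodule.exists_mem_ne_zero_of_ne_bot
      (Ideal.comap_ne_bot_of_integral_mem hg0 (Ideal.mem_span_singleton_self _) (hint _))
    rw [Ideal.mem_comap, Ideal.mem_span_singleton] at hb
    have h2 : algebraMap (MvPolynomial {i // i ≠ e} K) (R ⧸ Q') b = Ideal.Quotient.mk Q' (aeval ℓ b) :=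
      (MvPolynomial.comp_aeval_apply ℓ (Ideal.Quotient.mkₐ K Q') b).symm
    rw [h2] at hb
    obtain ⟨z, hz⟩ := hb
    obtain ⟨z, rfl⟩ := Ideal.Quotient.mk_surjective z
    rw [← map_mul, Ideal.Quotient.mk_eq_mk_iff_sub_mem] at hz
    have h3 : aeval ℓ b ∈ Q := by
      have := Q.add_mem (hle hz) (Q.mul_mem_right z hgQ)
      rwa [sub_add_cancel] at this
    have h4 := hgen' b hb0
    rw [← (hlt _)] at h3
    have h5 : σ (algebraMap R F (aeval ℓ b)) = aeval (fun i => σ (algebraMap R F (ℓ i))) b :=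
      MvPolynomial.comp_aeval_apply ℓ (σ.comp (IsScalarTower.toAlgHom K R F)) b
    rw [h5] at h3
    refine absurd h4 (ne_of_lt ?_)
    convert h3 using 4
    funext i
    simp [ℓ, ← IsScalarTower.algebraMap_apply K R F]
  · have hpow {f : R} (hf : f ≠ 0) :
        ∃ n : ℕ, v (σ (algebraMap R F f)) = v (σ (algebraMap R F t)) ^ n := hv.exists_pow htu hf
    have ht1 : v (σ (algebraMap R F t)) < 1 := (hlt t).2 htu.mem
    have ht0 : σ (algebraMap R F t) ≠ 0 := by
      rw [Ne, map_eq_zero_iff σ (σ : F →+* Λ).injective,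
        map_eq_zero_iff _ (IsFractionRing.injective R F)]
      exact htu.ne_zero
    have hvt0 : v (σ (algebraMap R F t)) ≠ 0 := by simpa using ht0
    have htξ : v (σ (algebraMap R F t)) ≤ v ξ := by
      obtain ⟨g, hg⟩ := h.exists_eq t
      have h1 := hle g (by rw [Ideal.mem_comap, ← hg]; exact I.mul_mem_left _ ht)
      rwa [apply_evPt, ← hg, map_mul, map_mul, map_mul, (heq m).2 hm, one_mul] at h1
    have hξ0 : ξ ≠ 0 := by
      rintro rfl
      rw [map_zero, le_zero_iff] at htξ
      exact hvt0 htξ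
    have hξt : v ξ ≤ v (σ (algebraMap R F t)) := by
      obtain ⟨a, b, rfl⟩ := (IntermediateField.mem_adjoin_range_iff _ _ _).1 hG
      have hab (a : MvPolynomial (Fin d) K) : aeval (fun i => σ (algebraMap R F (x i))) a =
          σ (algebraMap R F (aeval x a)) :=
        (MvPolynomial.comp_aeval_apply x (σ.comp (IsScalarTower.toAlgHom K R F)) a).symm
      rw [hab, hab] at hGξ
      have hG0 : σ (algebraMap R F (aeval x a)) / σ (algebraMap R F (aeval x b)) ≠ 0 := fun h0 => by
        rw [h0, map_zero] at hGξ
        exact hξ0 (by simpa using hGξ.symm)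
      have ha : aeval x a ≠ 0 := fun h0 => hG0 (by simp [h0])
      have hb : aeval x b ≠ 0 := fun h0 => hG0 (by simp [h0])
      obtain ⟨n₁, h1⟩ := hpow ha
      obtain ⟨n₂, h2⟩ := hpow hb
      rw [map_div₀, h1, h2] at hGξ
      rcases le_or_gt n₁ n₂ with hn | hn
      · refine absurd hξ (not_lt.2 ?_)
        rw [← hGξ, le_div_iff₀ (zero_lt_iff.2 (pow_ne_zero _ hvt0)), one_mul]
        exact pow_le_pow_right_of_le_one' ht1.le hn
      · rw [← hGξ, div_le_iff₀ (zero_lt_iff.2 (pow_ne_zero _ hvt0)), ← pow_succ']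
        exact pow_le_pow_right_of_le_one' ht1.le hn
    have hη : v (σ (algebraMap R F t) / ξ) = 1 := by
      rw [map_div₀, le_antisymm htξ hξt, div_self (by simpa using hξ0)]
    have hη0 : σ (algebraMap R F t) / ξ ≠ 0 := div_ne_zero ht0 hξ0
    have hDt : D (σ (algebraMap R F t)) / σ (algebraMap R F t) =
        D ξ / ξ + D (σ (algebraMap R F t) / ξ) / (σ (algebraMap R F t) / ξ) := by
      have h1 : σ (algebraMap R F t) = ξ * (σ (algebraMap R F t) / ξ) := by field_simp
      have h2 := D.leibniz ξ (σ (algebraMap R F t) / ξ)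
      rw [← h1, smul_eq_mul, smul_eq_mul] at h2
      rw [h2]
      field_simp
      ring
    have h2 : v (ϖ * (D (σ (algebraMap R F t) / ξ) / (σ (algebraMap R F t) / ξ))) < 1 := by
      rw [mul_div_assoc', map_div₀, hη, div_one]
      exact hD.lt_one _ hη.le
    rw [hDt, ← sub_sub, mul_sub]
    exact v.map_sub_lt hlog h2
end

section
variable {K Λ Γ : Type*} [Field K] [CharZero K] [Field Λ] [Algebra K Λ]
  [LinearOrderedCommGroupWithZero Γ] {v : Valuation Λ Γ} {l : ℕ} {u : Fin l → Λ}
  {π : MvPolynomial (Fin l) K}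

omit [CharZero K] in
theorem LiesOverChart.algebraMap_le_one (hv : LiesOverChart u π v) (c : K) :
    v (algebraMap K Λ c) ≤ 1 := by
  have := (hv (C c)).1
  rwa [aeval_C] at this

omit [CharZero K] in
theorem LiesOverChart.derivation_le_one (hv : LiesOverChart u π v) {D : Derivation K Λ Λ}
    (hD : ∀ i, v (D (u i)) ≤ 1) (a : MvPolynomial (Fin l) K) : v (D (aeval u a)) ≤ 1 := by
  induction a using MvPolynomial.induction_on with
  | C c => rw [aeval_C, Derivation.map_algebraMap, map_zero]; exact zero_le
  | add p q hp hq => rw [map_add, map_add]; exact v.map_add_le hp hq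
  | mul_X p i hp =>
    rw [map_mul, aeval_X, Derivation.leibniz, smul_eq_mul, smul_eq_mul]
    refine v.map_add_le ?_ ?_
    · rw [map_mul]; exact mul_le_one' (hv p).1 (hD i)
    · rw [map_mul]
      have := (hv (X i)).1
      rw [aeval_X] at this
      exact mul_le_one' this hp

theorem LiesOverChart.logGood (hu : IsTranscendenceBasis K u) (hπ : Prime π)
    (hv : LiesOverChart u π v) {D : Derivation K Λ Λ} (hD : ∀ i, v (D (u i)) ≤ 1) :
    LogGood v (aeval u π) D := by
  let iA := chartAlgebra (K := K) u
  have := hu.isAlgebraic_chartAlgebra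
  have := hu.1.faithfulSMul_chartAlgebra
  have : CharZero Λ := charZero_of_injective_algebraMap (algebraMap K Λ).injective
  have : CharZero (MvPolynomial (Fin l) K) :=
    charZero_of_injective_algebraMap (MvPolynomial.C_injective (Fin l) K)
  refine LiesOverElem.logGood (A := MvPolynomial (Fin l) K) (fun n hn => ?_) hπ hv.liesOverElem D
    fun a => hv.derivation_le_one hD a
  rw [← map_natCast (C : K →+* MvPolynomial (Fin l) K)]
  exact (IsUnit.mk0 (n : K) (Nat.cast_ne_zero.2 hn)).map C

end

section

theorem MvPolynomial.exists_not_dvd_pderiv {K ι : Type*} [Field K] [CharZero K]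
    {π : MvPolynomial ι K} (hπ : Prime π) : ∃ i, ¬ π ∣ pderiv i π := by
  classical
  by_contra! hdvd
  have hz (i : ι) : pderiv i π = 0 := by
    obtain ⟨q, hq⟩ := hdvd i
    by_contra h0
    have hq0 : q ≠ 0 := by rintro rfl; simp at hq; exact h0 hq
    have h1 : (pderiv i π).totalDegree = π.totalDegree + q.totalDegree := by
      rw [hq, totalDegree_mul_of_isDomain hπ.ne_zero hq0]
    obtain ⟨s, hs, h2⟩ := Finset.exists_mem_eq_sup (pderiv i π).support (support_nonempty.2 h0)
      fun s => s.sum fun _ e => e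
    have h3 : s + Finsupp.single i 1 ∈ π.support := by
      rw [mem_support_iff] at hs ⊢
      rw [coeff_pderiv] at hs
      exact left_ne_zero_of_mul hs
    have h4 := le_totalDegree h3
    rw [Finsupp.sum_add_index' (fun _ => rfl) (fun _ _ _ => rfl), Finsupp.sum_single_index rfl] at h4
    change (pderiv i π).totalDegree = _ at h2
    omega
  refine hπ.not_isUnit ?_
  have h5 : π = C (coeff 0 π) := by
    ext s
    rw [coeff_C]
    split_ifs with hs
    · rw [hs]
    · obtain ⟨i, hi⟩ : ∃ i, s i ≠ 0 := by
        by_contra! h; exact hs (Finsupp.ext h).symm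
      have h6 := congrArg (coeff (s - Finsupp.single i 1)) (hz i)
      rw [coeff_pderiv, tsub_add_cancel_of_le, coeff_zero] at h6
      · refine (mul_eq_zero.1 h6).resolve_right ?_
        exact Nat.cast_add_one_ne_zero _
      · rw [Finsupp.single_le_iff]; omega
  rw [h5]
  refine (IsUnit.mk0 _ fun h0 => hπ.ne_zero ?_).map C
  rw [h5, h0, C_0]

end

section
variable {K R F : Type*} [Field K] [CommRing R] [IsDomain R] [Algebra K R] {d : ℕ} {x : Fin d → R}

theorem HeightOnePrime.exists_chart (hx : AlgebraicIndependent K x)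
    (hint : (aeval x : MvPolynomial (Fin d) K →ₐ[K] R).toRingHom.IsIntegral) {Q : Ideal R}
    (hQ : HeightOnePrime Q) :
    ∃ π : MvPolynomial (Fin d) K, Prime π ∧ ∀ a, aeval x a ∈ Q ↔ π ∣ a := by
  let iAR : Algebra (MvPolynomial (Fin d) K) R := (aeval x).toRingHom.toAlgebra
  have : Algebra.IsIntegral (MvPolynomial (Fin d) K) R := ⟨hint⟩
  have : FaithfulSMul (MvPolynomial (Fin d) K) R :=
    (faithfulSMul_iff_algebraMap_injective _ _).2 hx
  have := hQ.1
  have : Algebra.HasGoingDown (MvPolynomial (Fin d) K) R := inferInstance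
  obtain ⟨r, hr, hr0⟩ := Submodule.exists_mem_ne_zero_of_ne_bot hQ.2.1
  obtain ⟨p, hp, hp0⟩ := Submodule.exists_mem_ne_zero_of_ne_bot
    (Ideal.comap_ne_bot_of_integral_mem hr0 hr (Algebra.IsIntegral.isIntegral (R := MvPolynomial (Fin d) K) r))
  have hprime : (Q.under (MvPolynomial (Fin d) K)).IsPrime := inferInstance
  obtain ⟨π, hπQ, hπ⟩ := hprime.exists_mem_prime_of_ne_bot (Submodule.ne_bot_iff _ |>.2 ⟨p, hp, hp0⟩)
  refine ⟨π, hπ, fun a => ?_⟩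
  have hle : Ideal.span {π} ≤ Q.under (MvPolynomial (Fin d) K) := by
    rwa [Ideal.span_singleton_le_iff_mem]
  have heq : Ideal.span {π} = Q.under (MvPolynomial (Fin d) K) := by
    by_contra hne
    have hpr : (Ideal.span {π}).IsPrime := (Ideal.span_singleton_prime hπ.ne_zero).2 hπ
    obtain ⟨P, hPQ, hP, hlo⟩ := Algebra.HasGoingDown.exists_ideal_le_liesOver_of_lt Q
      (lt_of_le_of_ne hle hne)
    rcases hPQ.eq_or_lt with h | h
    · exact hne (by rw [hlo.over, h])
    · have := hQ.2.2 P hP h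
      subst this
      have h1 : π ∈ (⊥ : Ideal R).under (MvPolynomial (Fin d) K) := by
        rw [← hlo.over]; exact Ideal.mem_span_singleton_self π
      rw [Ideal.mem_comap, Ideal.mem_bot] at h1
      exact hπ.ne_zero (hx (h1.trans (map_zero _).symm))
  rw [← Ideal.mem_span_singleton, heq]
  rfl

end

theorem LinearIndependent.eq_zero_of_sum_smul {K F ι X : Type*} [Field K] [Field F] [Algebra K F]
    [Fintype ι] {w : ι → X → K} (hw : LinearIndependent K w) {a : ι → F}
    (h : ∀ p, ∑ j, w j p • a j = 0) : a = 0 := by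
  funext j
  refine (Module.forall_dual_apply_eq_zero_iff K _).1 fun φ => ?_
  refine Fintype.linearIndependent_iff.1 hw (fun j => φ (a j)) ?_ j
  funext p
  have := congrArg φ (h p)
  rw [map_sum, map_zero] at this
  simpa [mul_comm] using this

theorem finite_of_finite_support {K X : Type*} [Field K] (W : Submodule K (X → K))
    [FiniteDimensional K W] (hfin : ∀ w ∈ W, (Function.support w).Finite) :
    {p | ∃ w ∈ W, w p ≠ 0}.Finite := by
  obtain ⟨s, hs⟩ := (Submodule.fg_iff_finiteDimensional W).2 inferInstance
  have hf : (⋃ w ∈ (s : Set (X → K)), Function.support w).Finite :=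
    s.finite_toSet.biUnion fun w hw => hfin w (hs ▸ Submodule.subset_span hw)
  refine hf.subset ?_
  rintro p ⟨w, hw, hp⟩
  by_contra hc
  simp only [Set.mem_iUnion, Function.mem_support, not_exists, not_not] at hc
  refine hp ?_
  have : W ≤ LinearMap.ker (LinearMap.proj (R := K) (φ := fun _ : X => K) p) := by
    rw [← hs, Submodule.span_le]
    intro w hw
    exact hc w hw
  exact this hw

section
variable {Λ Γ k : Type*} [Field Λ] [LinearOrderedCommGroupWithZero Γ] {v : Valuation Λ Γ}
  [CommRing k] [Algebra k Λ]

theorem Derivation.div_mul {D : Derivation k Λ Λ} {a b : Λ} (ha : a ≠ 0) (hb : b ≠ 0) :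
    D (a * b) / (a * b) = D a / a + D b / b := by
  rw [D.leibniz, smul_eq_mul, smul_eq_mul]
  field_simp
  ring

theorem Derivation.div_pow {D : Derivation k Λ Λ} {a : Λ} (ha : a ≠ 0) (n : ℕ) :
    D (a ^ n) / a ^ n = n * (D a / a) := by
  induction n with
  | zero => simp
  | succ n ih => rw [pow_succ, D.div_mul (pow_ne_zero _ ha) ha, ih]; push_cast; ring

theorem LogGood.div_lt_one {w : Λ} {D : Derivation k Λ Λ} (hD : LogGood v w D) {a : Λ}
    (ha : v a = 1) : v (w * (D a / a)) < 1 := by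
  rw [← mul_div_assoc, map_div₀, ha, div_one]
  exact hD.lt_one a ha.le

theorem LogGood.div_sub_div_lt_one {w : Λ} {D : Derivation k Λ Λ} (hD : LogGood v w D) {a b : Λ}
    (ha : a ≠ 0) (h : v a = v b) : v (w * (D a / a - D b / b)) < 1 := by
  have hb : b ≠ 0 := by
    rintro rfl; rw [map_zero, v.zero_iff] at h; exact ha h
  have h1 : D a / a - D b / b = D (a / b) / (a / b) := by
    have := D.div_mul (div_ne_zero ha hb) hb
    rw [div_mul_cancel₀ _ hb] at this
    rw [this]; ring
  rw [h1]
  refine hD.div_lt_one ?_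
  rw [map_div₀, h, div_self]
  rwa [v.ne_zero_iff]

end

section
variable {R F Λ Γ : Type*} [CommRing R] [Field F] [Algebra R F] [Field Λ]
    [LinearOrderedCommGroupWithZero Γ] {σ : F →+* Λ} {v : Valuation Λ Γ} {P : Ideal R}

theorem CenteredAt.le_of_isUniformizer [IsDomain R] [IsFractionRing R F] (h : CenteredAt σ v P) {t t' : R}
    (ht : IsUniformizer P t) (ht' : IsUniformizer P t') :
    v (σ (algebraMap R F t)) ≤ v (σ (algebraMap R F t')) := by
  obtain ⟨n, hn⟩ := h.exists_pow ht' ht.ne_zero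
  rcases n.eq_zero_or_pos with rfl | hn0
  · rw [pow_zero] at hn
    exact absurd hn ((h.lt_one_iff t).2 ht.mem).ne
  · rw [hn]
    exact pow_le_of_le_one₀ hn0 (h.le_one t')
where
  pow_le_of_le_one₀ {a : Γ} {n : ℕ} (hn : 0 < n) (ha : a ≤ 1) : a ^ n ≤ a := by
    simpa using pow_le_pow_right_of_le_one' ha hn

theorem CenteredAt.eq_of_isUniformizer [IsDomain R] [IsFractionRing R F] (h : CenteredAt σ v P) {t t' : R}
    (ht : IsUniformizer P t) (ht' : IsUniformizer P t') :
    v (σ (algebraMap R F t)) = v (σ (algebraMap R F t')) :=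
  (h.le_of_isUniformizer ht ht').antisymm (h.le_of_isUniformizer ht' ht)

/-- The element `b` of the fraction field is a unit in the localization at `P`. -/
def UnitAt (P : Ideal R) (b : F) : Prop :=
  ∃ r₁ r₂ : R, r₁ ∉ P ∧ r₂ ∉ P ∧ algebraMap R F r₂ * b = algebraMap R F r₁

theorem CenteredAt.eq_one_of_unitAt (h : CenteredAt σ v P) {b : F} (hb : UnitAt P b) : v (σ b) = 1 := by
  obtain ⟨r₁, r₂, h1, h2, h3⟩ := hb
  have h4 := congrArg (fun r => v (σ r)) h3
  simpa only [map_mul, h.eq_one_iff.2 h1, h.eq_one_iff.2 h2, one_mul] using h4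

end

theorem HeightOnePrime.mem_minimalPrimes {R : Type*} [CommRing R] [IsDomain R] {P I : Ideal R}
    (hP : HeightOnePrime P) (hI : I ≠ ⊥) (h : I ≤ P) : P ∈ I.minimalPrimes := by
  have := hP.1
  obtain ⟨Q, hQ, hQP⟩ := Ideal.exists_minimalPrimes_le h
  rcases hQP.eq_or_lt with rfl | hlt
  · exact hQ
  · have := hP.2.2 Q hQ.1.1 hlt
    subst this
    exact absurd (le_bot_iff.1 hQ.1.2) hI

theorem finite_heightOnePrime {R : Type*} [CommRing R] [IsDomain R] [IsNoetherianRing R] {r : R} (hr : r ≠ 0) :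
    {P : Ideal R | HeightOnePrime P ∧ r ∈ P}.Finite := by
  refine (Ideal.finite_minimalPrimes_of_isNoetherianRing R (Ideal.span {r})).subset ?_
  rintro P ⟨hP, h⟩
  exact hP.mem_minimalPrimes (by rwa [Ne, Ideal.span_singleton_eq_bot])
    (by rwa [Ideal.span_singleton_le_iff_mem])

theorem derivation_aeval_eq_pderiv {K Λ ι : Type*} [CommRing K] [CommRing Λ] [Algebra K Λ]
    [DecidableEq ι] {u : ι → Λ} {D : Derivation K Λ Λ} {a : ι}
    (hD : ∀ b, D (u b) = if b = a then 1 else 0) (p : MvPolynomial ι K) :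
    D (aeval u p) = aeval u (pderiv a p) := by
  induction p using MvPolynomial.induction_on with
  | C c => simp
  | add p q hp hq => rw [map_add, map_add, hp, hq, map_add, map_add]
  | mul_X p i hp =>
    simp only [map_mul, D.leibniz, hp, aeval_X, hD, Derivation.leibniz, pderiv_X, map_add, smul_eq_mul]
    by_cases h : i = a
    · subst h; simp
    · simp [h]

theorem exists_linearIndependent_fin {K V : Type*} [Field K] [AddCommGroup V] [Module K V]
    (hV : ¬ FiniteDimensional K V) (n : ℕ) : ∃ w : Fin n → V, LinearIndependent K w := by
  refine exists_linearIndependent_of_le_rank ?_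
  have h1 : ¬ Module.rank K V < Cardinal.aleph0 := by
    rwa [Module.rank_lt_aleph0_iff]
  exact Cardinal.natCast_le_aleph0.trans (not_lt.1 h1)

/-- The family `θ` consists of the coefficients of the logarithmic forms attached to the
hypersurfaces in `ℋ`. -/
def IsLogFamily {K R F : Type*} [Field K] [CommRing R] [Algebra K R] [Field F] [Algebra K F]
    [Algebra R F] {d : ℕ} (x : Fin d → R) (y : R) (P : Polynomial (MvPolynomial (Fin d) K))
    {ℋ : Set (Ideal R)} (θ : ℋ → Fin d → F) : Prop :=
  ∀ I : ℋ, IsHypersurfaceIdeal I.1 ∧ ∃ c p, SectionData (I.1.comap (evPt x y)) P c p ∧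
    IsLogCoeff (I.1.comap (evPt x y)) P c (fun i => algebraMap R F (x i)) (algebraMap R F y) (θ I)

theorem IsHypersurfaceIdeal.ne_bot {R : Type*} [CommRing R] [IsDomain R] {I : Ideal R}
    (hI : IsHypersurfaceIdeal I) : I ≠ ⊥ := by
  rintro rfl
  exact (hI.2.2 ⊥ ⟨⟨Ideal.isPrime_bot, le_rfl⟩, fun _ _ _ => bot_le⟩).2.1 rfl

section
variable {K R F : Type*} [Field K] [CharZero K] [CommRing R] [IsDomain R] [IsNoetherianRing R]
  [Algebra K R] [Field F] [Algebra K F]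
  [Algebra R F] [IsScalarTower K R F] [IsFractionRing R F] {d : ℕ} {x : Fin d → R}
  {y m : R} {P : Polynomial (MvPolynomial (Fin d) K)} {ℋ : Set (Ideal R)} {θ : ℋ → Fin d → F}

variable {Λ Γ : Type*} [Field Λ] [IsAlgClosed Λ] [Algebra K Λ] [LinearOrderedCommGroupWithZero Γ] {σ : F →ₐ[K] Λ}
  {v : Valuation Λ Γ} {Q : Ideal R}

open Classical in
theorem Presentation.linearCombination_sub_lt_one (h : Presentation F x y P m) (hθ : IsLogFamily x y P θ)
    (hv : CenteredAt (σ : F →+* Λ) v Q) (hm : m ∉ Q) (hQ : HeightOnePrime Q)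
    (hgen : GenericAt K (fun i => σ (algebraMap R F (x i))) v) {t : R} (ht : IsUniformizer Q t)
    {ϖ : Λ} {D : Derivation K Λ Λ} (hD : LogGood v ϖ D) {a : Fin d}
    (hDa : ∀ b, D (σ (algebraMap R F (x b))) = if b = a then 1 else 0) (c : ℋ →₀ K) :
    v (ϖ * (σ (Finsupp.linearCombination K θ c a) - σ (algebraMap K F (Finsupp.linearCombination K
      (fun I : ℋ => if I.1 ≤ Q then (1 : K) else 0) c)) *
      (D (σ (algebraMap R F t)) / σ (algebraMap R F t)))) < 1 := by
  have ht0 : σ (algebraMap R F t) ≠ 0 := by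
    rw [map_ne_zero, Ne, FaithfulSMul.algebraMap_eq_zero_iff]; exact ht.ne_zero
  induction c using Finsupp.induction_linear with
  | zero => simp
  | add c c' hc hc' =>
    convert v.map_add_lt hc hc' using 2
    simp only [map_add, Pi.add_apply]
    ring
  | single I k =>
    have key : v (ϖ * (σ (θ I a) - (if I.1 ≤ Q then 1 else 0) *
      (D (σ (algebraMap R F t)) / σ (algebraMap R F t)))) < 1 := by
      obtain ⟨hI, c, p, hS, hc⟩ := hθ I
      have hsum : ∑ b, σ (θ I b) * D (σ (algebraMap R F (x b))) = σ (θ I a) := by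
        simp [hDa]
      split_ifs with hle
      · obtain ⟨t', ht', hu⟩ := exists_isUniformizer (F := F) hI.1
          (hQ.mem_minimalPrimes hI.ne_bot hle) hQ hm h.cond
        have h1 := (h.logCoeff_sub_lt_one hv hm hS hc hD hle hgen).2 t' ht' hu
        have ht0' : σ (algebraMap R F t') ≠ 0 := by
          rw [map_ne_zero, Ne, FaithfulSMul.algebraMap_eq_zero_iff]; exact hu.ne_zero
        have h2 := hD.div_sub_div_lt_one ht0' (hv.eq_of_isUniformizer hu ht)
        convert v.map_add_lt h1 h2 using 2
        rw [hsum, ← mul_add, one_mul]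
        simp
      · rw [zero_mul, sub_zero, ← hsum]
        exact h.logCoeff_lt_one hv hm hS hc hD hle
    have h3 : v (algebraMap K Λ k) ≤ 1 := hv.algebraMap_le_one k
    have h4 := (mul_le_of_le_one_left' h3).trans_lt key
    rw [← map_mul] at h4
    convert h4 using 2
    simp only [Finsupp.linearCombination_single, Pi.smul_apply, Algebra.smul_def, map_mul,
      AlgHom.commutes]
    split_ifs <;> simp <;> ring

end

section
variable {K R F : Type*} [Field K] [CharZero K] [CommRing R] [IsDomain R] [IsNoetherianRing R]
  [Algebra K R] [Field F] [Algebra K F]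
  [Algebra R F] [IsScalarTower K R F] [IsFractionRing R F] {d : ℕ} {x : Fin d → R}
  {y m : R} {P : Polynomial (MvPolynomial (Fin d) K)} {ℋ : Set (Ideal R)} {θ : ℋ → Fin d → F}
  {Q : Ideal R}

open Classical in
theorem Presentation.exists_not_unitAt (h : Presentation F x y P m) (hθ : IsLogFamily x y P θ) :
    ∃ f : R, f ≠ 0 ∧ ∀ Q : Ideal R, HeightOnePrime Q → f ∉ Q → (∃ I : ℋ, I.1 ≤ Q) →
      ∀ {n} (c : Fin n → ℋ →₀ K) (a : Fin n → F),
      ∑ j, a j • Finsupp.linearCombination K θ (c j) = 0 → (∀ j, a j = 0 ∨ UnitAt Q (a j)) →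
      ¬ UnitAt Q (∑ j, a j * algebraMap K F (Finsupp.linearCombination K
        (fun I : ℋ => if I.1 ≤ Q then (1 : K) else 0) (c j))) := by
  let Λ := AlgebraicClosure F
  have hxF : IsTranscendenceBasis K fun i => algebraMap R F (x i) :=
    isTranscendenceBasis_of_isIntegral h.inj h.int
  have hx : IsTranscendenceBasis K fun i => algebraMap F Λ (algebraMap R F (x i)) :=
    hxF.algebraMap_comp (A := Λ)
  obtain ⟨f, hf0, hf⟩ := IsTranscendenceBasis.exists_good_residue hx.1 hx
  have hinjx : Function.Injective (aeval x : MvPolynomial (Fin d) K →ₐ[K] R) := h.inj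
  refine ⟨m * aeval x f, mul_ne_zero h.ne_zero ((map_ne_zero_iff _ hinjx).2 hf0), ?_⟩
  intro Q hQ hmf hI n c a hsum ha hunit
  have := hQ.1
  have hm : m ∉ Q := fun h => hmf (Q.mul_mem_right _ h)
  have hfQ : aeval x f ∉ Q := fun h => hmf (Q.mul_mem_left _ h)
  obtain ⟨π, hπ, hπQ⟩ := hQ.exists_chart h.inj h.int
  obtain ⟨O, hO⟩ := exists_valuationSubring_center ((algebraMap F Λ).comp (algebraMap R F))
    ((algebraMap F Λ).injective.comp (IsFractionRing.injective R F)) Q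
  let v := O.valuation
  let σ : F →ₐ[K] Λ := IsScalarTower.toAlgHom K F Λ
  have hv : CenteredAt (σ : F →+* Λ) v Q := ⟨fun r => (hO r).1, fun r => (hO r).2⟩
  have hσ (p : MvPolynomial (Fin d) K) : aeval (fun i => algebraMap F Λ (algebraMap R F (x i))) p =
      σ (algebraMap R F (aeval x p)) := by
    have := aeval_algebraMap_apply Λ (fun i => algebraMap R F (x i)) p
    refine Eq.trans this (congrArg (algebraMap F Λ) ?_)
    exact aeval_algebraMap_apply F x p
  have hchart : LiesOverChart (fun i => algebraMap F Λ (algebraMap R F (x i))) π v := by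
    intro p
    rw [hσ, ← hπQ]
    exact hO _
  have hgen : GenericAt K (fun i => σ (algebraMap R F (x i))) v :=
    hf v π hπ hchart (by rwa [← hπQ])
  obtain ⟨a₀, ha₀⟩ := exists_not_dvd_pderiv hπ
  obtain ⟨D, hDx⟩ := hx.1.exists_derivation fun b => if b = a₀ then 1 else 0
  have hD : LogGood v (aeval (fun i => algebraMap F Λ (algebraMap R F (x i))) π) D := by
    refine hchart.logGood hx hπ fun i => ?_
    rw [hDx]
    split_ifs <;> simp
  obtain ⟨I, hIQ⟩ := hI
  have hI := (hθ I).1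
  obtain ⟨t, -, ht⟩ := exists_isUniformizer (F := F) hI.1
    (hQ.mem_minimalPrimes hI.ne_bot hIQ) hQ hm h.cond
  have ht0 : σ (algebraMap R F t) ≠ 0 := by
    rw [map_ne_zero, Ne, FaithfulSMul.algebraMap_eq_zero_iff]; exact ht.ne_zero
  set ϖ := aeval (fun i => algebraMap F Λ (algebraMap R F (x i))) π with hϖ
  set q := D (σ (algebraMap R F t)) / σ (algebraMap R F t) with hq
  have h1 : v (ϖ * q) < 1 := by
    have h2 (j) := h.linearCombination_sub_lt_one hθ hv hm hQ hgen ht hD hDx (c j)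
    have h3 (j) : v (σ (a j)) ≤ 1 := by
      rcases ha j with h0 | h0
      · rw [h0, map_zero, map_zero]; exact zero_le
      · exact (hv.eq_one_of_unitAt h0).le
    have h4 := v.map_sum_lt (s := Finset.univ) (g := 1) one_ne_zero fun j _ =>
      (map_mul v _ _).trans_lt <| (mul_le_of_le_one_left' (h3 j)).trans_lt (h2 j)
    have h5 := congrArg σ (congrFun hsum a₀)
    simp only [Finset.sum_apply, Pi.smul_apply, smul_eq_mul, map_sum, map_mul, Pi.zero_apply, map_zero] at h5
    have h6 : ∀ j, σ (a j) * (ϖ * (σ (Finsupp.linearCombination K θ (c j) a₀) - σ (algebraMap K F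
      (Finsupp.linearCombination K (fun I : ℋ => if I.1 ≤ Q then (1 : K) else 0) (c j))) * q)) =
      ϖ * (σ (a j) * σ (Finsupp.linearCombination K θ (c j) a₀)) -
        σ (a j * algebraMap K F
      (Finsupp.linearCombination K (fun I : ℋ => if I.1 ≤ Q then (1 : K) else 0) (c j))) * (ϖ * q) := by
      intro j; rw [map_mul]; ring
    rw [Finset.sum_congr rfl fun j _ => h6 j, Finset.sum_sub_distrib, ← Finset.mul_sum, h5, mul_zero,
      zero_sub, Valuation.map_neg, ← Finset.sum_mul, ← map_sum, map_mul] at h4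
    have h7 := hv.eq_one_of_unitAt hunit
    erw [h7] at h4
    rwa [one_mul] at h4
  have hπ0 : aeval x π ≠ 0 := (map_ne_zero_iff _ hinjx).2 hπ.ne_zero
  obtain ⟨e, r₁, r₂, hr₁, hr₂, he⟩ := ht.exists_eq _ hπ0
  have hne {r : R} (hr : r ∉ Q) : σ (algebraMap R F r) ≠ 0 := by
    rw [map_ne_zero, Ne, FaithfulSMul.algebraMap_eq_zero_iff]; rintro rfl; exact hr Q.zero_mem
  have hϖ0 : ϖ ≠ 0 := by
    rw [hϖ, hσ, map_ne_zero, Ne, FaithfulSMul.algebraMap_eq_zero_iff]; exact hπ0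
  have h2 := congrArg (fun r => D (σ (algebraMap R F r)) / σ (algebraMap R F r)) he
  simp only [map_mul, map_pow] at h2
  rw [← hσ, ← hϖ, D.div_mul (hne hr₂) hϖ0, D.div_mul (hne hr₁) (pow_ne_zero _ ht0),
    D.div_pow ht0, ← hq] at h2
  have h3 : D ϖ = ϖ * (D (σ (algebraMap R F r₁)) / σ (algebraMap R F r₁))
      - ϖ * (D (σ (algebraMap R F r₂)) / σ (algebraMap R F r₂)) + e * (ϖ * q) := by
    rw [← mul_sub, mul_left_comm, ← mul_add, eq_comm, sub_add_eq_add_sub, ← h2, add_sub_cancel_left,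
      mul_div_cancel₀ _ hϖ0]
  have h4 : v (D ϖ) < 1 := by
    rw [h3]
    refine v.map_add_lt (v.map_sub_lt (hD.div_lt_one (hv.eq_one_iff.2 hr₁))
      (hD.div_lt_one (hv.eq_one_iff.2 hr₂))) ?_
    rw [map_mul]
    refine (mul_le_of_le_one_left' ?_).trans_lt h1
    exact_mod_cast hv.le_one (e : R)
  apply ha₀
  rw [← (hchart _).2]
  rwa [← derivation_aeval_eq_pderiv hDx]

theorem Presentation.finite_horizontal (h : Presentation F x y P m) (hθ : IsLogFamily x y P θ)
    (E : IntermediateField K F) (N : Submodule K (Fin d → F))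
    (hN : ∀ n (c : Fin n → Fin d → F), (∀ j, c j ∈ N) → LinearIndependent E c → LinearIndependent F c)
    (hcofg : (N.comap (Finsupp.linearCombination K θ)).CoFG) :
    {Q : Ideal R | (∃ I ∈ ℋ, Q ∈ I.minimalPrimes) ∧ ∀ b ∈ E, b ≠ 0 → UnitAt Q b}.Finite := by
  classical
  obtain ⟨f, hf0, hf⟩ := h.exists_not_unitAt hθ
  by_contra hinf
  set X := {Q : Ideal R | (∃ I ∈ ℋ, Q ∈ I.minimalPrimes) ∧ ∀ b ∈ E, b ≠ 0 → UnitAt Q b} \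
    {Q | HeightOnePrime Q ∧ f ∈ Q} with hX
  have hXinf : X.Infinite := Set.Infinite.sdiff hinf (finite_heightOnePrime hf0)
  have hXh : ∀ Q ∈ X, HeightOnePrime Q := by
    rintro Q ⟨⟨⟨I, hI, hQ⟩, -⟩, -⟩
    exact (hθ ⟨I, hI⟩).1.2.2 Q hQ
  let Ψ : (ℋ →₀ K) →ₗ[K] (X → K) := Finsupp.linearCombination K fun I Q => if I.1 ≤ Q.1 then 1 else 0
  have hΨ (c : ℋ →₀ K) (Q : X) : Ψ c Q =
      Finsupp.linearCombination K (fun I : ℋ => if I.1 ≤ Q.1 then (1 : K) else 0) c := by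
    simp only [Ψ, Finsupp.linearCombination_apply, Finsupp.sum, Finset.sum_apply, Pi.smul_apply]
  set V := N.comap (Finsupp.linearCombination K θ)
  have hnfd : ¬ FiniteDimensional K (V.map Ψ) := by
    intro hfd
    have hfg : (V.map Ψ).FG := (Submodule.fg_iff_finiteDimensional _).2 hfd
    obtain ⟨W, hW⟩ := Submodule.exists_isCompl V
    have : FiniteDimensional K W :=
      Module.Finite.equiv (Submodule.quotientEquivOfIsCompl V W hW)
    have hr : (LinearMap.range Ψ).FG := by
      rw [← Submodule.map_top, ← hW.sup_eq_top, Submodule.map_sup]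
      exact hfg.sup (((Submodule.fg_iff_finiteDimensional _).2 this).map Ψ)
    have := (Submodule.fg_iff_finiteDimensional _).1 hr
    have hfin := finite_of_finite_support (LinearMap.range Ψ) ?_
    · apply hXinf
      refine (hfin.image Subtype.val).subset fun Q hQ => ⟨⟨Q, hQ⟩, ?_, rfl⟩
      obtain ⟨⟨⟨I, hI, hQI⟩, -⟩, -⟩ := id hQ
      refine ⟨_, ⟨Finsupp.single ⟨I, hI⟩ 1, rfl⟩, ?_⟩
      rw [hΨ, Finsupp.linearCombination_single, if_pos hQI.1.2]
      simp
    · rintro _ ⟨c, rfl⟩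
      have hsub : (⋃ I ∈ (c.support : Set ℋ), {Q : X | I.1 ≤ Q.1}).Finite := by
        refine c.support.finite_toSet.biUnion fun I _ => ?_
        refine Set.Finite.of_finite_image (f := Subtype.val) ?_ Subtype.val_injective.injOn
        refine (Ideal.finite_minimalPrimes_of_isNoetherianRing R I.1).subset ?_
        rintro _ ⟨Q, hQ, rfl⟩
        exact (hXh _ Q.2).mem_minimalPrimes (hθ I).1.ne_bot hQ
      refine hsub.subset fun Q hQ => ?_
      by_contra hc
      simp only [Set.mem_iUnion, not_exists, Set.mem_ofPred_eq] at hc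
      refine hQ ?_
      rw [hΨ, Finsupp.linearCombination_apply]
      refine Finset.sum_eq_zero fun I hI => ?_
      dsimp only
      rw [if_neg (hc I hI), smul_zero]
  obtain ⟨w, hw⟩ : ∃ w : Fin (d + 1) → V.map Ψ, LinearIndependent K w :=
    exists_linearIndependent_fin hnfd _
  choose c hcV hc using fun j => (w j).2
  have hΨc : LinearIndependent K fun j => Ψ (c j) := by
    simp only [hc]
    exact hw.map' (V.map Ψ).subtype (Submodule.ker_subtype _)
  have hE : LinearIndependent E fun j => Finsupp.linearCombination K θ (c j) := by
    rw [Fintype.linearIndependent_iff]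
    intro g hg
    have hg' : ∑ j, (g j : F) • Finsupp.linearCombination K θ (c j) = 0 := hg
    have h0 : (fun j => (g j : F)) = 0 := by
      refine hΨc.eq_zero_of_sum_smul fun Q => ?_
      by_contra hne
      have hmem : ∑ j, Ψ (c j) Q • (g j : F) ∈ E :=
        sum_mem fun j _ => E.smul_mem (g j).2
      have hu := Q.2.1.2 _ hmem hne
      obtain ⟨I, hI, hQI⟩ := Q.2.1.1
      refine hf Q.1 (hXh _ Q.2) (fun h => Q.2.2 ⟨hXh _ Q.2, h⟩) ⟨⟨I, hI⟩, hQI.1.2⟩ c _ hg' (fun j => ?_) ?_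
      · by_cases h0 : (g j : F) = 0
        · exact Or.inl h0
        · exact Or.inr (Q.2.1.2 _ (g j).2 h0)
      · convert hu using 3 with j
        rw [hΨ, Algebra.smul_def, mul_comm]
    intro j
    exact Subtype.ext (congrFun h0 j)
  have hF := hN _ _ hcV hE
  have := hF.fintype_card_le_finrank
  simp at this

end

section
variable {R F S T Λ Γ : Type*} [CommRing R] [Field F] [Algebra R F] [CommRing S] [CommRing T]
  [Algebra S T] [Field Λ] [LinearOrderedCommGroupWithZero Γ]

/-- The elements of `T` that can be written as fractions of elements of `S` whose denominators
are units with respect to the valuation `v`. -/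
def centerSubring (S : Type*) {T : Type*} [CommRing S] [CommRing T] [Algebra S T]
    (κ : T →+* Λ) (v : Valuation Λ Γ) : Subring T where
  carrier := {τ | ∃ s₁ s₂ : S, v (κ (algebraMap S T s₂)) = 1 ∧ τ * algebraMap S T s₂ = algebraMap S T s₁}
  mul_mem' := by
    rintro a b ⟨s₁, s₂, h, ha⟩ ⟨r₁, r₂, h', hb⟩
    refine ⟨s₁ * r₁, s₂ * r₂, by simp [h, h'], ?_⟩
    rw [map_mul, map_mul, ← ha, ← hb]; ring
  one_mem' := ⟨1, 1, by simp, by simp⟩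
  add_mem' := by
    rintro a b ⟨s₁, s₂, h, ha⟩ ⟨r₁, r₂, h', hb⟩
    refine ⟨s₁ * r₂ + r₁ * s₂, s₂ * r₂, by simp [h, h'], ?_⟩
    rw [map_mul, map_add, map_mul, map_mul, ← ha, ← hb]; ring
  zero_mem' := ⟨0, 1, by simp, by simp⟩
  neg_mem' := by
    rintro a ⟨s₁, s₂, h, ha⟩
    exact ⟨-s₁, s₂, h, by rw [neg_mul, ha, map_neg]⟩

variable {κ : T →+* Λ} {v : Valuation Λ Γ}

theorem algebraMap_mem_centerSubring (s : S) : algebraMap S T s ∈ centerSubring S κ v :=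
  ⟨s, 1, by simp, by simp⟩

theorem le_one_of_mem_centerSubring (hS : ∀ s : S, v (κ (algebraMap S T s)) ≤ 1) {τ : T}
    (hτ : τ ∈ centerSubring S κ v) : v (κ τ) ≤ 1 := by
  obtain ⟨s₁, s₂, h, ha⟩ := hτ
  have := hS s₁
  rwa [← ha, map_mul, map_mul, h, mul_one] at this

variable [IsDomain R] [IsFractionRing R F] {f f₁ f₂ : R →+* S} {ψ ψ₁ ψ₂ : F →+* T}

omit [IsDomain R] [IsFractionRing R F] in
theorem apply_mem_centerSubring_of_unitAt (hT : ∀ τ, κ τ ≠ 0 → IsUnit τ)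
    (hψ : ∀ r, ψ (algebraMap R F r) = algebraMap S T (f r)) {P : Ideal R}
    (hP : CenteredAt (κ.comp ψ) v P) {b : F} (hb : UnitAt P b) : ψ b ∈ centerSubring S κ v := by
  obtain ⟨r₁, r₂, h1, h2, h3⟩ := hb
  refine ⟨f r₁, f r₂, ?_, ?_⟩
  · rw [← hψ]; exact hP.eq_one_iff.2 h2
  · rw [← hψ, ← hψ, ← map_mul, mul_comm, h3]

theorem exists_eq_mul_of_map_le (hT : ∀ τ, κ τ ≠ 0 → IsUnit τ)
    (hψ₁ : ∀ r, ψ₁ (algebraMap R F r) = algebraMap S T (f₁ r))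
    (hψ₂ : ∀ r, ψ₂ (algebraMap R F r) = algebraMap S T (f₂ r)) {P₂ I : Ideal R}
    (hP₂ : CenteredAt (κ.comp ψ₂) v P₂) (hI : I.map f₁ ≤ I.map f₂) (hIP : I ≤ P₂) {t₁ t₂ : R}
    (ht₁ : t₁ ∈ I) (ht₂ : IsUniformizer P₂ t₂) :
    ∃ w ∈ centerSubring S κ v, ψ₁ (algebraMap R F t₁) = w * ψ₂ (algebraMap R F t₂) := by
  rw [hψ₁]
  have h1 : f₁ t₁ ∈ I.map f₂ := hI (Ideal.mem_map_of_mem _ ht₁)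
  generalize f₁ t₁ = s at h1
  induction h1 using Submodule.span_induction with
  | zero => exact ⟨0, zero_mem _, by simp⟩
  | add a b _ _ ha hb =>
    obtain ⟨w, hw, ha⟩ := ha
    obtain ⟨w', hw', hb⟩ := hb
    exact ⟨w + w', add_mem hw hw', by rw [map_add, ha, hb, add_mul]⟩
  | smul c a _ ha =>
    obtain ⟨w, hw, ha⟩ := ha
    exact ⟨algebraMap S T c * w, mul_mem (algebraMap_mem_centerSubring c) hw,
      by rw [smul_eq_mul, map_mul, ha, mul_assoc]⟩
  | mem a ha =>
    obtain ⟨r, hr, rfl⟩ := ha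
    by_cases hr0 : r = 0
    · exact ⟨0, zero_mem _, by simp [hr0]⟩
    obtain ⟨n, r₁, r₂, h1, h2, h3⟩ := ht₂.exists_eq r hr0
    have hn : n ≠ 0 := by
      rintro rfl
      rw [pow_zero, mul_one] at h3
      exact h1 (h3 ▸ P₂.mul_mem_left r₂ (hIP hr))
    obtain ⟨n, rfl⟩ := Nat.exists_eq_succ_of_ne_zero hn
    refine ⟨ψ₂ (algebraMap R F r₁ / algebraMap R F r₂) * ψ₂ (algebraMap R F t₂) ^ n,
      mul_mem (apply_mem_centerSubring_of_unitAt hT hψ₂ hP₂ ⟨r₁, r₂, h1, h2, ?_⟩)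
        (pow_mem (by rw [hψ₂]; exact algebraMap_mem_centerSubring _) n), ?_⟩
    · refine mul_div_cancel₀ _ ?_
      rw [Ne, FaithfulSMul.algebraMap_eq_zero_iff]; rintro rfl; exact h2 P₂.zero_mem
    · rw [← hψ₂, ← map_pow, mul_assoc, ← map_mul, ← map_mul, ← map_pow, ← map_mul]
      congr 1
      rw [div_mul_eq_mul_div, ← map_mul, ← pow_succ, ← h3, map_mul, mul_div_cancel_left₀]
      rw [Ne, FaithfulSMul.algebraMap_eq_zero_iff]; rintro rfl; exact h2 P₂.zero_mem

theorem exists_unit_mul_of_map_eq (hT : ∀ τ, κ τ ≠ 0 → IsUnit τ)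
    (hψ₁ : ∀ r, ψ₁ (algebraMap R F r) = algebraMap S T (f₁ r))
    (hψ₂ : ∀ r, ψ₂ (algebraMap R F r) = algebraMap S T (f₂ r)) {P₁ P₂ I : Ideal R}
    (hP₁ : CenteredAt (κ.comp ψ₁) v P₁)
    (hP₂ : CenteredAt (κ.comp ψ₂) v P₂) (hI : I.map f₁ = I.map f₂) (hIP₁ : I ≤ P₁) (hIP₂ : I ≤ P₂)
    {t₁ t₂ : R} (ht₁ : IsUniformizer P₁ t₁) (ht₁I : t₁ ∈ I) (ht₂ : IsUniformizer P₂ t₂) (ht₂I : t₂ ∈ I) :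
    ∃ w ∈ centerSubring S κ v, ∃ w' ∈ centerSubring S κ v, w * w' = 1 ∧
      ψ₁ (algebraMap R F t₁) = w * ψ₂ (algebraMap R F t₂) := by
  obtain ⟨w, hw, h⟩ := exists_eq_mul_of_map_le hT hψ₁ hψ₂ hP₂ hI.le hIP₂ ht₁I ht₂
  obtain ⟨w', hw', h'⟩ := exists_eq_mul_of_map_le hT hψ₂ hψ₁ hP₁ hI.ge hIP₁ ht₂I ht₁
  refine ⟨w, hw, w', hw', ?_, h⟩
  have hu : IsUnit (ψ₁ (algebraMap R F t₁)) := by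
    refine (IsUnit.mk0 _ ?_).map ψ₁
    rw [Ne, FaithfulSMul.algebraMap_eq_zero_iff]; exact ht₁.ne_zero
  rw [h', ← mul_assoc] at h
  exact hu.mul_right_cancel (by rw [one_mul]; exact h.symm)

omit [IsDomain R] [IsFractionRing R F] in
theorem le_of_map_eq (hS : ∀ s : S, v (κ (algebraMap S T s)) ≤ 1)
    (hψ₁ : ∀ r, ψ₁ (algebraMap R F r) = algebraMap S T (f₁ r))
    (hψ₂ : ∀ r, ψ₂ (algebraMap R F r) = algebraMap S T (f₂ r)) {P₁ P₂ I : Ideal R}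
    (hP₁ : CenteredAt (κ.comp ψ₁) v P₁)
    (hP₂ : CenteredAt (κ.comp ψ₂) v P₂) (hI : I.map f₁ = I.map f₂) (hIP₁ : I ≤ P₁) : I ≤ P₂ := by
  intro r hr
  rw [← hP₂.lt_one_iff, RingHom.comp_apply, hψ₂]
  have h1 : f₂ r ∈ I.map f₁ := hI ▸ Ideal.mem_map_of_mem _ hr
  generalize f₂ r = s at h1
  induction h1 using Submodule.span_induction with
  | zero => simp
  | add a b _ _ ha hb => rw [map_add, map_add]; exact v.map_add_lt ha hb
  | smul c a _ ha =>
    rw [smul_eq_mul, map_mul, map_mul, map_mul]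
    exact (mul_le_of_le_one_left' (hS c)).trans_lt ha
  | mem a ha =>
    obtain ⟨r, hr, rfl⟩ := ha
    have := (hP₁.lt_one_iff r).2 (hIP₁ hr)
    rwa [RingHom.comp_apply, hψ₁] at this

end

section
variable {K R F S T Λ Γ : Type*} [Field K] [CharZero K] [CommRing R] [IsDomain R] [IsNoetherianRing R]
  [Algebra K R] [Field F] [Algebra K F]
  [Algebra R F] [IsScalarTower K R F] [IsFractionRing R F] {d : ℕ} {x : Fin d → R}
  {y m : R} {P : Polynomial (MvPolynomial (Fin d) K)}
  [CommRing S] [CommRing T] [Algebra S T] [Algebra K T] [Field Λ] [IsAlgClosed Λ] [Algebra K Λ]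
  [LinearOrderedCommGroupWithZero Γ] {κ : T →ₐ[K] Λ} {ψ ψ₁ ψ₂ : F →ₐ[K] T} {f f₁ f₂ : R →+* S}
  {v : Valuation Λ Γ}

/-- The conditions on the valuation `v` under which the logarithmic forms pulled back along `ψ`
can be controlled. -/
structure GoodAt (x : Fin d → R) (m : R) (κ : T →ₐ[K] Λ) (ψ : F →ₐ[K] T) (v : Valuation Λ Γ) : Prop where
  generic : GenericAt K (fun i => κ (ψ (algebraMap R F (x i)))) v
  eq_one : v (κ (ψ (algebraMap R F m))) = 1

/-- The ideal of `R` consisting of the elements whose images in `S` have valuation less than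
one. -/
def centerIdeal (κ : T →ₐ[K] Λ) (f : R →+* S) (v : Valuation Λ Γ) (hS : ∀ s : S, v (κ (algebraMap S T s)) ≤ 1) :
    Ideal R where
  carrier := {r | v (κ (algebraMap S T (f r))) < 1}
  zero_mem' := by simp
  add_mem' {a b} ha hb := by
    simp only [Set.mem_ofPred_eq, map_add] at ha hb ⊢; exact v.map_add_lt ha hb
  smul_mem' c a ha := by
    simp only [Set.mem_ofPred_eq, smul_eq_mul, map_mul] at ha ⊢
    exact (mul_le_of_le_one_left' (hS _)).trans_lt ha

omit [CharZero K] [IsDomain R] [IsNoetherianRing R] [Algebra K R] [IsScalarTower K R F]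
  [IsFractionRing R F] [IsAlgClosed Λ] in
theorem centeredAt_centerIdeal (hS : ∀ s : S, v (κ (algebraMap S T s)) ≤ 1)
    (hψ : ∀ r, ψ (algebraMap R F r) = algebraMap S T (f r)) :
    CenteredAt ((κ.comp ψ : F →ₐ[K] Λ) : F →+* Λ) v (centerIdeal κ f v hS) := by
  refine ⟨fun r => ?_, fun r => ?_⟩
  · have := hS (f r)
    rwa [← hψ] at this
  · change v (κ (ψ (algebraMap R F r))) < 1 ↔ v (κ (algebraMap S T (f r))) < 1
    rw [hψ]

/-- The relation between the two pullbacks of a hypersurface at a good valuation. -/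
def LocalPair (S : Type*) [CommRing S] [Algebra S T] (I : Ideal R) (κ : T →ₐ[K] Λ) (ψ₁ ψ₂ : F →ₐ[K] T) (v : Valuation Λ Γ) (t₁ t₂ : F) : Prop :=
  (t₁ = 1 ∧ t₂ = 1) ∨ ∃ (Q₁ Q₂ : Ideal R) (t₁' t₂' : R), t₁ = algebraMap R F t₁' ∧
    t₂ = algebraMap R F t₂' ∧ CenteredAt ((κ.comp ψ₁ : F →ₐ[K] Λ) : F →+* Λ) v Q₁ ∧
    CenteredAt ((κ.comp ψ₂ : F →ₐ[K] Λ) : F →+* Λ) v Q₂ ∧ Q₁ ∈ I.minimalPrimes ∧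
    IsUniformizer Q₁ t₁' ∧ IsUniformizer Q₂ t₂' ∧ ∃ w ∈ centerSubring S (κ : T →+* Λ) v,
    ∃ w' ∈ centerSubring S (κ : T →+* Λ) v, w * w' = 1 ∧ ψ₁ t₁ = w * ψ₂ t₂

theorem Presentation.exists_localPair (h : Presentation F x y P m)
    (hT : ∀ τ, κ τ ≠ 0 → IsUnit τ) (hS : ∀ s : S, v (κ (algebraMap S T s)) ≤ 1)
    (hψ₁ : ∀ r, ψ₁ (algebraMap R F r) = algebraMap S T (f₁ r))
    (hψ₂ : ∀ r, ψ₂ (algebraMap R F r) = algebraMap S T (f₂ r))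
    (h₁ : GoodAt x m κ ψ₁ v) (h₂ : GoodAt x m κ ψ₂ v) {I : Ideal R} (hI : IsHypersurfaceIdeal I)
    (hmap : I.map f₁ = I.map f₂) {c : Fin d → K} {p : MvPolynomial (Fin d) K}
    (hSec : SectionData (I.comap (evPt x y)) P c p)
    {θ : Fin d → F} (hθ : IsLogCoeff (I.comap (evPt x y)) P c
      (fun i => algebraMap R F (x i)) (algebraMap R F y) θ)
    {ϖ : Λ} :
    ∃ t₁ t₂ : F, t₁ ≠ 0 ∧ t₂ ≠ 0 ∧ v (κ (ψ₁ t₁)) = v (κ (ψ₂ t₂)) ∧ LocalPair S I κ ψ₁ ψ₂ v t₁ t₂ ∧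
    ∀ D : Derivation K Λ Λ, LogGood v ϖ D →
    v (ϖ * (∑ b, κ (ψ₁ (θ b)) * D (κ (ψ₁ (algebraMap R F (x b)))) - D (κ (ψ₁ t₁)) / κ (ψ₁ t₁))) < 1 ∧
    v (ϖ * (∑ b, κ (ψ₂ (θ b)) * D (κ (ψ₂ (algebraMap R F (x b)))) - D (κ (ψ₂ t₂)) / κ (ψ₂ t₂))) < 1 := by
  have hc₁ := centeredAt_centerIdeal (ψ := ψ₁) hS hψ₁
  have hc₂ := centeredAt_centerIdeal (ψ := ψ₂) hS hψ₂
  set Q₁ := centerIdeal κ f₁ v hS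
  set Q₂ := centerIdeal κ f₂ v hS
  have hm₁ : m ∉ Q₁ := hc₁.eq_one_iff.1 h₁.eq_one
  have hm₂ : m ∉ Q₂ := hc₂.eq_one_iff.1 h₂.eq_one
  have hD₀ : LogGood v (1 : Λ) (0 : Derivation K Λ Λ) := ⟨by simp, by simp⟩
  by_cases hle : I ≤ Q₁
  · have hle₂ : I ≤ Q₂ := le_of_map_eq (κ := (κ : T →+* Λ)) (ψ₁ := (ψ₁ : F →+* T)) (ψ₂ := (ψ₂ : F →+* T))
      hS hψ₁ hψ₂ hc₁ hc₂ hmap hle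
    have hQ₁ := (h.logCoeff_sub_lt_one hc₁ hm₁ hSec hθ hD₀ hle h₁.generic).1
    have hQ₂ := (h.logCoeff_sub_lt_one hc₂ hm₂ hSec hθ hD₀ hle₂ h₂.generic).1
    obtain ⟨t₁, ht₁I, ht₁⟩ := exists_isUniformizer (F := F) hI.1 hQ₁ (hI.2.2 _ hQ₁) hm₁ h.cond
    obtain ⟨t₂, ht₂I, ht₂⟩ := exists_isUniformizer (F := F) hI.1 hQ₂ (hI.2.2 _ hQ₂) hm₂ h.cond
    obtain ⟨w, hw, w', hw', hww, heq⟩ := exists_unit_mul_of_map_eq (κ := (κ : T →+* Λ))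
      (ψ₁ := (ψ₁ : F →+* T)) (ψ₂ := (ψ₂ : F →+* T)) hT hψ₁ hψ₂ hc₁ hc₂ hmap hle hle₂ ht₁ ht₁I ht₂ ht₂I
    refine ⟨algebraMap R F t₁, algebraMap R F t₂, ?_, ?_, ?_, Or.inr ⟨Q₁, Q₂, t₁, t₂, rfl, rfl, hc₁, hc₂,
      hQ₁, ht₁, ht₂, w, hw, w', hw', hww, heq⟩, fun D hD => ⟨?_, ?_⟩⟩
    · rw [Ne, FaithfulSMul.algebraMap_eq_zero_iff]; exact ht₁.ne_zero
    · rw [Ne, FaithfulSMul.algebraMap_eq_zero_iff]; exact ht₂.ne_zero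
    · have hw1 := le_one_of_mem_centerSubring hS hw
      have hw1' := le_one_of_mem_centerSubring hS hw'
      have hv1 : v (κ w) = 1 := by
        refine le_antisymm hw1 ?_
        have := congrArg (fun τ => v (κ τ)) hww
        simp only [map_mul, map_one] at this
        rw [← this]
        exact mul_le_of_le_one_right' hw1'
      have := congrArg (fun τ => v (κ τ)) heq
      simp only [map_mul, hv1, one_mul] at this
      exact this
    · exact (h.logCoeff_sub_lt_one hc₁ hm₁ hSec hθ hD hle h₁.generic).2 t₁ ht₁I ht₁
    · exact (h.logCoeff_sub_lt_one hc₂ hm₂ hSec hθ hD hle₂ h₂.generic).2 t₂ ht₂I ht₂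
  · have hle₂ : ¬ I ≤ Q₂ := fun h => hle <|
      le_of_map_eq (κ := (κ : T →+* Λ)) (ψ₁ := (ψ₂ : F →+* T)) (ψ₂ := (ψ₁ : F →+* T))
      hS hψ₂ hψ₁ hc₂ hc₁ hmap.symm h
    refine ⟨1, 1, one_ne_zero, one_ne_zero, by simp, Or.inl ⟨rfl, rfl⟩, fun D hD => ⟨?_, ?_⟩⟩
    · simp only [map_one, Derivation.map_one_eq_zero, zero_div, sub_zero]
      exact h.logCoeff_lt_one hc₁ hm₁ hSec hθ hD hle
    · simp only [map_one, Derivation.map_one_eq_zero, zero_div, sub_zero]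
      exact h.logCoeff_lt_one hc₂ hm₂ hSec hθ hD hle₂

end

section
variable {K Λ Γ : Type*} [Field K] [CharZero K] [Field Λ] [Algebra K Λ]
  [LinearOrderedCommGroupWithZero Γ] {v : Valuation Λ Γ} {l : ℕ} {u : Fin l → Λ}
  {π : MvPolynomial (Fin l) K}

theorem LiesOverChart.logGood_mul (hu : IsTranscendenceBasis K u) (hπ : Prime π)
    (hv : LiesOverChart u π v) {D : Derivation K Λ Λ} {G : Λ} (hD : ∀ i, v (G * D (u i)) ≤ 1) :
    LogGood v (aeval u π * G) D := by
  have := hv.logGood hu hπ (D := G • D) hD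
  refine ⟨fun f hf => ?_, fun f => ?_⟩
  · rw [mul_assoc]; exact this.lt_one f hf
  · rw [mul_assoc]; exact this.le f

end

section
variable {K R F : Type*} [Field K] [CharZero K] [CommRing R] [IsDomain R]
  [Algebra K R] [Field F] [Algebra K F]
  [Algebra R F] [IsScalarTower K R F] [IsFractionRing R F] {d : ℕ} {x : Fin d → R}
  {y m : R} {P : Polynomial (MvPolynomial (Fin d) K)}

universe u₁ in
theorem Presentation.exists_logCoeff_bound (h : Presentation F x y P m) {Λ : Type*} [Field Λ] [IsAlgClosed Λ]
    [Algebra K Λ] (σ : F →ₐ[K] Λ) :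
    ∃ M : ℕ, ∀ {Γ : Type u₁} [LinearOrderedCommGroupWithZero Γ] {v : Valuation Λ Γ},
    (∀ c : K, v (algebraMap K Λ c) ≤ 1) → ∀ {G : Λ}, G ≠ 0 → v G ≤ 1 →
    (∀ i, v (G * σ (algebraMap R F (x i))) ≤ 1) → v (G * σ (algebraMap R F y)) ≤ 1 →
    v (G * (σ (algebraMap R F (evPt x y P.derivative)))⁻¹) ≤ 1 →
    ∀ {I : Ideal R} {c p θ}, SectionData (I.comap (evPt x y)) P c p → IsLogCoeff (I.comap (evPt x y)) P c
      (fun i => algebraMap R F (x i)) (algebraMap R F y) θ → ∀ {ϖ : Λ} {D : Derivation K Λ Λ},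
      (∀ f, v (ϖ * D f) ≤ v f) →
      v (ϖ * G ^ M * ∑ b, σ (θ b) * D (σ (algebraMap R F (x b)))) ≤ 1 := by
  have hx : IsTranscendenceBasis K fun i => algebraMap R F (x i) :=
    isTranscendenceBasis_of_isIntegral h.inj h.int
  obtain ⟨M, hM⟩ := exists_logForm_bound.{_, _, _, u₁} Λ P
  refine ⟨M, fun {Γ} _ {v} hK {G} hG0 hG hGx hGy hGP {I c p θ} hS hθ {ϖ D} hD => ?_⟩
  have hvG : v G ≠ 0 := v.ne_zero_iff.2 hG0
  have key {s : Λ} (hs : v (G * s) ≤ 1) : v s ≤ (v G)⁻¹ := by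
    rw [map_mul, mul_comm] at hs
    rwa [← one_div, le_div_iff₀ (zero_lt_iff.2 hvG)]
  have h1 := hM hS hK (γ := (v G)⁻¹) ((one_le_inv₀ (zero_lt_iff.2 hvG)).2 hG)
    (x := fun i => σ (algebraMap R F (x i))) (fun i => key (hGx i))
    (y := σ (algebraMap R F y)) (key hGy) (by rw [apply_evPt]; simpa only [map_inv₀] using key hGP) (D := D) hD
  rw [hθ.logForm_eq hS hx σ D] at h1
  rw [mul_right_comm, map_mul, map_pow]
  calc _ ≤ (v G)⁻¹ ^ M * v G ^ M := mul_le_mul_left h1 _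
    _ = 1 := by rw [← mul_pow, inv_mul_cancel₀ hvG, one_pow]

end

universe w in
theorem finiteDimensional_span_of_good {K : Type*} {L Λ : Type w} [Field K] [CharZero K]
    [Field L] [Field Λ] [Algebra K L] [Algebra K Λ] [Algebra L Λ] [IsScalarTower K L Λ]
    [IsAlgClosed Λ] [Algebra.IsAlgebraic L Λ] [Algebra.EssFiniteType K L] (W : Set L)
    (hW : ∀ {l : ℕ} (u : Fin l → L), IsTranscendenceBasis K u →
      ∃ (e g : MvPolynomial (Fin l) K) (k M : ℕ), e ≠ 0 ∧ g ≠ 0 ∧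
        ∀ {Γ : Type w} [LinearOrderedCommGroupWithZero Γ] (v : Valuation Λ Γ)
          (π : MvPolynomial (Fin l) K), Prime π →
          LiesOverChart (fun i => algebraMap L Λ (u i)) π v →
          ∀ s ∈ W, (¬ π ∣ e → v (algebraMap L Λ s) ≤ 1) ∧
            v (aeval (fun i => algebraMap L Λ (u i)) π ^ k *
              aeval (fun i => algebraMap L Λ (u i)) g ^ M * algebraMap L Λ s) ≤ 1) :
    FiniteDimensional K (Submodule.span K W) := by
  refine finiteDimensional_span_of_charts (Λ := Λ) W fun {l} u hu => ?_
  obtain ⟨e, g, k, M, he, hg, H⟩ := hW u hu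
  refine ⟨e ^ k * g ^ M, mul_ne_zero (pow_ne_zero _ he) (pow_ne_zero _ hg), fun Γ _ v π hπ hv s hs => ?_⟩
  obtain ⟨h1, h2⟩ := H v π hπ hv s hs
  have hA (a : MvPolynomial (Fin l) K) : algebraMap L Λ (aeval u a) =
      aeval (fun i => algebraMap L Λ (u i)) a := (aeval_algebraMap_apply Λ u a).symm
  rw [map_mul (algebraMap L Λ), hA, map_mul (aeval _), map_pow (aeval _), map_pow (aeval _)]
  by_cases hd : π ∣ e
  · obtain ⟨q, rfl⟩ := hd
    have he (a b c d : Λ) : (a * b) ^ k * c ^ M * d = b ^ k * (a ^ k * c ^ M * d) := by ring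
    rw [map_mul (aeval _), he, map_mul]
    refine mul_le_one' ?_ h2
    rw [map_pow]
    exact pow_le_one' (hv q).1 k
  · rw [map_mul, map_mul, map_pow, map_pow]
    exact mul_le_one' (mul_le_one' (pow_le_one' (hv e).1 k) (pow_le_one' (hv g).1 M)) (h1 hd)

section
variable {K L Λ Γ : Type*} [Field K] [CharZero K] [Field L] [Algebra K L] [Field Λ] [Algebra K Λ]
  [Algebra L Λ] [IsScalarTower K L Λ]
  [LinearOrderedCommGroupWithZero Γ] {v : Valuation Λ Γ} {l : ℕ} {u : Fin l → L}
  {π : MvPolynomial (Fin l) K}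

theorem Derivation.exists_extend (D : Derivation K L L) :
    ∃ D' : Derivation K Λ Λ, ∀ a, D' (algebraMap L Λ a) = algebraMap L Λ (D a) :=
  have := charZero_of_injective_algebraMap (algebraMap K L).injective
  exists_derivation_extend (IsScalarTower.toAlgHom K L Λ) (algebraMap L Λ).injective
    ((IsScalarTower.toAlgHom K L Λ).toLinearMap ∘ₗ (D : L →ₗ[K] L)) fun a b => by simp

omit [CharZero K] [IsScalarTower K L Λ] in
theorem LogGood.comap {D : Derivation K L L} {D' : Derivation K Λ Λ}
    (hD : ∀ a, D' (algebraMap L Λ a) = algebraMap L Λ (D a)) {w : L}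
    (h : LogGood v (algebraMap L Λ w) D') : LogGood (v.comap (algebraMap L Λ)) w D := by
  refine ⟨fun f hf => ?_, fun f => ?_⟩
  · have := h.lt_one _ hf
    rwa [hD, ← map_mul] at this
  · have := h.le (algebraMap L Λ f)
    rwa [hD, ← map_mul] at this

omit [CharZero K] in
theorem algebraMap_aeval (u : Fin l → L) (a : MvPolynomial (Fin l) K) :
    algebraMap L Λ (aeval u a) = aeval (fun i => algebraMap L Λ (u i)) a :=
  (aeval_algebraMap_apply Λ u a).symm

end

section
variable {K R F S T L Γ : Type*} [Field K] [CharZero K] [CommRing R] [IsDomain R] [IsNoetherianRing R]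
  [Algebra K R] [Field F] [Algebra K F]
  [Algebra R F] [IsScalarTower K R F] [IsFractionRing R F] {d : ℕ} (x : Fin d → R)
  (y m : R) (P : Polynomial (MvPolynomial (Fin d) K))
  [CommRing S] [CommRing T] [Algebra S T] [Algebra K T] [Field L] [Algebra K L]
  [LinearOrderedCommGroupWithZero Γ] (κ : T →ₐ[K] L) (ψ ψ₁ ψ₂ : F →ₐ[K] T) (f₁ f₂ : R →+* S)
  (v : Valuation L Γ)

/-- `θ` is the vector of coefficients of the logarithmic form attached to `I`. -/
def IsLogVector (x : Fin d → R) (y : R) (P : Polynomial (MvPolynomial (Fin d) K)) (I : Ideal R)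
    (θ : Fin d → F) : Prop :=
  ∃ c p, SectionData (I.comap (evPt x y)) P c p ∧ IsLogCoeff (I.comap (evPt x y)) P c
    (fun i => algebraMap R F (x i)) (algebraMap R F y) θ

/-- The value at `D` of the pullback along `κ ∘ ψ` of the form `∑ θ_b dx_b`. -/
def formValue (θ : Fin d → F) (D : Derivation K L L) : L :=
  ∑ b, κ (ψ (θ b)) * D (κ (ψ (algebraMap R F (x b))))

/-- The valuations of `L` with parameter `ϖ` at which the two pullbacks of a hypersurface can be
compared. -/
structure GoodValuation {l : ℕ} (u : Fin l → L) (ϖ : L) : Prop where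
  algebraMap_le_one (c : K) : v (algebraMap K L c) ≤ 1
  le_one (s : S) : v (κ (algebraMap S T s)) ≤ 1
  le_one_of_lt (s : L) : v (ϖ * s) < 1 → v s ≤ 1
  logGood (D : Derivation K L L) : (∀ i, v (D (u i)) ≤ 1) → LogGood v ϖ D
  exists_localPair {I : Ideal R} {θ : Fin d → F} : IsHypersurfaceIdeal I → I.map f₁ = I.map f₂ →
    IsLogVector x y P I θ → ∃ t₁ t₂ : F, t₁ ≠ 0 ∧ t₂ ≠ 0 ∧ v (κ (ψ₁ t₁)) = v (κ (ψ₂ t₂)) ∧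
      LocalPair S I κ ψ₁ ψ₂ v t₁ t₂ ∧ ∀ D : Derivation K L L, (∀ i, v (D (u i)) ≤ 1) →
      v (ϖ * (formValue x κ ψ₁ θ D - D (κ (ψ₁ t₁)) / κ (ψ₁ t₁))) < 1 ∧
      v (ϖ * (formValue x κ ψ₂ θ D - D (κ (ψ₂ t₂)) / κ (ψ₂ t₂))) < 1

/-- The valuations of `L` with parameter `ϖ` at which `G` clears denominators. -/
structure BoundedValuation (M : ℕ) {l : ℕ} (u : Fin l → L) (ϖ G : L) : Prop where
  parameter_le_one : v ϖ ≤ 1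
  le_one : v G ≤ 1
  mul_le (D : Derivation K L L) : (∀ i, v (G * D (u i)) ≤ 1) → ∀ f, v (ϖ * G * D f) ≤ v f
  formValue_le {I : Ideal R} {θ : Fin d → F} : IsLogVector x y P I θ →
    ∀ D : Derivation K L L, (∀ i, v (G * D (u i)) ≤ 1) →
      v (ϖ * G ^ M * formValue x κ ψ₁ θ D) ≤ 1 ∧ v (ϖ * G ^ M * formValue x κ ψ₂ θ D) ≤ 1

end

section
universe w
variable {K R F S T : Type*} {L Λ : Type w} [Field K] [CharZero K] [CommRing R] [IsDomain R] [IsNoetherianRing R]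
  [Algebra K R] [Field F] [Algebra K F]
  [Algebra R F] [IsScalarTower K R F] [IsFractionRing R F] {d : ℕ} {x : Fin d → R}
  {y m : R} {P : Polynomial (MvPolynomial (Fin d) K)}
  [CommRing S] [CommRing T] [Algebra K S] [Algebra.FiniteType K S] [Algebra S T] [Algebra K T] [IsScalarTower K S T] [Field L] [Algebra K L] [Algebra.EssFiniteType K L]
  [Field Λ] [IsAlgClosed Λ] [Algebra K Λ] [Algebra L Λ] [IsScalarTower K L Λ] [Algebra.IsAlgebraic L Λ]
  {κ : T →ₐ[K] L} {ψ₁ ψ₂ : F →ₐ[K] T} {f₁ f₂ : R →+* S}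

omit [CharZero K] [IsDomain R] [IsNoetherianRing R] [IsFractionRing R F] [IsScalarTower K R F]
  [Algebra K S] [Algebra.FiniteType K S] [IsScalarTower K S T] [Algebra.EssFiniteType K L]
  [IsAlgClosed Λ] [Algebra.IsAlgebraic L Λ] in
theorem LocalPair.comap {Γ : Type*} [LinearOrderedCommGroupWithZero Γ] {v : Valuation Λ Γ} {I : Ideal R}
    {t₁ t₂ : F} (h : LocalPair S I ((IsScalarTower.toAlgHom K L Λ).comp κ) ψ₁ ψ₂ v t₁ t₂) :
    LocalPair S I κ ψ₁ ψ₂ (v.comap (algebraMap L Λ)) t₁ t₂ := by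
  obtain h | ⟨Q₁, Q₂, t₁', t₂', h₁, h₂, hc₁, hc₂, h⟩ := h
  · exact .inl h
  · exact .inr ⟨Q₁, Q₂, t₁', t₂', h₁, h₂, ⟨hc₁.le_one, hc₁.lt_one_iff⟩, ⟨hc₂.le_one, hc₂.lt_one_iff⟩, h⟩

variable (Λ) in
theorem Presentation.exists_goodValuation (h : Presentation F x y P m)
    (hT : ∀ τ, κ τ ≠ 0 → IsUnit τ)
    (hψ₁ : ∀ r, ψ₁ (algebraMap R F r) = algebraMap S T (f₁ r))
    (hψ₂ : ∀ r, ψ₂ (algebraMap R F r) = algebraMap S T (f₂ r))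
    {l : ℕ} {u : Fin l → L} (hu : IsTranscendenceBasis K u) (E : Finset L) :
    ∃ e : MvPolynomial (Fin l) K, e ≠ 0 ∧ ∀ {Γ : Type w} [LinearOrderedCommGroupWithZero Γ]
      (v : Valuation Λ Γ) (π : MvPolynomial (Fin l) K), Prime π →
      LiesOverChart (fun i => algebraMap L Λ (u i)) π v → ¬ π ∣ e →
      GoodValuation x y P κ ψ₁ ψ₂ f₁ f₂ (v.comap (algebraMap L Λ)) u (aeval u π) ∧
      ∀ s ∈ E, v (algebraMap L Λ s) ≤ 1 ∧ (s ≠ 0 → v (algebraMap L Λ s) = 1) := by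
  classical
  have huΛ : IsTranscendenceBasis K fun i => algebraMap L Λ (u i) := hu.algebraMap_comp
  have hx : IsTranscendenceBasis K fun i => algebraMap R F (x i) :=
    isTranscendenceBasis_of_isIntegral h.inj h.int
  let κ' : T →ₐ[K] Λ := (IsScalarTower.toAlgHom K L Λ).comp κ
  obtain ⟨e₁, he₁, H₁⟩ := huΛ.exists_good_residue.{w}
    (hx.1.map' (f := κ'.comp ψ₁) (κ'.comp ψ₁).injective)
  obtain ⟨e₂, he₂, H₂⟩ := huΛ.exists_good_residue.{w}
    (hx.1.map' (f := κ'.comp ψ₂) (κ'.comp ψ₂).injective)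
  obtain ⟨e₃, he₃, H₃⟩ := hu.exists_good_unramified.{w} (Λ := Λ)
  obtain ⟨gen, hgen⟩ := Algebra.FiniteType.out (R := K) (A := S)
  obtain ⟨e₄, he₄, H₄⟩ := huΛ.exists_good.{w}
    (E.image (algebraMap L Λ) ∪ gen.image (fun s => κ' (algebraMap S T s)) ∪
      {κ' (ψ₁ (algebraMap R F m)), κ' (ψ₂ (algebraMap R F m))})
  refine ⟨e₁ * e₂ * e₃ * e₄, by simp [*], fun {Γ} _ v π hπ hv hd => ?_⟩
  have hd₁ : ¬ π ∣ e₁ := fun h => hd (((h.mul_right _).mul_right _).mul_right _)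
  have hd₂ : ¬ π ∣ e₂ := fun h => hd (((h.mul_left _).mul_right _).mul_right _)
  have hd₃ : ¬ π ∣ e₃ := fun h => hd ((h.mul_left _).mul_right _)
  have hd₄ : ¬ π ∣ e₄ := fun h => hd (h.mul_left _)
  have h4 := H₄ v π hv hd₄
  have hS (s : S) : v (κ' (algebraMap S T s)) ≤ 1 := by
    have hs : s ∈ Algebra.adjoin K (gen : Set S) := hgen ▸ Algebra.mem_top
    induction hs using Algebra.adjoin_induction with
    | mem s hs => exact (h4 _ (by simp only [Finset.mem_union, Finset.mem_image]; exact .inl (.inr ⟨s, hs, rfl⟩))).1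
    | algebraMap c =>
      rw [← IsScalarTower.algebraMap_apply, AlgHom.commutes]
      exact hv.algebraMap_le_one c
    | add a b _ _ ha hb => simp only [map_add]; exact v.map_add_le ha hb
    | mul a b _ _ ha hb => simp only [map_mul]; exact mul_le_one' ha hb
  have hm : m ≠ 0 := h.ne_zero
  have hm' : algebraMap R F m ≠ 0 := by rwa [Ne, FaithfulSMul.algebraMap_eq_zero_iff]
  have hg₁ : GoodAt x m κ' ψ₁ v := ⟨fun hι ℓ => H₁ v π hπ hv hd₁ hι ℓ,
    (h4 _ (by simp)).2 ((map_ne_zero (κ'.comp ψ₁)).2 hm')⟩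
  have hg₂ : GoodAt x m κ' ψ₂ v := ⟨fun hι ℓ => H₂ v π hπ hv hd₂ hι ℓ,
    (h4 _ (by simp)).2 ((map_ne_zero (κ'.comp ψ₂)).2 hm')⟩
  have hlog {D : Derivation K L L} (hD : ∀ i, v (algebraMap L Λ (D (u i))) ≤ 1) {D' : Derivation K Λ Λ}
      (hD' : ∀ a, D' (algebraMap L Λ a) = algebraMap L Λ (D a)) :
      LogGood v (algebraMap L Λ (aeval u π)) D' := by
    rw [algebraMap_aeval]
    exact hv.logGood huΛ hπ fun i => by rw [hD']; exact hD i
  refine ⟨⟨fun c => ?_, hS, fun s hs => ?_, fun D hD => ?_, fun {I θ} hI hmap ⟨c, p, hSec, hθ⟩ => ?_⟩,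
    fun s hs => ?_⟩
  · change v _ ≤ 1
    rw [← IsScalarTower.algebraMap_apply K L Λ]
    exact hv.algebraMap_le_one c
  · refine H₃ v π hπ hv hd₃ s ?_
    rw [← algebraMap_aeval, ← map_mul]
    exact hs
  · obtain ⟨D', hD'⟩ := D.exists_extend (Λ := Λ)
    exact (hlog hD hD').comap hD'
  · obtain ⟨t₁, t₂, ht₁, ht₂, hv₁, hp, hb⟩ := h.exists_localPair (κ := κ') (fun τ hτ => hT τ fun h0 => hτ (by simp [κ', h0]))
      hS hψ₁ hψ₂ hg₁ hg₂ hI hmap hSec hθ (ϖ := algebraMap L Λ (aeval u π))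
    refine ⟨t₁, t₂, ht₁, ht₂, hv₁, hp.comap, fun D hD => ?_⟩
    obtain ⟨D', hD'⟩ := D.exists_extend (Λ := Λ)
    have hκ (τ : T) : κ' τ = algebraMap L Λ (κ τ) := rfl
    have := hb D' (hlog hD hD')
    simp only [hκ, hD', ← map_mul, ← map_sum, ← map_div₀, ← map_sub] at this
    exact this
  · have := h4 (algebraMap L Λ s) (by simp only [Finset.mem_union, Finset.mem_image]; exact .inl (.inl ⟨s, hs, rfl⟩))
    exact ⟨this.1, fun h0 => this.2 ((map_ne_zero _).2 h0)⟩

end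

section
universe w
variable {K R F S T : Type*} {L Λ : Type w} [Field K] [CharZero K] [CommRing R] [IsDomain R] [IsNoetherianRing R]
  [Algebra K R] [Field F] [Algebra K F]
  [Algebra R F] [IsScalarTower K R F] [IsFractionRing R F] {d : ℕ} {x : Fin d → R}
  {y m : R} {P : Polynomial (MvPolynomial (Fin d) K)}
  [CommRing T] [Algebra K T] [Field L] [Algebra K L] [Algebra.EssFiniteType K L]
  [Field Λ] [IsAlgClosed Λ] [Algebra K Λ] [Algebra L Λ] [IsScalarTower K L Λ] [Algebra.IsAlgebraic L Λ]
  {κ : T →ₐ[K] L} {ψ₁ ψ₂ : F →ₐ[K] T}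

omit [IsNoetherianRing R] [Algebra.EssFiniteType K L] in
variable (Λ) in
theorem Presentation.exists_boundedValuation (h : Presentation F x y P m) (κ : T →ₐ[K] L)
    (ψ₁ ψ₂ : F →ₐ[K] T) : ∃ M : ℕ, ∀ {l : ℕ} {u : Fin l → L}, IsTranscendenceBasis K u →
    ∀ E : Finset L,
    ∃ g : MvPolynomial (Fin l) K, g ≠ 0 ∧ ∀ {Γ : Type w} [LinearOrderedCommGroupWithZero Γ]
      (v : Valuation Λ Γ) (π : MvPolynomial (Fin l) K), Prime π →
      LiesOverChart (fun i => algebraMap L Λ (u i)) π v →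
      BoundedValuation x y P κ ψ₁ ψ₂ (v.comap (algebraMap L Λ)) M u (aeval u π) (aeval u g) ∧
      ∀ s ∈ E, v (algebraMap L Λ (aeval u g * s)) ≤ 1 := by
  classical
  let κ' : T →ₐ[K] Λ := (IsScalarTower.toAlgHom K L Λ).comp κ
  obtain ⟨M₁, hM₁⟩ := h.exists_logCoeff_bound.{w} (κ'.comp ψ₁)
  obtain ⟨M₂, hM₂⟩ := h.exists_logCoeff_bound.{w} (κ'.comp ψ₂)
  refine ⟨M₁ + M₂ + 1, fun {l u} hu E => ?_⟩
  have huΛ : IsTranscendenceBasis K fun i => algebraMap L Λ (u i) := hu.algebraMap_comp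
  obtain ⟨g, hg, H⟩ := huΛ.exists_clearDen
    (E.image (algebraMap L Λ) ∪ Finset.univ.image (fun i => κ' (ψ₁ (algebraMap R F (x i)))) ∪
      Finset.univ.image (fun i => κ' (ψ₂ (algebraMap R F (x i)))) ∪
      {κ' (ψ₁ (algebraMap R F y)), κ' (ψ₂ (algebraMap R F y)),
       (κ' (ψ₁ (algebraMap R F (evPt x y P.derivative))))⁻¹,
       (κ' (ψ₂ (algebraMap R F (evPt x y P.derivative))))⁻¹})
  refine ⟨g, hg, fun {Γ} _ v π hπ hv => ?_⟩
  have h4 := H v π hv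
  have hG1 : v (algebraMap L Λ (aeval u g)) ≤ 1 := by rw [algebraMap_aeval]; exact (hv g).1
  have hG0 : algebraMap L Λ (aeval u g) ≠ 0 := by
    rw [algebraMap_aeval]
    exact (map_ne_zero_iff _ huΛ.1).2 hg
  rw [← algebraMap_aeval] at h4
  have hlog {D : Derivation K L L} (hD : ∀ i, v (algebraMap L Λ (aeval u g * D (u i))) ≤ 1) {D' : Derivation K Λ Λ}
      (hD' : ∀ a, D' (algebraMap L Λ a) = algebraMap L Λ (D a)) :
      LogGood v (algebraMap L Λ (aeval u π * aeval u g)) D' := by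
    rw [map_mul, algebraMap_aeval u π]
    exact hv.logGood_mul huΛ hπ fun i => by rw [hD', ← map_mul]; exact hD i
  have hKv := fun c => hv.algebraMap_le_one c
  refine ⟨⟨?_, hG1, fun D hD => ?_, fun {I θ} ⟨c, p, hSec, hθ⟩ D hD => ?_⟩, fun s hs => ?_⟩
  · change v _ ≤ 1
    rw [algebraMap_aeval]; exact (hv π).1
  · obtain ⟨D', hD'⟩ := D.exists_extend (Λ := Λ)
    exact ((hlog hD hD').comap hD').le
  · obtain ⟨D', hD'⟩ := D.exists_extend (Λ := Λ)
    have hκ (τ : T) : κ' τ = algebraMap L Λ (κ τ) := rfl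
    have b₁ := hM₁ hKv hG0 hG1 (fun i => h4 _ (by simp)) (h4 _ (by simp)) (h4 _ (by simp))
      hSec hθ (hlog hD hD').le
    have b₂ := hM₂ hKv hG0 hG1 (fun i => h4 _ (by simp)) (h4 _ (by simp)) (h4 _ (by simp))
      hSec hθ (hlog hD hD').le
    simp only [AlgHom.comp_apply, hκ, hD', ← map_mul (algebraMap L Λ), ← map_sum, ← map_pow (algebraMap L Λ)] at b₁ b₂
    have hp (N : ℕ) : v (algebraMap L Λ (aeval u g ^ N)) ≤ 1 := by
      rw [map_pow, map_pow]; exact pow_le_one' hG1 N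
    constructor
    · have := mul_le_one' (hp M₂) b₁
      rw [← map_mul, ← map_mul] at this
      convert this using 1
      refine congrArg (v ∘ algebraMap L Λ) ?_
      simp only [formValue]; ring
    · have := mul_le_one' (hp M₁) b₂
      rw [← map_mul, ← map_mul] at this
      convert this using 1
      refine congrArg (v ∘ algebraMap L Λ) ?_
      simp only [formValue]; ring
  · rw [map_mul]
    exact h4 _ (by simp only [Finset.mem_union, Finset.mem_image]; exact .inl (.inl (.inl ⟨s, hs, rfl⟩)))

end

section
universe w
variable {K R F S T : Type*} {L : Type w} [Field K] [CharZero K] [CommRing R] [IsDomain R] [IsNoetherianRing R]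
  [Algebra K R] [Field F] [Algebra K F]
  [Algebra R F] [IsScalarTower K R F] [IsFractionRing R F] {d : ℕ} {x : Fin d → R}
  {y m : R} {P : Polynomial (MvPolynomial (Fin d) K)}
  [CommRing S] [CommRing T] [Algebra K S] [Algebra.FiniteType K S] [Algebra S T] [Algebra K T] [IsScalarTower K S T] [Field L] [Algebra K L] [Algebra.EssFiniteType K L]
  {κ : T →ₐ[K] L} {ψ₁ ψ₂ : F →ₐ[K] T} {f₁ f₂ : R →+* S}

/-- The boundedness criterion for a set of elements of `L` to span a finite dimensional space. -/
theorem Presentation.finiteDimensional_span (h : Presentation F x y P m)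
    (hT : ∀ τ, κ τ ≠ 0 → IsUnit τ)
    (hψ₁ : ∀ r, ψ₁ (algebraMap R F r) = algebraMap S T (f₁ r))
    (hψ₂ : ∀ r, ψ₂ (algebraMap R F r) = algebraMap S T (f₂ r)) (W : Set L) (k N : ℕ)
    (H : ∀ M, ∀ {l : ℕ} (u : Fin l → L), ∃ E : Finset L,
      ∀ {Γ : Type w} [LinearOrderedCommGroupWithZero Γ] (v : Valuation L Γ) (ϖ : L),
      (GoodValuation x y P κ ψ₁ ψ₂ f₁ f₂ v u ϖ → (∀ e ∈ E, v e ≤ 1 ∧ (e ≠ 0 → v e = 1)) →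
        ∀ s ∈ W, v s ≤ 1) ∧
      (∀ G : L, BoundedValuation x y P κ ψ₁ ψ₂ v M u ϖ G → (∀ e ∈ E, v (G * e) ≤ 1) →
        ∀ s ∈ W, v (ϖ ^ k * G ^ (M + N) * s) ≤ 1)) :
    FiniteDimensional K (Submodule.span K W) := by
  obtain ⟨M, hM⟩ := h.exists_boundedValuation (AlgebraicClosure L) κ ψ₁ ψ₂
  refine finiteDimensional_span_of_good (Λ := AlgebraicClosure L) W fun {l} u hu => ?_
  obtain ⟨E, hE⟩ := H M u
  obtain ⟨e, he, h₁⟩ := h.exists_goodValuation (AlgebraicClosure L) hT hψ₁ hψ₂ hu E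
  obtain ⟨g, hg, h₂⟩ := hM hu E
  refine ⟨e, g, k, M + N, he, hg, fun {Γ} _ v π hπ hv s hs => ⟨fun hd => ?_, ?_⟩⟩
  · obtain ⟨h1, h2⟩ := h₁ v π hπ hv hd
    exact (hE _ _).1 h1 h2 s hs
  · obtain ⟨h1, h2⟩ := h₂ v π hπ hv
    have := (hE (v.comap (algebraMap L (AlgebraicClosure L))) _).2 _ h1 h2 s hs
    rw [← algebraMap_aeval, ← algebraMap_aeval, ← map_pow (algebraMap L _), ← map_pow (algebraMap L _), ← map_mul, ← map_mul]
    exact this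

/-- The first step: the difference of the two pullbacks of the logarithmic forms. -/
theorem Presentation.finiteDimensional_formValue_sub (h : Presentation F x y P m)
    (hT : ∀ τ, κ τ ≠ 0 → IsUnit τ)
    (hψ₁ : ∀ r, ψ₁ (algebraMap R F r) = algebraMap S T (f₁ r))
    (hψ₂ : ∀ r, ψ₂ (algebraMap R F r) = algebraMap S T (f₂ r)) {ℋ : Set (Ideal R)}
    (hℋ : ∀ I ∈ ℋ, I.map f₁ = I.map f₂) {θ : ℋ → Fin d → F} (hθ : IsLogFamily x y P θ)
    (D : Derivation K L L) : FiniteDimensional K (Submodule.span K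
      (Set.range fun I => formValue x κ ψ₁ (θ I) D - formValue x κ ψ₂ (θ I) D)) := by
  classical
  refine h.finiteDimensional_span hT hψ₁ hψ₂ _ 1 0 fun M {l} u =>
    ⟨Finset.univ.image fun i => D (u i), fun {Γ} _ v ϖ => ⟨fun hv hE => ?_, fun G hv hE => ?_⟩⟩
  all_goals
    rintro _ ⟨I, rfl⟩
    obtain ⟨hI, hIθ⟩ := hθ I
  · have hD : ∀ i, v (D (u i)) ≤ 1 := fun i => (hE _ (by simp)).1
    obtain ⟨t₁, t₂, ht₁, ht₂, heq, -, hb⟩ := hv.exists_localPair hI (hℋ _ I.2) hIθ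
    obtain ⟨b₁, b₂⟩ := hb D hD
    have b₃ := (hv.logGood D hD).div_sub_div_lt_one ((map_ne_zero (κ.comp ψ₁)).2 ht₁) heq
    refine hv.le_one_of_lt _ ?_
    have := v.map_sub_lt (v.map_add_lt b₁ b₃) b₂
    convert this using 2
    change _ = ϖ * (_ - D (κ (ψ₁ t₁)) / κ (ψ₁ t₁)) + ϖ * (D (κ (ψ₁ t₁)) / κ (ψ₁ t₁) - _) - _
    ring
  · have hD : ∀ i, v (G * D (u i)) ≤ 1 := fun i => hE _ (by simp)
    obtain ⟨b₁, b₂⟩ := hv.formValue_le hIθ D hD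
    rw [pow_one, add_zero, mul_sub]
    exact (v.map_sub _ _).trans (max_le b₁ b₂)

end

section
variable {R F Λ Γ : Type*} [CommRing R] [IsDomain R] [Field F] [Algebra R F] [IsFractionRing R F]

theorem UnitAt.inv {P : Ideal R} {b : F} (h : UnitAt P b) (h0 : b ≠ 0) : UnitAt P b⁻¹ := by
  obtain ⟨r₁, r₂, h1, h2, h3⟩ := h
  exact ⟨r₂, r₁, h2, h1, by rw [← h3, mul_assoc, mul_inv_cancel₀ h0, mul_one]⟩

theorem UnitAt.mul {P : Ideal R} [P.IsPrime] {a b : F} (ha : UnitAt P a) (hb : UnitAt P b) :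
    UnitAt P (a * b) := by
  obtain ⟨r₁, r₂, h1, h2, h3⟩ := ha
  obtain ⟨s₁, s₂, h1', h2', h3'⟩ := hb
  have hP : P.IsPrime := ‹_›
  exact ⟨r₁ * s₁, r₂ * s₂, hP.mul_notMem h1 h1', hP.mul_notMem h2 h2', by
    rw [map_mul, map_mul, ← h3, ← h3']; ring⟩

theorem IsUniformizer.exists_zpow {P : Ideal R} [P.IsPrime] {t : R} (ht : IsUniformizer P t) {b : F}
    (hb : b ≠ 0) : ∃ (z : ℤ) (ρ : F), ρ ≠ 0 ∧ UnitAt P ρ ∧ b = ρ * algebraMap R F t ^ z := by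
  have hinj {r : R} : algebraMap R F r = 0 ↔ r = 0 := FaithfulSMul.algebraMap_eq_zero_iff R F
  have h0 {r : R} (hr : r ∉ P) : algebraMap R F r ≠ 0 := fun h => hr (by rw [hinj.1 h]; exact P.zero_mem)
  have ht0 : algebraMap R F t ≠ 0 := fun h => ht.ne_zero (hinj.1 h)
  have key (r : R) (hr : r ≠ 0) : ∃ (z : ℤ) (ρ : F), ρ ≠ 0 ∧ UnitAt P ρ ∧
      algebraMap R F r = ρ * algebraMap R F t ^ z := by
    obtain ⟨n, r₁, r₂, h1, h2, h3⟩ := ht.exists_eq r hr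
    refine ⟨n, algebraMap R F r₁ / algebraMap R F r₂, div_ne_zero (h0 h1) (h0 h2),
      ⟨r₁, r₂, h1, h2, mul_div_cancel₀ _ (h0 h2)⟩, ?_⟩
    have := congrArg (algebraMap R F) h3
    rw [map_mul, map_mul, map_pow] at this
    rw [zpow_natCast, div_mul_eq_mul_div, eq_div_iff (h0 h2), ← this, mul_comm]
  obtain ⟨r, s, hs, rfl⟩ := IsFractionRing.div_surjective (A := R) b
  have hs0 := nonZeroDivisors.ne_zero hs
  have hr0 : r ≠ 0 := by rintro rfl; simp at hb
  obtain ⟨z, ρ, h1, h2, h3⟩ := key r hr0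
  obtain ⟨z', ρ', h1', h2', h3'⟩ := key s hs0
  refine ⟨z - z', ρ * ρ'⁻¹, mul_ne_zero h1 (inv_ne_zero h1'), h2.mul (h2'.inv h1'), ?_⟩
  rw [h3, h3', zpow_sub₀ ht0, div_eq_mul_inv, div_eq_mul_inv, mul_inv]; ring

end

section
variable {K R F S T L Γ : Type*} [Field K] [CharZero K] [CommRing R] [IsDomain R]
  [Algebra K R] [Field F] [Algebra K F]
  [Algebra R F] [IsScalarTower K R F] [IsFractionRing R F]
  [CommRing S] [CommRing T] [Algebra S T] [Algebra K T] [Field L] [Algebra K L]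
  [LinearOrderedCommGroupWithZero Γ] {κ : T →ₐ[K] L} {ψ₁ ψ₂ : F →ₐ[K] T} {v : Valuation L Γ}

theorem exists_mem_centerSubring_zpow {t₁ t₂ : F} (h₁ : t₁ ≠ 0) (h₂ : t₂ ≠ 0) {w w' : T}
    (hw : w ∈ centerSubring S (κ : T →+* L) v) (hw' : w' ∈ centerSubring S (κ : T →+* L) v) (hww : w * w' = 1)
    (h : ψ₁ t₁ = w * ψ₂ t₂) (z : ℤ) :
    ∃ W ∈ centerSubring S (κ : T →+* L) v, ψ₁ (t₁ ^ z) = W * ψ₂ (t₂ ^ z) := by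
  obtain ⟨n, rfl | rfl⟩ := z.eq_nat_or_neg
  · refine ⟨w ^ n, pow_mem hw n, ?_⟩
    rw [zpow_natCast, zpow_natCast, map_pow, h, mul_pow, map_pow]
  · refine ⟨w' ^ n, pow_mem hw' n, ?_⟩
    rw [zpow_neg, zpow_neg, zpow_natCast, zpow_natCast]
    have e₁ : ψ₁ (t₁ ^ n)⁻¹ * ψ₁ (t₁ ^ n) = 1 := by
      rw [← map_mul, inv_mul_cancel₀ (pow_ne_zero _ h₁), map_one]
    have e₂ : ψ₂ (t₂ ^ n) * ψ₂ (t₂ ^ n)⁻¹ = 1 := by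
      rw [← map_mul, mul_inv_cancel₀ (pow_ne_zero _ h₂), map_one]
    have e₃ : w ^ n * w' ^ n = 1 := by rw [← mul_pow, hww, one_pow]
    have e₄ : ψ₁ (t₁ ^ n) = w ^ n * ψ₂ (t₂ ^ n) := by rw [map_pow, h, mul_pow, map_pow]
    calc _ = ψ₁ (t₁ ^ n)⁻¹ * (w ^ n * w' ^ n) * (ψ₂ (t₂ ^ n) * ψ₂ (t₂ ^ n)⁻¹) := by rw [e₂, e₃]; ring
      _ = ψ₁ (t₁ ^ n)⁻¹ * (w ^ n * ψ₂ (t₂ ^ n)) * w' ^ n * ψ₂ (t₂ ^ n)⁻¹ := by ring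
      _ = _ := by rw [← e₄, e₁, one_mul]

theorem le_one_of_mem_centerSubring_of_linear {J : Ideal T} (φ : J →+ L)
    (hφ : ∀ (t : T) (j : J), φ (t • j) = κ t * φ j) (hS : ∀ s : S, v (κ (algebraMap S T s)) ≤ 1)
    {gen : Set S} (hgen : Ideal.span gen = J.comap (algebraMap S T))
    (hv : ∀ (s : S) (hs : algebraMap S T s ∈ J), s ∈ gen → v (φ ⟨_, hs⟩) ≤ 1)
    {j : J} (hj : (j : T) ∈ centerSubring S (κ : T →+* L) v) : v (φ j) ≤ 1 := by
  have key (s : S) (hs : algebraMap S T s ∈ J) : v (φ ⟨_, hs⟩) ≤ 1 := by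
    have h1 : s ∈ Ideal.span gen := by rw [hgen]; exact hs
    induction h1 using Submodule.span_induction with
    | mem s h => exact hv s hs h
    | zero =>
      have : (⟨_, hs⟩ : J) = 0 := Subtype.ext (map_zero _)
      rw [this, map_zero, map_zero]; exact zero_le_one
    | add a b ha hb iha ihb =>
      have ha' : algebraMap S T a ∈ J := by rw [← Ideal.mem_comap, ← hgen]; exact ha
      have hb' : algebraMap S T b ∈ J := by rw [← Ideal.mem_comap, ← hgen]; exact hb
      have : (⟨_, hs⟩ : J) = ⟨_, ha'⟩ + ⟨_, hb'⟩ := Subtype.ext (map_add _ _ _)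
      rw [this, map_add]
      exact v.map_add_le (iha ha') (ihb hb')
    | smul c a ha iha =>
      have ha' : algebraMap S T a ∈ J := by rw [← Ideal.mem_comap, ← hgen]; exact ha
      have : (⟨_, hs⟩ : J) = algebraMap S T c • ⟨_, ha'⟩ := Subtype.ext (map_mul _ _ _)
      rw [this, hφ, map_mul]
      exact mul_le_one' (hS c) (iha ha')
  obtain ⟨s₁, s₂, h2, h3⟩ := hj
  have hs₁ : algebraMap S T s₁ ∈ J := h3 ▸ J.mul_mem_right _ j.2
  have h4 : (⟨_, hs₁⟩ : J) = algebraMap S T s₂ • j := Subtype.ext (by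
    change algebraMap S T s₁ = algebraMap S T s₂ * j
    rw [← h3, mul_comm])
  have h5 := key s₁ hs₁
  rw [h4, hφ, map_mul] at h5
  have h2' : v (κ (algebraMap S T s₂)) = 1 := h2
  rwa [h2', one_mul] at h5

theorem Derivation.div_zpow (D : Derivation K L L) {a : L} (ha : a ≠ 0) (z : ℤ) :
    D (a ^ z) / a ^ z = z * (D a / a) := by
  rw [D.leibniz_zpow, zpow_sub_one₀ ha]
  simp only [zsmul_eq_mul, smul_eq_mul]
  have := zpow_ne_zero z ha
  field_simp

/-- If the prime under `v` is vertical over the field `E`, then the logarithmic derivative of the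
uniformizer is integral. -/
theorem LocalPair.div_le_one {I : Ideal R} {t₁ t₂ : F} (h : LocalPair S I κ ψ₁ ψ₂ v t₁ t₂)
    (ht₁ : t₁ ≠ 0) (ht₂ : t₂ ≠ 0) {f₁ f₂ : R →+* S}
    (hT : ∀ τ, κ τ ≠ 0 → IsUnit τ)
    (hψ₁ : ∀ r, ψ₁ (algebraMap R F r) = algebraMap S T (f₁ r))
    (hψ₂ : ∀ r, ψ₂ (algebraMap R F r) = algebraMap S T (f₂ r))
    (hv : v (κ (ψ₁ t₁)) = v (κ (ψ₂ t₂))) {ϖ : L}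
    (hϖ : ∀ s : L, v (ϖ * s) < 1 → v s ≤ 1) (hK : ∀ c : K, v (algebraMap K L c) ≤ 1)
    {Δ : Derivation K L L} (hΔ : LogGood v ϖ Δ)
    {J : Ideal T} (hJ : ∀ t ∈ J, κ t = 0) {E : Set F} (hE : ∀ b ∈ E, ψ₁ b - ψ₂ b ∈ J) (φ : J →+ L)
    (hφ : ∀ (t : T) (j : J), φ (t • j) = κ t * φ j) (hΔφ : ∀ b (hb : b ∈ E), Δ (κ (ψ₁ b)) = φ ⟨_, hE b hb⟩)
    (hle : ∀ j : J, (j : T) ∈ centerSubring S (κ : T →+* L) v → v (φ j) ≤ 1)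
    (hvert : ∀ Q ∈ I.minimalPrimes, CenteredAt ((κ.comp ψ₁ : F →ₐ[K] L) : F →+* L) v Q →
      ∃ b ∈ E, b ≠ 0 ∧ ¬ UnitAt Q b) :
    v (Δ (κ (ψ₁ t₁)) / κ (ψ₁ t₁)) ≤ 1 := by
  obtain ⟨rfl, -⟩ | ⟨Q₁, Q₂, t₁', t₂', rfl, rfl, hc₁, hc₂, hQ₁, hu₁, hu₂, w, hw, w', hw', hww, heq⟩ := h
  · simp
  obtain ⟨b, hbE, hb0, hb⟩ := hvert Q₁ hQ₁ hc₁
  have := hc₁.isPrime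
  have := hc₂.isPrime
  obtain ⟨z, ρ, hρ0, hρ, hbz⟩ := hu₁.exists_zpow hb0
  obtain ⟨z', ρ', hρ0', hρ', hbz'⟩ := hu₂.exists_zpow hb0
  have hσ : κ (ψ₁ b) = κ (ψ₂ b) := by rw [← sub_eq_zero, ← map_sub]; exact hJ _ (hE b hbE)
  have hvρ : v (κ (ψ₁ ρ)) = 1 := hc₁.eq_one_of_unitAt hρ
  have hvρ' : v (κ (ψ₂ ρ')) = 1 := hc₂.eq_one_of_unitAt hρ'
  have h1 {s : F} (hs : s ≠ 0) (ψ : F →ₐ[K] T) : κ (ψ s) ≠ 0 := (map_ne_zero (κ.comp ψ)).2 hs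
  set t₁ := algebraMap R F t₁'
  set t₂ := algebraMap R F t₂'
  have hlt : v (κ (ψ₁ t₁)) < 1 := (hc₁.lt_one_iff t₁').2 hu₁.mem
  have hzz : z = z' := by
    have e₁ : v (κ (ψ₁ b)) = v (κ (ψ₁ t₁)) ^ z := by
      rw [hbz, map_mul, map_mul, map_mul, hvρ, one_mul, ← map_zpow₀ v]
      exact congrArg v (map_zpow₀ (κ.comp ψ₁) _ _)
    have e₂ : v (κ (ψ₂ b)) = v (κ (ψ₁ t₁)) ^ z' := by
      rw [hbz', map_mul, map_mul, map_mul, hvρ', one_mul, hv, ← map_zpow₀ v]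
      exact congrArg v (map_zpow₀ (κ.comp ψ₂) _ _)
    refine zpow_right_injective₀ (zero_lt_iff.2 (v.ne_zero_iff.2 (h1 ht₁ ψ₁))) hlt.ne ?_
    change _ ^ _ = _ ^ _
    rw [← e₁, ← e₂, hσ]
  subst hzz
  have hz : z ≠ 0 := by
    rintro rfl
    rw [zpow_zero, mul_one] at hbz
    exact hb (hbz ▸ hρ)
  obtain ⟨W, hW, hWz⟩ := exists_mem_centerSubring_zpow ht₁ ht₂ hw hw' hww heq z
  set V := ψ₁ ρ * W * ψ₂ ρ'⁻¹ - 1 with hV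
  have hVb : ψ₁ b - ψ₂ b = ψ₂ b * V := by
    have e₁ : ψ₁ b = ψ₁ ρ * W * ψ₂ (t₂ ^ z) := by
      rw [mul_assoc, ← hWz, ← map_mul, ← hbz]
    have e₂ : t₂ ^ z = ρ'⁻¹ * b := by rw [hbz', inv_mul_cancel_left₀ hρ0']
    rw [e₁, hV, e₂, map_mul]; ring
  have hVJ : V ∈ J := by
    have e : V = ψ₂ b⁻¹ * (ψ₁ b - ψ₂ b) := by
      rw [hVb, ← mul_assoc, ← map_mul, inv_mul_cancel₀ hb0, map_one, one_mul]
    rw [e]; exact J.mul_mem_left _ (hE b hbE)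
  have hVc : V ∈ centerSubring S (κ : T →+* L) v := by
    refine sub_mem (mul_mem (mul_mem ?_ hW) ?_) (one_mem _)
    · exact apply_mem_centerSubring_of_unitAt (κ := (κ : T →+* L)) (ψ := (ψ₁ : F →+* T)) hT hψ₁ hc₁ hρ
    · exact apply_mem_centerSubring_of_unitAt (κ := (κ : T →+* L)) (ψ := (ψ₂ : F →+* T)) hT hψ₂ hc₂
        (hρ'.inv hρ0')
  have hb1 : v (Δ (κ (ψ₁ b)) / κ (ψ₁ b)) ≤ 1 := by
    have e : (⟨_, hE b hbE⟩ : J) = ψ₂ b • ⟨V, hVJ⟩ := Subtype.ext hVb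
    rw [hΔφ b hbE, e, hφ, ← hσ, mul_div_cancel_left₀ _ (h1 hb0 ψ₁)]
    exact hle ⟨V, hVJ⟩ hVc
  have hρ1 : v (Δ (κ (ψ₁ ρ)) / κ (ψ₁ ρ)) ≤ 1 := hϖ _ (hΔ.div_lt_one hvρ)
  have e : Δ (κ (ψ₁ b)) / κ (ψ₁ b) = Δ (κ (ψ₁ ρ)) / κ (ψ₁ ρ) + z * (Δ (κ (ψ₁ t₁)) / κ (ψ₁ t₁)) := by
    have e₁ : κ (ψ₁ b) = κ (ψ₁ ρ) * κ (ψ₁ t₁) ^ z := by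
      have := congrArg (κ.comp ψ₁) hbz
      rwa [map_mul, map_zpow₀] at this
    rw [e₁, Δ.div_mul (h1 hρ0 ψ₁) (zpow_ne_zero z (h1 ht₁ ψ₁)), Δ.div_zpow (h1 ht₁ ψ₁)]
  have hvz : v (z : L) = 1 := by
    have := Valuation.algebraMap_eq_one hK (c := (z : K)) (Int.cast_ne_zero.2 hz)
    rwa [map_intCast] at this
  have := v.map_sub_le hb1 hρ1
  rwa [e, add_sub_cancel_left, map_mul, hvz, one_mul] at this

end

section
variable {K R F T L : Type*} [Field K] [CharZero K] [CommRing R] [IsDomain R]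
  [Algebra K R] [Field F] [Algebra K F]
  [Algebra R F] [IsScalarTower K R F] [IsFractionRing R F] {d : ℕ} {x : Fin d → R}
  [CommRing T] [Algebra K T] [Field L] [Algebra K L] {κ : T →ₐ[K] L} {ψ : F →ₐ[K] T}
  {D : Fin d → Derivation K L L}

theorem formValue_dual (hD : ∀ a b, D b (κ (ψ (algebraMap R F (x a)))) = if a = b then 1 else 0)
    (θ : Fin d → F) (b : Fin d) : formValue x κ ψ θ (D b) = κ (ψ (θ b)) := by
  simp [formValue, hD]

theorem derivation_comm (hx : IsTranscendenceBasis K fun i => algebraMap R F (x i))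
    (hD : ∀ a b, D b (κ (ψ (algebraMap R F (x a)))) = if a = b then 1 else 0) (Δ : Derivation K L L)
    (b : Fin d) (f : F) :
    D b (Δ (κ (ψ f))) - Δ (D b (κ (ψ f))) =
      ∑ a, D b (Δ (κ (ψ (algebraMap R F (x a))))) * D a (κ (ψ f)) := by
  let B : Derivation K L L := ⁅D b, Δ⁆ - ∑ a, D b (Δ (κ (ψ (algebraMap R F (x a))))) • D a
  have hB (z : L) : B z = D b (Δ z) - Δ (D b z) -
      ∑ a, D b (Δ (κ (ψ (algebraMap R F (x a))))) * D a z := by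
    have h1 (g : Fin d → Derivation K L L) : (∑ a, g a) z = ∑ a, g a z := by
      rw [← Derivation.coeFnAddMonoidHom_apply, map_sum, Finset.sum_apply]; rfl
    simp only [B, Derivation.sub_apply, Derivation.commutator_apply, h1, Derivation.smul_apply, smul_eq_mul]
  rw [← sub_eq_zero, ← hB]
  refine hx.derivation_eq_zero (κ.comp ψ) ((B : L →ₗ[K] L) ∘ₗ (κ.comp ψ).toLinearMap) (fun a b => by simp)
    (fun i => ?_) f
  change B (κ (ψ _)) = 0
  rw [hB, hD]
  have h0 : Δ (if i = b then 1 else 0) = 0 := by split_ifs <;> simp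
  simp [hD, h0]

/-- The coefficients of the Lie derivative along `Δ` of the form `∑ θ_a dx_a`, where `D` is dual to
the `dx_a`. -/
def lieCoeff (x : Fin d → R) (κ : T →ₐ[K] L) (ψ : F →ₐ[K] T) (Δ : Derivation K L L)
    (D : Fin d → Derivation K L L) (θ : Fin d → F) (b : Fin d) : L :=
  Δ (κ (ψ (θ b))) + ∑ a, κ (ψ (θ a)) * D b (Δ (κ (ψ (algebraMap R F (x a)))))

theorem lieCoeff_eq (hx : IsTranscendenceBasis K fun i => algebraMap R F (x i))
    (hD : ∀ a b, D b (κ (ψ (algebraMap R F (x a)))) = if a = b then 1 else 0) (Δ : Derivation K L L)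
    (θ : Fin d → F) (b : Fin d) {t : F} (ht : t ≠ 0) :
    lieCoeff x κ ψ Δ D θ b = Δ (κ (ψ (θ b)) - D b (κ (ψ t)) / κ (ψ t)) +
      ∑ a, (κ (ψ (θ a)) - D a (κ (ψ t)) / κ (ψ t)) * D b (Δ (κ (ψ (algebraMap R F (x a))))) +
      D b (Δ (κ (ψ t)) / κ (ψ t)) := by
  have h0 : κ (ψ t) ≠ 0 := (map_ne_zero (κ.comp ψ)).2 ht
  have h := derivation_comm hx hD Δ b t
  have h1 : ∑ a, D a (κ (ψ t)) / κ (ψ t) * D b (Δ (κ (ψ (algebraMap R F (x a))))) =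
      (D b (Δ (κ (ψ t))) - Δ (D b (κ (ψ t)))) / κ (ψ t) := by
    rw [h, Finset.sum_div]
    exact Finset.sum_congr rfl fun a _ => by ring
  simp only [lieCoeff, sub_mul, Finset.sum_sub_distrib, h1, map_sub, Derivation.leibniz_div]
  simp only [smul_eq_mul]
  field_simp
  ring

end

section
universe w
variable {K R F S T : Type*} {L : Type w} [Field K] [CharZero K] [CommRing R] [IsDomain R] [IsNoetherianRing R]
  [Algebra K R] [Field F] [Algebra K F]
  [Algebra R F] [IsScalarTower K R F] [IsFractionRing R F] {d : ℕ} {x : Fin d → R}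
  {y m : R} {P : Polynomial (MvPolynomial (Fin d) K)}
  [CommRing S] [CommRing T] [Algebra K S] [Algebra.FiniteType K S] [Algebra S T] [Algebra K T] [IsScalarTower K S T] [Field L] [Algebra K L] [Algebra.EssFiniteType K L]
  {κ : T →ₐ[K] L} {ψ₁ ψ₂ : F →ₐ[K] T} {f₁ f₂ : R →+* S}

/-- The inductive step: the Lie derivatives of the logarithmic forms along a derivation measuring
the difference of the two pullbacks modulo a smaller ideal. -/
theorem Presentation.finiteDimensional_lieCoeff (h : Presentation F x y P m)
    (hT : ∀ τ, κ τ ≠ 0 → IsUnit τ)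
    (hψ₁ : ∀ r, ψ₁ (algebraMap R F r) = algebraMap S T (f₁ r))
    (hψ₂ : ∀ r, ψ₂ (algebraMap R F r) = algebraMap S T (f₂ r)) {ℋ : Set (Ideal R)}
    (hℋ : ∀ I ∈ ℋ, I.map f₁ = I.map f₂) {θ : ℋ → Fin d → F} (hθ : IsLogFamily x y P θ)
    {J : Ideal T} (hJ : ∀ t ∈ J, κ t = 0) {E : Set F} (hE : ∀ b ∈ E, ψ₁ b - ψ₂ b ∈ J) (φ : J →+ L)
    (hφ : ∀ (t : T) (j : J), φ (t • j) = κ t * φ j) {Δ : Derivation K L L}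
    (hΔφ : ∀ b (hb : b ∈ E), Δ (κ (ψ₁ b)) = φ ⟨_, hE b hb⟩)
    (hfin : {Q : Ideal R | (∃ I ∈ ℋ, Q ∈ I.minimalPrimes) ∧ ∀ b ∈ E, b ≠ 0 → UnitAt Q b}.Finite)
    {D : Fin d → Derivation K L L}
    (hD : ∀ a b, D b (κ (ψ₁ (algebraMap R F (x a)))) = if a = b then 1 else 0) (b : Fin d) :
    FiniteDimensional K (Submodule.span K (Set.range fun I => lieCoeff x κ ψ₁ Δ D (θ I) b)) := by
  classical
  have hx : IsTranscendenceBasis K fun i => algebraMap R F (x i) :=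
    isTranscendenceBasis_of_isIntegral h.inj h.int
  have : IsNoetherianRing S := Algebra.FiniteType.isNoetherianRing K S
  obtain ⟨gen, hgen⟩ := IsNoetherian.noetherian (J.comap (algebraMap S T))
  obtain ⟨r, hr0, hr⟩ : ∃ r : R, r ≠ 0 ∧ ∀ Q ∈ {Q : Ideal R | (∃ I ∈ ℋ, Q ∈ I.minimalPrimes) ∧
      ∀ b ∈ E, b ≠ 0 → UnitAt Q b}, r ∈ Q := by
    have hex : ∀ Q ∈ hfin.toFinset, ∃ q ∈ Q, q ≠ 0 := by
      intro Q hQ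
      obtain ⟨⟨I, hI, hQI⟩, -⟩ := hfin.mem_toFinset.1 hQ
      exact Q.ne_bot_iff.1 ((hθ ⟨I, hI⟩).1.2.2 Q hQI).2.1
    choose! q hqQ hq0 using hex
    refine ⟨∏ Q ∈ hfin.toFinset, q Q, Finset.prod_ne_zero_iff.2 hq0, fun Q hQ => ?_⟩
    have hQ' := hfin.mem_toFinset.2 hQ
    exact Q.mem_of_dvd (Finset.dvd_prod_of_mem q hQ') (hqQ Q hQ')
  have hr1 : κ (ψ₁ (algebraMap R F r)) ≠ 0 :=
    (map_ne_zero (κ.comp ψ₁)).2 (by rwa [Ne, FaithfulSMul.algebraMap_eq_zero_iff])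
  refine h.finiteDimensional_span hT hψ₁ hψ₂ _ 2 2 fun M {l} u =>
    ⟨Finset.univ.image (fun i => Δ (u i)) ∪ Finset.univ.image (fun p : Fin d × Fin l => D p.1 (u p.2)) ∪
      Finset.univ.image (fun a => D b (Δ (κ (ψ₁ (algebraMap R F (x a)))))) ∪
      gen.image (fun s => if hs : algebraMap S T s ∈ J then φ ⟨_, hs⟩ else 0) ∪
      {κ (ψ₁ (algebraMap R F r))}, fun {Γ} _ v ϖ => ⟨fun hv hE' => ?_, fun G hv hE' => ?_⟩⟩
  all_goals
    rintro _ ⟨I, rfl⟩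
    obtain ⟨hI, hIθ⟩ := hθ I
    dsimp only
  · have hΔu : ∀ i, v (Δ (u i)) ≤ 1 := fun i => (hE' _ (by simp)).1
    have hDu : ∀ a i, v (D a (u i)) ≤ 1 := fun a i => (hE' _ (by simp)).1
    have hDΔ : ∀ a, v (D b (Δ (κ (ψ₁ (algebraMap R F (x a)))))) ≤ 1 := fun a => (hE' _ (by simp)).1
    obtain ⟨t₁, t₂, ht₁, ht₂, heq, hp, hb⟩ := hv.exists_localPair hI (hℋ _ I.2) hIθ
    have hη (a : Fin d) : v (κ (ψ₁ (θ I a)) - D a (κ (ψ₁ t₁)) / κ (ψ₁ t₁)) ≤ 1 := by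
      refine hv.le_one_of_lt _ ?_
      have := (hb (D a) (hDu a)).1
      rwa [formValue_dual hD] at this
    have hτ : v (Δ (κ (ψ₁ t₁)) / κ (ψ₁ t₁)) ≤ 1 := by
      refine hp.div_le_one ht₁ ht₂ hT hψ₁ hψ₂ heq hv.le_one_of_lt hv.algebraMap_le_one (hv.logGood Δ hΔu)
        hJ hE φ hφ hΔφ (fun j hj => le_one_of_mem_centerSubring_of_linear φ hφ hv.le_one hgen
          (fun s hs hsg => ?_) hj) fun Q hQ hc => ?_
      · refine (hE' _ ?_).1
        simp only [Finset.mem_union, Finset.mem_image]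
        exact .inl (.inr ⟨s, hsg, dif_pos hs⟩)
      · by_contra! hcon
        have h1 := hr Q ⟨⟨I, I.2, hQ⟩, hcon⟩
        have h2 := (hc.lt_one_iff r).2 h1
        exact h2.ne ((hE' _ (by simp)).2 hr1)
    rw [lieCoeff_eq hx hD Δ (θ I) b ht₁]
    refine v.map_add_le (v.map_add_le (hv.le_one_of_lt _ ((hv.logGood Δ hΔu).lt_one _ (hη b))) ?_)
      (hv.le_one_of_lt _ ((hv.logGood (D b) (hDu b)).lt_one _ hτ))
    exact v.map_sum_le fun a _ => by rw [map_mul]; exact mul_le_one' (hη a) (hDΔ a)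
  · have hΔu : ∀ i, v (G * Δ (u i)) ≤ 1 := fun i => hE' _ (by simp)
    have hDu : ∀ a i, v (G * D a (u i)) ≤ 1 := fun a i => hE' _ (by simp)
    have hDΔ : ∀ a, v (G * D b (Δ (κ (ψ₁ (algebraMap R F (x a)))))) ≤ 1 := fun a => hE' _ (by simp)
    have hb (a : Fin d) : v (ϖ * G ^ M * κ (ψ₁ (θ I a))) ≤ 1 := by
      have := (hv.formValue_le hIθ (D a) (hDu a)).1
      rwa [formValue_dual hD] at this
    have hϖ := hv.parameter_le_one
    have hG := hv.le_one
    rw [lieCoeff, mul_add, Finset.mul_sum]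
    refine v.map_add_le ?_ (v.map_sum_le fun a _ => ?_)
    · have h1 := mul_le_mul' (hv.mul_le Δ hΔu (κ (ψ₁ (θ I b)))) (le_refl (v (ϖ * G ^ M)))
      rw [← map_mul v (κ _), mul_comm (κ _)] at h1
      have h2 := mul_le_one' (h1.trans (hb b)) hG
      rw [← map_mul, ← map_mul] at h2
      convert h2 using 2
      ring
    · have h2 := mul_le_one' (mul_le_one' hϖ hG) (mul_le_one' (hb a) (hDΔ a))
      simp only [← map_mul v] at h2
      convert h2 using 2
      ring

end

theorem LinearIndependent.map_field {F L : Type*} [Field F] [Field L] (σ : F →+* L) {n d : ℕ}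
    {c : Fin n → Fin d → F} (hc : LinearIndependent F c) :
    LinearIndependent L fun j a => σ (c j a) := by
  classical
  obtain ⟨g, hg⟩ := (Fintype.linearCombination F c).exists_leftInverse_of_injective
    (LinearMap.ker_eq_bot.2 (linearIndependent_iff_injective_fintypeLinearCombination.1 hc))
  have h1 (j k : Fin n) : ∑ a, c j a * g (Pi.single a 1) k = if j = k then 1 else 0 := by
    have h2 : g (c j) = Pi.single j 1 := by
      have := LinearMap.congr_fun hg (Pi.single j 1)
      simpa [Fintype.linearCombination_apply_single] using this
    have h3 : c j = ∑ a, c j a • (Pi.single a 1 : Fin d → F) := pi_eq_sum_univ' (c j)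
    have h4 := congrFun h2 k
    rw [h3, map_sum, Finset.sum_apply] at h4
    simp only [map_smul, Pi.smul_apply, smul_eq_mul] at h4
    rw [h4, Pi.single_apply]
    exact if_congr eq_comm rfl rfl
  rw [Fintype.linearIndependent_iff]
  intro l hl k
  have h5 : ∑ a, (∑ j, l j * σ (c j a)) * σ (g (Pi.single a 1) k) = l k := by
    calc _ = ∑ j, l j * σ (∑ a, c j a * g (Pi.single a 1) k) := by
          simp only [Finset.sum_mul, map_sum, Finset.mul_sum, map_mul]
          rw [Finset.sum_comm]
          exact Finset.sum_congr rfl fun j _ => Finset.sum_congr rfl fun a _ => by ring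
      _ = l k := by simp [h1]
  rw [← h5]
  refine Finset.sum_eq_zero fun a _ => ?_
  have := congrFun hl a
  simp only [Finset.sum_apply, Pi.smul_apply, smul_eq_mul, Pi.zero_apply] at this
  rw [this, zero_mul]

section
variable {K F L : Type*} [Field K] [Field F] [Algebra K F] [Field L] [Algebra K L] {d : ℕ}

/-- Families in `N` which are linearly independent over `E` are so over `F`. -/
def Transfers (E : IntermediateField K F) (N : Submodule K (Fin d → F)) : Prop :=
  ∀ (n : ℕ) (c : Fin n → Fin d → F), (∀ j, c j ∈ N) → LinearIndependent E c → LinearIndependent F c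

theorem Transfers.inf_ker {E E' : IntermediateField K F} {N : Submodule K (Fin d → F)}
    (hN : Transfers E N) (σ σ' : F →+* L) (δ : F → L) (s : (Fin d → F) →ₗ[K] (Fin d → L))
    (hs : ∀ g ∈ E, ∀ θ a, s (g • θ) a = σ' g * s θ a + δ g * σ (θ a))
    (hδ : ∀ g ∈ E, δ g = 0 → g ∈ E') : Transfers E' (N ⊓ LinearMap.ker s) := by
  intro n
  induction n with
  | zero => intro c _ _; exact linearIndependent_empty_type
  | succ n ih =>
    intro c hc hE'
    rw [linearIndependent_finSucc'] at hE'
    have hF := ih (Fin.init c) (fun j => hc _) hE'.1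
    by_contra hcF
    have hE : ¬ LinearIndependent E c := fun h => hcF (hN _ c (fun j => (hc j).1) h)
    have hE₀ : LinearIndependent E (Fin.init c) := hF.restrict_scalars' E
    have h1 : c (Fin.last n) ∈ Submodule.span E (Set.range (Fin.init c)) := by
      by_contra h2
      exact hE (linearIndependent_finSucc'.2 ⟨hE₀, h2⟩)
    obtain ⟨l, hl⟩ := (Submodule.mem_span_range_iff_exists_fun E).1 h1
    have h3 (a : Fin d) : ∑ j, δ (l j) * σ (Fin.init c j a) = 0 := by
      have h4 : s (c (Fin.last n)) a = 0 := by
        rw [LinearMap.mem_ker.1 (hc _).2]; rfl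
      rw [← hl, map_sum, Finset.sum_apply] at h4
      rw [← h4]
      refine Finset.sum_congr rfl fun j _ => ?_
      have h5 : s (Fin.init c j) a = 0 := by
        change s (c (Fin.castSucc j)) a = 0
        rw [LinearMap.mem_ker.1 (hc (Fin.castSucc j)).2]; rfl
      have h6 := hs (l j) (l j).2 (Fin.init c j) a
      rw [h5, mul_zero, zero_add] at h6
      exact h6.symm
    have h7 := Fintype.linearIndependent_iff.1 (hF.map_field σ) (fun j => δ (l j)) (by
      ext a
      simpa using h3 a)
    refine hE'.2 ((Submodule.mem_span_range_iff_exists_fun E').2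
      ⟨fun j => ⟨l j, hδ _ (l j).2 (h7 j)⟩, ?_⟩)
    rw [← hl]; rfl

theorem cofg_inf_ker_comap {V ι : Type*} [AddCommGroup V] [Module K V] {N : Submodule K V} {θ : ι → V}
    (hN : (N.comap (Finsupp.linearCombination K θ)).CoFG) (s : V →ₗ[K] (Fin d → L))
    (hs : ∀ b, FiniteDimensional K (Submodule.span K (Set.range fun i => s (θ i) b))) :
    ((N ⊓ LinearMap.ker s).comap (Finsupp.linearCombination K θ)).CoFG := by
  have h1 (b : Fin d) : (LinearMap.ker ((LinearMap.proj b ∘ₗ s) ∘ₗ Finsupp.linearCombination K θ)).CoFG := by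
    rw [← Submodule.range_fg_iff_ker_cofg]
    refine Submodule.FG.of_le ((Submodule.fg_iff_finiteDimensional _).2 (hs b)) ?_
    rintro _ ⟨f, rfl⟩
    induction f using Finsupp.induction_linear with
    | zero => simp
    | add f g hf hg => rw [map_add]; exact add_mem hf hg
    | single i c =>
      simp only [LinearMap.comp_apply, Finsupp.linearCombination_single, map_smul, LinearMap.proj_apply]
      exact Submodule.smul_mem _ _ (Submodule.subset_span ⟨i, rfl⟩)
  have h2 : (sInf (Set.range fun b : Fin d =>
      LinearMap.ker ((LinearMap.proj b ∘ₗ s) ∘ₗ Finsupp.linearCombination K θ))).CoFG :=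
    Submodule.CoFG.sInf_of_finite (Set.finite_range _) (by rintro _ ⟨b, rfl⟩; exact h1 b)
  refine Submodule.CoFG.of_le ?_ (hN.inf h2)
  intro f hf
  refine ⟨hf.1, ?_⟩
  refine LinearMap.mem_ker.2 (funext fun b => ?_)
  exact (Submodule.mem_sInf.1 hf.2) _ ⟨b, rfl⟩

end

section
variable {K F T : Type*} [Field K] [Field F] [Algebra K F] [CommRing T] [Algebra K T]

/-- The subfield on which two homomorphisms agree modulo `J`. -/
def AlgHom.agreeField (ψ₁ ψ₂ : F →ₐ[K] T) (J : Ideal T) : IntermediateField K F where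
  carrier := {b | ψ₁ b - ψ₂ b ∈ J}
  mul_mem' {a b} ha hb := by
    have : ψ₁ (a * b) - ψ₂ (a * b) = ψ₁ a * (ψ₁ b - ψ₂ b) + ψ₂ b * (ψ₁ a - ψ₂ a) := by
      rw [map_mul, map_mul]; ring
    rw [Set.mem_ofPred_eq, this]
    exact J.add_mem (J.mul_mem_left _ hb) (J.mul_mem_left _ ha)
  add_mem' {a b} ha hb := by
    have : ψ₁ (a + b) - ψ₂ (a + b) = (ψ₁ a - ψ₂ a) + (ψ₁ b - ψ₂ b) := by
      rw [map_add, map_add]; ring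
    rw [Set.mem_ofPred_eq, this]
    exact J.add_mem ha hb
  algebraMap_mem' c := by simp
  inv_mem' b hb := by
    by_cases h0 : b = 0
    · simp [h0]
    have h1 : ψ₁ b⁻¹ * ψ₁ b = 1 := by rw [← map_mul, inv_mul_cancel₀ h0, map_one]
    have h2 : ψ₂ b⁻¹ * ψ₂ b = 1 := by rw [← map_mul, inv_mul_cancel₀ h0, map_one]
    have : ψ₁ b⁻¹ - ψ₂ b⁻¹ = - (ψ₁ b⁻¹ * ψ₂ b⁻¹) * (ψ₁ b - ψ₂ b) := by
      linear_combination (- ψ₁ b⁻¹) * h2 + ψ₂ b⁻¹ * h1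
    change ψ₁ b⁻¹ - ψ₂ b⁻¹ ∈ J
    rw [this]
    exact J.mul_mem_left _ hb

theorem AlgHom.mem_agreeField {ψ₁ ψ₂ : F →ₐ[K] T} {J : Ideal T} {b : F} :
    b ∈ ψ₁.agreeField ψ₂ J ↔ ψ₁ b - ψ₂ b ∈ J := Iff.rfl

end

theorem IsLocalRing.exists_linearMap_residueField {T M : Type*} [CommRing T] [IsLocalRing T]
    [AddCommGroup M] [Module T M] [Module.Finite T M] [Nontrivial M] :
    ∃ φ : M →ₗ[T] ResidueField T, φ ≠ 0 := by
  have h1 : Nontrivial (TensorProduct T (ResidueField T) M) := by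
    rw [← not_subsingleton_iff_nontrivial, IsLocalRing.subsingleton_tensorProduct,
      not_subsingleton_iff_nontrivial]
    infer_instance
  obtain ⟨v, hv⟩ := exists_ne (0 : TensorProduct T (ResidueField T) M)
  by_contra! h
  refine hv ((Module.forall_dual_apply_eq_zero_iff (ResidueField T) v).1 fun g => ?_)
  have h2 : (g.restrictScalars T) ∘ₗ (TensorProduct.mk T (ResidueField T) M 1) = 0 := h _
  clear hv
  induction v using TensorProduct.induction_on with
  | zero => simp
  | tmul a j =>
    rw [← mul_one a, ← smul_eq_mul, ← TensorProduct.smul_tmul', map_smul]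
    simpa using Or.inr (LinearMap.congr_fun h2 j)
  | add v w hv hw => rw [map_add, hv, hw, add_zero]

section
universe w
variable {K R F S : Type*} {T : Type w} [Field K] [CharZero K] [CommRing R] [IsDomain R]
  [IsNoetherianRing R] [Algebra K R] [Field F] [Algebra K F]
  [Algebra R F] [IsScalarTower K R F] [IsFractionRing R F] {d : ℕ} {x : Fin d → R}
  {y m : R} {P : Polynomial (MvPolynomial (Fin d) K)}
  [CommRing S] [Algebra K S] [Algebra.FiniteType K S]
  [CommRing T] [IsLocalRing T] [Algebra K T] [Algebra S T] [IsScalarTower K S T]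
  [Algebra.EssFiniteType K (IsLocalRing.ResidueField T)]
  {ψ₁ ψ₂ : F →ₐ[K] T} {f₁ f₂ : R →+* S} {ℋ : Set (Ideal R)} {θ : ℋ → Fin d → F}

/-- A subspace of finite codimension, up to `θ`, on which linear independence transfers from the
subfield where the two homomorphisms agree modulo `J`. -/
def TransfersModulo (ψ₁ ψ₂ : F →ₐ[K] T) (θ : ℋ → Fin d → F) (J : Ideal T) : Prop :=
  ∃ N : Submodule K (Fin d → F), Transfers (ψ₁.agreeField ψ₂ J) N ∧
    (N.comap (Finsupp.linearCombination K θ)).CoFG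

omit [CharZero K] [Algebra.EssFiniteType K (IsLocalRing.ResidueField T)] in
theorem IsLocalRing.isUnit_of_toAlgHom_ne_zero (τ : T)
    (h : IsScalarTower.toAlgHom K T (IsLocalRing.ResidueField T) τ ≠ 0) : IsUnit τ :=
  (IsLocalRing.residue_ne_zero_iff_isUnit τ).1 h

omit [IsNoetherianRing R] [Algebra.EssFiniteType K (IsLocalRing.ResidueField T)] in
theorem Presentation.exists_dual_derivation (h : Presentation F x y P m) (ψ : F →ₐ[K] T) :
    ∃ D : Fin d → Derivation K (IsLocalRing.ResidueField T) (IsLocalRing.ResidueField T),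
      ∀ a b, D b (IsScalarTower.toAlgHom K T (IsLocalRing.ResidueField T)
        (ψ (algebraMap R F (x a)))) = if a = b then 1 else 0 := by
  let κ := IsScalarTower.toAlgHom K T (IsLocalRing.ResidueField T)
  have hx : AlgebraicIndependent K fun i => algebraMap R F (x i) :=
    (isTranscendenceBasis_of_isIntegral h.inj h.int).1
  have hx' := hx.map' (f := κ.comp ψ) (κ.comp ψ).toRingHom.injective
  choose D hD using fun b : Fin d => hx'.exists_derivation (fun a => if a = b then 1 else 0)
  exact ⟨D, fun a b => hD b a⟩

theorem Presentation.transfersModulo_maximalIdeal (h : Presentation F x y P m)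
    (hψ₁ : ∀ r, ψ₁ (algebraMap R F r) = algebraMap S T (f₁ r))
    (hψ₂ : ∀ r, ψ₂ (algebraMap R F r) = algebraMap S T (f₂ r))
    (hℋ : ∀ I ∈ ℋ, I.map f₁ = I.map f₂) (hθ : IsLogFamily x y P θ) :
    TransfersModulo ψ₁ ψ₂ θ (IsLocalRing.maximalIdeal T) := by
  let L := IsLocalRing.ResidueField T
  let κ : T →ₐ[K] L := IsScalarTower.toAlgHom K T L
  obtain ⟨D, hD⟩ := h.exists_dual_derivation ψ₁
  let s : (Fin d → F) →ₗ[K] (Fin d → L) :=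
    { toFun := fun θ b => formValue x κ ψ₁ θ (D b) - formValue x κ ψ₂ θ (D b)
      map_add' := fun θ θ' => by
        ext b
        simp only [formValue, Pi.add_apply, map_add, add_mul, Finset.sum_add_distrib]
        ring
      map_smul' := fun c θ => by
        ext b
        simp only [formValue, Pi.smul_apply, map_smul, smul_mul_assoc, ← Finset.smul_sum, RingHom.id_apply,
          smul_sub] }
  have hN : Transfers (⊤ : IntermediateField K F) (⊤ : Submodule K (Fin d → F)) := by
    intro n c _ hc
    rw [Fintype.linearIndependent_iff] at hc ⊢
    intro l hl j
    exact congrArg Subtype.val (hc (fun j => ⟨l j, trivial⟩) hl j)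
  refine ⟨⊤ ⊓ LinearMap.ker s, hN.inf_ker ((κ.comp ψ₁ : F →ₐ[K] L) : F →+* L)
    ((κ.comp ψ₂ : F →ₐ[K] L) : F →+* L) (fun g => κ (ψ₁ g) - κ (ψ₂ g)) s (fun g _ θ b => ?_)
    (fun g _ hg => ?_), cofg_inf_ker_comap (by simp) s fun b => ?_⟩
  · change formValue x κ ψ₁ (g • θ) (D b) - formValue x κ ψ₂ (g • θ) (D b) =
      κ (ψ₂ g) * (formValue x κ ψ₁ θ (D b) - formValue x κ ψ₂ θ (D b)) +
      (κ (ψ₁ g) - κ (ψ₂ g)) * κ (ψ₁ (θ b))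
    rw [formValue_dual hD, formValue_dual hD]
    simp only [formValue, Pi.smul_apply, smul_eq_mul, map_mul, mul_assoc, ← Finset.mul_sum]
    ring
  · rw [AlgHom.mem_agreeField, ← IsLocalRing.residue_eq_zero_iff, map_sub]
    exact hg
  · exact h.finiteDimensional_formValue_sub IsLocalRing.isUnit_of_toAlgHom_ne_zero hψ₁ hψ₂ hℋ hθ (D b)

theorem Presentation.exists_lt_transfersModulo [IsNoetherianRing T] (h : Presentation F x y P m)
    (hψ₁ : ∀ r, ψ₁ (algebraMap R F r) = algebraMap S T (f₁ r))
    (hψ₂ : ∀ r, ψ₂ (algebraMap R F r) = algebraMap S T (f₂ r))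
    (hℋ : ∀ I ∈ ℋ, I.map f₁ = I.map f₂) (hθ : IsLogFamily x y P θ) {J : Ideal T}
    (hJ : J ≤ IsLocalRing.maximalIdeal T) (hJ0 : J ≠ ⊥) (hQ : TransfersModulo ψ₁ ψ₂ θ J) :
    ∃ J' < J, TransfersModulo ψ₁ ψ₂ θ J' := by
  let L := IsLocalRing.ResidueField T
  let κ : T →ₐ[K] L := IsScalarTower.toAlgHom K T L
  obtain ⟨D, hD⟩ := h.exists_dual_derivation ψ₁
  obtain ⟨N, hN, hcofg⟩ := hQ
  have : Nontrivial J := Submodule.nontrivial_iff_ne_bot.2 hJ0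
  obtain ⟨φ, hφ0⟩ := IsLocalRing.exists_linearMap_residueField (T := T) (M := J)
  set E := ψ₁.agreeField ψ₂ J with hE
  have hκ : ∀ t ∈ J, κ t = 0 := fun t ht => (IsLocalRing.residue_eq_zero_iff t).2 (hJ ht)
  have hφ (t : T) (j : J) : φ (t • j) = κ t * φ j := by
    rw [map_smul, Algebra.smul_def]; rfl
  let ρ (b : E) : J := ⟨ψ₁ b - ψ₂ b, b.2⟩
  let σ : E →ₐ[K] L := (κ.comp ψ₁).comp E.val
  let δ : E →ₗ[K] L :=
    { toFun := fun b => φ (ρ b)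
      map_add' := fun b c => by
        rw [← map_add]
        congr 1
        ext
        simp only [ρ, AddMemClass.coe_add, map_add]
        ring
      map_smul' := fun c b => by
        have : ρ (c • b) = algebraMap K T c • ρ b := by
          ext
          simp [ρ, Algebra.smul_def, mul_sub]
        rw [this, hφ, RingHom.id_apply, Algebra.smul_def]
        simp }
  have hδ (a b : E) : δ (a * b) = σ a * δ b + σ b * δ a := by
    have h1 : ρ (a * b) = ψ₁ a • ρ b + ψ₂ b • ρ a := by
      ext
      simp [ρ]
      ring
    have h2 : κ (ψ₂ b) = κ (ψ₁ b) := by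
      have := hκ _ b.2
      rw [map_sub, sub_eq_zero] at this
      exact this.symm
    change φ (ρ (a * b)) = κ (ψ₁ a) * φ (ρ b) + κ (ψ₁ b) * φ (ρ a)
    rw [h1, map_add, hφ, hφ, h2]
  have : CharZero E := charZero_of_injective_algebraMap (algebraMap K E).injective
  obtain ⟨Δ, hΔ⟩ := exists_derivation_extend σ σ.toRingHom.injective δ hδ
  have hΔ' (b : F) (hb : b ∈ E) : Δ (κ (ψ₁ b)) = φ ⟨ψ₁ b - ψ₂ b, hb⟩ := hΔ ⟨b, hb⟩
  have hfin := h.finite_horizontal hθ E N hN hcofg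
  let s : (Fin d → F) →ₗ[K] (Fin d → L) :=
    { toFun := fun θ b => lieCoeff x κ ψ₁ Δ D θ b
      map_add' := fun θ θ' => by
        ext b
        simp only [lieCoeff, Pi.add_apply, map_add, add_mul, Finset.sum_add_distrib]
        ring
      map_smul' := fun c θ => by
        ext b
        simp only [lieCoeff, Pi.smul_apply, map_smul, Derivation.map_smul, smul_mul_assoc, ← Finset.smul_sum,
          RingHom.id_apply, smul_add] }
  let J' : Ideal T := (LinearMap.ker φ).map (Submodule.subtype J)
  have hJ'J : J' ≤ J := Submodule.map_subtype_le _ _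
  refine ⟨J', lt_of_le_of_ne hJ'J fun he => hφ0 ?_, N ⊓ LinearMap.ker s,
    hN.inf_ker ((κ.comp ψ₁ : F →ₐ[K] L) : F →+* L)
    ((κ.comp ψ₁ : F →ₐ[K] L) : F →+* L) (fun g => Δ (κ (ψ₁ g))) s (fun g _ θ b => ?_)
    (fun g hg hg0 => ?_), cofg_inf_ker_comap hcofg s fun b => ?_⟩
  · ext j
    obtain ⟨j', hj', he'⟩ : (j : T) ∈ J' := by rw [he]; exact j.2
    obtain rfl : j' = j := Subtype.ext he'
    exact hj'
  · change lieCoeff x κ ψ₁ Δ D (g • θ) b = κ (ψ₁ g) * lieCoeff x κ ψ₁ Δ D θ b +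
      Δ (κ (ψ₁ g)) * κ (ψ₁ (θ b))
    simp only [lieCoeff, Pi.smul_apply, smul_eq_mul, map_mul, mul_assoc, ← Finset.mul_sum, Derivation.leibniz]
    ring
  · exact ⟨ρ ⟨g, hg⟩, (hΔ' g hg).symm.trans hg0, rfl⟩
  · exact h.finiteDimensional_lieCoeff IsLocalRing.isUnit_of_toAlgHom_ne_zero hψ₁ hψ₂ hℋ hθ hκ
      (E := (E : Set F)) (fun b hb => hb) φ.toAddMonoidHom hφ hΔ' hfin hD b

theorem Presentation.transfersModulo_bot [IsArtinianRing T] (h : Presentation F x y P m)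
    (hψ₁ : ∀ r, ψ₁ (algebraMap R F r) = algebraMap S T (f₁ r))
    (hψ₂ : ∀ r, ψ₂ (algebraMap R F r) = algebraMap S T (f₂ r))
    (hℋ : ∀ I ∈ ℋ, I.map f₁ = I.map f₂) (hθ : IsLogFamily x y P θ) : TransfersModulo ψ₁ ψ₂ θ ⊥ := by
  obtain ⟨J, ⟨hJ, hJQ⟩, hmin⟩ := WellFounded.has_min (wellFounded_lt (α := Ideal T))
    {J | J ≤ IsLocalRing.maximalIdeal T ∧ TransfersModulo ψ₁ ψ₂ θ J}
    ⟨_, le_rfl, h.transfersModulo_maximalIdeal hψ₁ hψ₂ hℋ hθ⟩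
  by_cases hJ0 : J = ⊥
  · exact hJ0 ▸ hJQ
  obtain ⟨J', hlt, hJ'⟩ := h.exists_lt_transfersModulo hψ₁ hψ₂ hℋ hθ hJ hJ0 hJQ
  exact absurd hlt (hmin J' ⟨hlt.le.trans hJ, hJ'⟩)

theorem Presentation.exists_eq_of_infinite [IsArtinianRing T] (h : Presentation F x y P m)
    (hψ₁ : ∀ r, ψ₁ (algebraMap R F r) = algebraMap S T (f₁ r))
    (hψ₂ : ∀ r, ψ₂ (algebraMap R F r) = algebraMap S T (f₂ r))
    (hinf : {I : Ideal R | IsHypersurfaceIdeal I ∧ I.map f₁ = I.map f₂}.Infinite) :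
    ∃ g : F, g ∉ Set.range (algebraMap K F) ∧ ψ₁ g = ψ₂ g := by
  set ℋ := {I : Ideal R | IsHypersurfaceIdeal I ∧ I.map f₁ = I.map f₂} with hℋ
  have hx : IsTranscendenceBasis K fun i => algebraMap R F (x i) :=
    isTranscendenceBasis_of_isIntegral h.inj h.int
  have (I : ℋ) : ∃ θ c p, SectionData (I.1.comap (evPt x y)) P c p ∧
      IsLogCoeff (I.1.comap (evPt x y)) P c (fun i => algebraMap R F (x i)) (algebraMap R F y) θ := by
    obtain ⟨c, p, hcp⟩ := h.exists_sectionData I.2.1.ne_bot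
    obtain ⟨θ, hθ⟩ := hcp.exists_isLogCoeff hx (algebraMap R F y)
    exact ⟨θ, c, p, hcp, hθ⟩
  choose θ hθ using this
  have hθ' : IsLogFamily x y P θ := fun I => ⟨I.2.1, hθ I⟩
  obtain ⟨N, hN, hcofg⟩ := h.transfersModulo_bot hψ₁ hψ₂ (fun I hI => hI.2) hθ'
  have hfin := h.finite_horizontal hθ' _ N hN hcofg
  by_contra! hcon
  refine hinf ((hfin.powerset.image sInf).subset fun I hI => ⟨I.minimalPrimes, fun Q hQ =>
    ⟨⟨I, hI, hQ⟩, fun b hb hb0 => ?_⟩, ?_⟩)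
  · have hQp := (hI.1.2.2 Q hQ).1
    rw [AlgHom.mem_agreeField, Ideal.mem_bot, sub_eq_zero] at hb
    obtain ⟨c, rfl⟩ := not_not.1 fun hb' => hcon b hb' hb
    have hc : c ≠ 0 := by rintro rfl; simp at hb0
    refine ⟨algebraMap K R c, 1, fun hm => hQp.ne_top (Ideal.eq_top_of_isUnit_mem _ hm
      ((Ne.isUnit hc).map _)), fun hm => hQp.ne_top ((Ideal.eq_top_iff_one _).2 hm), ?_⟩
    rw [map_one, one_mul, ← IsScalarTower.algebraMap_apply]
  · rw [Ideal.sInf_minimalPrimes, hI.1.1.radical]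

end

theorem isArtinianRing_localization_nilradical {S T : Type*} [CommRing S] [IsNoetherianRing S]
    [hS : (nilradical S).IsPrime] [CommRing T] [Algebra S T] [IsLocalization.AtPrime T (nilradical S)]
    [IsLocalRing T] : IsArtinianRing T := by
  have : IsNoetherianRing T := IsLocalization.isNoetherianRing (nilradical S).primeCompl T ‹_›
  rw [isArtinianRing_iff_isNilpotent_maximalIdeal]
  obtain ⟨n, hn⟩ := IsNoetherianRing.isNilpotent_nilradical S
  refine ⟨n, ?_⟩
  rw [← IsLocalization.AtPrime.map_eq_maximalIdeal (nilradical S) T, ← Ideal.map_pow, hn]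
  exact Ideal.map_bot

theorem exists_frac_eq_of_infinite {K R S R' S' F T : Type*} [Field K] [CharZero K] [CommRing R]
    [IsDomain R] [Algebra K R] [Algebra.FiniteType K R] [CommRing S] [Algebra K S]
    [Algebra.FiniteType K S] [hS : (nilradical S).IsPrime] (f₁ f₂ : R →ₐ[K] S) (hf₁ : ∀ r ≠ 0, f₁ r ∉ nilradical S)
    (hf₂ : ∀ r ≠ 0, f₂ r ∉ nilradical S)
    {r : R} (hr : r ≠ 0) {s : S} [CommRing R'] [Algebra R R'] [Algebra K R'] [IsScalarTower K R R']
    [IsLocalization.Away r R'] [CommRing S'] [Algebra S S'] [Algebra K S'] [IsScalarTower K S S']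
    [IsLocalization.Away s S'] [Field F] [Algebra K F] [Algebra R F] [IsScalarTower K R F]
    [IsFractionRing R F] [Algebra R' F] [IsScalarTower R R' F] [CommRing T] [Algebra K T] [Algebra S T]
    [IsScalarTower K S T] [IsLocalization.AtPrime T (nilradical S)] [Algebra S' T] [IsScalarTower S S' T]
    (F₁ F₂ : R' →+* S') (hF₁ : F₁.comp (algebraMap R R') = (algebraMap S S').comp (f₁ : R →+* S))
    (hF₂ : F₂.comp (algebraMap R R') = (algebraMap S S').comp (f₂ : R →+* S))
    (hinf : {I : Ideal R' | IsHypersurfaceIdeal I ∧ I.map F₁ = I.map F₂}.Infinite) :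
    ∃ a b : R, b ≠ 0 ∧ (∀ c : K, a ≠ algebraMap K R c * b) ∧
        ∃ u : S, u ∉ nilradical S ∧ u * (f₁ a * f₂ b - f₂ a * f₁ b) = 0 := by
  have hle : Submonoid.powers r ≤ nonZeroDivisors R :=
    powers_le_nonZeroDivisors_of_noZeroDivisors hr
  have : IsDomain R' := IsLocalization.isDomain_of_le_nonZeroDivisors R' hle
  have : IsFractionRing R' F :=
    IsFractionRing.isFractionRing_of_isDomain_of_isLocalization (Submonoid.powers r) R' F
  have : IsScalarTower K R' F := .of_algebraMap_eq fun c => by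
    rw [IsScalarTower.algebraMap_apply K R F, IsScalarTower.algebraMap_apply R R' F,
      ← IsScalarTower.algebraMap_apply K R R']
  have : IsScalarTower K S' T := .of_algebraMap_eq fun c => by
    rw [IsScalarTower.algebraMap_apply K S T, IsScalarTower.algebraMap_apply S S' T,
      ← IsScalarTower.algebraMap_apply K S S']
  have : Algebra.FiniteType R R' := IsLocalization.finiteType_of_monoid_fg (Submonoid.powers r) R'
  have : Algebra.FiniteType S S' := IsLocalization.finiteType_of_monoid_fg (Submonoid.powers s) S'
  have : Algebra.FiniteType K R' := .trans ‹_› ‹Algebra.FiniteType R R'›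
  have : Algebra.FiniteType K S' := .trans ‹_› ‹Algebra.FiniteType S S'›
  have : IsNoetherianRing R' := Algebra.FiniteType.isNoetherianRing K R'
  have : IsNoetherianRing S := Algebra.FiniteType.isNoetherianRing K S
  have : IsLocalRing T := IsLocalization.AtPrime.isLocalRing T (nilradical S)
  have : IsArtinianRing T := isArtinianRing_localization_nilradical (S := S)
  have : Algebra.EssFiniteType S T := .of_isLocalization T (nilradical S).primeCompl
  have : Algebra.EssFiniteType K T := .comp K S T
  have : Algebra.EssFiniteType K (IsLocalRing.ResidueField T) := .comp K T _
  have hu {f : R →ₐ[K] S} (hf : ∀ r ≠ 0, f r ∉ nilradical S) (y : nonZeroDivisors R) :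
      IsUnit (((IsScalarTower.toAlgHom K S T).comp f) y) :=
    IsLocalization.map_units T (⟨f y, hf _ (nonZeroDivisors.ne_zero y.2)⟩ : (nilradical S).primeCompl)
  let ψ₁ : F →ₐ[K] T := IsLocalization.liftAlgHom (hu hf₁)
  let ψ₂ : F →ₐ[K] T := IsLocalization.liftAlgHom (hu hf₂)
  have hψ₁ (r : R) : ψ₁ (algebraMap R F r) = algebraMap S T (f₁ r) := IsLocalization.lift_eq (hu hf₁) r
  have hψ₂ (r : R) : ψ₂ (algebraMap R F r) = algebraMap S T (f₂ r) := IsLocalization.lift_eq (hu hf₂) r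
  have hext {ψ : F →ₐ[K] T} {f : R →ₐ[K] S} {f' : R' →+* S'} (hψ : ∀ r, ψ (algebraMap R F r) = algebraMap S T (f r))
      (hf : f'.comp (algebraMap R R') = (algebraMap S S').comp (f : R →+* S)) (t : R') :
      ψ (algebraMap R' F t) = algebraMap S' T (f' t) := by
    have : (ψ : F →+* T).comp (algebraMap R' F) = (algebraMap S' T).comp f' := by
      refine IsLocalization.ringHom_ext (Submonoid.powers r) ?_
      ext t
      have h1 := RingHom.congr_fun hf t
      simp only [RingHom.comp_apply, RingHom.coe_coe] at h1 ⊢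
      rw [h1, ← IsScalarTower.algebraMap_apply, ← IsScalarTower.algebraMap_apply, hψ]
    exact RingHom.congr_fun this t
  obtain ⟨d, x, y, P, m, h⟩ := exists_presentation K R' F
  obtain ⟨g, hgK, hg⟩ := h.exists_eq_of_infinite (hext hψ₁ hF₁) (hext hψ₂ hF₂) hinf
  obtain ⟨a, b, hb, rfl⟩ := IsFractionRing.div_surjective (A := R) g
  have hb0 := nonZeroDivisors.ne_zero hb
  have hb' : algebraMap R F b ≠ 0 := by rwa [Ne, FaithfulSMul.algebraMap_eq_zero_iff]
  refine ⟨a, b, hb0, fun c hc => hgK ⟨c, ?_⟩, ?_⟩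
  · rw [eq_div_iff hb', hc, map_mul, ← IsScalarTower.algebraMap_apply]
  · have h1 : ψ₁ (algebraMap R F a) * ψ₂ (algebraMap R F b) = ψ₂ (algebraMap R F a) * ψ₁ (algebraMap R F b) := by
      have h2 : algebraMap R F a = algebraMap R F a / algebraMap R F b * algebraMap R F b :=
        (div_mul_cancel₀ _ hb').symm
      rw [h2, map_mul, map_mul, hg]
      ring
    rw [hψ₁, hψ₁, hψ₂, hψ₂, ← map_mul, ← map_mul, ← sub_eq_zero, ← map_sub,
      IsLocalization.map_eq_zero_iff (nilradical S).primeCompl T] at h1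
    obtain ⟨u, hu⟩ := h1
    exact ⟨u, u.2, hu⟩

theorem heightOnePrime_of_mem_minimalPrimes_span {A : Type*} [CommRing A] [IsDomain A] [IsNoetherianRing A]
    {t : A} (ht : t ≠ 0) {P : Ideal A} (hP : P ∈ (Ideal.span {t}).minimalPrimes) : HeightOnePrime P := by
  have hPp : P.IsPrime := hP.1.1
  refine ⟨hPp, ?_, fun Q hQ hlt => ?_⟩
  · rintro rfl
    exact ht ((Ideal.mem_bot).1 (hP.1.2 (Ideal.mem_span_singleton_self t)))
  · have h1 := Ideal.height_add_one_le_of_lt_of_isPrime hlt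
    have h2 := h1.trans (Ideal.height_le_one_of_isPrincipal_of_mem_minimalPrimes (Ideal.span {t}) P hP)
    have h3 : Q.height = 0 := by
      rw [← zero_add (1 : ℕ∞)] at h2
      simpa using (ENat.add_le_add_iff_right ENat.one_ne_top).1 h2
    rw [Ideal.height_eq_zero_iff, IsDomain.minimalPrimes_eq_singleton_bot] at h3
    exact h3

theorem Transcendental.exists_derivation {K F : Type*} [Field K] [CharZero K] [Field F] [Algebra K F] {g : F}
    (hg : Transcendental K g) : ∃ D : Derivation K F F, D g = 1 := by
  have : CharZero (Polynomial K) := charZero_of_injective_algebraMap (algebraMap K (Polynomial K)).injective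
  obtain ⟨D, hD⟩ := exists_derivation_extend (Polynomial.aeval g) (transcendental_iff_injective.1 hg)
    ((Polynomial.aeval g).toLinearMap ∘ₗ Polynomial.derivative) (fun a b => by
      simp [Polynomial.derivative_mul]; ring)
  exact ⟨D, by simpa using hD Polynomial.X⟩

theorem Transcendental.infinite_not_isUnit {K A : Type*} [Field K] [IsAlgClosed K] [CommRing A] [IsDomain A] [Algebra K A]
    [Algebra.FiniteType K A] {g : A} (hg : Transcendental K g) :
    {c : K | ¬ IsUnit (g - algebraMap K A c)}.Infinite := by
  let _ : Algebra (Polynomial K) A := (Polynomial.aeval g).toRingHom.toAlgebra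
  have htower : IsScalarTower K (Polynomial K) A := .of_algebraMap_eq fun c =>
    ((Polynomial.aeval g).commutes c).symm
  have hinj : Function.Injective (algebraMap (Polynomial K) A) := transcendental_iff_injective.1 hg
  have : Algebra.FiniteType (Polynomial K) A := .of_restrictScalars_finiteType K _ _
  have : Algebra.FinitePresentation (Polynomial K) A := (Algebra.FinitePresentation.of_finiteType).1 this
  have : FaithfulSMul (Polynomial K) A := (faithfulSMul_iff_algebraMap_injective _ _).2 hinj
  have hopen := (PrimeSpectrum.isOpenMap_comap_of_hasGoingDown_of_finitePresentation
    (R := Polynomial K) (S := A)).isOpen_range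
  let η : PrimeSpectrum A := ⟨⊥, Ideal.isPrime_bot⟩
  obtain ⟨_, ⟨_, ⟨f, rfl⟩, rfl⟩, hf, hfs⟩ := PrimeSpectrum.isBasis_basic_opens.exists_subset_of_mem_open
    (Set.mem_range_self η) hopen
  have hf0 : f ≠ 0 := by
    rintro rfl
    simp at hf
  refine ((Polynomial.finite_setOfPred_isRoot hf0).infinite_compl).mono fun c hc hcu => ?_
  have hpr : (Ideal.span {Polynomial.X - Polynomial.C c}).IsPrime :=
    (Ideal.span_singleton_prime (Polynomial.X_sub_C_ne_zero c)).2 (Polynomial.prime_X_sub_C c)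
  obtain ⟨q, hq⟩ := hfs (show (⟨_, hpr⟩ : PrimeSpectrum (Polynomial K)) ∈ (PrimeSpectrum.basicOpen f : Set _) from fun hm =>
    hc (Polynomial.dvd_iff_isRoot.1 (Ideal.mem_span_singleton.1 hm)))
  refine q.2.ne_top (Ideal.eq_top_of_isUnit_mem _ ?_ hcu)
  have h1 : Polynomial.X - Polynomial.C c ∈ (PrimeSpectrum.comap (algebraMap (Polynomial K) A) q).asIdeal := by
    rw [hq]; exact Ideal.mem_span_singleton_self _
  have h2 : algebraMap (Polynomial K) A (Polynomial.X - Polynomial.C c) = g - algebraMap K A c := by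
    change Polynomial.aeval g _ = _
    simp
  rw [← h2]
  exact h1

theorem Derivation.isRadical_span_of_eq_one {K A F : Type*} [Field K] [CommRing A] [Field F] [Algebra A F]
    [IsDomain A] [IsFractionRing A F]
    [IsIntegrallyClosed A] [Algebra K F] [Algebra K A] [IsScalarTower K A F] (D : Derivation K F F)
    (hD : ∀ a : A, D (algebraMap A F a) ∈ (algebraMap A F).range) {g : A} (hg : D (algebraMap A F g) = 1) :
    (Ideal.span {g}).IsRadical := by
  rw [Ideal.isRadical_iff_pow_one_lt 2 one_lt_two]
  intro f hf
  rw [Ideal.mem_span_singleton] at hf ⊢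
  obtain ⟨h, hh⟩ := hf
  have hg0 : algebraMap A F g ≠ 0 := by
    intro h0; rw [h0] at hg; simp at hg
  obtain ⟨f', hf'⟩ := hD f
  obtain ⟨h', hh'⟩ := hD h
  have h1 : algebraMap A F f ^ 2 = algebraMap A F g * algebraMap A F h := by rw [← map_pow, hh, map_mul]
  have h2 := congrArg D h1
  rw [Derivation.leibniz_pow, Derivation.leibniz, hg] at h2
  simp only [smul_eq_mul, nsmul_eq_mul] at h2
  have hint : IsIntegral A (algebraMap A F f / algebraMap A F g) := by
    refine ⟨Polynomial.X ^ 2 - Polynomial.C (2 * f') * Polynomial.X + Polynomial.C h', by monicity!, ?_⟩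
    simp only [Polynomial.eval₂_add, Polynomial.eval₂_sub, Polynomial.eval₂_mul, Polynomial.eval₂_pow,
      Polynomial.eval₂_X, Polynomial.eval₂_C, Polynomial.eval₂_ofNat, map_mul, map_ofNat, hf', hh']
    field_simp
    push_cast at h2
    simp only [pow_one] at h2
    linear_combination h1 - algebraMap A F g * h2
  obtain ⟨e, he⟩ := IsIntegrallyClosed.isIntegral_iff.1 hint
  refine ⟨e, FaithfulSMul.algebraMap_injective A F ?_⟩
  rw [map_mul, he]
  field_simp

section
variable {R R' F : Type*} [CommRing R] [CommRing R'] [Algebra R R']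
  [Field F] [Algebra R F] [Algebra R' F] [IsScalarTower R R' F] {r : R} [IsLocalization.Away r R']

omit [Field F] [Algebra R F] [Algebra R' F] [IsScalarTower R R' F] in
theorem IsLocalization.Away.isUnit_of_dvd_pow {e : R} {n : ℕ} (he : e ∣ r ^ n) : IsUnit (algebraMap R R' e) :=
  isUnit_of_dvd_unit (map_dvd (algebraMap R R') he)
    (by rw [map_pow]; exact (IsLocalization.Away.algebraMap_isUnit r).pow n)

theorem IsLocalization.Away.mem_range_of_mul_mem {e : R} {n : ℕ} (he : e ∣ r ^ n) {f : F}
    (hf : algebraMap R F e * f ∈ (algebraMap R' F).range) : f ∈ (algebraMap R' F).range := by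
  obtain ⟨v, hv⟩ := (IsLocalization.Away.isUnit_of_dvd_pow (R' := R') he).exists_left_inv
  obtain ⟨b, hb⟩ := hf
  refine ⟨v * b, ?_⟩
  rw [map_mul, hb, ← mul_assoc, IsScalarTower.algebraMap_apply R R' F, ← map_mul, hv, map_one, one_mul]

theorem IsLocalization.Away.isIntegrallyClosed_of_conductor [IsDomain R'] [IsFractionRing R' F] {m : R}
    (hm : ∀ f : F, IsIntegral R f → ∃ b, algebraMap R F b = algebraMap R F m * f) (hr : m ∣ r) :
    IsIntegrallyClosed R' := by
  rw [isIntegrallyClosed_iff F]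
  intro f hf
  obtain ⟨⟨_, n, rfl⟩, hk⟩ := hf.exists_multiple_integral_of_isLocalization (Submonoid.powers r) (R := R)
  obtain ⟨b, hb⟩ := hm _ hk
  refine IsLocalization.Away.mem_range_of_mul_mem (e := m * r ^ n) (r := r) (n := n + 1) ?_
    ⟨algebraMap R R' b, ?_⟩
  · rw [pow_succ']; exact mul_dvd_mul_right hr _
  · rw [← IsScalarTower.algebraMap_apply, hb, Submonoid.smul_def, Algebra.smul_def, map_mul, mul_assoc]

theorem Derivation.mem_range_of_adjoin {K : Type*} [Field K] [Algebra K R] [Algebra K F] [IsScalarTower K R F]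
    {t : Set R} (ht : Algebra.adjoin K t = ⊤) (D : Derivation K F F) {e : R} (he : e ∣ r)
    (hD : ∀ x ∈ t, ∃ y, algebraMap R F y = algebraMap R F e * D (algebraMap R F x)) (a : R') :
    D (algebraMap R' F a) ∈ (algebraMap R' F).range := by
  have hmem (y : R) : algebraMap R F y ∈ (algebraMap R' F).range :=
    ⟨algebraMap R R' y, (IsScalarTower.algebraMap_apply R R' F y).symm⟩
  have h1 (x : R) : D (algebraMap R F x) ∈ (algebraMap R' F).range := by
    have hx : x ∈ Algebra.adjoin K t := ht ▸ Algebra.mem_top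
    induction hx using Algebra.adjoin_induction with
    | mem x hx =>
      obtain ⟨y, hy⟩ := hD x hx
      exact IsLocalization.Away.mem_range_of_mul_mem (r := r) (n := 1) (by simpa using he) (hy ▸ hmem y)
    | algebraMap c =>
      rw [← IsScalarTower.algebraMap_apply, D.map_algebraMap]
      exact zero_mem _
    | add x y _ _ hx hy => rw [map_add, map_add]; exact add_mem hx hy
    | mul x y _ _ hx hy =>
      rw [map_mul, Derivation.leibniz]
      exact add_mem (mul_mem (hmem _) hy) (mul_mem (hmem _) hx)
  obtain ⟨n, b, hb⟩ := IsLocalization.Away.surj r a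
  refine IsLocalization.Away.mem_range_of_mul_mem (e := r ^ n) (r := r) dvd_rfl ?_
  have h2 := congrArg (fun z => D (algebraMap R' F z)) hb
  simp only [← map_pow, map_mul, ← IsScalarTower.algebraMap_apply, Derivation.leibniz] at h2
  rw [smul_eq_mul, smul_eq_mul, ← eq_sub_iff_add_eq'] at h2
  rw [h2]
  exact sub_mem (h1 _) (mul_mem ⟨a, rfl⟩ (h1 _))

end

theorem infinite_hypersurfaces_of_eq {K R S : Type*} [Field K] [IsAlgClosed K] [CharZero K] [CommRing R]
    [IsDomain R] [Algebra K R] [Algebra.FiniteType K R] [CommRing S] [Algebra K S]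
    (hS : (nilradical S).IsPrime) (f₁ f₂ : R →ₐ[K] S) (hf₁ : ∀ r ≠ 0, f₁ r ∉ nilradical S)
    (hf₂ : ∀ r ≠ 0, f₂ r ∉ nilradical S) {a b : R} (hb : b ≠ 0) (hab : ∀ c : K, a ≠ algebraMap K R c * b)
    {u : S} (hu : u ∉ nilradical S) (heq : u * (f₁ a * f₂ b - f₂ a * f₁ b) = 0) :
    ∃ (r : R), r ≠ 0 ∧ ∃ (s : S), s ∉ nilradical S ∧
        ∃ (F₁ F₂ : Localization.Away r →+* Localization.Away s),
          F₁.comp (algebraMap R (Localization.Away r))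
              = (algebraMap S (Localization.Away s)).comp (f₁ : R →+* S) ∧
          F₂.comp (algebraMap R (Localization.Away r))
              = (algebraMap S (Localization.Away s)).comp (f₂ : R →+* S) ∧
          {I : Ideal (Localization.Away r) |
            IsHypersurfaceIdeal I ∧ I.map F₁ = I.map F₂}.Infinite := by
  classical
  let F := FractionRing R
  have hb' : algebraMap R F b ≠ 0 := by rwa [Ne, FaithfulSMul.algebraMap_eq_zero_iff]
  have hg : Transcendental K (algebraMap R F a / algebraMap R F b) := by
    intro halg
    obtain ⟨c, hc⟩ := minpoly.mem_range_of_degree_eq_one K _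
      (IsAlgClosed.degree_eq_one_of_irreducible K (minpoly.irreducible halg.isIntegral))
    refine hab c (FaithfulSMul.algebraMap_injective R F ?_)
    rw [eq_div_iff hb'] at hc
    rw [← hc, map_mul, ← IsScalarTower.algebraMap_apply]
  obtain ⟨D, hD⟩ := hg.exists_derivation
  obtain ⟨d, x, y, P, m, h⟩ := exists_presentation K R F
  obtain ⟨t, ht⟩ := ‹Algebra.FiniteType K R›.out
  obtain ⟨e, he⟩ := IsLocalization.exist_integer_multiples_of_finset (nonZeroDivisors R)
    (t.image fun x => D (algebraMap R F x))
  let r : R := b * m * e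
  have hr : r ≠ 0 := mul_ne_zero (mul_ne_zero hb h.ne_zero) (nonZeroDivisors.ne_zero e.2)
  have hbr : b ∣ r := (Dvd.intro _ rfl).trans (Dvd.intro _ rfl)
  let R' := Localization.Away r
  have hle : Submonoid.powers r ≤ nonZeroDivisors R :=
    powers_le_nonZeroDivisors_of_noZeroDivisors hr
  let _ : Algebra R' F := (IsLocalization.lift (M := Submonoid.powers r) (S := R') (g := algebraMap R F) fun y =>
    IsUnit.mk0 _ (by rw [Ne, FaithfulSMul.algebraMap_eq_zero_iff]; exact nonZeroDivisors.ne_zero (hle y.2))).toAlgebra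
  have : IsScalarTower R R' F := .of_algebraMap_eq fun y => (IsLocalization.lift_eq _ y).symm
  have : IsDomain R' := IsLocalization.isDomain_of_le_nonZeroDivisors R' hle
  have : IsFractionRing R' F :=
    IsFractionRing.isFractionRing_of_isDomain_of_isLocalization (Submonoid.powers r) R' F
  have : IsScalarTower K R' F := .of_algebraMap_eq fun c => by
    rw [IsScalarTower.algebraMap_apply K R F, IsScalarTower.algebraMap_apply R R' F,
      ← IsScalarTower.algebraMap_apply K R R']
  have : Algebra.FiniteType R R' := IsLocalization.finiteType_of_monoid_fg (Submonoid.powers r) R'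
  have : Algebra.FiniteType K R' := .trans ‹_› this
  have : IsNoetherianRing R' := Algebra.FiniteType.isNoetherianRing K R'
  have : IsIntegrallyClosed R' :=
    IsLocalization.Away.isIntegrallyClosed_of_conductor (r := r) h.cond ((Dvd.intro_left _ rfl).trans (Dvd.intro _ rfl))
  have hDR (z : R') : D (algebraMap R' F z) ∈ (algebraMap R' F).range :=
    Derivation.mem_range_of_adjoin (r := r) ht D (Dvd.intro_left _ rfl) (fun x hx => by
      obtain ⟨y, hy⟩ := he _ (Finset.mem_image_of_mem _ hx)
      exact ⟨y, by rw [hy, Algebra.smul_def]⟩) z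
  obtain ⟨g, hg'⟩ : algebraMap R F a / algebraMap R F b ∈ (algebraMap R' F).range := by
    refine IsLocalization.Away.mem_range_of_mul_mem (e := b) (r := r) (n := 1) (by simpa using hbr)
      ⟨algebraMap R R' a, ?_⟩
    rw [← IsScalarTower.algebraMap_apply, mul_div_cancel₀ _ hb']
  have hgb : g * algebraMap R R' b = algebraMap R R' a := by
    apply FaithfulSMul.algebraMap_injective R' F
    rw [map_mul, hg', ← IsScalarTower.algebraMap_apply, ← IsScalarTower.algebraMap_apply, div_mul_cancel₀ _ hb']
  have hgK : Transcendental K g := by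
    rw [← hg'] at hg
    exact (transcendental_algebraMap_iff (FaithfulSMul.algebraMap_injective R' F)).1 hg
  let s : S := f₁ r * f₂ r * u
  have hs : s ∉ nilradical S :=
    hS.mul_notMem (hS.mul_notMem (hf₁ r hr) (hf₂ r hr)) hu
  let S' := Localization.Away s
  have hunit {v : S} (hv : v ∣ s) : IsUnit (algebraMap S S' v) :=
    IsLocalization.Away.isUnit_of_dvd_pow (r := s) (n := 1) (by simpa using hv)
  have h₁ : f₁ r ∣ s := (Dvd.intro _ rfl).trans (Dvd.intro _ rfl)
  have h₂ : f₂ r ∣ s := (Dvd.intro_left _ rfl).trans (Dvd.intro _ rfl)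
  let F₁ : R' →+* S' := IsLocalization.Away.lift r (g := (algebraMap S S').comp (f₁ : R →+* S)) (hunit h₁)
  let F₂ : R' →+* S' := IsLocalization.Away.lift r (g := (algebraMap S S').comp (f₂ : R →+* S)) (hunit h₂)
  have hF₁ (z : R) : F₁ (algebraMap R R' z) = algebraMap S S' (f₁ z) := IsLocalization.Away.lift_eq r _ z
  have hF₂ (z : R) : F₂ (algebraMap R R' z) = algebraMap S S' (f₂ z) := IsLocalization.Away.lift_eq r _ z
  have hFg : F₁ g = F₂ g := by
    have e₁ := congrArg F₁ hgb
    have e₂ := congrArg F₂ hgb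
    rw [map_mul, hF₁, hF₁] at e₁
    rw [map_mul, hF₂, hF₂] at e₂
    have e₃ := congrArg (algebraMap S S') heq
    rw [map_mul, map_sub, map_mul, map_mul, ← e₁, ← e₂, map_zero] at e₃
    have u₁ := hunit ((map_dvd f₁ hbr).trans h₁)
    have u₂ := hunit ((map_dvd f₂ hbr).trans h₂)
    have u₃ := hunit (Dvd.intro_left (f₁ r * f₂ r) rfl : u ∣ s)
    refine (u₃.mul (u₁.mul u₂)).mul_left_cancel ?_
    linear_combination e₃
  have hFc (c : K) : F₁ (algebraMap K R' c) = F₂ (algebraMap K R' c) := by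
    rw [IsScalarTower.algebraMap_apply K R R', hF₁, hF₂, AlgHom.commutes, AlgHom.commutes]
  refine ⟨r, hr, s, hs, F₁, F₂, RingHom.ext hF₁, RingHom.ext hF₂, ?_⟩
  refine (hgK.infinite_not_isUnit.image (f := fun c => Ideal.span {g - algebraMap K R' c}) ?_).mono ?_
  · intro c hc c' hc' hcc
    by_contra hne
    refine hc (Ideal.span_singleton_eq_top.1 (Ideal.eq_top_of_isUnit_mem _ (x := algebraMap K R' (c - c')) ?_
      ((Ne.isUnit (sub_ne_zero.2 hne)).map _)))
    have m₁ := Ideal.mem_span_singleton_self (g - algebraMap K R' c)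
    have m₂ := Ideal.mem_span_singleton_self (g - algebraMap K R' c')
    change _ = Ideal.span {g - algebraMap K R' c'} at hcc
    rw [← hcc] at m₂
    have := Ideal.sub_mem _ m₂ m₁
    rwa [sub_sub_sub_cancel_left, ← map_sub] at this
  · rintro _ ⟨c, hc, rfl⟩
    refine ⟨⟨D.isRadical_span_of_eq_one hDR ?_, fun he => hc (Ideal.span_singleton_eq_top.1 he), fun P hP =>
      heightOnePrime_of_mem_minimalPrimes_span ?_ hP⟩, ?_⟩
    · rw [map_sub, map_sub, hg', hD, ← IsScalarTower.algebraMap_apply, D.map_algebraMap, sub_zero]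
    · intro h0
      rw [sub_eq_zero] at h0
      exact hgK (h0 ▸ isAlgebraic_algebraMap c)
    · rw [Ideal.map_span, Ideal.map_span, Set.image_singleton, Set.image_singleton, map_sub, map_sub, hFg, hFc]

/-- **Theorem 4.1.** -/
theorem main_theorem_scheme_inverse_images
    (K : Type*) [Field K] [IsAlgClosed K] [CharZero K]
    (R : Type*) [CommRing R] [IsDomain R] [Algebra K R] [Algebra.FiniteType K R]
    (S : Type*) [CommRing S] [Nontrivial S] [Algebra K S] [Algebra.FiniteType K S]
    -- `Z` is irreducible
    (hZirr : (nilradical S).IsPrime)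
    (f₁ f₂ : R →ₐ[K] S)
    -- the restrictions of `φ₁, φ₂` to `Z_red` are dominant
    (hdom₁ : Function.Injective ((Ideal.Quotient.mk (nilradical S)).comp (f₁ : R →+* S)))
    (hdom₂ : Function.Injective ((Ideal.Quotient.mk (nilradical S)).comp (f₂ : R →+* S))) :
    (∃ (r : R), r ≠ 0 ∧ ∃ (s : S), s ∉ nilradical S ∧
        ∃ (F₁ F₂ : Localization.Away r →+* Localization.Away s),
          F₁.comp (algebraMap R (Localization.Away r))
              = (algebraMap S (Localization.Away s)).comp (f₁ : R →+* S) ∧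
          F₂.comp (algebraMap R (Localization.Away r))
              = (algebraMap S (Localization.Away s)).comp (f₂ : R →+* S) ∧
          {I : Ideal (Localization.Away r) |
            IsHypersurfaceIdeal I ∧ I.map F₁ = I.map F₂}.Infinite)
      ↔
    (∃ a b : R, b ≠ 0 ∧ (∀ c : K, a ≠ algebraMap K R c * b) ∧
        ∃ u : S, u ∉ nilradical S ∧ u * (f₁ a * f₂ b - f₂ a * f₁ b) = 0) := by
  have := hZirr
  have hf {f : R →ₐ[K] S}
      (hdom : Function.Injective ((Ideal.Quotient.mk (nilradical S)).comp (f : R →+* S))) (r : R) (hr : r ≠ 0) :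
      f r ∉ nilradical S := fun hm =>
    hr (hdom (((Ideal.Quotient.eq_zero_iff_mem).2 hm).trans (map_zero _).symm))
  constructor
  · rintro ⟨r, hr, s, hs, F₁, F₂, hF₁, hF₂, hinf⟩
    let R' := Localization.Away r
    let F := FractionRing R
    let S' := Localization.Away s
    let T := Localization.AtPrime (nilradical S)
    let _ : Algebra R' F := (IsLocalization.lift (M := Submonoid.powers r) (S := R') (g := algebraMap R F)
      fun y => IsUnit.mk0 _ (by
        rw [Ne, FaithfulSMul.algebraMap_eq_zero_iff]
        exact nonZeroDivisors.ne_zero (powers_le_nonZeroDivisors_of_noZeroDivisors hr y.2))).toAlgebra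
    have : IsScalarTower R R' F := .of_algebraMap_eq fun y => (IsLocalization.lift_eq _ y).symm
    let _ : Algebra S' T := (IsLocalization.Away.lift s (g := algebraMap S T)
      (IsLocalization.map_units T (⟨s, hs⟩ : (nilradical S).primeCompl))).toAlgebra
    have : IsScalarTower S S' T := .of_algebraMap_eq fun y => (IsLocalization.Away.lift_eq s _ y).symm
    exact exists_frac_eq_of_infinite (r := r) (s := s) (F := F) (T := T) f₁ f₂ (hf hdom₁) (hf hdom₂) hr F₁ F₂ hF₁ hF₂ hinf
  · rintro ⟨a, b, hb, hab, u, hu, heq⟩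
    exact infinite_hypersurfaces_of_eq hZirr f₁ f₂ (hf hdom₁) (hf hdom₂) hb hab hu heq
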